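/- Every planar graph that contains no triangle normally adjacent to a cycle of length at most 8, no 4-cycle normally adjacent to a cycle of length at most 6, and no two normally adjacent 5-cycles, is (I,F)-colorable. -/

import Mathlib

open SimpleGraph

namespace IFPaper

variable {V : Type}

/-- An `(I,F)`-coloring of a graph, encoded as a Boolean coloring where
`true` means color `I` and `false` means color `F`:  the `I`-colored vertices
form an independent set and the `F`-colored vertices induce a forest
(no cycle has all of its vertices colored `F`). -/
def IFColoring (G : SimpleGraph V) (c : V → Bool) : Prop :=
  (∀ ⦃u v : V⦄, G.Adj u v → c u = true → c v = false) ∧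
  (∀ (v : V) (w : G.Walk v v), w.IsCycle → ¬ (∀ x ∈ w.support, c x = false))

/-- A graph is `(I,F)`-colorable if it admits an `(I,F)`-coloring. -/
def IFColorable (G : SimpleGraph V) : Prop := ∃ c : V → Bool, IFColoring G c

/-- An `(I,F)`-coloring of the subgraph of `G` induced on the set `S`. -/
def IFColoringOn (G : SimpleGraph V) (S : Set V) (c : V → Bool) : Prop :=
  (∀ ⦃u v : V⦄, u ∈ S → v ∈ S → G.Adj u v → c u = true → c v = false) ∧
  (∀ (v : V) (w : G.Walk v v), w.IsCycle → (∀ x ∈ w.support, x ∈ S) →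
    ¬ (∀ x ∈ w.support, c x = false))

/-- A splitting `F`-path of (the vertex set `Q` of) a cycle: a path all of whose
vertices get color `F`, whose two endpoints lie on `Q`, and all of whose other
vertices (at least one) do not lie on `Q`. -/
def IsSplittingFPath (G : SimpleGraph V) (Q : Set V) (c : V → Bool)
    {a b : V} (p : G.Walk a b) : Prop :=
  p.IsPath ∧ (∀ x ∈ p.support, c x = false) ∧ a ∈ Q ∧ b ∈ Q ∧ 2 ≤ p.length ∧
  ∀ x ∈ p.support, x ≠ a → x ≠ b → x ∉ Q

/-- A super IF-coloring of `(G, Q)`: an `(I,F)`-coloring of `G` with no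
splitting `F`-path of `Q`. -/
def SuperIFColoring (G : SimpleGraph V) (Q : Set V) (c : V → Bool) : Prop :=
  IFColoring G c ∧ ∀ (a b : V) (p : G.Walk a b), ¬ IsSplittingFPath G Q c p

/-- `d* ≥ 3`: any two distinct cycles of length at most `5` are at distance at
least `3`. -/
def Cycles5Apart (G : SimpleGraph V) : Prop :=
  ∀ ⦃u v : V⦄ (c1 : G.Walk u u) (c2 : G.Walk v v),
    c1.IsCycle → c2.IsCycle → c1.length ≤ 5 → c2.length ≤ 5 →
    {e : Sym2 V | e ∈ c1.edges} ≠ {e : Sym2 V | e ∈ c2.edges} →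
    ∀ x ∈ c1.support, ∀ y ∈ c2.support, 3 ≤ G.dist x y

/-- A claw of the cycle `C`: a vertex not on `C` with three neighbors on `C`. -/
def HasClaw (G : SimpleGraph V) {v : V} (C : G.Walk v v) : Prop :=
  ∃ x : V, x ∉ C.support ∧ ∃ a b c : V, a ∈ C.support ∧ b ∈ C.support ∧ c ∈ C.support ∧
    a ≠ b ∧ a ≠ c ∧ b ≠ c ∧ G.Adj x a ∧ G.Adj x b ∧ G.Adj x c

/-- A triclaw of the cycle `C`: a triangle `x y z` disjoint from `C`, joined by
three edges to three distinct vertices of `C`. -/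
def HasTriclaw (G : SimpleGraph V) {v : V} (C : G.Walk v v) : Prop :=
  ∃ x y z : V, x ∉ C.support ∧ y ∉ C.support ∧ z ∉ C.support ∧
    G.Adj x y ∧ G.Adj y z ∧ G.Adj x z ∧
    ∃ a b c : V, a ∈ C.support ∧ b ∈ C.support ∧ c ∈ C.support ∧
      a ≠ b ∧ a ≠ c ∧ b ≠ c ∧ G.Adj x a ∧ G.Adj y b ∧ G.Adj z c

/-- A bad cycle is a `9`-cycle having a claw or a triclaw. -/
def IsBadCycle (G : SimpleGraph V) {v : V} (C : G.Walk v v) : Prop :=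
  C.IsCycle ∧ C.length = 9 ∧ (HasClaw G C ∨ HasTriclaw G C)

/-- A good cycle is a cycle that is not bad. -/
def IsGoodCycle (G : SimpleGraph V) {v : V} (C : G.Walk v v) : Prop :=
  C.IsCycle ∧ ¬ IsBadCycle G C

/-- The interior of an arc parametrized by `[0,1]`. -/
def ArcInterior (γ : ℝ → ℝ × ℝ) : Set (ℝ × ℝ) := γ '' Set.Ioo 0 1

/-- The image of an arc parametrized by `[0,1]`. -/
def ArcImage (γ : ℝ → ℝ × ℝ) : Set (ℝ × ℝ) := γ '' Set.Icc 0 1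

/-- A plane embedding of a simple graph: an injective placement of the vertices
in the plane together with, for every edge, a simple arc joining the images of
its endpoints, such that arcs meet only at common endpoints and no arc passes
through a vertex. -/
structure IsPlaneEmbedding (G : SimpleGraph V) (vtx : V → ℝ × ℝ)
    (arc : V → V → ℝ → ℝ × ℝ) : Prop where
  vtx_inj : Function.Injective vtx
  arc_cont : ∀ ⦃u v : V⦄, G.Adj u v → ContinuousOn (arc u v) (Set.Icc 0 1)
  arc_injOn : ∀ ⦃u v : V⦄, G.Adj u v → Set.InjOn (arc u v) (Set.Icc 0 1)
  arc_start : ∀ ⦃u v : V⦄, G.Adj u v → arc u v 0 = vtx u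
  arc_end : ∀ ⦃u v : V⦄, G.Adj u v → arc u v 1 = vtx v
  arc_symm : ∀ ⦃u v : V⦄, G.Adj u v → ∀ t : ℝ, arc v u t = arc u v (1 - t)
  arc_avoids_vtx : ∀ ⦃u v : V⦄, G.Adj u v → ∀ w : V, vtx w ∉ ArcInterior (arc u v)
  arc_disjoint : ∀ ⦃u v u' v' : V⦄, G.Adj u v → G.Adj u' v' → s(u, v) ≠ s(u', v') →
    ArcInterior (arc u v) ∩ ArcInterior (arc u' v') = ∅

/-- A graph is planar if it admits a plane embedding. -/
def IsPlanarGraph (G : SimpleGraph V) : Prop :=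
  ∃ (vtx : V → ℝ × ℝ) (arc : V → V → ℝ → ℝ × ℝ), IsPlaneEmbedding G vtx arc

/-- The subset of the plane covered by a plane drawing of `G`. -/
def Drawing (G : SimpleGraph V) (vtx : V → ℝ × ℝ) (arc : V → V → ℝ → ℝ × ℝ) :
    Set (ℝ × ℝ) :=
  Set.range vtx ∪ ⋃ (u : V) (v : V) (_ : G.Adj u v), ArcImage (arc u v)

/-- The subset of the plane covered by the drawing of a walk `w`. -/
def WalkDrawing (G : SimpleGraph V) (arc : V → V → ℝ → ℝ × ℝ)
    {a b : V} (w : G.Walk a b) : Set (ℝ × ℝ) :=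
  ⋃ (u : V) (v : V) (_ : G.Adj u v) (_ : s(u, v) ∈ w.edges), ArcImage (arc u v)

/-- A face of a plane drawing: a connected component of the complement of the
drawing. -/
def IsFace (G : SimpleGraph V) (vtx : V → ℝ × ℝ) (arc : V → V → ℝ → ℝ × ℝ)
    (f : Set (ℝ × ℝ)) : Prop :=
  ∃ p : ℝ × ℝ, p ∉ Drawing G vtx arc ∧
    f = connectedComponentIn (Drawing G vtx arc)ᶜ p

/-- The outer face: the unbounded face. -/
def IsOuterFace (G : SimpleGraph V) (vtx : V → ℝ × ℝ) (arc : V → V → ℝ → ℝ × ℝ)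
    (f : Set (ℝ × ℝ)) : Prop :=
  IsFace G vtx arc f ∧ ¬ Bornology.IsBounded f

/-- A vertex is on a face if its image lies on the boundary of the face. -/
def VertexOnFace (vtx : V → ℝ × ℝ) (f : Set (ℝ × ℝ)) (v : V) : Prop :=
  vtx v ∈ frontier f

/-- The face `f` is bounded by the (closed) walk `w`. -/
def FaceBoundedBy (G : SimpleGraph V) (vtx : V → ℝ × ℝ) (arc : V → V → ℝ → ℝ × ℝ)
    (f : Set (ℝ × ℝ)) {a : V} (w : G.Walk a a) : Prop :=
  IsFace G vtx arc f ∧ frontier f = WalkDrawing G arc w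

/-- A vertex lies (strictly) inside the cycle `C` of the plane graph. -/
def VertexInsideCycle (G : SimpleGraph V) (vtx : V → ℝ × ℝ)
    (arc : V → V → ℝ → ℝ × ℝ) {a : V} (C : G.Walk a a) (v : V) : Prop :=
  vtx v ∉ WalkDrawing G arc C ∧
  Bornology.IsBounded (connectedComponentIn (WalkDrawing G arc C)ᶜ (vtx v))

/-- A vertex lies (strictly) outside the cycle `C` of the plane graph. -/
def VertexOutsideCycle (G : SimpleGraph V) (vtx : V → ℝ × ℝ)
    (arc : V → V → ℝ → ℝ × ℝ) {a : V} (C : G.Walk a a) (v : V) : Prop :=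
  vtx v ∉ WalkDrawing G arc C ∧
  ¬ Bornology.IsBounded (connectedComponentIn (WalkDrawing G arc C)ᶜ (vtx v))

/-- A cycle of a plane graph is separating if its interior and its exterior
each contain a vertex of the graph. -/
def IsSeparatingCycle (G : SimpleGraph V) (vtx : V → ℝ × ℝ)
    (arc : V → V → ℝ → ℝ × ℝ) {a : V} (C : G.Walk a a) : Prop :=
  (∃ v : V, VertexInsideCycle G vtx arc C v) ∧
  (∃ v : V, VertexOutsideCycle G vtx arc C v)

/-- The cycle `C` has no chord in `G`. -/
def Chordless (G : SimpleGraph V) {a : V} (C : G.Walk a a) : Prop :=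
  ∀ ⦃u v : V⦄, u ∈ C.support → v ∈ C.support → G.Adj u v → s(u, v) ∈ C.edges

/-- The precoloring `c0` of the cycle `C0` extends to a super IF-coloring of
`(G, C0)`. -/
def ExtendsToSuper (G : SimpleGraph V) {v0 : V} (C0 : G.Walk v0 v0)
    (c0 : V → Bool) : Prop :=
  ∃ c : V → Bool, SuperIFColoring G {x | x ∈ C0.support} c ∧
    ∀ x ∈ C0.support, c x = c0 x

/-- A counterexample to the extension theorem: a planar graph with `d* ≥ 3`, a
good cycle `C0` of length at most `9`, and an `(I,F)`-coloring of `G[V(C0)]`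
which does not extend to a super IF-coloring of `(G, C0)`. -/
def IsCounterexample (G : SimpleGraph V) {v0 : V} (C0 : G.Walk v0 v0)
    (c0 : V → Bool) : Prop :=
  IsPlanarGraph G ∧ Cycles5Apart G ∧ IsGoodCycle G C0 ∧ C0.length ≤ 9 ∧
  IFColoringOn G {x | x ∈ C0.support} c0 ∧ ¬ ExtendsToSuper G C0 c0

/-- The quantity `|V(G)| + |E(G)|`. -/
noncomputable def graphSize {V : Type} [Fintype V] (G : SimpleGraph V) : ℕ :=
  Fintype.card V + G.edgeSet.ncard

/-- A minimal counterexample to the extension theorem: one minimizing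
`|V(G)| + |E(G)|` among all counterexamples. -/
def IsMinimalCounterexample [Fintype V] (G : SimpleGraph V) {v0 : V}
    (C0 : G.Walk v0 v0) (c0 : V → Bool) : Prop :=
  IsCounterexample G C0 c0 ∧
  ∀ (n : ℕ) (G' : SimpleGraph (Fin n)) (v0' : Fin n) (C0' : G'.Walk v0' v0')
    (c0' : Fin n → Bool), IsCounterexample G' C0' c0' →
      graphSize G ≤ graphSize G'

/-- A chord of the cycle `C` splitting it into two cycles of lengths `l1` and
`l2`: an edge between two non-consecutive vertices of `C` together with two
cycles of lengths `l1` and `l2` which both use the chord, use otherwise only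
edges of `C`, and together partition the edges of `C`. -/
def HasChordSplit (G : SimpleGraph V) {a : V} (C : G.Walk a a) (l1 l2 : ℕ) : Prop :=
  ∃ u v : V, u ∈ C.support ∧ v ∈ C.support ∧ G.Adj u v ∧ s(u, v) ∉ C.edges ∧
    ∃ (c1 c2 : G.Walk u u), c1.IsCycle ∧ c2.IsCycle ∧
      c1.length = l1 ∧ c2.length = l2 ∧
      s(u, v) ∈ c1.edges ∧ s(u, v) ∈ c2.edges ∧
      (∀ e ∈ c1.edges, e ≠ s(u, v) → e ∈ C.edges) ∧
      (∀ e ∈ c2.edges, e ≠ s(u, v) → e ∈ C.edges) ∧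
      (∀ e ∈ C.edges, (e ∈ c1.edges ↔ e ∉ c2.edges))

/-- A `(l1, l2, l3)`-claw of the cycle `C`: a claw which together with `C`
forms three cycles of lengths `l1`, `l2` and `l3`. -/
def HasClawSplit (G : SimpleGraph V) {a : V} (C : G.Walk a a) (l1 l2 l3 : ℕ) : Prop :=
  ∃ x : V, x ∉ C.support ∧ ∃ v1 v2 v3 : V,
    v1 ∈ C.support ∧ v2 ∈ C.support ∧ v3 ∈ C.support ∧
    v1 ≠ v2 ∧ v1 ≠ v3 ∧ v2 ≠ v3 ∧ G.Adj x v1 ∧ G.Adj x v2 ∧ G.Adj x v3 ∧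
    ∃ (w1 w2 w3 : G.Walk x x), w1.IsCycle ∧ w2.IsCycle ∧ w3.IsCycle ∧
      w1.length = l1 ∧ w2.length = l2 ∧ w3.length = l3 ∧
      (∀ e ∈ w1.edges, e ∈ C.edges ∨ e = s(x, v1) ∨ e = s(x, v2) ∨ e = s(x, v3)) ∧
      (∀ e ∈ w2.edges, e ∈ C.edges ∨ e = s(x, v1) ∨ e = s(x, v2) ∨ e = s(x, v3)) ∧
      (∀ e ∈ w3.edges, e ∈ C.edges ∨ e = s(x, v1) ∨ e = s(x, v2) ∨ e = s(x, v3)) ∧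
      (∀ e ∈ C.edges, (e ∈ w1.edges ∧ e ∉ w2.edges ∧ e ∉ w3.edges) ∨
        (e ∉ w1.edges ∧ e ∈ w2.edges ∧ e ∉ w3.edges) ∨
        (e ∉ w1.edges ∧ e ∉ w2.edges ∧ e ∈ w3.edges))

/-- A special `9`-cycle: a `9`-cycle having a `(3,8)`-chord or a
`(5,5,5)`-claw. -/
def IsSpecial9Cycle (G : SimpleGraph V) {a : V} (C : G.Walk a a) : Prop :=
  C.IsCycle ∧ C.length = 9 ∧ (HasChordSplit G C 3 8 ∨ HasClawSplit G C 5 5 5)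

/-- Two cycles are normally adjacent if they share exactly one edge and
exactly two vertices. -/
def NormallyAdjacent (G : SimpleGraph V) {a b : V}
    (c1 : G.Walk a a) (c2 : G.Walk b b) : Prop :=
  (∃ e : Sym2 V, {e' : Sym2 V | e' ∈ c1.edges} ∩ {e' : Sym2 V | e' ∈ c2.edges} = {e}) ∧
  (∃ x y : V, x ≠ y ∧ {z : V | z ∈ c1.support} ∩ {z : V | z ∈ c2.support} = {x, y})

/-- A `3`-fold cover `(H, L)` of `G`. -/
def IsDPCover (G : SimpleGraph V) {W : Type} (H : SimpleGraph W)
    (L : V → Finset W) : Prop :=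
  (∀ v : V, (L v).card = 3) ∧
  (∀ ⦃u v : V⦄, u ≠ v → Disjoint (L u) (L v)) ∧
  (∀ v : V, ∀ a ∈ L v, ∀ b ∈ L v, ¬ H.Adj a b) ∧
  (∀ ⦃a b : W⦄, H.Adj a b → ∃ u v : V, G.Adj u v ∧ a ∈ L u ∧ b ∈ L v) ∧
  (∀ ⦃u v : V⦄, u ≠ v → ∀ a ∈ L u, ∀ b ∈ L v, ∀ b' ∈ L v,
    H.Adj a b → H.Adj a b' → b = b')

/-- `G` is DP-`3`-colorable: for every `3`-fold cover `(H, L)` of `G` there is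
an independent transversal picking one vertex from each fiber. -/
def DP3Colorable (G : SimpleGraph V) : Prop :=
  ∀ (W : Type) (H : SimpleGraph W) (L : V → Finset W), IsDPCover G H L →
    ∃ f : V → W, (∀ v : V, f v ∈ L v) ∧ ∀ u v : V, ¬ H.Adj (f u) (f v)


section Forests
open Classical Finset

variable {V W W' : Type}

/-- The edges of `D` whose endpoints are sent into `Y` by `r`. -/
noncomputable def spanned (D : Finset (Sym2 V)) (r : V → W) (Y : Finset W) : Finset (Sym2 V) :=
  D.filter fun e => ∀ x ∈ e, r x ∈ Y

/-- The multigraph obtained from `D` by identifying vertices along `r` is a forest. -/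
def Forest (D : Finset (Sym2 V)) (r : V → W) : Prop :=
  ∀ Y : Finset W, Y.Nonempty → #(spanned D r Y) + 1 ≤ #Y

/-- Some set containing `a` and `b` spans as many edges as a tree; in a forest this means that
`a` and `b` lie in the same component. -/
def Tight (D : Finset (Sym2 V)) (r : V → W) (a b : W) : Prop :=
  ∃ Y : Finset W, a ∈ Y ∧ b ∈ Y ∧ #(spanned D r Y) + 1 = #Y

variable {D D' : Finset (Sym2 V)} {r : V → W}

lemma spanned_mono (h : D ⊆ D') (Y : Finset W) : spanned D r Y ⊆ spanned D' r Y :=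
  filter_subset_filter _ h

lemma Forest.mono (hF : Forest D' r) (h : D ⊆ D') : Forest D r := fun Y hY =>
  (Nat.add_le_add_right (card_le_card (spanned_mono h Y)) 1).trans (hF Y hY)

lemma Tight.mono {a b : W} (ht : Tight D r a b) (h : D ⊆ D') (hF : Forest D' r) :
    Tight D' r a b := by
  obtain ⟨Y, ha, hb, hY⟩ := ht
  refine ⟨Y, ha, hb, le_antisymm (hF Y ⟨a, ha⟩) ?_⟩
  rw [← hY]
  exact Nat.add_le_add_right (card_le_card (spanned_mono h Y)) 1

lemma Tight.symm {a b : W} (ht : Tight D r a b) : Tight D r b a := by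
  obtain ⟨Y, ha, hb, hY⟩ := ht
  exact ⟨Y, hb, ha, hY⟩

lemma Forest.tight_trans (hF : Forest D r) {a b d : W} (h1 : Tight D r a b)
    (h2 : Tight D r b d) : Tight D r a d := by
  obtain ⟨Y, ha, hb, hY⟩ := h1
  obtain ⟨Z, hb', hd, hZ⟩ := h2
  refine ⟨Y ∪ Z, mem_union_left _ ha, mem_union_right _ hd,
    le_antisymm (hF _ ⟨a, mem_union_left _ ha⟩) ?_⟩
  have e1 := card_union_add_card_inter Y Z
  have e2 := card_union_add_card_inter (spanned D r Y) (spanned D r Z)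
  have s1 : spanned D r Y ∪ spanned D r Z ⊆ spanned D r (Y ∪ Z) := by
    intro e
    simp only [spanned, mem_union, mem_filter]
    rintro (⟨h, h'⟩ | ⟨h, h'⟩)
    exacts [⟨h, fun x hx => Or.inl (h' x hx)⟩, ⟨h, fun x hx => Or.inr (h' x hx)⟩]
  have s2 : spanned D r Y ∩ spanned D r Z ⊆ spanned D r (Y ∩ Z) := by
    intro e
    simp only [spanned, mem_inter, mem_filter]
    rintro ⟨⟨h, h'⟩, _, h''⟩
    exact ⟨h, fun x hx => ⟨h' x hx, h'' x hx⟩⟩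
  have c1 := card_le_card s1
  have c2 := card_le_card s2
  have f := hF (Y ∩ Z) ⟨b, mem_inter.2 ⟨hb, hb'⟩⟩
  omega

lemma spanned_insert_subset (e : Sym2 V) (Y : Finset W) :
    spanned (insert e D) r Y ⊆ insert e (spanned D r Y) := by
  intro f
  simp only [spanned, mem_insert, mem_filter]
  tauto

lemma Forest.insert (hF : Forest D r) {u v : V} (h : ¬ Tight D r (r u) (r v)) :
    Forest (insert s(u, v) D) r := by
  intro Y hY
  have f := hF Y hY
  by_cases hh : r u ∈ Y ∧ r v ∈ Y
  · have hn : #(spanned D r Y) + 1 ≠ #Y := fun e => h ⟨Y, hh.1, hh.2, e⟩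
    have := (card_le_card (spanned_insert_subset (D := D) (r := r) s(u, v) Y)).trans
      (card_insert_le _ _)
    omega
  · have : spanned (Insert.insert s(u, v) D) r Y ⊆ spanned D r Y := by
      intro e
      simp only [spanned, mem_insert, mem_filter]
      rintro ⟨rfl | h1, h2⟩
      · exact absurd ⟨h2 u (by simp), h2 v (by simp)⟩ hh
      · exact ⟨h1, h2⟩
    have := card_le_card this
    omega

lemma spanned_erase {w : W} (hw : ∀ e ∈ D, ∀ x ∈ e, r x ≠ w) (Y : Finset W) :
    spanned D r (Y.erase w) = spanned D r Y := by
  ext e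
  simp only [spanned, mem_filter, mem_erase]
  constructor
  · rintro ⟨h, h'⟩
    exact ⟨h, fun x hx => (h' x hx).2⟩
  · rintro ⟨h, h'⟩
    exact ⟨h, fun x hx => ⟨hw e h x hx, h' x hx⟩⟩

lemma Forest.not_tight_of_isolated (hF : Forest D r) {w b : W}
    (hw : ∀ e ∈ D, ∀ x ∈ e, r x ≠ w) (hb : b ≠ w) : ¬ Tight D r w b := by
  rintro ⟨Y, hwY, hbY, hY⟩
  have := hF (Y.erase w) ⟨b, mem_erase.2 ⟨hb, hbY⟩⟩
  rw [spanned_erase hw, card_erase_of_mem hwY] at this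
  omega

/-- After attaching a pendant edge `uv` at `u`, everything tight with `u` was tight with `v`. -/
lemma Forest.tight_of_pendant (hF : Forest D r) {u v : V} {b : W}
    (hw : ∀ e ∈ D, ∀ x ∈ e, r x ≠ r u) (huv : r v ≠ r u) (hb : b ≠ r u)
    (ht : Tight (Insert.insert s(u, v) D) r (r u) b) : Tight D r (r v) b := by
  obtain ⟨Y, hwY, hbY, hY⟩ := ht
  have hne : (Y.erase (r u)).Nonempty := ⟨b, mem_erase.2 ⟨hb, hbY⟩⟩
  have h1 := hF (Y.erase (r u)) hne
  have h2 := (card_le_card (spanned_insert_subset (D := D) (r := r) s(u, v) Y)).trans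
      (card_insert_le _ _)
  have h3 := card_erase_of_mem hwY
  have h4 := spanned_erase hw Y
  have h5 := card_pos.2 hne
  by_cases hv : r v ∈ Y
  · refine ⟨Y.erase (r u), mem_erase.2 ⟨huv, hv⟩, mem_erase.2 ⟨hb, hbY⟩, ?_⟩
    rw [h4] at h1 ⊢
    omega
  · exfalso
    have : spanned (Insert.insert s(u, v) D) r Y ⊆ spanned D r Y := by
      intro e
      simp only [spanned, mem_insert, mem_filter]
      rintro ⟨rfl | h1, h2⟩
      · exact absurd (h2 v (by simp)) hv
      · exact ⟨h1, h2⟩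
    have := card_le_card this
    rw [h4] at h1
    omega

lemma Forest.tight_of_pendant_of_ne (hF : Forest D r) {u v : V} {a b : W}
    (hw : ∀ e ∈ D, ∀ x ∈ e, r x ≠ r u) (ha : a ≠ r u) (hb : b ≠ r u)
    (ht : Tight (Insert.insert s(u, v) D) r a b) : Tight D r a b := by
  obtain ⟨Y, haY, hbY, hY⟩ := ht
  by_cases huY : r u ∈ Y
  · refine ⟨Y.erase (r u), mem_erase.2 ⟨ha, haY⟩, mem_erase.2 ⟨hb, hbY⟩, ?_⟩
    have h1 := hF (Y.erase (r u)) ⟨b, mem_erase.2 ⟨hb, hbY⟩⟩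
    have h2 := (card_le_card (spanned_insert_subset (D := D) (r := r) s(u, v) Y)).trans
      (card_insert_le _ _)
    have h3 := card_erase_of_mem huY
    have h4 := spanned_erase hw Y
    rw [h4] at h1 ⊢
    omega
  · refine ⟨Y, haY, hbY, ?_⟩
    have : spanned (Insert.insert s(u, v) D) r Y ⊆ spanned D r Y := by
      intro e
      simp only [spanned, mem_insert, mem_filter]
      rintro ⟨rfl | h1, h2⟩
      · exact absurd (h2 u (by simp)) huY
      · exact ⟨h1, h2⟩
    have h1 := card_le_card this
    have := hF Y ⟨b, hbY⟩
    omega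

/-- Pulling a forest back along an identification of vertices that is injective on edges. -/
lemma Forest.of_identify {V' : Type} {f : V → V'} {E : Finset (Sym2 V')} {r' : V' → W'}
    {s : W → W'} (hE : Forest E r') (hmap : ∀ e ∈ D, Sym2.map f e ∈ E)
    (hinj : ∀ e ∈ D, ∀ e' ∈ D, Sym2.map f e = Sym2.map f e' → e = e')
    (hr : ∀ x, r' (f x) = s (r x)) (Y : Finset W) (hY : Y.Nonempty) :
    #(spanned D r Y) + 1 ≤ #(Y.image s) := by
  refine le_trans (Nat.add_le_add_right ?_ 1) (hE (Y.image s) (hY.image s))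
  refine card_le_card_of_injOn (Sym2.map f) ?_ ?_
  · intro e he
    simp only [spanned, coe_filter, Set.mem_ofPred_eq] at he ⊢
    refine ⟨hmap e he.1, ?_⟩
    intro y hy
    obtain ⟨x, hx, rfl⟩ := Sym2.mem_map.1 hy
    rw [hr]
    exact mem_image_of_mem _ (he.2 x hx)
  · intro e he e' he'
    simp only [spanned, coe_filter, Set.mem_ofPred_eq] at he he'
    exact hinj e he.1 e' he'.1

lemma Forest.pullback {V' : Type} {f : V → V'} {E : Finset (Sym2 V')} {r' : V' → W'}
    {s : W → W'} (hE : Forest E r') (hmap : ∀ e ∈ D, Sym2.map f e ∈ E)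
    (hinj : ∀ e ∈ D, ∀ e' ∈ D, Sym2.map f e = Sym2.map f e' → e = e')
    (hr : ∀ x, r' (f x) = s (r x)) : Forest D r := fun Y hY =>
  (hE.of_identify hmap hinj hr Y hY).trans card_image_le

lemma Forest.not_tight_of_identified {V' : Type} {f : V → V'} {E : Finset (Sym2 V')} {r' : V' → W'}
    {s : W → W'} (hE : Forest E r') (hmap : ∀ e ∈ D, Sym2.map f e ∈ E)
    (hinj : ∀ e ∈ D, ∀ e' ∈ D, Sym2.map f e = Sym2.map f e' → e = e')
    (hr : ∀ x, r' (f x) = s (r x)) {a b : W} (hab : a ≠ b) (hs : s a = s b) :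
    ¬ Tight D r a b := by
  rintro ⟨Y, ha, hb, hY⟩
  have h1 := hE.of_identify hmap hinj hr Y ⟨a, ha⟩
  have h2 : #(Y.image s) < #Y := by
    refine lt_of_le_of_ne card_image_le fun h => hab ?_
    exact (card_image_iff.1 h) ha hb hs
  omega

end Forests

section Good
open Classical Finset

variable {V : Type}

/-- `G` with all edges at vertices of `Z` deleted. -/
def del (G : SimpleGraph V) (Z : Set V) : SimpleGraph V where
  Adj u v := G.Adj u v ∧ u ∉ Z ∧ v ∉ Z
  symm := ⟨fun _ _ h => ⟨h.1.symm, h.2.2, h.2.1⟩⟩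
  loopless := ⟨fun _ h => G.loopless.irrefl _ h.1⟩

lemma del_adj {G : SimpleGraph V} {Z : Set V} {u v : V} :
    (del G Z).Adj u v ↔ G.Adj u v ∧ u ∉ Z ∧ v ∉ Z := Iff.rfl

lemma del_le (G : SimpleGraph V) (Z : Set V) : del G Z ≤ G := fun _ _ h => h.1

/-- Contraction of `S` to the single point `none`. -/
noncomputable def contract (S : Set V) (x : V) : Option V := if x ∈ S then none else some x

lemma contract_of_mem {S : Set V} {x : V} (h : x ∈ S) : contract S x = none := if_pos h
lemma contract_of_notMem {S : Set V} {x : V} (h : x ∉ S) : contract S x = some x := if_neg h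

lemma contract_eq_some {S : Set V} {x y : V} : contract S x = some y ↔ x = y ∧ x ∉ S := by
  unfold contract
  split_ifs with h <;> simp [h]

lemma contract_eq_contract {S : Set V} {x v : V} (hv : v ∉ S) :
    contract S x = contract S v ↔ x = v := by
  rw [contract_of_notMem hv, contract_eq_some]
  constructor
  · exact fun h => h.1
  · rintro rfl
    exact ⟨rfl, hv⟩

variable [Fintype V]

/-- The edges between vertices colored `false` that do not have both ends in `S`. -/
noncomputable def fedges (G : SimpleGraph V) (S : Set V) (c : V → Bool) : Finset (Sym2 V) :=
  univ.filter fun e => e ∈ G.edgeSet ∧ (∀ x ∈ e, c x = false) ∧ ¬ ∀ x ∈ e, x ∈ S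

lemma mk_mem_fedges {G : SimpleGraph V} {S : Set V} {c : V → Bool} {u v : V} :
    s(u, v) ∈ fedges G S c ↔ G.Adj u v ∧ (c u = false ∧ c v = false) ∧ ¬ (u ∈ S ∧ v ∈ S) := by
  simp only [fedges, mem_filter, mem_univ, true_and, mem_edgeSet, Sym2.ball]

/-- `c` is an `(I,F)`-coloring of `G` relative to the precolored set `S`: edges inside `S` are
ignored, and the forest condition is required after contracting `S`. -/
def Good (G : SimpleGraph V) (S : Set V) (c : V → Bool) : Prop :=
  (∀ u v, G.Adj u v → c u = true → c v = true → u ∈ S ∧ v ∈ S) ∧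
  Forest (fedges G S c) (contract S)

/-- Tightness of two vertices in the `false`-colored graph with `S` contracted. -/
abbrev Linked (G : SimpleGraph V) (S : Set V) (c : V → Bool) (u v : V) : Prop :=
  Tight (fedges G S c) (contract S) (contract S u) (contract S v)

variable {G H : SimpleGraph V} {S Z : Set V} {c c' : V → Bool}

lemma Good.of_le_of_eq (h : Good H S c)
    (hle : ∀ u v, G.Adj u v → ¬ (u ∈ S ∧ v ∈ S) → H.Adj u v)
    (hc : ∀ u v, G.Adj u v → ¬ (u ∈ S ∧ v ∈ S) → c' u = c u) : Good G S c' := by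
  refine ⟨fun u v huv hu hv => ?_, h.2.mono ?_⟩
  · by_contra hS
    have hS' : ¬ (v ∈ S ∧ u ∈ S) := fun h => hS h.symm
    exact hS (h.1 u v (hle u v huv hS) (hc u v huv hS ▸ hu) (hc v u huv.symm hS' ▸ hv))
  · intro e
    induction e with | _ u v
    rw [mk_mem_fedges, mk_mem_fedges]
    rintro ⟨huv, ⟨hu, hv⟩, hS⟩
    have hS' : ¬ (v ∈ S ∧ u ∈ S) := fun h => hS h.symm
    exact ⟨hle u v huv hS, ⟨hc u v huv hS ▸ hu, hc v u huv.symm hS' ▸ hv⟩, hS⟩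

/-- The color of an isolated vertex is irrelevant. -/
lemma fedges_update {v : V} (hv : ∀ w, ¬ G.Adj v w) (b : Bool) :
    fedges G S (Function.update c v b) = fedges G S c := by
  ext e
  induction e with | _ x y
  rw [mk_mem_fedges, mk_mem_fedges]
  refine and_congr_right fun h => ?_
  have hx : x ≠ v := by rintro rfl; exact hv _ h
  have hy : y ≠ v := by rintro rfl; exact hv _ h.symm
  simp [Function.update_of_ne, hx, hy]

lemma Good.update (h : Good G S c) {v : V} (hv : ∀ w, ¬ G.Adj v w) (b : Bool) :
    Good G S (Function.update c v b) := by
  refine h.of_le_of_eq (fun _ _ h _ => h) fun x y hxy _ => ?_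
  rw [Function.update_of_ne]
  rintro rfl
  exact hv _ hxy

omit [Fintype V] in
lemma not_del_insert_adj {v w : V} : ¬ (del G (insert v Z)).Adj v w := fun h => h.2.1 (by simp)

lemma fedges_del_subset_of_forall {v : V} {D : Finset (Sym2 V)}
    (h : fedges (del G (insert v Z)) S c ⊆ D)
    (hv : ∀ w, G.Adj v w → v ∉ Z → w ∉ Z → c v = false → c w = false → s(v, w) ∈ D) :
    fedges (del G Z) S c ⊆ D := by
  intro e
  induction e with | _ x y
  rw [mk_mem_fedges]
  rintro ⟨⟨hxy, hx, hy⟩, ⟨hcx, hcy⟩, hS⟩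
  by_cases hxv : x = v
  · subst hxv; exact hv y hxy hx hy hcx hcy
  by_cases hyv : y = v
  · subst hyv; rw [Sym2.eq_swap]; exact hv x hxy.symm hy hx hcy hcx
  · refine h ?_
    rw [mk_mem_fedges]
    exact ⟨⟨hxy, by simp [hxv, hx], by simp [hyv, hy]⟩, ⟨hcx, hcy⟩, hS⟩

lemma contract_ne_of_mem_fedges {v : V} (hS : v ∉ S) :
    ∀ e ∈ fedges (del G (insert v Z)) S c, ∀ x ∈ e, contract S x ≠ contract S v := by
  intro e
  induction e with | _ x y
  rw [mk_mem_fedges]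
  rintro ⟨⟨-, hx, hy⟩, -⟩ w hw
  rw [Ne, contract_eq_contract hS]
  rintro rfl
  rcases Sym2.mem_iff.1 hw with rfl | rfl
  · exact hx (by simp)
  · exact hy (by simp)

lemma Good.ind_of_del {v : V} (h : Good (del G (insert v Z)) S c)
    (hv : ∀ w, G.Adj v w → w ∉ Z → c v = true → c w = false) :
    ∀ x y, (del G Z).Adj x y → c x = true → c y = true → x ∈ S ∧ y ∈ S := by
  rintro x y ⟨hxy, hx, hy⟩ hcx hcy
  by_cases hxv : x = v
  · subst hxv; simp [hv y hxy hy hcx] at hcy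
  by_cases hyv : y = v
  · subst hyv; simp [hv x hxy.symm hx hcy] at hcx
  exact h.1 x y ⟨hxy, by simp [hxv, hx], by simp [hyv, hy]⟩ hcx hcy

lemma Good.add_true {v : V} (h : Good (del G (insert v Z)) S c) (hc : c v = true)
    (hv : ∀ w, G.Adj v w → w ∉ Z → c w = false) :
    Good (del G Z) S c ∧ ∀ a b, Linked (del G Z) S c a b → Linked (del G (insert v Z)) S c a b := by
  have hsub : fedges (del G Z) S c ⊆ fedges (del G (insert v Z)) S c :=
    fedges_del_subset_of_forall subset_rfl fun w _ _ _ h => by simp [hc] at h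
  exact ⟨⟨h.ind_of_del fun w h1 h2 _ => hv w h1 h2, h.2.mono hsub⟩,
    fun a b hab => hab.mono hsub h.2⟩

/-- Adding a vertex colored `false` with at most one neighbor `p` colored `false`. -/
lemma Good.add_false {v p : V} (h : Good (del G (insert v Z)) S c) (hS : v ∉ S) (hp : p ≠ v)
    (hc : c v = false) (hv : ∀ w, G.Adj v w → w ∉ Z → c w = false → w = p) :
    Good (del G Z) S c ∧
      (∀ b, b ≠ v → Linked (del G Z) S c v b → Linked (del G (insert v Z)) S c p b) ∧
      (∀ a b, a ≠ v → b ≠ v → Linked (del G Z) S c a b →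
        Linked (del G (insert v Z)) S c a b) := by
  have hiso := contract_ne_of_mem_fedges (G := G) (Z := Z) (c := c) hS
  have hne : ∀ b, b ≠ v → contract S b ≠ contract S v := fun b hb => by
    rwa [Ne, contract_eq_contract hS]
  have hF : Forest (insert s(v, p) (fedges (del G (insert v Z)) S c)) (contract S) :=
    h.2.insert (h.2.not_tight_of_isolated hiso (hne p hp))
  have hsub : fedges (del G Z) S c ⊆ insert s(v, p) (fedges (del G (insert v Z)) S c) := by
    refine fedges_del_subset_of_forall (subset_insert _ _) fun w h1 _ h3 _ h5 => ?_
    rw [hv w h1 h3 h5]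
    exact mem_insert_self _ _
  refine ⟨⟨h.ind_of_del fun w _ _ h => by simp [hc] at h, hF.mono hsub⟩, ?_, ?_⟩
  · intro b hb hab
    exact h.2.tight_of_pendant hiso (hne p hp) (hne b hb) (hab.mono hsub hF)
  · intro a b ha hb hab
    exact h.2.tight_of_pendant_of_ne hiso (hne a ha) (hne b hb) (hab.mono hsub hF)

/-- Adding a vertex colored `false` with two `false` neighbors in different components. -/
lemma Good.add_false_two {v p q : V} (h : Good (del G (insert v Z)) S c) (hS : v ∉ S)
    (hp : p ≠ v) (hq : q ≠ v) (hc : c v = false)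
    (hv : ∀ w, G.Adj v w → w ∉ Z → c w = false → w = p ∨ w = q)
    (hpq : ¬ Linked (del G (insert v Z)) S c p q) :
    Good (del G Z) S c := by
  have hiso := contract_ne_of_mem_fedges (G := G) (Z := Z) (c := c) hS
  have hne : ∀ b, b ≠ v → contract S b ≠ contract S v := fun b hb => by
    rwa [Ne, contract_eq_contract hS]
  have hF : Forest (insert s(v, p) (fedges (del G (insert v Z)) S c)) (contract S) :=
    h.2.insert (h.2.not_tight_of_isolated hiso (hne p hp))
  have hF2 := hF.insert (u := v) (v := q) fun ht =>
    hpq (h.2.tight_of_pendant hiso (hne p hp) (hne q hq) ht)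
  have hsub : fedges (del G Z) S c ⊆
      insert s(v, q) (insert s(v, p) (fedges (del G (insert v Z)) S c)) := by
    refine fedges_del_subset_of_forall
      ((subset_insert _ _).trans (subset_insert _ _)) fun w h1 _ h3 _ h5 => ?_
    rcases hv w h1 h3 h5 with rfl | rfl <;> simp
  exact ⟨h.ind_of_del fun w _ _ h => by simp [hc] at h, hF2.mono hsub⟩

/-- A vertex with at most two remaining neighbors can always be colored. -/
lemma Good.add_of_two {v p q : V} (h : Good (del G (insert v Z)) S c) (hS : v ∉ S)
    (hp : p ≠ v) (hq : q ≠ v) (hv : ∀ w, G.Adj v w → w ∉ Z → w = p ∨ w = q) :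
    ∃ b, Good (del G Z) S (Function.update c v b) := by
  by_cases hb : c p = false ∧ c q = false
  · refine ⟨true, ((h.update (fun w => not_del_insert_adj) true).add_true (by simp) ?_).1⟩
    intro w h1 h2
    rcases hv w h1 h2 with rfl | rfl
    · rw [Function.update_of_ne hp, hb.1]
    · rw [Function.update_of_ne hq, hb.2]
  · refine ⟨false, ?_⟩
    have h' := h.update (v := v) (fun w => not_del_insert_adj) false
    by_cases hcp : c p = false
    · refine (h'.add_false (p := p) hS hp (by simp) fun w h1 h2 h3 => ?_).1
      rcases hv w h1 h2 with rfl | rfl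
      · rfl
      · rw [Function.update_of_ne hq] at h3
        exact absurd ⟨hcp, h3⟩ hb
    · refine (h'.add_false (p := q) hS hq (by simp) fun w h1 h2 h3 => ?_).1
      rcases hv w h1 h2 with rfl | rfl
      · rw [Function.update_of_ne hp] at h3
        exact absurd h3 hcp
      · rfl

/-- Gluing a coloring of `G - A` and a coloring of `A ∪ D` relative to `D`. -/
lemma Good.glue {A D : Set V} (hAD : ∀ x ∈ A, x ∉ D) (hAS : ∀ x ∈ A, x ∉ S)
    (hsep : ∀ x ∈ A, ∀ y, G.Adj x y → y ∈ A ∨ y ∈ D)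
    (h1 : Good (del G A) S c) (h2 : Good (del G (A ∪ D)ᶜ) D c) : Good G S c := by
  constructor
  · intro u v huv hu hv
    by_cases hA : u ∈ A ∨ v ∈ A
    · have hmem : (u ∈ A ∨ u ∈ D) ∧ (v ∈ A ∨ v ∈ D) := by
        rcases hA with hA | hA
        · exact ⟨Or.inl hA, hsep u hA v huv⟩
        · exact ⟨hsep v hA u huv.symm, Or.inl hA⟩
      have := h2.1 u v ⟨huv, not_not.2 hmem.1, not_not.2 hmem.2⟩ hu hv
      rcases hA with hA | hA
      · exact absurd this.1 (hAD u hA)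
      · exact absurd this.2 (hAD v hA)
    · push Not at hA
      exact h1.1 u v ⟨huv, hA.1, hA.2⟩ hu hv
  · intro Y hY
    let Y1 := Y.filter fun o => ∀ x ∈ A, o ≠ some x
    let Y2 := Y.filter fun o => ¬ ∀ x ∈ A, o ≠ some x
    have hYc : #Y1 + #Y2 = #Y := card_filter_add_card_filter_not _
    have hsub : spanned (fedges G S c) (contract S) Y ⊆
        spanned (fedges (del G A) S c) (contract S) Y1 ∪
        spanned (fedges (del G (A ∪ D)ᶜ) D c) (contract D)
          (if Y1.Nonempty then insert none Y2 else Y2) := by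
      intro e
      induction e with | _ u v
      simp only [spanned, mem_union, mem_filter, mk_mem_fedges, Sym2.ball]
      rintro ⟨⟨huv, hc, hS⟩, hu, hv⟩
      have key : ∀ x, x ∉ A → contract S x ∈ Y → contract S x ∈ Y1 := by
        intro x hx hxY
        refine mem_filter.2 ⟨hxY, fun y hy he => ?_⟩
        rw [contract_eq_some] at he
        exact hx (he.1 ▸ hy)
      have key2 : ∀ x, x ∈ A → contract S x ∈ Y → contract D x ∈ Y2 := by
        intro x hx hxY
        rw [contract_of_notMem (hAS x hx)] at hxY
        rw [contract_of_notMem (hAD x hx)]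
        exact mem_filter.2 ⟨hxY, fun h => h x hx rfl⟩
      by_cases hA : u ∈ A ∨ v ∈ A
      · right
        have hmem : (u ∈ A ∨ u ∈ D) ∧ (v ∈ A ∨ v ∈ D) := by
          rcases hA with hA | hA
          · exact ⟨Or.inl hA, hsep u hA v huv⟩
          · exact ⟨hsep v hA u huv.symm, Or.inl hA⟩
        refine ⟨⟨⟨huv, not_not.2 hmem.1, not_not.2 hmem.2⟩, hc, ?_⟩, ?_⟩
        · rintro ⟨hu', hv'⟩
          rcases hA with hA | hA
          · exact hAD u hA hu'
          · exact hAD v hA hv'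
        · have key3 : ∀ x, (x ∈ A ∨ x ∈ D) → contract S x ∈ Y →
              contract D x ∈ (if Y1.Nonempty then insert none Y2 else Y2) := by
            intro x hx hxY
            by_cases hxA : x ∈ A
            · have := key2 x hxA hxY
              split_ifs
              · exact mem_insert_of_mem this
              · exact this
            · have hxD := hx.resolve_left hxA
              rw [if_pos ⟨_, key x hxA hxY⟩, contract_of_mem hxD]
              exact mem_insert_self _ _
          exact ⟨key3 u hmem.1 hu, key3 v hmem.2 hv⟩
      · left
        push Not at hA
        exact ⟨⟨⟨huv, hA.1, hA.2⟩, hc, hS⟩, key u hA.1 hu, key v hA.2 hv⟩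
    have hcard := (card_le_card hsub).trans (card_union_le _ _)
    by_cases hne : Y1.Nonempty
    · rw [if_pos hne] at hcard
      have e1 := h1.2 Y1 hne
      have e2 := h2.2 (insert none Y2) ⟨none, mem_insert_self _ _⟩
      have e3 := card_insert_le (none : Option V) Y2
      omega
    · rw [if_neg hne] at hcard
      rw [not_nonempty_iff_eq_empty] at hne
      have e0 : spanned (fedges (del G A) S c) (contract S) Y1 = ∅ := by
        rw [hne]
        ext e
        induction e with | _ u v
        simp [spanned, Sym2.ball, -Sym2.mem_iff]
      rw [hne, card_empty, zero_add] at hYc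
      have e2 := h2.2 Y2 (card_pos.1 (by rw [hYc]; exact card_pos.2 hY))
      rw [e0, card_empty, zero_add] at hcard
      omega

end Good

section Paths

variable {V : Type} {G H : SimpleGraph V} {u v x y : V} {A B : List V}

/-- `u :: A ++ [v]` is a path in `G`. -/
def Pth (G : SimpleGraph V) (u : V) (A : List V) (v : V) : Prop :=
  (u :: (A ++ [v])).IsChain G.Adj ∧ (u :: (A ++ [v])).Nodup

lemma Pth.mono (h : Pth G u A v) (hGH : G ≤ H) : Pth H u A v :=
  ⟨h.1.imp fun _ _ h => hGH h, h.2⟩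

lemma Pth.imp (h : Pth G u A v)
    (hGH : ∀ a ∈ u :: (A ++ [v]), ∀ b ∈ u :: (A ++ [v]), G.Adj a b → H.Adj a b) : Pth H u A v :=
  ⟨List.IsChain.imp_of_mem_imp (fun a b ha hb hab => hGH a ha b hb hab) h.1, h.2⟩

lemma Pth.map {V' : Type} {G' : SimpleGraph V'} {f : V → V'} (hf : Function.Injective f)
    (h : Pth G u A v)
    (hG : ∀ a ∈ u :: (A ++ [v]), ∀ b ∈ u :: (A ++ [v]), G.Adj a b → G'.Adj (f a) (f b)) :
    Pth G' (f u) (A.map f) (f v) := by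
  have e : f u :: (A.map f ++ [f v]) = (u :: (A ++ [v])).map f := by simp
  unfold Pth
  rw [e]
  refine ⟨?_, h.2.map hf⟩
  rw [List.isChain_map]
  exact List.IsChain.imp_of_mem_imp (fun a b ha hb hab => hG a ha b hb hab) h.1

lemma Pth.symm (h : Pth G u A v) : Pth G v A.reverse u := by
  have e : v :: (A.reverse ++ [u]) = (u :: (A ++ [v])).reverse := by simp
  unfold Pth
  rw [e]
  exact ⟨by rw [List.isChain_reverse]; exact h.1.imp fun _ _ h => h.symm,
    List.nodup_reverse.2 h.2⟩

lemma Pth.ne (h : Pth G u A v) : u ≠ v := by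
  have := h.2
  grind

lemma Pth.left_notMem (h : Pth G u A v) : u ∉ A := by
  have := h.2
  grind

lemma Pth.right_notMem (h : Pth G u A v) : v ∉ A := by
  have := h.2
  grind

lemma pth_nil : Pth G u [] v ↔ G.Adj u v := by
  simp only [Pth, List.nil_append, List.isChain_cons_cons, List.isChain_singleton, and_true,
    and_iff_left_iff_imp]
  intro h
  simp [h.ne]

/-- The two halves of a path at an inner vertex. -/
lemma pth_append : Pth G u (A ++ x :: B) v ↔ Pth G u A x ∧ Pth G x B v ∧
    u ∉ B ∧ u ≠ v ∧ v ∉ A ∧ A.Disjoint B := by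
  have e : u :: ((A ++ x :: B) ++ [v]) = (u :: A) ++ x :: (B ++ [v]) := by simp
  have e2 : u :: (A ++ [x]) = (u :: A) ++ [x] := by simp
  unfold Pth
  rw [e, List.isChain_split, e2]
  constructor
  · rintro ⟨⟨h1, h2⟩, h3⟩
    refine ⟨⟨h1, ?_⟩, ⟨h2, ?_⟩, ?_⟩ <;> grind [List.Disjoint]
  · rintro ⟨⟨h1, h2⟩, ⟨h3, h4⟩, h5⟩
    refine ⟨⟨h1, h3⟩, ?_⟩
    grind [List.Disjoint]

lemma pth_cons : Pth G u (x :: B) v ↔ G.Adj u x ∧ Pth G x B v ∧ u ∉ B ∧ u ≠ v := by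
  have := pth_append (G := G) (u := u) (A := []) (x := x) (B := B) (v := v)
  simpa [pth_nil] using this

lemma pth_concat : Pth G u (A ++ [x]) v ↔ Pth G u A x ∧ G.Adj x v ∧ u ≠ v ∧ v ∉ A := by
  rw [pth_append, pth_nil]
  simp

/-- Two cycles sharing exactly the edge `uv` and exactly the vertices `u` and `v`. -/
def Theta (G : SimpleGraph V) (u v : V) (A B : List V) : Prop :=
  G.Adj u v ∧ Pth G u A v ∧ Pth G u B v ∧ A ≠ [] ∧ B ≠ [] ∧ A.Disjoint B

lemma Theta.symm (h : Theta G u v A B) : Theta G u v B A :=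
  ⟨h.1, h.2.2.1, h.2.1, h.2.2.2.2.1, h.2.2.2.1, h.2.2.2.2.2.symm⟩

/-- No triangle, 4-cycle or 5-cycle normally adjacent to an 8⁻-, 6⁻- or 5-cycle, respectively. -/
def Sparse (G : SimpleGraph V) : Prop := ∀ u v A B, Theta G u v A B →
  ¬ (A.length = 1 ∧ B.length ≤ 6) ∧ ¬ (A.length = 2 ∧ B.length ≤ 4) ∧
    ¬ (A.length = 3 ∧ B.length = 3)

lemma Sparse.mono (h : Sparse H) (hGH : G ≤ H) : Sparse G := fun u v A B ht =>
  h u v A B ⟨hGH ht.1, ht.2.1.mono hGH, ht.2.2.1.mono hGH, ht.2.2.2⟩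

/-- The edge `uv` lies on no cycle of length 4, …, 8. -/
def LongEdge (G : SimpleGraph V) (u v : V) : Prop :=
  G.Adj u v ∧ ∀ A, Pth G u A v → A.length ≤ 1 ∨ 7 ≤ A.length

lemma Sparse.triangle (h : Sparse G) (huv : G.Adj u v) (hux : G.Adj u x) (hvx : G.Adj v x)
    (hA : Pth G u A v) : A = [] ∨ A = [x] ∨ 7 ≤ A.length := by
  have tri : ∀ {a b d : V} {B : List V}, G.Adj a b → G.Adj a d → G.Adj b d → Pth G a B b →
      B ≠ [] → d ∉ B → 7 ≤ B.length := by
    intro a b d B hab had hbd hB hne hd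
    have hd' : Pth G a [d] b := by
      rw [pth_cons, pth_nil]
      exact ⟨had, hbd.symm, by simp, hab.ne⟩
    have := (h a b [d] B ⟨hab, hd', hB, by simp, hne, by simpa using hd⟩).1
    simp at this
    omega
  by_cases hx : x ∈ A
  · obtain ⟨A1, A2, rfl⟩ := List.append_of_mem hx
    have hv := hA.right_notMem
    have hu := hA.left_notMem
    rw [pth_append] at hA
    simp only [List.mem_append, List.mem_cons, not_or] at hv hu
    by_cases h1 : A1 = []
    · by_cases h2 : A2 = []
      · subst h1 h2; simp
      · have := tri hvx.symm hux.symm huv.symm hA.2.1 h2 hu.2.2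
        simp
        omega
    · have := tri hux huv hvx.symm hA.1 h1 hv.1
      simp
      omega
  · by_cases hne : A = []
    · exact Or.inl hne
    · exact Or.inr (Or.inr (tri huv hux hvx hA hne hx))

lemma Sparse.longEdge_of_triangle (h : Sparse G) (huv : G.Adj u v) (hux : G.Adj u x)
    (hvx : G.Adj v x) : LongEdge G u v := by
  refine ⟨huv, fun A hA => ?_⟩
  rcases h.triangle huv hux hvx hA with rfl | rfl | h <;> simp_all

end Paths

section Grid
open Classical

variable {V : Type} {G H : SimpleGraph V}

/-- Adjacency in the square grid. -/
def GAdj (p q : ℤ × ℤ) : Prop :=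
  (p.1 = q.1 ∧ (p.2 + 1 = q.2 ∨ q.2 + 1 = p.2)) ∨ (p.2 = q.2 ∧ (p.1 + 1 = q.1 ∨ q.1 + 1 = p.1))

lemma GAdj.symm {p q : ℤ × ℤ} (h : GAdj p q) : GAdj q p := by
  unfold GAdj at *
  omega

lemma reflTransGen_imp {α : Type} {R R' : α → α → Prop} (h : ∀ a b, R a b → R' a b) {a b : α}
    (hab : Relation.ReflTransGen R a b) : Relation.ReflTransGen R' a b :=
  Relation.ReflTransGen.mono h a b hab

/-- `R`-connectedness of a set. -/
def Conn {α : Type} (R : α → α → Prop) (B : Finset α) : Prop :=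
  ∀ p ∈ B, ∀ q ∈ B, Relation.ReflTransGen (fun a b => R a b ∧ a ∈ B ∧ b ∈ B) p q

lemma conn_toFinset {α : Type} {R : α → α → Prop} (hR : ∀ a b, R a b → R b a) {l : List α}
    (hl : l.IsChain R) : Conn R l.toFinset := by
  have aux : ∀ l : List α, l.IsChain R → ∀ B : Finset α, (∀ x ∈ l, x ∈ B) → ∀ p ∈ l, ∀ q ∈ l,
      Relation.ReflTransGen (fun a b => R a b ∧ a ∈ B ∧ b ∈ B) p q := by
    intro l
    induction l with
    | nil => simp
    | cons a l ih =>
      intro hl B hB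
      cases l with
      | nil =>
        intro p hp q hq
        simp only [List.mem_singleton] at hp hq
        subst hp hq
        exact .refl
      | cons b l =>
        rw [List.isChain_cons_cons] at hl
        have ih' := ih hl.2 B (fun x hx => hB x (List.mem_cons_of_mem _ hx))
        have hab : R a b ∧ a ∈ B ∧ b ∈ B := ⟨hl.1, hB a (by simp), hB b (by simp)⟩
        intro p hp q hq
        rcases List.mem_cons.1 hp with hpa | hp <;> rcases List.mem_cons.1 hq with hqa | hq
        · rw [hpa, hqa]
        · rw [hpa]; exact .head hab (ih' b (by simp) q hq)
        · rw [hqa]; exact .tail (ih' p hp b (by simp)) ⟨hR _ _ hab.1, hab.2.2, hab.2.1⟩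
        · exact ih' p hp q hq
  intro p hp q hq
  exact aux l hl _ (fun x hx => List.mem_toFinset.2 hx) p (List.mem_toFinset.1 hp) q
    (List.mem_toFinset.1 hq)

/-- A model of `G` as a minor of the square grid; isolated vertices may have empty branch sets. -/
structure GridModel (G : SimpleGraph V) (B : V → Finset (ℤ × ℤ)) : Prop where
  disj : ∀ u v p, p ∈ B u → p ∈ B v → u = v
  conn : ∀ v, Conn GAdj (B v)
  adj : ∀ u v, G.Adj u v → ∃ p ∈ B u, ∃ q ∈ B v, GAdj p q

def GridMinor (G : SimpleGraph V) : Prop := ∃ B, GridModel G B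

lemma GridMinor.mono (h : GridMinor H) (hGH : G ≤ H) : GridMinor G := by
  obtain ⟨B, hB⟩ := h
  exact ⟨B, hB.disj, hB.conn, fun u v huv => hB.adj u v (hGH huv)⟩

lemma GridMinor.minor (h : GridMinor G) (H : SimpleGraph V) (P : V → Finset V)
    (hdisj : ∀ u v w, w ∈ P u → w ∈ P v → u = v) (hconn : ∀ v, Conn G.Adj (P v))
    (hadj : ∀ u v, H.Adj u v → ∃ a ∈ P u, ∃ b ∈ P v, G.Adj a b) : GridMinor H := by
  obtain ⟨B, hB⟩ := h
  refine ⟨fun v => (P v).biUnion B, ?_, ?_, ?_⟩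
  · intro u v p hu hv
    simp only [Finset.mem_biUnion] at hu hv
    obtain ⟨a, ha, hpa⟩ := hu
    obtain ⟨b, hb, hpb⟩ := hv
    obtain rfl := hB.disj a b p hpa hpb
    exact hdisj u v a ha hb
  · intro v p hp q hq
    simp only [Finset.mem_biUnion] at hp hq
    obtain ⟨a, ha, hpa⟩ := hp
    obtain ⟨b, hb, hqb⟩ := hq
    have inner : ∀ c ∈ P v, ∀ p ∈ B c, ∀ q ∈ B c, Relation.ReflTransGen
        (fun x y => GAdj x y ∧ x ∈ (P v).biUnion B ∧ y ∈ (P v).biUnion B) p q := by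
      intro c hc p hp q hq
      refine reflTransGen_imp (fun x y h => ?_) (hB.conn c p hp q hq)
      exact ⟨h.1, Finset.mem_biUnion.2 ⟨c, hc, h.2.1⟩, Finset.mem_biUnion.2 ⟨c, hc, h.2.2⟩⟩
    have key := hconn v a ha b hb
    induction key generalizing q with
    | refl => exact inner a ha p hpa q hqb
    | tail _ hcd ih =>
      rename_i c d _
      obtain ⟨x, hx, y, hy, hxy⟩ := hB.adj c d hcd.1
      refine ((ih x hcd.2.1 hx).tail ⟨hxy, ?_, ?_⟩).trans (inner d hb y hy q hqb)
      · exact Finset.mem_biUnion.2 ⟨c, hcd.2.1, hx⟩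
      · exact Finset.mem_biUnion.2 ⟨d, hb, hy⟩
  · intro u v huv
    obtain ⟨a, ha, b, hb, hab⟩ := hadj u v huv
    obtain ⟨p, hp, q, hq, hpq⟩ := hB.adj a b hab
    exact ⟨p, Finset.mem_biUnion.2 ⟨a, ha, hp⟩, q, Finset.mem_biUnion.2 ⟨b, hb, hq⟩, hpq⟩

/-- The combinatorial data of the faces of a plane graph: `fc u v` is the face to the left of the
dart from `u` to `v`. -/
structure Dual [Fintype V] (G : SimpleGraph V) where
  X : Type
  fin : Fintype X
  fc : V → V → X
  surj : ∀ x, ∃ u v, G.Adj u v ∧ fc u v = x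
  even : ∀ (S : X → ZMod 2) (u : V),
    ∑ v, (if G.Adj u v then S (fc u v) + S (fc v u) else 0) = 0
  cyc : ∀ c : V → V → ZMod 2, (∀ u v, c u v = c v u) → (∀ u v, ¬ G.Adj u v → c u v = 0) →
    (∀ u, ∑ v, c u v = 0) → ∃ S : X → ZMod 2, ∀ u v, G.Adj u v → c u v = S (fc u v) + S (fc v u)
  count : (∃ u v, G.Adj u v) → (Finset.univ.filter fun p : V × V => G.Adj p.1 p.2).card + 4 ≤
    2 * Fintype.card X + 2 * (Finset.univ.filter fun u => ∃ v, G.Adj u v).card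

end Grid

section Rings

variable {V : Type} {G H : SimpleGraph V}

/-- `a` and `b` are consecutive in the list (in either order). -/
def Lnk : List V → V → V → Prop
  | x :: y :: l, a, b => (a = x ∧ b = y) ∨ (a = y ∧ b = x) ∨ Lnk (y :: l) a b
  | [_], _, _ => False
  | [], _, _ => False

lemma Lnk.symm {l : List V} {a b : V} (h : Lnk l a b) : Lnk l b a := by
  induction l with
  | nil => exact h
  | cons x l ih =>
    cases l with
    | nil => exact h
    | cons y l =>
      simp only [Lnk] at h ih ⊢
      tauto

lemma lnk_append {l m : List V} {x a b : V} :
    Lnk (l ++ x :: m) a b ↔ Lnk (l ++ [x]) a b ∨ Lnk (x :: m) a b := by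
  induction l with
  | nil => simp [Lnk]
  | cons y l ih =>
    cases l with
    | nil => simp [Lnk, or_assoc]
    | cons z l =>
      simp only [List.cons_append, Lnk] at ih ⊢
      tauto

lemma Lnk.mem {l : List V} {a b : V} (h : Lnk l a b) : a ∈ l ∧ b ∈ l := by
  induction l with
  | nil => exact h.elim
  | cons x l ih =>
    cases l with
    | nil => exact h.elim
    | cons y l =>
      simp only [Lnk] at h
      rcases h with ⟨rfl, rfl⟩ | ⟨rfl, rfl⟩ | h
      · simp
      · simp
      · exact ⟨List.mem_cons_of_mem _ (ih h).1, List.mem_cons_of_mem _ (ih h).2⟩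

lemma Lnk.adj {l : List V} (hl : l.IsChain G.Adj) {a b : V} (h : Lnk l a b) : G.Adj a b := by
  induction l with
  | nil => exact h.elim
  | cons x l ih =>
    cases l with
    | nil => exact h.elim
    | cons y l =>
      rw [List.isChain_cons_cons] at hl
      simp only [Lnk] at h
      rcases h with ⟨rfl, rfl⟩ | ⟨rfl, rfl⟩ | h
      · exact hl.1
      · exact hl.1.symm
      · exact ih hl.2 h

lemma isChain_of_lnk {R : V → V → Prop} {l : List V} (h : ∀ a b, Lnk l a b → R a b) :
    l.IsChain R := by
  induction l with
  | nil => simp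
  | cons x l ih =>
    cases l with
    | nil => simp
    | cons y l =>
      rw [List.isChain_cons_cons]
      exact ⟨h x y (by simp [Lnk]), ih fun a b hab => h a b (by simp [Lnk, hab])⟩

lemma lnk_cons_concat {l : List V} {x y a b : V} (h : Lnk (l ++ [x]) a b) :
    Lnk (l ++ [x, y]) a b := by
  rw [show l ++ [x, y] = l ++ x :: [y] by simp, lnk_append]
  exact Or.inl h

lemma lnk_reverse {l : List V} {a b : V} : Lnk l.reverse a b ↔ Lnk l a b := by
  induction l with
  | nil => simp [Lnk]
  | cons x l ih =>
    cases l with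
    | nil => simp [Lnk]
    | cons y l =>
      rw [List.reverse_cons, List.reverse_cons, List.append_assoc, List.singleton_append,
        lnk_append]
      rw [List.reverse_cons] at ih
      rw [ih]
      simp only [Lnk]
      tauto

/-- Consecutive in the cyclic list. -/
def RE (L : List V) (a b : V) : Prop := Lnk (L ++ L.head?.toList) a b

/-- `L` lists the vertices of a cycle of `G` in cyclic order (or is very short). -/
def Ring (G : SimpleGraph V) (L : List V) : Prop :=
  (L ++ L.head?.toList).IsChain G.Adj ∧ L.Nodup

lemma RE.symm {L : List V} {a b : V} (h : RE L a b) : RE L b a := Lnk.symm h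

lemma RE.mem {L : List V} {a b : V} (h : RE L a b) : a ∈ L ∧ b ∈ L := by
  have := Lnk.mem h
  cases L with
  | nil => exact h.elim
  | cons x l =>
    simp only [List.head?_cons, Option.toList, List.mem_append, List.mem_singleton] at this
    refine ⟨?_, ?_⟩
    · rcases this.1 with h | rfl
      exacts [h, by simp]
    · rcases this.2 with h | rfl
      exacts [h, by simp]

lemma Ring.adj {L : List V} (h : Ring G L) {a b : V} (hab : RE L a b) : G.Adj a b :=
  Lnk.adj h.1 hab

lemma ring_iff {L : List V} : Ring G L ↔ (∀ a b, RE L a b → G.Adj a b) ∧ L.Nodup :=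
  ⟨fun h => ⟨fun _ _ hab => h.adj hab, h.2⟩, fun h => ⟨isChain_of_lnk h.1, h.2⟩⟩

lemma re_cons_cons {x y : V} {l m : List V} {a b : V} :
    RE (x :: (l ++ y :: m)) a b ↔ Lnk (x :: (l ++ [y])) a b ∨ Lnk (y :: (m ++ [x])) a b := by
  have : (x :: (l ++ y :: m)) ++ (x :: (l ++ y :: m)).head?.toList =
    (x :: l) ++ y :: (m ++ [x]) := by simp
  unfold RE
  rw [this, lnk_append]
  simp

lemma re_append_comm {l m : List V} {a b : V} : RE (l ++ m) a b ↔ RE (m ++ l) a b := by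
  cases l with
  | nil => simp
  | cons x l =>
    cases m with
    | nil => simp
    | cons y m =>
      rw [List.cons_append, List.cons_append, re_cons_cons, re_cons_cons, or_comm]

lemma Ring.rotate {l m : List V} (h : Ring G (l ++ m)) : Ring G (m ++ l) := by
  rw [ring_iff] at h ⊢
  exact ⟨fun a b hab => h.1 a b (re_append_comm.1 hab), List.nodup_append_comm.1 h.2⟩

lemma re_cons_concat {x y : V} {l : List V} {a b : V} :
    RE (x :: (l ++ [y])) a b ↔
      Lnk (x :: (l ++ [y])) a b ∨ (a = y ∧ b = x) ∨ (a = x ∧ b = y) := by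
  rw [re_cons_cons]
  simp [Lnk]

lemma ring_cons_concat {x y : V} {l : List V} :
    Ring G (x :: (l ++ [y])) ↔ Pth G x l y ∧ G.Adj x y := by
  rw [ring_iff]
  constructor
  · rintro ⟨h1, h2⟩
    refine ⟨⟨isChain_of_lnk fun a b hab => h1 a b (re_cons_concat.2 (Or.inl hab)), h2⟩, ?_⟩
    exact h1 x y (re_cons_concat.2 (by simp))
  · rintro ⟨h1, h2⟩
    refine ⟨fun a b hab => ?_, h1.2⟩
    rcases re_cons_concat.1 hab with h | ⟨rfl, rfl⟩ | ⟨rfl, rfl⟩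
    exacts [h.adj h1.1, h2.symm, h2]

lemma re_reverse {L : List V} {a b : V} : RE L.reverse a b ↔ RE L a b := by
  cases L with
  | nil => simp
  | cons x l =>
    rw [List.reverse_cons, re_append_comm]
    unfold RE
    rw [← lnk_reverse]
    simp

lemma Ring.reverse {L : List V} (h : Ring G L) : Ring G L.reverse := by
  rw [ring_iff] at h ⊢
  exact ⟨fun a b hab => h.1 a b (re_reverse.1 hab), List.nodup_reverse.2 h.2⟩

/-- Every vertex of a cycle can be moved to the front. -/
lemma Ring.start {L : List V} (h : Ring G L) {x : V} (hx : x ∈ L) : ∃ M, Ring G (x :: M) ∧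
    (x :: M).length = L.length ∧ (∀ y, y ∈ x :: M ↔ y ∈ L) ∧
    (∀ a b, RE (x :: M) a b ↔ RE L a b) := by
  obtain ⟨l, m, rfl⟩ := List.append_of_mem hx
  refine ⟨m ++ l, by simpa using h.rotate, by simp; omega, fun y => by simp; tauto, fun a b => ?_⟩
  rw [re_append_comm (l := l)]
  simp

lemma lnk_head {l : List V} {x y a : V} (hl : (x :: y :: l).Nodup) (h : Lnk (x :: y :: l) x a) :
    a = y := by
  simp only [Lnk] at h
  simp only [List.nodup_cons, List.mem_cons, not_or] at hl
  rcases h with h | h | h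
  · exact h.2
  · exact absurd h.1 hl.1.1
  · have := h.mem.1
    simp [hl.1.1, hl.1.2] at this

/-- Every edge of a cycle can be made the closing edge. -/
lemma Ring.open {L : List V} (h : Ring G L) {a b : V} (hab : RE L a b) : ∃ M,
    Pth G a M b ∧ G.Adj a b ∧ M.length + 2 = L.length ∧ (∀ y, y ∈ a :: (M ++ [b]) ↔ y ∈ L) ∧
    (∀ c d, RE (a :: (M ++ [b])) c d ↔ RE L c d) := by
  obtain ⟨M, h1, h2, h3, h4⟩ := h.start hab.mem.1
  have hne := (h.adj hab).ne
  rw [← h4] at hab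
  have hnil : M ≠ [] := by
    rintro rfl
    have := hab.mem.2
    simp [hne.symm] at this
  obtain ⟨M', y, rfl⟩ := (List.eq_nil_or_concat' M).resolve_left hnil
  by_cases hy : b = y
  · subst hy
    have := ring_cons_concat.1 h1
    exact ⟨M', this.1, this.2, by simpa using h2, h3, h4⟩
  · have hl : Lnk (a :: (M' ++ [y])) a b := by
      rcases re_cons_concat.1 hab with h | ⟨rfl, rfl⟩ | ⟨_, rfl⟩
      exacts [h, absurd rfl hne, absurd rfl hy]
    cases M' with
    | nil => exact absurd (lnk_head h1.2 hl) hy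
    | cons z M' =>
      obtain rfl := lnk_head h1.2 hl
      have e : (a :: ((M' ++ [y]).reverse ++ [b])) = (b :: (M' ++ [y]) ++ [a]).reverse := by simp
      have e' : a :: (b :: M' ++ [y]) = [a] ++ (b :: (M' ++ [y])) := by simp
      have hR : Ring G (a :: ((M' ++ [y]).reverse ++ [b])) := by
        rw [e]
        refine Ring.reverse ?_
        rw [e'] at h1
        exact h1.rotate
      have := ring_cons_concat.1 hR
      refine ⟨(M' ++ [y]).reverse, this.1, this.2, by simpa using h2, fun w => ?_, fun c d => ?_⟩
      · rw [← h3]; simp; tauto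
      · rw [← h4, e, re_reverse, e', re_append_comm]

/-- Two vertices cut a cycle into two paths. -/
lemma Ring.arcs {L : List V} (h : Ring G L) {p q : V} (hp : p ∈ L) (hq : q ∈ L) (hpq : p ≠ q) :
    ∃ A B, Pth G p A q ∧ Pth G q B p ∧ A.Disjoint B ∧ A.length + B.length + 2 = L.length ∧
    (∀ y, y ∈ L ↔ y = p ∨ y = q ∨ y ∈ A ∨ y ∈ B) ∧
    (∀ a b, RE L a b ↔ Lnk (p :: (A ++ [q])) a b ∨ Lnk (q :: (B ++ [p])) a b) := by
  obtain ⟨M, h1, h2, h3, h4⟩ := h.start hp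
  have hqM : q ∈ M := by
    have := (h3 q).2 hq
    simpa [hpq.symm] using this
  obtain ⟨A, B, rfl⟩ := List.append_of_mem hqM
  have hnd := h1.2
  rw [ring_iff] at h1
  refine ⟨A, B, ⟨isChain_of_lnk fun a b hab => h1.1 a b (re_cons_cons.2 (Or.inl hab)), ?_⟩,
    ⟨isChain_of_lnk fun a b hab => h1.1 a b (re_cons_cons.2 (Or.inr hab)), ?_⟩, ?_, ?_, ?_, ?_⟩
  · grind
  · grind
  · grind [List.Disjoint]
  · simp at h2; omega
  · intro y
    rw [← h3]
    simp
    tauto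
  · intro a b
    rw [← h4, re_cons_cons]

section Chains
open Classical

variable [Fintype V]

/-- The mod 2 chain of the edges of a list. -/
noncomputable def lch : List V → V → V → ZMod 2
  | x :: y :: l, a, b => (if (a = x ∧ b = y) ∨ (a = y ∧ b = x) then 1 else 0) + lch (y :: l) a b
  | [_], _, _ => 0
  | [], _, _ => 0

omit [Fintype V] in
lemma lch_symm (l : List V) (a b : V) : lch l a b = lch l b a := by
  induction l with
  | nil => rfl
  | cons x l ih =>
    cases l with
    | nil => rfl
    | cons y l =>
      simp only [lch]
      rw [ih]
      congr 2
      exact propext ⟨by tauto, by tauto⟩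

omit [Fintype V] in
lemma lch_eq_zero {l : List V} {a b : V} (h : ¬ Lnk l a b) : lch l a b = 0 := by
  induction l with
  | nil => rfl
  | cons x l ih =>
    cases l with
    | nil => rfl
    | cons y l =>
      simp only [Lnk, not_or] at h
      simp only [lch]
      rw [ih h.2.2, if_neg, add_zero]
      rintro (h' | h')
      exacts [h.1 h', h.2.1 h']

lemma sum_lch {x y : V} {l : List V} (hl : (x :: (l ++ [y])).IsChain G.Adj) (u : V) :
    ∑ v, lch (x :: (l ++ [y])) u v = (if u = x then 1 else 0) + (if u = y then 1 else 0) := by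
  have step : ∀ x z : V, x ≠ z → ∑ v, (if (u = x ∧ v = z) ∨ (u = z ∧ v = x) then 1 else 0 : ZMod 2)
      = (if u = x then 1 else 0) + (if u = z then 1 else 0) := by
    intro x z hxz
    by_cases hx : u = x
    · subst hx; simp [hxz]
    · by_cases hz : u = z
      · subst hz; simp [hx]
      · simp [hx, hz]
  induction l generalizing x with
  | nil =>
    simp only [List.nil_append, List.isChain_cons_cons] at hl
    simp [lch, step x y hl.1.ne]
  | cons z l ih =>
    simp only [List.cons_append, List.isChain_cons_cons] at hl
    simp only [List.cons_append, lch, Finset.sum_add_distrib]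
    rw [step x z hl.1.ne, ih hl.2]
    rw [add_assoc, ← add_assoc (if u = z then (1 : ZMod 2) else 0), CharTwo.add_self_eq_zero,
      zero_add]

/-- The chain of a closed list is the coboundary of a set of faces. -/
lemma Dual.closed (D : Dual G) {x : V} {l : List V} (hl : (x :: (l ++ [x])).IsChain G.Adj) :
    ∃ T : D.X → ZMod 2, ∀ u v, G.Adj u v →
      lch (x :: (l ++ [x])) u v = T (D.fc u v) + T (D.fc v u) := by
  refine D.cyc _ (fun u v => lch_symm _ u v) (fun u v huv => ?_) (fun u => ?_)
  · exact lch_eq_zero fun h => huv (h.adj hl)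
  · rw [sum_lch hl, CharTwo.add_self_eq_zero]

omit [Fintype V] in
lemma lch_of_nodup {l : List V} (hl : l.Nodup) (a b : V) :
    lch l a b = if Lnk l a b then 1 else 0 := by
  induction l with
  | nil => simp [lch, Lnk]
  | cons x l ih =>
    cases l with
    | nil => simp [lch, Lnk]
    | cons y l =>
      rw [lch, ih (List.nodup_cons.1 hl).2]
      by_cases h : (a = x ∧ b = y) ∨ (a = y ∧ b = x)
      · have : ¬ Lnk (y :: l) a b := fun h' => by
          have hx := (List.nodup_cons.1 hl).1
          rcases h with ⟨rfl, -⟩ | ⟨-, rfl⟩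
          exacts [hx h'.mem.1, hx h'.mem.2]
        rw [if_pos h, if_neg this, if_pos, add_zero]
        simp only [Lnk]
        tauto
      · rw [if_neg h, zero_add]
        congr 1
        simp only [Lnk]
        exact propext ⟨by tauto, by tauto⟩

omit [Fintype V] in
lemma lch_concat (l : List V) (x y a b : V) : lch (l ++ [x, y]) a b =
    lch (l ++ [x]) a b + (if (a = x ∧ b = y) ∨ (a = y ∧ b = x) then 1 else 0) := by
  induction l with
  | nil => simp [lch]
  | cons z l ih =>
    cases l with
    | nil => simp [lch]
    | cons w l =>
      simp only [List.cons_append, lch] at ih ⊢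
      rw [ih, add_assoc]

/-- A cycle separates the faces into two classes. -/
lemma Dual.ring (D : Dual G) {L : List V} (hL : Ring G L) (h3 : 3 ≤ L.length) :
    ∃ T : D.X → ZMod 2, ∀ u v, G.Adj u v →
      (RE L u v ↔ T (D.fc u v) + T (D.fc v u) = 1) := by
  obtain ⟨x, z, l, y, rfl⟩ : ∃ x z l y, L = x :: (z :: l ++ [y]) := by
    rcases L with _ | ⟨x, _ | ⟨z, L⟩⟩
    · simp at h3
    · simp at h3
    · rcases List.eq_nil_or_concat' L with rfl | ⟨l, y, rfl⟩
      · simp at h3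
      · exact ⟨x, z, l, y, by simp⟩
  have h1 := hL.1
  have e : (x :: (z :: l ++ [y])) ++ (x :: (z :: l ++ [y])).head?.toList =
    x :: ((z :: l ++ [y]) ++ [x]) := by simp
  rw [e] at h1
  obtain ⟨T, hT⟩ := D.closed h1
  refine ⟨T, fun u v huv => ?_⟩
  rw [← hT u v huv]
  have e' : x :: ((z :: l ++ [y]) ++ [x]) = (x :: z :: l) ++ [y, x] := by simp
  rw [e', lch_concat, lch_of_nodup (by simpa using hL.2), re_cons_concat]
  have hnd := hL.2
  have key : Lnk (x :: z :: (l ++ [y])) u v → ¬ ((u = y ∧ v = x) ∨ (u = x ∧ v = y)) := by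
    intro h h'
    have hxy : Lnk (x :: z :: (l ++ [y])) x y := by
      rcases h' with ⟨rfl, rfl⟩ | ⟨rfl, rfl⟩
      exacts [h.symm, h]
    have := lnk_head (by simpa using hnd) hxy
    subst this
    simp at hnd
  by_cases h : Lnk (x :: z :: (l ++ [y])) u v
  · have := key h
    simp only [List.cons_append, h, if_true, this, if_false]
    simp
  · simp only [List.cons_append, h, if_false, false_or, zero_add]
    split_ifs with h <;> simp [h]

end Chains

end Rings

section Minimal
open Classical

variable {V : Type} {G H : SimpleGraph V} {S : Set V} {φ : V → Bool}

/-- A cycle whose coloring is to be extended: short, or of length at most 12 with a long edge. -/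
def AdmRing (G : SimpleGraph V) (L : List V) : Prop :=
  Ring G L ∧ 3 ≤ L.length ∧
    (L.length ≤ 9 ∨ L.length ≤ 12 ∧ ∃ a b, RE L a b ∧ LongEdge G a b)

/-- The precolored sets: single vertices and the vertex sets of admissible cycles. -/
def Adm (G : SimpleGraph V) (S : Set V) : Prop :=
  (∃ z, S = {z}) ∨ ∃ L, AdmRing G L ∧ S = {x | x ∈ L}

lemma LongEdge.mono {a b : V} (h : LongEdge G a b) (hle : H ≤ G) (hab : H.Adj a b) :
    LongEdge H a b := ⟨hab, fun A hA => h.2 A (hA.mono hle)⟩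

lemma AdmRing.mono {L : List V} (h : AdmRing G L) (hle : H ≤ G)
    (hL : ∀ a b, RE L a b → H.Adj a b) : AdmRing H L := by
  obtain ⟨h1, h2, h3⟩ := h
  refine ⟨ring_iff.2 ⟨hL, h1.2⟩, h2, h3.imp_right ?_⟩
  rintro ⟨h4, a, b, hab, hl⟩
  exact ⟨h4, a, b, hab, hl.mono hle (hL a b hab)⟩

lemma Adm.mono (h : Adm G S) (hle : H ≤ G) (hS : ∀ a ∈ S, ∀ b ∈ S, G.Adj a b → H.Adj a b) :
    Adm H S := by
  rcases h with h | ⟨L, h, rfl⟩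
  · exact Or.inl h
  · exact Or.inr ⟨L, h.mono hle fun a b hab => hS a hab.mem.1 b hab.mem.2 (h.1.adj hab), rfl⟩

lemma adm_singleton (z : V) : Adm G {z} := Or.inl ⟨z, rfl⟩

/-- In a cycle every vertex has two neighbors. -/
lemma re_two {L : List V} (hnd : L.Nodup) (h3 : 3 ≤ L.length) {a : V} (ha : a ∈ L) :
    ∃ b c, b ≠ c ∧ ∀ d, RE L a d ↔ d = b ∨ d = c := by
  obtain ⟨l, m, rfl⟩ := List.append_of_mem ha
  have hre : ∀ d, RE (l ++ a :: m) a d ↔ RE (a :: (m ++ l)) a d := fun d => by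
    rw [re_append_comm]; simp
  have hlen : (a :: (m ++ l)).length = (l ++ a :: m).length := by simp; omega
  have hnd' : (a :: (m ++ l)).Nodup := by
    have := List.nodup_append_comm.1 hnd
    simpa using this
  simp only [hre]
  rw [← hlen] at h3
  generalize m ++ l = k at *
  rcases k with _ | ⟨x, k⟩
  · simp at h3
  rcases List.eq_nil_or_concat' k with rfl | ⟨k, y, rfl⟩
  · simp at h3
  have hxy : x ≠ y := by rintro rfl; simp at hnd'
  have hay : a ≠ y := by rintro rfl; simp at hnd'
  have hax : a ≠ x := by rintro rfl; simp at hnd'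
  refine ⟨x, y, hxy, fun d => ?_⟩
  have := re_cons_concat (x := a) (y := y) (l := x :: k) (a := a) (b := d)
  simp only [List.cons_append] at this
  rw [this]
  constructor
  · rintro (h | h | h)
    · exact Or.inl (lnk_head hnd' h)
    · exact absurd h.1 hay
    · exact Or.inr h.2
  · rintro (rfl | rfl)
    · exact Or.inl (by simp [Lnk])
    · simp

variable [Fintype V]

/-- A minimal counterexample to the extension theorem. -/
structure Ctr (G : SimpleGraph V) (S : Set V) (φ : V → Bool) : Prop where
  grid : GridMinor G
  sparse : Sparse G
  adm : Adm G S
  bad : ¬ ∃ c, (∀ x ∈ S, c x = φ x) ∧ Good G S c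
  ih : ∀ (H : SimpleGraph V) (S' : Set V), GridMinor H → Sparse H → Adm H S' →
    H.edgeSet.ncard < G.edgeSet.ncard → ∀ φ' : V → Bool, ∃ c, (∀ x ∈ S', c x = φ' x) ∧ Good H S' c

lemma ncard_edgeSet_lt (hle : H ≤ G) {u v : V} (huv : G.Adj u v) (hn : ¬ H.Adj u v) :
    H.edgeSet.ncard < G.edgeSet.ncard := by
  refine Set.ncard_lt_ncard ?_ (Set.toFinite _)
  refine ⟨edgeSet_subset_edgeSet.2 hle, fun h => hn ?_⟩
  exact (mem_edgeSet H).1 (h ((mem_edgeSet G).2 huv))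

/-- Proper subgraphs can be colored. -/
lemma Ctr.sub (hC : Ctr G S φ) (hle : H ≤ G) {u v : V} (huv : G.Adj u v) (hn : ¬ H.Adj u v)
    {S' : Set V} (hS : Adm H S') (φ' : V → Bool) :
    ∃ c, (∀ x ∈ S', c x = φ' x) ∧ Good H S' c :=
  hC.ih H S' (hC.grid.mono hle) (hC.sparse.mono hle) hS (ncard_edgeSet_lt hle huv hn) φ'

omit [Fintype V] in
lemma del_empty : del G ∅ = G := by
  ext u v
  simp [del_adj]

/-- An admissible set does not separate a part disjoint from `S`. -/
lemma Ctr.glue (hC : Ctr G S φ) {A D : Set V} (hD : Adm G D) (hAD : ∀ x ∈ A, x ∉ D)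
    (hAS : ∀ x ∈ A, x ∉ S) (hsep : ∀ x ∈ A, ∀ y, G.Adj x y → y ∈ A ∨ y ∈ D)
    {a b : V} (ha : a ∈ A) (hab : G.Adj a b) {x y : V} (hxA : x ∉ A) (hxD : x ∉ D)
    (hxy : G.Adj x y) : False := by
  obtain ⟨c1, h1, h2⟩ := hC.sub (del_le G A) hab (fun h => h.2.1 ha)
    (hC.adm.mono (del_le G A) fun a ha b hb hab => ⟨hab, fun h => hAS a h ha, fun h => hAS b h hb⟩) φ
  obtain ⟨c2, h3, h4⟩ := hC.sub (del_le G (A ∪ D)ᶜ) hxy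
    (fun h => h.2.1 (by simp [hxA, hxD]))
    (hD.mono (del_le G (A ∪ D)ᶜ) fun a ha b hb hab => ⟨hab, by simp [ha], by simp [hb]⟩) c1
  refine hC.bad ⟨fun x => if x ∈ A then c2 x else c1 x, fun x hx => ?_, ?_⟩
  · simp only [if_neg fun h => hAS x h hx, h1 x hx]
  · refine Good.glue hAD hAS hsep (h2.of_le_of_eq (fun _ _ h _ => h) ?_)
      (h4.of_le_of_eq (fun _ _ h _ => h) ?_)
    · intro u v huv _
      exact if_neg huv.2.1
    · intro u v huv _
      have hu : u ∈ A ∨ u ∈ D := not_not.1 huv.2.1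
      by_cases huA : u ∈ A
      · exact if_pos huA
      · simp only [huA, if_false]
        exact (h3 u (hu.resolve_left huA)).symm

/-- Every vertex outside `S` that is not isolated has degree at least 3. -/
lemma Ctr.three (hC : Ctr G S φ) {v w : V} (hv : v ∉ S) (hvw : G.Adj v w) (p q : V) :
    ∃ x, G.Adj v x ∧ x ≠ p ∧ x ≠ q := by
  by_contra! hno
  obtain ⟨p', hp', hp2⟩ : ∃ p', p' ≠ v ∧ ∀ x, G.Adj v x → x = p → x = p' := by
    by_cases h : p = v
    · exact ⟨w, hvw.ne', fun x hx h' => absurd hx (by rw [h', h]; exact G.irrefl)⟩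
    · exact ⟨p, h, fun _ _ h => h⟩
  obtain ⟨q', hq', hq2⟩ : ∃ q', q' ≠ v ∧ ∀ x, G.Adj v x → x = q → x = q' := by
    by_cases h : q = v
    · exact ⟨w, hvw.ne', fun x hx h' => absurd hx (by rw [h', h]; exact G.irrefl)⟩
    · exact ⟨q, h, fun _ _ h => h⟩
  obtain ⟨c, h1, h2⟩ := hC.sub (del_le G {v}) hvw (fun h => h.2.1 rfl)
    (hC.adm.mono (del_le G {v}) fun a ha b hb hab =>
      ⟨hab, fun h => hv (h ▸ ha), fun h => hv (h ▸ hb)⟩) φ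
  have h3 : Good (del G (insert v ∅)) S c := by simpa using h2
  obtain ⟨b, hb⟩ := h3.add_of_two hv hp' hq' fun x hx _ => by
    by_cases hxp : x = p
    · exact Or.inl (hp2 x hx hxp)
    · exact Or.inr (hq2 x hx (hno x hx hxp))
  rw [del_empty] at hb
  refine hC.bad ⟨_, fun x hx => ?_, hb⟩
  rw [Function.update_of_ne (by rintro rfl; exact hv hx), h1 x hx]

/-- The precolored cycle has no chord. -/
lemma Ctr.chordless (hC : Ctr G S φ) {L : List V} (hL : AdmRing G L) (hS : S = {x | x ∈ L})
    {a b : V} (ha : a ∈ S) (hb : b ∈ S) (hab : G.Adj a b) : RE L a b := by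
  by_contra hn
  let H : SimpleGraph V :=
    { Adj := fun u v => G.Adj u v ∧ ¬ ((u = a ∧ v = b) ∨ (u = b ∧ v = a))
      symm := ⟨fun u v h => ⟨h.1.symm, by tauto⟩⟩
      loopless := ⟨fun _ h => G.loopless.irrefl _ h.1⟩ }
  have hle : H ≤ G := fun _ _ h => h.1
  have hLH : AdmRing H L := hL.mono hle fun u v huv => ⟨hL.1.adj huv, by
    rintro (⟨rfl, rfl⟩ | ⟨rfl, rfl⟩)
    exacts [hn huv, hn huv.symm]⟩
  obtain ⟨c, h1, h2⟩ := hC.sub hle hab (fun h => h.2 (Or.inl ⟨rfl, rfl⟩))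
    (Or.inr ⟨L, hLH, hS⟩) φ
  refine hC.bad ⟨c, h1, h2.of_le_of_eq (fun u v huv hnS => ⟨huv, ?_⟩) fun _ _ _ _ => rfl⟩
  rintro (⟨rfl, rfl⟩ | ⟨rfl, rfl⟩)
  exacts [hnS ⟨ha, hb⟩, hnS ⟨hb, ha⟩]

omit [Fintype V] in
lemma reflTransGen_symm {R : V → V → Prop} (hR : ∀ a b, R a b → R b a) {a b : V}
    (h : Relation.ReflTransGen R a b) : Relation.ReflTransGen R b a := by
  induction h with
  | refl => exact .refl
  | tail _ h ih => exact .head (hR _ _ h) ih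

/-- The walks avoiding `v`. -/
abbrev Av (G : SimpleGraph V) (v a b : V) : Prop :=
  Relation.ReflTransGen (fun a b => G.Adj a b ∧ a ≠ v ∧ b ≠ v) a b

omit [Fintype V] in
lemma Av.symm {v a b : V} (h : Av G v a b) : Av G v b a := by
  exact reflTransGen_symm (fun _ _ h => ⟨h.1.symm, h.2.2, h.2.1⟩) h

omit [Fintype V] in
lemma conn_list {R : V → V → Prop} (hR : ∀ a b, R a b → R b a) {l : List V} (hl : l.IsChain R)
    {a b : V} (ha : a ∈ l) (hb : b ∈ l) : Relation.ReflTransGen R a b :=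
  reflTransGen_imp (fun _ _ h => h.1)
    (conn_toFinset hR hl a (List.mem_toFinset.2 ha) b (List.mem_toFinset.2 hb))

omit [Fintype V] in
/-- The rest of `S` is connected after deleting a vertex. -/
lemma Adm.av (h : Adm G S) {v a b : V} (ha : a ∈ S) (hb : b ∈ S) (hav : a ≠ v) (hbv : b ≠ v) :
    Av G v a b := by
  have symm : ∀ a b, (G.Adj a b ∧ a ≠ v ∧ b ≠ v) → (G.Adj b a ∧ b ≠ v ∧ a ≠ v) :=
    fun _ _ h => ⟨h.1.symm, h.2.2, h.2.1⟩
  have main : ∀ l : List V, l.IsChain G.Adj → v ∉ l → a ∈ l → b ∈ l → Av G v a b := by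
    intro l hl hv ha hb
    refine conn_list symm (List.IsChain.imp_of_mem_imp (fun x y hx hy hxy => ⟨hxy, ?_, ?_⟩) hl) ha hb
    exacts [fun h => hv (h ▸ hx), fun h => hv (h ▸ hy)]
  rcases h with ⟨z, rfl⟩ | ⟨L, hL, rfl⟩
  · rw [Set.mem_singleton_iff] at ha hb
    rw [ha, hb]
  · by_cases hv : v ∈ L
    · obtain ⟨M, h1, h2, h3, h4⟩ := hL.1.start hv
      have hM := h1.1
      refine main M ?_ (List.nodup_cons.1 h1.2).1 ?_ ?_
      · have := List.IsChain.of_cons hM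
        exact (List.isChain_append.1 this).1
      · have := (h3 a).2 ha
        simpa [hav] using this
      · have := (h3 b).2 hb
        simpa [hbv] using this
    · exact main L (List.isChain_append.1 hL.1.1).1 hv ha hb

/-- A minimal counterexample has no cut vertex. -/
lemma Ctr.av (hC : Ctr G S φ) {v p q : V} (hp : G.Adj v p) (hq : G.Adj v q) : Av G v p q := by
  by_contra hn
  have key : ∀ p q, G.Adj v p → G.Adj v q → ¬ Av G v p q → ∃ s ∈ S, s ≠ v ∧ Av G v p s := by
    intro p q hp hq hn
    by_contra! hno
    refine hC.glue (A := {x | x ≠ v ∧ Av G v p x}) (D := {v}) (adm_singleton v) (fun x hx => hx.1)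
      (fun x hx hxS => hno x hxS hx.1 hx.2) ?_ (a := p) ⟨hp.ne', .refl⟩ hp.symm
      (x := q) (fun h => hn h.2) hq.ne' hq.symm
    rintro x ⟨hx, hpx⟩ y hxy
    by_cases hy : y = v
    · exact Or.inr hy
    · exact Or.inl ⟨hy, hpx.tail ⟨hxy, hx, hy⟩⟩
  obtain ⟨s, hs, hsv, h1⟩ := key p q hp hq hn
  obtain ⟨t, ht, htv, h2⟩ := key q p hq hp fun h => hn h.symm
  exact hn ((h1.trans (hC.adm.av hs ht hsv htv)).trans h2.symm)

/-- A minimal counterexample is connected up to isolated vertices. -/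
lemma Ctr.conn (hC : Ctr G S φ) {a a' b b' : V} (ha : G.Adj a a') (hb : G.Adj b b') :
    Relation.ReflTransGen G.Adj a b := by
  have sym : ∀ {x y : V}, Relation.ReflTransGen G.Adj x y → Relation.ReflTransGen G.Adj y x :=
    fun h => reflTransGen_symm (fun _ _ h => h.symm) h
  by_contra hn
  have key : ∀ a a' b b', G.Adj a a' → G.Adj b b' → ¬ Relation.ReflTransGen G.Adj a b →
      ∃ s ∈ S, Relation.ReflTransGen G.Adj a s := by
    intro a a' b b' ha hb hn
    by_contra! hno
    refine hC.glue (A := {x | Relation.ReflTransGen G.Adj a x}) (D := {b}) (adm_singleton b) ?_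
      (fun x hx hxS => hno x hxS hx) (fun x hx y hxy => Or.inl (hx.tail hxy)) (a := a) .refl ha
      (x := b') (fun h => hn (h.tail hb.symm)) hb.ne' hb.symm
    rintro x hx rfl
    exact hn hx
  obtain ⟨s, hs, h1⟩ := key a a' b b' ha hb hn
  obtain ⟨t, ht, h2⟩ := key b b' a a' hb ha fun h => hn (sym h)
  refine hn ((h1.trans ?_).trans (sym h2))
  by_cases hst : s = t
  · rw [hst]
  rcases hC.adm with ⟨z, rfl⟩ | ⟨L, hL, rfl⟩
  · rw [Set.mem_singleton_iff] at hs ht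
    rw [hs, ht]
  · exact conn_list (fun _ _ h => h.symm) (List.isChain_append.1 hL.1.1).1 hs ht

end Minimal

section Faces
open Classical

variable {V : Type} {G H : SimpleGraph V} {S : Set V} {φ : V → Bool}

lemma exists_pth {a b : V} (h : Relation.ReflTransGen G.Adj a b) (hab : a ≠ b) :
    ∃ A, Pth G a A b := by
  have hr : G.Reachable a b := by
    rw [SimpleGraph.reachable_iff_reflTransGen]; exact h
  obtain ⟨p, hp⟩ := hr.exists_isPath
  have h1 := p.isChain_adj_support
  have h2 := hp.support_nodup
  have h3 := p.cons_tail_support.symm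
  have h4 : p.support.getLast? = some b := by
    rw [List.getLast?_eq_some_getLast p.support_ne_nil, p.getLast_support]
  rw [h3] at h1 h2
  obtain ⟨A, c, hA⟩ : ∃ A c, p.support.tail = A ++ [c] := by
    rcases List.eq_nil_or_concat' p.support.tail with h | ⟨A, c, h⟩
    · rw [h3, h] at h4
      exact absurd (by simpa using h4) hab
    · exact ⟨A, c, h⟩
  have : c = b := by
    rw [h3, hA, ← List.cons_append, List.getLast?_concat] at h4
    exact Option.some.inj h4
  subst this
  rw [hA] at h1 h2
  exact ⟨A, h1, h2⟩

variable [Fintype V]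

lemma zmod2 (a : ZMod 2) : a = 0 ∨ a = 1 := by
  revert a; decide

/-- If every face meets a set of edges at `v` evenly, the set contains all edges at `v` or none. -/
lemma Ctr.link (hC : Ctr G S φ) (D : Dual G) {v : V} (P : V → Prop)
    (hP : ∀ T : D.X → ZMod 2,
      ∑ w, (if G.Adj v w ∧ P w then T (D.fc v w) + T (D.fc w v) else 0) = 0)
    {p q : V} (hp : G.Adj v p) (hPp : P p) (hq : G.Adj v q) : P q := by
  by_contra hPq
  have hpq : p ≠ q := fun h => hPq (h ▸ hPp)
  have hav : Relation.ReflTransGen (del G {v}).Adj p q := hC.av hp hq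
  obtain ⟨A, hA⟩ := exists_pth hav hpq
  have hvA : v ∉ p :: (A ++ [q]) := by
    intro h
    have hc := hA.1
    simp only [List.mem_cons, List.mem_append, List.not_mem_nil, or_false] at h
    rcases h with h | h | h
    · exact hp.ne h
    · obtain ⟨A1, A2, rfl⟩ := List.append_of_mem h
      rw [show p :: (A1 ++ v :: A2 ++ [q]) = (p :: A1) ++ v :: (A2 ++ [q]) by simp,
        List.isChain_split] at hc
      have := hc.2
      cases A2 <;> simp [del_adj] at this
    · exact hq.ne h
  have hch : (v :: ((p :: (A ++ [q])) ++ [v])).IsChain G.Adj := by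
    have h1 : (p :: (A ++ [q])).IsChain G.Adj := hA.1.imp fun _ _ h => h.1
    have h2 : (p :: (A ++ [q])) ++ [v] = (p :: A) ++ q :: [v] := by simp
    rw [show v :: ((p :: (A ++ [q])) ++ [v]) = v :: p :: (A ++ q :: [v]) by simp,
      List.isChain_cons_cons]
    refine ⟨hp, ?_⟩
    rw [← List.cons_append, List.isChain_split]
    exact ⟨by simpa using h1, by simpa using hq.symm⟩
  obtain ⟨T, hT⟩ := D.closed hch
  have hval : ∀ w, G.Adj v w → T (D.fc v w) + T (D.fc w v) =
      (if w = p then 1 else 0) + (if w = q then 1 else 0) := by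
    intro w hw
    rw [← hT v w hw, show v :: ((p :: (A ++ [q])) ++ [v]) = (v :: p :: A) ++ [q, v] by simp,
      lch_concat, show (v :: p :: A) ++ [q] = v :: p :: (A ++ [q]) by simp, lch,
      lch_eq_zero fun h => hvA h.mem.1, add_zero]
    congr 1
    · simp [hp.ne]
    · simp [hq.ne]
  have h0 := hP T
  rw [Finset.sum_eq_single p] at h0
  · rw [if_pos ⟨hp, hPp⟩, hval p hp] at h0
    simp [hpq] at h0
  · intro w _ hwp
    split_ifs with hw
    · rw [hval w hw.1, if_neg hwp, if_neg, add_zero]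
      rintro rfl
      exact hPq hw.2
    · rfl
  · simp

lemma Ctr.fc_ne (hC : Ctr G S φ) (D : Dual G) {u v : V} (huv : G.Adj u v) :
    D.fc u v ≠ D.fc v u := by
  intro h
  have key : ∀ {u v : V}, G.Adj u v → D.fc u v = D.fc v u → ∀ q, G.Adj u q → q = v := by
    intro u v huv h q hq
    refine hC.link D (fun w => w = v) (fun T => ?_) huv rfl hq
    rw [Finset.sum_eq_single v]
    · rw [if_pos ⟨huv, rfl⟩, h, CharTwo.add_self_eq_zero]
    · intro w _ hw
      simp [hw]
    · simp
  have hS : ∀ {u v : V}, G.Adj u v → D.fc u v = D.fc v u → u ∈ S := by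
    intro u v huv h
    by_contra hu
    obtain ⟨x, hx, hxv, -⟩ := hC.three hu huv v v
    exact hxv (key huv h x hx)
  have h1 := hS huv h
  have h2 := hS huv.symm h.symm
  rcases hC.adm with ⟨z, rfl⟩ | ⟨L, hL, rfl⟩
  · exact huv.ne (h1.trans h2.symm)
  · obtain ⟨b, c, hbc, hb⟩ := re_two hL.1.2 hL.2.1 h1
    have e1 := key huv h b (hL.1.adj ((hb b).2 (Or.inl rfl)))
    have e2 := key huv h c (hL.1.adj ((hb c).2 (Or.inr rfl)))
    exact hbc (e1.trans e2.symm)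

/-- If every face meets a set of edges evenly at every vertex, the set contains all edges or
none. -/
lemma Ctr.all (hC : Ctr G S φ) (D : Dual G) (P : V → V → Prop) (hs : ∀ u v, P u v → P v u)
    (hP : ∀ (u : V) (T : D.X → ZMod 2),
      ∑ w, (if G.Adj u w ∧ P u w then T (D.fc u w) + T (D.fc w u) else 0) = 0)
    {a b : V} (hab : G.Adj a b) (hPab : P a b) {c d : V} (hcd : G.Adj c d) : P c d := by
  have hr := hC.conn hab hcd
  have : ∀ x, Relation.ReflTransGen G.Adj a x → ∀ y, G.Adj x y → P x y := by
    intro x hx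
    induction hx with
    | refl => exact fun y hy => hC.link D (P a) (hP a) hab hPab hy
    | tail _ hxz ih =>
      intro y hy
      exact hC.link D (P _) (hP _) hxz.symm (hs _ _ (ih _ hxz)) hy
  exact this c hr d hcd

/-- Away from the edges on its boundary, a set of faces is constant around each vertex. -/
lemma Ctr.side (hC : Ctr G S φ) (D : Dual G) (T : D.X → ZMod 2) {v : V}
    (hT : ∀ w, G.Adj v w → T (D.fc v w) = T (D.fc w v)) {p q : V} (hp : G.Adj v p)
    (hq : G.Adj v q) : T (D.fc v p) = T (D.fc v q) := by
  by_contra hne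
  refine hne (hC.link D (fun w => T (D.fc v p) = T (D.fc v w)) (fun T' => ?_) hp rfl hq)
  have := D.even (fun x => (T (D.fc v p) + T x + 1) * T' x) v
  refine (Finset.sum_congr rfl fun w _ => ?_).trans this
  by_cases hw : G.Adj v w
  · by_cases h : T (D.fc v p) = T (D.fc v w)
    · rw [if_pos ⟨hw, h⟩, if_pos hw, ← hT w hw, h, CharTwo.add_self_eq_zero]
      simp
    · rw [if_neg fun h' => h h'.2, if_pos hw, ← hT w hw]
      have : T (D.fc v p) + T (D.fc v w) + 1 = 0 := by
        revert h
        generalize T (D.fc v p) = a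
        generalize T (D.fc v w) = b
        revert a b; decide
      rw [this]; simp
  · simp [hw]

/-- The edge `uv` lies on the boundary of the face `x`. -/
def bd (D : Dual G) (x : D.X) (u v : V) : Prop := G.Adj u v ∧ (D.fc u v = x ∨ D.fc v u = x)

lemma bd.symm {D : Dual G} {x : D.X} {u v : V} (h : bd D x u v) : bd D x v u :=
  ⟨h.1.symm, h.2.symm⟩

lemma Ctr.bd_even (hC : Ctr G S φ) (D : Dual G) (x : D.X) (u : V) :
    ∑ v, (if bd D x u v then 1 else 0 : ZMod 2) = 0 := by
  have := D.even (fun y => if y = x then 1 else 0) u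
  refine (Finset.sum_congr rfl fun v _ => ?_).trans this
  by_cases huv : G.Adj u v
  · have hne := hC.fc_ne D huv
    simp only [bd, huv, true_and, if_true]
    by_cases h1 : D.fc u v = x
    · have h2 : D.fc v u ≠ x := fun h => hne (h1.trans h.symm)
      simp [h1, h2]
    · by_cases h2 : D.fc v u = x <;> simp [h1, h2]
  · simp [bd, huv]

/-- In an even graph, every edge is on a cycle. -/
lemma reach_of_even (E : V → V → Prop) (hE : ∀ a b, E a b → E b a) (hirr : ∀ a, ¬ E a a)
    (hev : ∀ u, ∑ v, (if E u v then 1 else 0 : ZMod 2) = 0) {u v : V} (huv : E u v) :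
    Relation.ReflTransGen (fun a b => E a b ∧ s(a, b) ≠ s(u, v)) u v := by
  by_contra hn
  let Q : V → V → Prop := fun a b => E a b ∧ s(a, b) ≠ s(u, v)
  let R : Finset V := Finset.univ.filter fun a => Relation.ReflTransGen Q u a
  have huR : u ∈ R := by simp only [R, Finset.mem_filter, Finset.mem_univ, true_and]; exact .refl
  have hvR : v ∉ R := by
    simp only [R, Finset.mem_filter, Finset.mem_univ, true_and]; exact hn
  have h1 : ∑ a ∈ R, ∑ b, (if E a b then 1 else 0 : ZMod 2) = 0 :=
    Finset.sum_eq_zero fun a _ => hev a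
  have h2 : ∀ a ∈ R, ∑ b, (if E a b then 1 else 0 : ZMod 2) =
      ∑ b ∈ R, (if E a b then 1 else 0) + (if a = u then 1 else 0) := by
    intro a ha
    rw [← Finset.sum_add_sum_compl R]
    congr 1
    have hout : ∀ b, b ∉ R → E a b → a = u ∧ b = v := by
      intro b hb hab
      by_contra hne
      refine hb ?_
      simp only [R, Finset.mem_filter, Finset.mem_univ, true_and] at ha ⊢
      refine ha.tail ⟨hab, fun h => ?_⟩
      rcases Sym2.eq_iff.1 h with ⟨rfl, rfl⟩ | ⟨rfl, rfl⟩
      · exact hne ⟨rfl, rfl⟩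
      · exact hvR (by simp only [R, Finset.mem_filter, Finset.mem_univ, true_and]; exact ha)
    rw [Finset.sum_eq_single v]
    · by_cases hau : a = u
      · subst hau; simp [huv]
      · have : ¬ E a v := fun h => hau (hout v hvR h).1
        simp [hau, this]
    · intro b hb hbv
      rw [if_neg fun h => hbv (hout b (Finset.mem_compl.1 hb) h).2]
    · exact fun h => absurd (Finset.mem_compl.2 hvR) h
  rw [Finset.sum_congr rfl h2, Finset.sum_add_distrib] at h1
  have h3 : ∑ a ∈ R, ∑ b ∈ R, (if E a b then 1 else 0 : ZMod 2) = 0 := by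
    rw [← Finset.sum_product']
    refine Finset.sum_involution (fun p _ => (p.2, p.1)) ?_ ?_ ?_ ?_
    · rintro ⟨a, b⟩ _
      have : E a b ↔ E b a := ⟨hE a b, hE b a⟩
      simp only [this]
      exact CharTwo.add_self_eq_zero _
    · rintro ⟨a, b⟩ _ h heq
      have hba : b = a := (Prod.ext_iff.1 heq).1
      subst hba
      exact h (if_neg (hirr _))
    · rintro ⟨a, b⟩ h
      simp only [Finset.mem_product] at h ⊢
      exact ⟨h.2, h.1⟩
    · rintro ⟨a, b⟩ _
      rfl
  rw [h3, zero_add, Finset.sum_ite_eq' R u, if_pos huR] at h1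
  exact one_ne_zero h1

/-- The boundary of every face is a cycle. -/
lemma Ctr.face (hC : Ctr G S φ) (D : Dual G) (x : D.X) :
    ∃ L, Ring G L ∧ 3 ≤ L.length ∧ ∀ a b, bd D x a b ↔ RE L a b := by
  obtain ⟨u, v, huv, hx⟩ := D.surj x
  have hbd : bd D x u v := ⟨huv, Or.inl hx⟩
  have hr := reach_of_even (bd D x) (fun _ _ h => h.symm) (fun a h => G.irrefl h.1)
    (hC.bd_even D x) hbd
  let Q : SimpleGraph V :=
    { Adj := fun a b => bd D x a b ∧ s(a, b) ≠ s(u, v)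
      symm := ⟨fun a b h => ⟨h.1.symm, by rw [Sym2.eq_swap]; exact h.2⟩⟩
      loopless := ⟨fun _ h => G.loopless.irrefl _ h.1.1⟩ }
  obtain ⟨A, hA⟩ := exists_pth (G := Q) hr huv.ne
  have hnil : A ≠ [] := by
    rintro rfl
    exact (pth_nil.1 hA).2 rfl
  have hR : Ring G (u :: (A ++ [v])) :=
    ring_cons_concat.2 ⟨hA.mono fun _ _ h => h.1.1, huv⟩
  have hlen : 3 ≤ (u :: (A ++ [v])).length := by
    have := List.length_pos_of_ne_nil hnil
    simp; omega
  have hsub : ∀ a b, RE (u :: (A ++ [v])) a b → bd D x a b := by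
    intro a b h
    rcases re_cons_concat.1 h with h | ⟨rfl, rfl⟩ | ⟨rfl, rfl⟩
    exacts [(h.adj hA.1 : Q.Adj a b).1, hbd.symm, hbd]
  refine ⟨_, hR, hlen, fun a b => ⟨fun hab => ?_, hsub a b⟩⟩
  obtain ⟨T, hTx, hT⟩ : ∃ T : D.X → ZMod 2, T x = 0 ∧ ∀ a b, G.Adj a b →
      (RE (u :: (A ++ [v])) a b ↔ T (D.fc a b) + T (D.fc b a) = 1) := by
    obtain ⟨T, hT⟩ := D.ring hR hlen
    refine ⟨fun y => T y + T x, CharTwo.add_self_eq_zero _, fun a b hab => ?_⟩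
    rw [hT a b hab]
    have : T (D.fc a b) + T x + (T (D.fc b a) + T x) = T (D.fc a b) + T (D.fc b a) := by
      rw [add_add_add_comm, CharTwo.add_self_eq_zero, add_zero]
    rw [this]
  have hone : ∀ a b, RE (u :: (A ++ [v])) a b → T (D.fc a b) = 1 ∨ T (D.fc b a) = 1 := by
    intro a b h
    have := (hT a b (hR.adj h)).1 h
    revert this
    generalize T (D.fc a b) = s
    generalize T (D.fc b a) = t
    revert s t; decide
  have hall : ∀ {c d}, G.Adj c d → (T (D.fc c d) = 1 ∨ T (D.fc d c) = 1) := by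
    intro c d hcd
    refine hC.all D (fun c d => T (D.fc c d) = 1 ∨ T (D.fc d c) = 1) (fun _ _ h => h.symm)
      (fun w T' => ?_) huv (hone u v (re_cons_concat.2 (Or.inr (Or.inr ⟨rfl, rfl⟩)))) hcd
    have e1 := D.even (fun y => T y * T' y) w
    have e2 : ∑ z : V, (if RE (u :: (A ++ [v])) w z then T' x else 0) = 0 := by
      by_cases hw : w ∈ u :: (A ++ [v])
      · obtain ⟨b, c, hbc, hb⟩ := re_two hR.2 hlen hw
        simp only [hb]
        have : ∀ z : V, (if z = b ∨ z = c then T' x else 0) =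
            (if z = b then T' x else 0) + (if z = c then T' x else 0) := by
          intro z
          by_cases h1 : z = b
          · subst h1; simp [hbc]
          · simp [h1]
        simp only [this, Finset.sum_add_distrib, Finset.sum_ite_eq', Finset.mem_univ, if_true]
        exact CharTwo.add_self_eq_zero _
      · exact Finset.sum_eq_zero fun z _ => if_neg fun h => hw h.mem.1
    have e3 := congrArg₂ (· + ·) e1 e2
    simp only [← Finset.sum_add_distrib, add_zero] at e3
    refine (Finset.sum_congr rfl fun z _ => ?_).trans e3
    by_cases hwz : G.Adj w z
    · have h3 := hT w z hwz
      by_cases hre : RE (u :: (A ++ [v])) w z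
      · have h4 := hone w z hre
        have h5 := (hsub w z hre).2
        rw [if_pos ⟨hwz, h4⟩, if_pos hwz, if_pos hre]
        rw [h3] at hre
        rcases h5 with h5 | h5
        · rw [h5, hTx] at hre ⊢
          rw [zero_add] at hre
          rw [hre]; ring
        · rw [h5, hTx] at hre ⊢
          rw [add_zero] at hre
          rw [hre]; ring
      · have h6 : T (D.fc w z) = T (D.fc z w) := by
          rw [h3] at hre
          revert hre
          generalize T (D.fc w z) = s
          generalize T (D.fc z w) = t
          revert s t; decide
        rw [if_neg hre, if_pos hwz, add_zero, h6]
        rcases zmod2 (T (D.fc z w)) with h | h <;> simp [hwz, h]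
    · have : ¬ RE (u :: (A ++ [v])) w z := fun h => hwz (hR.adj h)
      simp [hwz, this]
  rw [hT a b hab.1]
  rcases hab.2 with h | h
  · have := hall hab.1
    rw [h, hTx] at this ⊢
    simpa using this
  · have := hall hab.1
    rw [h, hTx] at this ⊢
    simpa using this

/-- Two faces sharing two edges at `b`: then `b` has degree two. -/
lemma Ctr.share (hC : Ctr G S φ) (D : Dual G) {x y : D.X} {a b c : V} (hac : a ≠ c)
    (h1 : bd D x b a) (h2 : bd D y b a) (h3 : bd D x b c) (h4 : bd D y b c) (hxy : x ≠ y)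
    {d : V} (hd : G.Adj b d) : d = a ∨ d = c := by
  refine hC.link D (fun w => w = a ∨ w = c) (fun T => ?_) h1.1 (Or.inl rfl) hd
  have h5 : ∀ w, bd D x b w → bd D y b w → T (D.fc b w) + T (D.fc w b) = T x + T y := by
    rintro w ⟨-, h | h⟩ ⟨-, h' | h'⟩
    · exact absurd (h.symm.trans h') hxy
    · rw [h, h']
    · rw [h, h', add_comm]
    · exact absurd (h.symm.trans h') hxy
  have h6 : ∀ w, (if G.Adj b w ∧ (w = a ∨ w = c) then T (D.fc b w) + T (D.fc w b) else 0) =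
      (if w = a then T x + T y else 0) + (if w = c then T x + T y else 0) := by
    intro w
    by_cases hwa : w = a
    · subst hwa
      rw [if_pos ⟨h1.1, Or.inl rfl⟩, if_pos rfl, if_neg hac, add_zero, h5 w h1 h2]
    · by_cases hwc : w = c
      · subst hwc
        rw [if_pos ⟨h3.1, Or.inr rfl⟩, if_neg hwa, if_pos rfl, zero_add, h5 w h3 h4]
      · simp [hwa, hwc]
  refine (Finset.sum_congr rfl fun w _ => Eq.trans (by congr) (h6 w)).trans ?_
  simp only [Finset.sum_add_distrib, Finset.sum_ite_eq', Finset.mem_univ, if_true]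
  exact CharTwo.add_self_eq_zero _

end Faces

section Separation
open Classical

variable {V : Type} {G H : SimpleGraph V} {S : Set V} {φ : V → Bool}

lemma mem_iff_re {L : List V} (hnd : L.Nodup) (h3 : 3 ≤ L.length) {a : V} :
    a ∈ L ↔ ∃ b, RE L a b := by
  refine ⟨fun h => ?_, fun ⟨b, h⟩ => h.mem.1⟩
  obtain ⟨b, c, -, h⟩ := re_two hnd h3 h
  exact ⟨b, (h b).2 (Or.inl rfl)⟩

/-- A cycle contained in another one is equal to it. -/
lemma re_of_subset {L M : List V} (hL : L.Nodup) (hL3 : 3 ≤ L.length) (hM : M.Nodup)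
    (hM3 : 3 ≤ M.length) (h : ∀ a b, RE M a b → RE L a b) {a b : V} (hab : RE L a b) :
    RE M a b := by
  have step : ∀ a, a ∈ M → ∀ b, RE L a b → RE M a b := by
    intro a ha b hab
    obtain ⟨x, y, hxy, h1⟩ := re_two hM hM3 ha
    obtain ⟨z, w, hzw, h2⟩ := re_two hL hL3 hab.mem.1
    have e1 := (h2 x).1 (h a x ((h1 x).2 (Or.inl rfl)))
    have e2 := (h2 y).1 (h a y ((h1 y).2 (Or.inr rfl)))
    have e3 := (h2 b).1 hab
    rw [h1]
    grind
  obtain ⟨x, hx⟩ : ∃ x, x ∈ M := List.exists_mem_of_length_pos (by omega)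
  obtain ⟨y, hy⟩ := (mem_iff_re hM hM3).1 hx
  have hxL := (h x y hy).mem.1
  have hch : L.IsChain (RE L) :=
    (List.isChain_append.1 (isChain_of_lnk (R := RE L) (l := L ++ L.head?.toList) fun _ _ h => h)).1
  have hr := conn_list (fun _ _ h => h.symm) hch hxL hab.mem.1
  refine step a ?_ b hab
  clear hab
  induction hr with
  | refl => exact hx
  | tail _ hyz ih => exact (step _ ih _ hyz).mem.2

variable [Fintype V]

lemma zmod2_ne {a b : ZMod 2} : a + b = 1 ↔ a ≠ b := by
  revert a b; decide

/-- An admissible cycle with `S` weakly on one side does not separate vertices. -/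
lemma Ctr.sep (hC : Ctr G S φ) (D : Dual G) {L : List V} (hL : AdmRing G L) {T : D.X → ZMod 2}
    (hT : ∀ u v, G.Adj u v → (RE L u v ↔ T (D.fc u v) + T (D.fc v u) = 1)) {i : ZMod 2}
    (hS : ∀ s ∈ S, s ∉ L → ∀ w, G.Adj s w → T (D.fc s w) = i)
    {p w : V} (hp : p ∉ L) (hpw : G.Adj p w) (hTp : T (D.fc p w) ≠ i)
    {p' w' : V} (hp' : p' ∉ L) (hpw' : G.Adj p' w') (hTp' : T (D.fc p' w') = i) : False := by
  have hconst : ∀ x, x ∉ L → ∀ y, G.Adj x y → T (D.fc x y) = T (D.fc y x) := by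
    intro x hx y hxy
    by_contra h
    exact hx ((hT x y hxy).2 (zmod2_ne.2 h)).mem.1
  refine hC.glue (A := {x | x ∉ L ∧ ∃ y, G.Adj x y ∧ T (D.fc x y) ≠ i}) (D := {x | x ∈ L})
    (Or.inr ⟨L, hL, rfl⟩) (fun x hx => hx.1) ?_ ?_ (a := p) ⟨hp, w, hpw, hTp⟩ hpw (x := p') ?_ hp' hpw'
  · rintro x ⟨hx, y, hxy, h⟩ hxS
    exact h (hS x hxS hx y hxy)
  · rintro x ⟨hx, y, hxy, h⟩ z hxz
    by_cases hz : z ∈ L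
    · exact Or.inr hz
    · refine Or.inl ⟨hz, x, hxz.symm, ?_⟩
      rwa [hconst z hz x hxz.symm, hC.side D T (hconst x hx) hxz hxy]
  · rintro ⟨-, y, hy, h⟩
    exact h ((hC.side D T (hconst p' hp') hy hpw').trans hTp')

/-- There are edges with an end outside `S`. -/
lemma Ctr.exists_edge (hC : Ctr G S φ) : ∃ p w, G.Adj p w ∧ p ∉ S := by
  by_contra! hno
  refine hC.bad ⟨φ, fun _ _ => rfl, fun u v huv _ _ => ⟨hno u v huv, hno v u huv.symm⟩, ?_⟩
  have : fedges G S φ = ∅ := by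
    ext e
    induction e with | _ x y
    rw [mk_mem_fedges]
    simp only [Finset.notMem_empty, iff_false]
    rintro ⟨h1, -, h2⟩
    exact h2 ⟨hno x y h1, hno y x h1.symm⟩
  rw [this]
  intro Y hY
  simp only [spanned, Finset.filter_empty, Finset.card_empty]
  exact Finset.card_pos.2 hY

/-- The precolored cycle bounds a face. -/
lemma Ctr.outer (hC : Ctr G S φ) (D : Dual G) {L : List V} (hL : AdmRing G L)
    (hS : S = {x | x ∈ L}) : ∃ f, ∀ a b, bd D f a b ↔ RE L a b := by
  obtain ⟨T, hT⟩ := D.ring hL.1 hL.2.1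
  obtain ⟨p, w, hpw, hp⟩ := hC.exists_edge
  have hpL : p ∉ L := fun h => hp (by rw [hS]; exact h)
  have hin : ∀ c d, G.Adj c d → ¬ RE L c d → T (D.fc c d) = T (D.fc p w) := by
    have aux : ∀ c d, G.Adj c d → c ∉ L → T (D.fc c d) = T (D.fc p w) := by
      intro c d hcd hc
      by_contra h
      exact hC.sep D hL hT (fun s hs hsL => absurd (by rwa [hS] at hs) hsL) hc hcd h hpL hpw rfl
    intro c d hcd hn
    have hTcd : T (D.fc c d) = T (D.fc d c) := by
      by_contra h
      exact hn ((hT c d hcd).2 (zmod2_ne.2 h))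
    by_cases hc : c ∈ L
    · have hd : d ∉ L := fun hd => hn (hC.chordless hL hS (by rw [hS]; exact hc)
        (by rw [hS]; exact hd) hcd)
      rw [hTcd]
      exact aux d c hcd.symm hd
    · exact aux c d hcd hc
  obtain ⟨a, ha⟩ : ∃ x, x ∈ L := List.exists_mem_of_length_pos (by have := hL.2.1; omega)
  obtain ⟨b, hab⟩ := (mem_iff_re hL.1.2 hL.2.1).1 ha
  obtain ⟨f, hf⟩ : ∃ f, T f ≠ T (D.fc p w) := by
    by_contra! h
    have := (hT a b (hL.1.adj hab)).1 hab
    rw [h (D.fc a b), h (D.fc b a), CharTwo.add_self_eq_zero] at this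
    exact zero_ne_one this
  have hsub : ∀ c d, bd D f c d → RE L c d := by
    intro c d hcd
    by_contra hn
    rcases hcd.2 with h | h
    · exact hf (h ▸ hin c d hcd.1 hn)
    · exact hf (h ▸ hin d c hcd.1.symm fun h => hn h.symm)
  obtain ⟨M, hM, hM3, hMbd⟩ := hC.face D f
  refine ⟨f, fun c d => ⟨hsub c d, fun h => (hMbd c d).2 ?_⟩⟩
  exact re_of_subset hL.1.2 hL.2.1 hM.2 hM3 (fun a b h => hsub a b ((hMbd a b).2 h)) h

/-- No two faces have the same boundary. -/
lemma Ctr.bd_ne (hC : Ctr G S φ) (D : Dual G) {x y : D.X} (hxy : x ≠ y)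
    (h : ∀ a b, bd D x a b → bd D y a b) : False := by
  obtain ⟨p, w, hpw, hp⟩ := hC.exists_edge
  obtain ⟨L, hL, h3, hLx⟩ := hC.face D x
  have key : ∀ u, (∃ v, bd D x u v) → ∃ a c, a ≠ c ∧ bd D x u a ∧ bd D x u c ∧
      ∀ d, G.Adj u d → d = a ∨ d = c := by
    rintro u ⟨v, hv⟩
    obtain ⟨a, c, hac, hac'⟩ := re_two hL.2 h3 ((hLx u v).1 hv).mem.1
    have ha := (hLx u a).2 ((hac' a).2 (Or.inl rfl))
    have hc := (hLx u c).2 ((hac' c).2 (Or.inr rfl))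
    exact ⟨a, c, hac, ha, hc, fun d hd =>
      hC.share D hac ha (h _ _ ha) hc (h _ _ hc) hxy hd⟩
  obtain ⟨u, v, huv, hx⟩ := D.surj x
  have hr := hC.conn huv hpw
  have hmem : ∀ q, Relation.ReflTransGen G.Adj u q → ∃ v, bd D x q v := by
    intro q hq
    induction hq with
    | refl => exact ⟨v, huv, Or.inl hx⟩
    | tail _ hyz ih =>
      obtain ⟨a, c, -, ha, hc, hall⟩ := key _ ih
      rcases hall _ hyz with rfl | rfl
      exacts [⟨_, ha.symm⟩, ⟨_, hc.symm⟩]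
  have := hmem p hr
  obtain ⟨a, c, -, -, -, hall⟩ := key p this
  obtain ⟨d, hd, hda, hdc⟩ := hC.three hp hpw a c
  exact (hall d hd).elim hda hdc

/-- The vertices on a face. -/
noncomputable def vf (D : Dual G) (x : D.X) : Finset V :=
  Finset.univ.filter fun u => ∃ v, bd D x u v

/-- The length of a face. -/
noncomputable def len (D : Dual G) (x : D.X) : ℕ := (vf D x).card

lemma mem_vf {D : Dual G} {x : D.X} {u : V} : u ∈ vf D x ↔ ∃ v, bd D x u v := by
  simp [vf]

/-- The boundary cycle of a face. -/
lemma Ctr.face_ring (hC : Ctr G S φ) (D : Dual G) (x : D.X) :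
    ∃ L, Ring G L ∧ 3 ≤ L.length ∧ L.length = len D x ∧ (∀ u, u ∈ L ↔ u ∈ vf D x) ∧
      ∀ a b, bd D x a b ↔ RE L a b := by
  obtain ⟨L, h1, h2, h3⟩ := hC.face D x
  have h4 : ∀ u, u ∈ L ↔ u ∈ vf D x := fun u => by
    rw [mem_vf, mem_iff_re h1.2 h2]
    exact exists_congr fun v => (h3 u v).symm
  refine ⟨L, h1, h2, ?_, h4, h3⟩
  rw [len, ← List.toFinset_card_of_nodup h1.2]
  congr 1
  ext u
  rw [List.mem_toFinset, h4]

lemma Ctr.len_ge (hC : Ctr G S φ) (D : Dual G) (x : D.X) : 3 ≤ len D x := by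
  obtain ⟨L, -, h, h', -⟩ := hC.face_ring D x
  omega

/-- The boundary of a face as a path closed up by a given edge. -/
lemma Ctr.face_open (hC : Ctr G S φ) (D : Dual G) {x : D.X} {a b : V} (hab : bd D x a b) :
    ∃ M, Pth G a M b ∧ M.length + 2 = len D x ∧ 1 ≤ M.length ∧
      (∀ u, u ∈ a :: (M ++ [b]) ↔ u ∈ vf D x) ∧
      ∀ c d, bd D x c d ↔ RE (a :: (M ++ [b])) c d := by
  obtain ⟨L, h1, h2, h3, h4, h5⟩ := hC.face_ring D x
  obtain ⟨M, m1, m2, m3, m4, m5⟩ := h1.open ((h5 a b).1 hab)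
  exact ⟨M, m1, by omega, by omega, fun u => (m4 u).trans (h4 u),
    fun c d => (h5 c d).trans (m5 c d).symm⟩

/-- A vertex on a face has two edges on that face. -/
lemma Ctr.bd_two (hC : Ctr G S φ) (D : Dual G) {x : D.X} {u : V} (hu : u ∈ vf D x) :
    ∃ a b, a ≠ b ∧ ∀ c, bd D x u c ↔ c = a ∨ c = b := by
  obtain ⟨L, h1, h2, -, h4, h5⟩ := hC.face_ring D x
  obtain ⟨a, b, hab, h⟩ := re_two h1.2 h2 ((h4 u).2 hu)
  exact ⟨a, b, hab, fun c => (h5 u c).trans (h c)⟩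

lemma Ctr.bd_other (hC : Ctr G S φ) (D : Dual G) {x : D.X} {u a : V} (hu : bd D x u a) :
    ∃ b, b ≠ a ∧ ∀ c, bd D x u c ↔ c = a ∨ c = b := by
  obtain ⟨p, q, hpq, h⟩ := hC.bd_two D (mem_vf.2 ⟨a, hu⟩)
  rcases (h a).1 hu with rfl | rfl
  · exact ⟨q, hpq.symm, h⟩
  · exact ⟨p, hpq, fun c => (h c).trans or_comm⟩

end Separation

section Extension
open Classical

variable {V : Type} [Fintype V] {G : SimpleGraph V} {S Z Z' : Set V} {c : V → Bool} {v p q : V}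

lemma Good.put_true (h : Good (del G Z') S c) (hZ' : Z' = insert v Z)
    (hv : ∀ w, G.Adj v w → w ∉ Z → c w = false) :
    ∃ c', c' v = true ∧ (∀ x, x ≠ v → c' x = c x) ∧ Good (del G Z) S c' ∧
      ∀ a b, Linked (del G Z) S c' a b → Linked (del G Z') S c a b := by
  subst hZ'
  have := (h.update (fun w => not_del_insert_adj) true).add_true (v := v) (by simp)
    (fun w hw hZ => by rw [Function.update_of_ne hw.ne']; exact hv w hw hZ)
  refine ⟨_, by simp, fun x hx => Function.update_of_ne hx _ _, this.1, fun a b hab => ?_⟩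
  have := this.2 a b hab
  rwa [Linked, fedges_update fun w => not_del_insert_adj] at this

lemma Good.put_false (h : Good (del G Z') S c) (hZ' : Z' = insert v Z) (hS : v ∉ S) (hp : p ≠ v)
    (hv : ∀ w, G.Adj v w → w ∉ Z → c w = false → w = p) :
    ∃ c', c' v = false ∧ (∀ x, x ≠ v → c' x = c x) ∧ Good (del G Z) S c' ∧
      (∀ b, b ≠ v → Linked (del G Z) S c' v b → Linked (del G Z') S c p b) ∧
      (∀ a b, a ≠ v → b ≠ v → Linked (del G Z) S c' a b →
        Linked (del G Z') S c a b) := by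
  subst hZ'
  have := (h.update (fun w => not_del_insert_adj) false).add_false hS hp (by simp)
    (fun w hw hZ => by rw [Function.update_of_ne hw.ne']; exact hv w hw hZ)
  simp only [Linked, fedges_update (G := del G (insert v Z)) fun w => not_del_insert_adj] at this
  exact ⟨_, by simp, fun x hx => Function.update_of_ne hx _ _, this⟩

lemma Good.put_false_two (h : Good (del G Z') S c) (hZ' : Z' = insert v Z) (hS : v ∉ S)
    (hp : p ≠ v) (hq : q ≠ v) (hv : ∀ w, G.Adj v w → w ∉ Z → c w = false → w = p ∨ w = q)
    (hpq : ¬ Linked (del G Z') S c p q) :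
    ∃ c', c' v = false ∧ (∀ x, x ≠ v → c' x = c x) ∧ Good (del G Z) S c' := by
  subst hZ'
  have := (h.update (fun w => not_del_insert_adj) false).add_false_two hS hp hq (by simp)
    (fun w hw hZ => by rw [Function.update_of_ne hw.ne']; exact hv w hw hZ)
    (by rwa [Linked, fedges_update fun w => not_del_insert_adj])
  exact ⟨_, by simp, fun x hx => Function.update_of_ne hx _ _, this⟩

lemma Good.put_any (h : Good (del G Z') S c) (hZ' : Z' = insert v Z) (hS : v ∉ S)
    (hp : p ≠ v) (hq : q ≠ v) (hv : ∀ w, G.Adj v w → w ∉ Z → w = p ∨ w = q) :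
    ∃ c', (∀ x, x ≠ v → c' x = c x) ∧ Good (del G Z) S c' := by
  subst hZ'
  obtain ⟨b, hb⟩ := h.add_of_two hS hp hq hv
  exact ⟨_, fun x hx => Function.update_of_ne hx _ _, hb⟩

/-- `v` has exactly the three neighbors `x`, `y` and `z`. -/
structure Deg3 (G : SimpleGraph V) (v x y z : V) : Prop where
  adj : ∀ w, G.Adj v w ↔ w = x ∨ w = y ∨ w = z
  ne₁ : x ≠ y
  ne₂ : x ≠ z
  ne₃ : y ≠ z

omit [Fintype V] in
lemma Deg3.swap {x y z : V} (h : Deg3 G v x y z) : Deg3 G v y x z :=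
  ⟨fun w => (h.adj w).trans (by tauto), h.ne₁.symm, h.ne₃, h.ne₂⟩

omit [Fintype V] in
lemma Deg3.rot {x y z : V} (h : Deg3 G v x y z) : Deg3 G v y z x :=
  ⟨fun w => (h.adj w).trans (by tauto), h.ne₃, h.ne₁.symm, h.ne₂.symm⟩

omit [Fintype V] in
lemma Deg3.adj₁ {x y z : V} (h : Deg3 G v x y z) : G.Adj v x := (h.adj x).2 (by simp)
omit [Fintype V] in
lemma Deg3.adj₂ {x y z : V} (h : Deg3 G v x y z) : G.Adj v y := (h.adj y).2 (by simp)
omit [Fintype V] in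
lemma Deg3.adj₃ {x y z : V} (h : Deg3 G v x y z) : G.Adj v z := (h.adj z).2 (by simp)

omit [Fintype V] in
lemma Deg3.all {x y z : V} (h : Deg3 G v x y z) {P : V → Prop} (hx : P x) (hy : P y) (hz : P z) :
    ∀ w, G.Adj v w → P w := by
  intro w hw
  rcases (h.adj w).1 hw with rfl | rfl | rfl <;> assumption

/-- Four vertices of degree 3 outside `S` along a path whose first edge lies on a triangle. -/
structure TriPath (G : SimpleGraph V) (S : Set V) (v₀ v₁ v₂ v₃ v₄ x q y z : V) : Prop where
  s₁ : v₁ ∉ S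
  s₂ : v₂ ∉ S
  s₃ : v₃ ∉ S
  s₄ : v₄ ∉ S
  d₁ : Deg3 G v₁ v₀ v₂ x
  d₂ : Deg3 G v₂ v₁ v₃ x
  d₃ : Deg3 G v₃ v₂ v₄ q
  d₄ : Deg3 G v₄ v₃ y z
  disj : [v₀, x, q].Disjoint [v₁, v₂, v₃, v₄]
  nodup : [v₁, v₂, v₃, v₄].Nodup

omit [Fintype V] in
lemma TriPath.ne {v₀ v₁ v₂ v₃ v₄ x y z : V} (h : TriPath G S v₀ v₁ v₂ v₃ v₄ x q y z) :
    ((v₀ ≠ v₁ ∧ v₀ ≠ v₂ ∧ v₀ ≠ v₃ ∧ v₀ ≠ v₄) ∧ (x ≠ v₁ ∧ x ≠ v₂ ∧ x ≠ v₃ ∧ x ≠ v₄) ∧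
      (q ≠ v₁ ∧ q ≠ v₂ ∧ q ≠ v₃ ∧ q ≠ v₄)) ∧ (v₁ ≠ v₂ ∧ v₁ ≠ v₃ ∧ v₁ ≠ v₄ ∧ v₂ ≠ v₃ ∧
      v₂ ≠ v₄ ∧ v₃ ≠ v₄) ∧ (v₂ ≠ v₁ ∧ v₃ ≠ v₁ ∧ v₄ ≠ v₁ ∧ v₃ ≠ v₂ ∧ v₄ ≠ v₂ ∧ v₄ ≠ v₃) ∧
      (y ≠ v₄ ∧ z ≠ v₄) := by
  have h1 := h.disj
  have h2 := h.nodup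
  simp only [List.disjoint_cons_left, List.mem_cons, List.not_mem_nil, or_false, not_or,
    List.disjoint_nil_left, and_true, List.nodup_cons, List.nodup_nil, not_false_eq_true] at h1 h2
  exact ⟨h1, by tauto, ⟨Ne.symm h2.1.1, Ne.symm h2.1.2.1, Ne.symm h2.1.2.2, Ne.symm h2.2.1.1, Ne.symm h2.2.1.2,
    Ne.symm h2.2.2⟩, h.d₄.adj₂.ne', h.d₄.adj₃.ne'⟩

omit [Fintype V] in
lemma TriPath.eq_of_mem {v₀ v₁ v₂ v₃ v₄ x y z : V} (h : TriPath G S v₀ v₁ v₂ v₃ v₄ x q y z)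
    {c c' : V → Bool} (hc : ∀ u, u ≠ v₁ → u ≠ v₂ → u ≠ v₃ → u ≠ v₄ → c' u = c u) :
    ∀ u ∈ S, c' u = c u := fun u hu => hc u (fun e => h.s₁ (e ▸ hu)) (fun e => h.s₂ (e ▸ hu))
    (fun e => h.s₃ (e ▸ hu)) (fun e => h.s₄ (e ▸ hu))

lemma TriPath.extend_true {v₀ v₁ v₂ v₃ v₄ x y z : V} (t : TriPath G S v₀ v₁ v₂ v₃ v₄ x q y z)
    (h : Good (del G {v₁, v₂, v₃, v₄}) S c) (ha : c v₀ = true) (hq : c q = true) :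
    ∃ c', (∀ u ∈ S, c' u = c u) ∧ Good G S c' := by
  have n := t.ne
  obtain ⟨c1, f1, h1⟩ := h.put_any (v := v₄) (Z := {v₁, v₂, v₃}) (by grind) t.s₄ (p := y) (q := z)
    (by simp [n]) (by simp [n]) (t.d₄.all (by simp) (by simp) (by simp))
  obtain ⟨c2, g2, f2, h2, -⟩ := h1.put_false (v := v₃) (Z := {v₁, v₂}) (by grind) t.s₃ (p := v₄)
    (by simp [n]) (t.d₃.all (by simp) (by simp) (by simp [n, f1, hq]))
  by_cases hx : c x = true
  · obtain ⟨c3, g3, f3, h3, -⟩ := h2.put_false (v := v₂) (Z := {v₁}) (by grind) t.s₂ (p := v₃)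
      (by simp [n]) (t.d₂.all (by simp) (by simp) (by simp [n, f1, f2, hx]))
    obtain ⟨c4, g4, f4, h4, -⟩ := h3.put_false (v := v₁) (Z := ∅) (by grind) t.s₁ (p := v₂)
      (by simp [n]) (t.d₁.all (by simp [n, f1, f2, f3, ha]) (by simp)
        (by simp [n, f1, f2, f3, hx]))
    rw [del_empty] at h4
    exact ⟨c4, t.eq_of_mem fun u a1 a2 a3 a4 => by simp [a1, a2, a3, a4, f1, f2, f3, f4], h4⟩
  · obtain ⟨c3, g3, f3, h3, -⟩ := h2.put_true (v := v₂) (Z := {v₁}) (by grind)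
      (t.d₂.all (by simp) (by simp [g2]) (by simpa [n, f1, f2] using hx))
    obtain ⟨c4, g4, f4, h4, -⟩ := h3.put_false (v := v₁) (Z := ∅) (by grind) t.s₁ (p := x)
      (by simp [n]) (t.d₁.all (by simp [n, f1, f2, f3, ha]) (by simp [g3]) (by simp))
    rw [del_empty] at h4
    exact ⟨c4, t.eq_of_mem fun u a1 a2 a3 a4 => by simp [a1, a2, a3, a4, f1, f2, f3, f4], h4⟩

lemma TriPath.extend_false {v₀ v₁ v₂ v₃ v₄ x y z : V} (t : TriPath G S v₀ v₁ v₂ v₃ v₄ x q y z)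
    (h : Good (del G {v₁, v₂, v₃, v₄}) S c) (ha : c v₀ = false) (hq : c q = false)
    (hyz : ¬ (c y = false ∧ c z = false)) :
    ∃ c', (∀ u ∈ S, c' u = c u) ∧ Good G S c' := by
  have n := t.ne
  obtain ⟨r, hr, hr4⟩ : ∃ r, r ≠ v₄ ∧ ∀ w, w = y ∨ w = z → c w = false → w = r := by
    by_cases hy : c y = false
    · exact ⟨y, n.2.2.2.1, by grind⟩
    · exact ⟨z, n.2.2.2.2, by grind⟩
  obtain ⟨c1, g1, f1, h1, -⟩ := h.put_false (v := v₄) (Z := {v₁, v₂, v₃}) (by grind) t.s₄ (p := r)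
    hr (t.d₄.all (by simp) (fun _ => hr4 _ (.inl rfl)) (fun _ => hr4 _ (.inr rfl)))
  obtain ⟨c2, g2, f2, h2, -⟩ := h1.put_true (v := v₃) (Z := {v₁, v₂}) (by grind)
    (t.d₃.all (by simp) (by simp [g1]) (by simp [n, f1, hq]))
  by_cases hx : c x = true
  · obtain ⟨c3, g3, f3, h3, -⟩ := h2.put_false (v := v₁) (Z := {v₂}) (by grind) t.s₁ (p := v₀)
      (by simp [n]) (t.d₁.all (by simp) (by simp) (by simp [n, f1, f2, hx]))
    obtain ⟨c4, g4, f4, h4, -⟩ := h3.put_false (v := v₂) (Z := ∅) (by grind) t.s₂ (p := v₁)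
      (by simp [n]) (t.d₂.all (by simp) (by simp [n, f3, g2]) (by simp [n, f1, f2, f3, hx]))
    rw [del_empty] at h4
    exact ⟨c4, t.eq_of_mem fun u a1 a2 a3 a4 => by simp [a1, a2, a3, a4, f1, f2, f3, f4], h4⟩
  · obtain ⟨c3, g3, f3, h3, -⟩ := h2.put_false (v := v₂) (Z := {v₁}) (by grind) t.s₂ (p := x)
      (by simp [n]) (t.d₂.all (by simp) (by simp [g2]) (by simp))
    obtain ⟨c4, g4, f4, h4, -⟩ := h3.put_true (v := v₁) (Z := ∅) (by grind)
      (t.d₁.all (by simp [n, f1, f2, f3, ha]) (by simp [g3]) (by simpa [n, f1, f2, f3] using hx))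
    rw [del_empty] at h4
    exact ⟨c4, t.eq_of_mem fun u a1 a2 a3 a4 => by simp [a1, a2, a3, a4, f1, f2, f3, f4], h4⟩

/-- Extending a coloring to four vertices of degree 3 on a path starting with a triangle. -/
lemma TriPath.extend {v₀ v₁ v₂ v₃ v₄ x y z : V} (t : TriPath G S v₀ v₁ v₂ v₃ v₄ x q y z)
    (h : Good (del G {v₁, v₂, v₃, v₄}) S c) (hc : c v₀ = c q)
    (hl : c v₀ = false → ¬ Linked (del G {v₁, v₂, v₃, v₄}) S c v₀ q) :
    ∃ c', (∀ u ∈ S, c' u = c u) ∧ Good G S c' := by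
  have n := t.ne
  by_cases ha : c v₀ = true
  · exact t.extend_true h ha (hc ▸ ha)
  have ha : c v₀ = false := by simpa using ha
  have hq : c q = false := hc ▸ ha
  have hl := hl ha
  by_cases hyz : c y = false ∧ c z = false
  swap
  · exact t.extend_false h ha hq hyz
  obtain ⟨c1, g1, f1, h1, l1⟩ := h.put_true (v := v₄) (Z := {v₁, v₂, v₃}) (by grind)
    (t.d₄.all (by simp) (by simp [hyz]) (by simp [hyz]))
  replace hl := fun h => hl (l1 _ _ h)
  by_cases hx : c x = true
  · obtain ⟨c2, g2, f2, h2, l2, -⟩ := h1.put_false (v := v₁) (Z := {v₂, v₃}) (by grind) t.s₁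
      (p := v₀) (by simp [n]) (t.d₁.all (by simp) (by simp) (by simp [n, f1, hx]))
    replace hl := fun h => hl (l2 q (by simp [n]) h)
    obtain ⟨c3, g3, f3, h3, l3, -⟩ := h2.put_false (v := v₂) (Z := {v₃}) (by grind) t.s₂
      (p := v₁) (by simp [n]) (t.d₂.all (by simp) (by simp) (by simp [n, f1, f2, hx]))
    replace hl := fun h => hl (l3 q (by simp [n]) h)
    obtain ⟨c4, g4, f4, h4⟩ := h3.put_false_two (v := v₃) (Z := ∅) (by grind) t.s₃ (p := v₂)
      (q := q) (by simp [n]) (by simp [n])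
      (t.d₃.all (by simp) (by simp [n, f3, f2, g1]) (by simp)) hl
    rw [del_empty] at h4
    exact ⟨c4, t.eq_of_mem fun u a1 a2 a3 a4 => by simp [a1, a2, a3, a4, f1, f2, f3, f4], h4⟩
  have hx : c x = false := by simpa using hx
  by_cases hxq : Linked (del G {v₁, v₂, v₃}) S c1 x q
  · have hl' : ¬ Linked (del G {v₁, v₂, v₃}) S c1 v₀ x := fun h =>
      hl (h1.2.tight_trans h hxq)
    obtain ⟨c2, g2, f2, h2⟩ := h1.put_false_two (v := v₁) (Z := {v₂, v₃}) (by grind) t.s₁ (p := v₀)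
      (q := x) (by simp [n]) (by simp [n]) (t.d₁.all (by simp) (by simp) (by simp)) hl'
    obtain ⟨c3, g3, f3, h3, -⟩ := h2.put_false (v := v₃) (Z := {v₂}) (by grind) t.s₃ (p := q)
      (by simp [n]) (t.d₃.all (by simp) (by simp [n, f2, g1]) (by simp))
    obtain ⟨c4, g4, f4, h4, -⟩ := h3.put_true (v := v₂) (Z := ∅) (by grind)
      (t.d₂.all (by simp [n, f3, g2]) (by simp [g3]) (by simp [n, f1, f2, f3, hx]))
    rw [del_empty] at h4
    exact ⟨c4, t.eq_of_mem fun u a1 a2 a3 a4 => by simp [a1, a2, a3, a4, f1, f2, f3, f4], h4⟩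
  · obtain ⟨c2, g2, f2, h2, l2, -⟩ := h1.put_false (v := v₂) (Z := {v₁, v₃}) (by grind) t.s₂ (p := x)
      (by simp [n]) (t.d₂.all (by simp) (by simp) (by simp))
    replace hxq := fun h => hxq (l2 q (by simp [n]) h)
    obtain ⟨c3, g3, f3, h3⟩ := h2.put_false_two (v := v₃) (Z := {v₁}) (by grind) t.s₃ (p := v₂)
      (q := q) (by simp [n]) (by simp [n])
      (t.d₃.all (by simp) (by simp [n, f2, g1]) (by simp)) hxq
    obtain ⟨c4, g4, f4, h4, -⟩ := h3.put_true (v := v₁) (Z := ∅) (by grind)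
      (t.d₁.all (by simp [n, f1, f2, f3, ha]) (by simp [n, f3, g2]) (by simp [n, f1, f2, f3, hx]))
    rw [del_empty] at h4
    exact ⟨c4, t.eq_of_mem fun u a1 a2 a3 a4 => by simp [a1, a2, a3, a4, f1, f2, f3, f4], h4⟩

/-- In a good coloring, deleting an edge separates its ends. -/
lemma Good.not_linked {H : SimpleGraph V} {a b : V} (h : Good H S c) (hab : H.Adj a b)
    (hS : ¬ (a ∈ S ∧ b ∈ S)) (ha : c a = false) (hb : c b = false)
    (hle : G ≤ H) (hG : ¬ G.Adj a b) : ¬ Linked G S c a b := by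
  rintro ⟨Y, hY1, hY2, hY⟩
  have hF := h.2 Y ⟨_, hY1⟩
  have hlt : (spanned (fedges G S c) (contract S) Y).card <
      (spanned (fedges H S c) (contract S) Y).card := by
    refine Finset.card_lt_card ⟨fun e => ?_, fun hs => ?_⟩
    · simp only [spanned, Finset.mem_filter]
      rintro ⟨he, h2⟩
      refine ⟨?_, h2⟩
      induction e with | _ u v
      rw [mk_mem_fedges] at he ⊢
      exact ⟨hle he.1, he.2⟩
    · have : s(a, b) ∈ spanned (fedges H S c) (contract S) Y := by
        simp only [spanned, Finset.mem_filter, mk_mem_fedges, Sym2.ball]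
        exact ⟨⟨hab, ⟨ha, hb⟩, hS⟩, hY1, hY2⟩
      have := hs this
      simp only [spanned, Finset.mem_filter, mk_mem_fedges] at this
      exact hG this.1.1
  omega

/-- A 4-cycle of vertices of degree 3 outside `S`. -/
structure Quad (G : SimpleGraph V) (S : Set V) (z₁ z₂ z₃ z₄ w₁ w₂ w₃ w₄ : V) : Prop where
  s₁ : z₁ ∉ S
  s₂ : z₂ ∉ S
  s₃ : z₃ ∉ S
  s₄ : z₄ ∉ S
  d₁ : Deg3 G z₁ z₄ z₂ w₁
  d₂ : Deg3 G z₂ z₁ z₃ w₂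
  d₃ : Deg3 G z₃ z₂ z₄ w₃
  d₄ : Deg3 G z₄ z₃ z₁ w₄
  disj : [w₁, w₂, w₃, w₄].Disjoint [z₁, z₂, z₃, z₄]

variable {z₁ z₂ z₃ z₄ z₅ w₁ w₂ w₃ w₄ w₅ : V}

omit [Fintype V] in
lemma Quad.rot (h : Quad G S z₁ z₂ z₃ z₄ w₁ w₂ w₃ w₄) : Quad G S z₂ z₃ z₄ z₁ w₂ w₃ w₄ w₁ :=
  ⟨h.s₂, h.s₃, h.s₄, h.s₁, h.d₂, h.d₃, h.d₄, h.d₁, by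
    have := h.disj
    simp only [List.disjoint_cons_left, List.mem_cons, List.not_mem_nil] at this ⊢
    tauto⟩

omit [Fintype V] in
lemma Quad.ne (h : Quad G S z₁ z₂ z₃ z₄ w₁ w₂ w₃ w₄) :
    ((w₁ ≠ z₁ ∧ w₁ ≠ z₂ ∧ w₁ ≠ z₃ ∧ w₁ ≠ z₄) ∧ (w₂ ≠ z₁ ∧ w₂ ≠ z₂ ∧ w₂ ≠ z₃ ∧ w₂ ≠ z₄) ∧
      (w₃ ≠ z₁ ∧ w₃ ≠ z₂ ∧ w₃ ≠ z₃ ∧ w₃ ≠ z₄) ∧ (w₄ ≠ z₁ ∧ w₄ ≠ z₂ ∧ w₄ ≠ z₃ ∧ w₄ ≠ z₄)) ∧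
      (z₁ ≠ z₂ ∧ z₁ ≠ z₃ ∧ z₁ ≠ z₄ ∧ z₂ ≠ z₃ ∧ z₂ ≠ z₄ ∧ z₃ ≠ z₄) ∧
      (z₂ ≠ z₁ ∧ z₃ ≠ z₁ ∧ z₄ ≠ z₁ ∧ z₃ ≠ z₂ ∧ z₄ ≠ z₂ ∧ z₄ ≠ z₃) := by
  have h1 := h.disj
  simp only [List.disjoint_cons_left, List.mem_cons, List.not_mem_nil, or_false, not_or,
    List.disjoint_nil_left, and_true] at h1
  have a1 := h.d₁.adj₂.ne
  have a2 := h.d₂.ne₁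
  have a3 := h.d₁.adj₁.ne
  have a4 := h.d₂.adj₂.ne
  have a5 := h.d₁.ne₁
  have a6 := h.d₃.adj₂.ne
  exact ⟨h1, ⟨a1, a2, a3, a4, a5.symm, a6⟩, a1.symm, a2.symm, a3.symm, a4.symm, a5, a6.symm⟩

omit [Fintype V] in
lemma Quad.eq_of_mem (h : Quad G S z₁ z₂ z₃ z₄ w₁ w₂ w₃ w₄) {c c' : V → Bool}
    (hc : ∀ u, u ≠ z₁ → u ≠ z₂ → u ≠ z₃ → u ≠ z₄ → c' u = c u) :
    ∀ u ∈ S, c' u = c u := fun u hu => hc u (fun e => h.s₁ (e ▸ hu)) (fun e => h.s₂ (e ▸ hu))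
    (fun e => h.s₃ (e ▸ hu)) (fun e => h.s₄ (e ▸ hu))

lemma Quad.extend_mixed (t : Quad G S z₁ z₂ z₃ z₄ w₁ w₂ w₃ w₄)
    (h : Good (del G {z₁, z₂, z₃, z₄}) S c) (ha : c w₁ = true) (hb : c w₂ = false) :
    ∃ c', (∀ u ∈ S, c' u = c u) ∧ Good G S c' := by
  have n := t.ne
  obtain ⟨c1, g1, f1, h1, -⟩ := h.put_true (v := z₂) (Z := {z₁, z₃, z₄}) (by grind)
    (t.d₂.all (by simp) (by simp) (by simp [hb]))
  obtain ⟨c2, g2, f2, h2, -⟩ := h1.put_false (v := z₃) (Z := {z₁, z₄}) (by grind) t.s₃ (p := w₃)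
    (by simp [n]) (t.d₃.all (by simp [g1]) (by simp) (by simp))
  obtain ⟨c3, f3, h3⟩ := h2.put_any (v := z₄) (Z := {z₁}) (by grind) t.s₄ (p := z₃) (q := w₄)
    (by simp [n]) (by simp [n]) (t.d₄.all (by simp) (by simp) (by simp))
  obtain ⟨c4, g4, f4, h4, -⟩ := h3.put_false (v := z₁) (Z := ∅) (by grind) t.s₁ (p := z₄)
    (by simp [n]) (t.d₁.all (by simp) (by simp [n, f3, f2, g1]) (by simp [n, f1, f2, f3, ha]))
  rw [del_empty] at h4
  exact ⟨c4, t.eq_of_mem fun u a1 a2 a3 a4 => by simp [a1, a2, a3, a4, f1, f2, f3, f4], h4⟩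

lemma Quad.extend (t : Quad G S z₁ z₂ z₃ z₄ w₁ w₂ w₃ w₄)
    (h : Good (del G {z₁, z₂, z₃, z₄}) S c) (hT : ¬ (c w₁ = true ∧ c w₃ = true)) :
    ∃ c', (∀ u ∈ S, c' u = c u) ∧ Good G S c' := by
  have n := t.ne
  by_cases m1 : c w₁ = true ∧ c w₂ = false
  · exact t.extend_mixed h m1.1 m1.2
  by_cases m2 : c w₂ = true ∧ c w₃ = false
  · exact t.rot.extend_mixed (by convert h using 2; grind) m2.1 m2.2
  by_cases m3 : c w₃ = true ∧ c w₄ = false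
  · exact t.rot.rot.extend_mixed (by convert h using 2; grind) m3.1 m3.2
  by_cases m4 : c w₄ = true ∧ c w₁ = false
  · exact t.rot.rot.rot.extend_mixed (by convert h using 2; grind) m4.1 m4.2
  obtain ⟨b1, b2, b3, b4⟩ : c w₁ = false ∧ c w₂ = false ∧ c w₃ = false ∧ c w₄ = false := by
    clear h t n
    grind
  obtain ⟨c1, g1, f1, h1, -⟩ := h.put_true (v := z₁) (Z := {z₂, z₃, z₄}) (by grind)
    (t.d₁.all (by simp) (by simp) (by simp [b1]))
  obtain ⟨c2, g2, f2, h2, -⟩ := h1.put_true (v := z₃) (Z := {z₂, z₄}) (by grind)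
    (t.d₃.all (by simp) (by simp) (by simp [n, f1, b3]))
  obtain ⟨c3, g3, f3, h3, -⟩ := h2.put_false (v := z₂) (Z := {z₄}) (by grind) t.s₂ (p := w₂)
    (by simp [n]) (t.d₂.all (by simp [n, f2, g1]) (by simp [g2]) (by simp))
  obtain ⟨c4, g4, f4, h4, -⟩ := h3.put_false (v := z₄) (Z := ∅) (by grind) t.s₄ (p := w₄)
    (by simp [n]) (t.d₄.all (by simp [n, f3, g2]) (by simp [n, f3, f2, g1]) (by simp))
  rw [del_empty] at h4
  exact ⟨c4, t.eq_of_mem fun u a1 a2 a3 a4 => by simp [a1, a2, a3, a4, f1, f2, f3, f4], h4⟩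

/-- A 5-cycle of vertices of degree 3 outside `S`. -/
structure Pent (G : SimpleGraph V) (S : Set V) (z₁ z₂ z₃ z₄ z₅ w₁ w₂ w₃ w₄ w₅ : V) : Prop where
  s₁ : z₁ ∉ S
  s₂ : z₂ ∉ S
  s₃ : z₃ ∉ S
  s₄ : z₄ ∉ S
  s₅ : z₅ ∉ S
  d₁ : Deg3 G z₁ z₅ z₂ w₁
  d₂ : Deg3 G z₂ z₁ z₃ w₂
  d₃ : Deg3 G z₃ z₂ z₄ w₃
  d₄ : Deg3 G z₄ z₃ z₅ w₄
  d₅ : Deg3 G z₅ z₄ z₁ w₅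
  disj : [w₁, w₂, w₃, w₄, w₅].Disjoint [z₁, z₂, z₃, z₄, z₅]

omit [Fintype V] in
lemma Pent.rot (h : Pent G S z₁ z₂ z₃ z₄ z₅ w₁ w₂ w₃ w₄ w₅) :
    Pent G S z₂ z₃ z₄ z₅ z₁ w₂ w₃ w₄ w₅ w₁ :=
  ⟨h.s₂, h.s₃, h.s₄, h.s₅, h.s₁, h.d₂, h.d₃, h.d₄, h.d₅, h.d₁, by
    have := h.disj
    simp only [List.disjoint_cons_left, List.mem_cons, List.not_mem_nil] at this ⊢
    tauto⟩

omit [Fintype V] in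
lemma Pent.ne (h : Pent G S z₁ z₂ z₃ z₄ z₅ w₁ w₂ w₃ w₄ w₅) :
    ((w₁ ≠ z₁ ∧ w₁ ≠ z₂ ∧ w₁ ≠ z₃ ∧ w₁ ≠ z₄ ∧ w₁ ≠ z₅) ∧
      (w₂ ≠ z₁ ∧ w₂ ≠ z₂ ∧ w₂ ≠ z₃ ∧ w₂ ≠ z₄ ∧ w₂ ≠ z₅) ∧
      (w₃ ≠ z₁ ∧ w₃ ≠ z₂ ∧ w₃ ≠ z₃ ∧ w₃ ≠ z₄ ∧ w₃ ≠ z₅) ∧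
      (w₄ ≠ z₁ ∧ w₄ ≠ z₂ ∧ w₄ ≠ z₃ ∧ w₄ ≠ z₄ ∧ w₄ ≠ z₅) ∧
      (w₅ ≠ z₁ ∧ w₅ ≠ z₂ ∧ w₅ ≠ z₃ ∧ w₅ ≠ z₄ ∧ w₅ ≠ z₅)) ∧
      (z₁ ≠ z₂ ∧ z₁ ≠ z₃ ∧ z₁ ≠ z₄ ∧ z₁ ≠ z₅ ∧ z₂ ≠ z₃ ∧ z₂ ≠ z₄ ∧ z₂ ≠ z₅ ∧ z₃ ≠ z₄ ∧ z₃ ≠ z₅ ∧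
        z₄ ≠ z₅) ∧
      (z₂ ≠ z₁ ∧ z₃ ≠ z₁ ∧ z₄ ≠ z₁ ∧ z₅ ≠ z₁ ∧ z₃ ≠ z₂ ∧ z₄ ≠ z₂ ∧ z₅ ≠ z₂ ∧ z₄ ≠ z₃ ∧ z₅ ≠ z₃ ∧
        z₅ ≠ z₄) := by
  have h1 := h.disj
  simp only [List.disjoint_cons_left, List.mem_cons, List.not_mem_nil, or_false, not_or,
    List.disjoint_nil_left, and_true] at h1
  have a1 := h.d₁.adj₂.ne
  have a2 := h.d₂.ne₁
  have a3 := h.d₅.ne₁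
  have a4 := h.d₁.adj₁.ne
  have a5 := h.d₂.adj₂.ne
  have a6 := h.d₃.ne₁
  have a7 := h.d₁.ne₁
  have a8 := h.d₃.adj₂.ne
  have a9 := h.d₄.ne₁
  have a10 := h.d₄.adj₂.ne
  exact ⟨h1, ⟨a1, a2, a3.symm, a4, a5, a6, a7.symm, a8, a9, a10⟩, a1.symm, a2.symm, a3, a4.symm,
    a5.symm, a6.symm, a7, a8.symm, a9.symm, a10.symm⟩

omit [Fintype V] in
lemma Pent.eq_of_mem (h : Pent G S z₁ z₂ z₃ z₄ z₅ w₁ w₂ w₃ w₄ w₅) {c c' : V → Bool}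
    (hc : ∀ u, u ≠ z₁ → u ≠ z₂ → u ≠ z₃ → u ≠ z₄ → u ≠ z₅ → c' u = c u) :
    ∀ u ∈ S, c' u = c u := fun u hu => hc u (fun e => h.s₁ (e ▸ hu)) (fun e => h.s₂ (e ▸ hu))
    (fun e => h.s₃ (e ▸ hu)) (fun e => h.s₄ (e ▸ hu)) (fun e => h.s₅ (e ▸ hu))

lemma Pent.extend_mixed (t : Pent G S z₁ z₂ z₃ z₄ z₅ w₁ w₂ w₃ w₄ w₅)
    (h : Good (del G {z₁, z₂, z₃, z₄, z₅}) S c) (ha : c w₁ = true) (hb : c w₂ = false) :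
    ∃ c', (∀ u ∈ S, c' u = c u) ∧ Good G S c' := by
  have n := t.ne
  obtain ⟨c1, g1, f1, h1, -⟩ := h.put_true (v := z₂) (Z := {z₁, z₃, z₄, z₅}) (by grind)
    (t.d₂.all (by simp) (by simp) (by simp [hb]))
  obtain ⟨c2, g2, f2, h2, -⟩ := h1.put_false (v := z₃) (Z := {z₁, z₄, z₅}) (by grind) t.s₃
    (p := w₃) (by simp [n]) (t.d₃.all (by simp [g1]) (by simp) (by simp))
  obtain ⟨c3, f3, h3⟩ := h2.put_any (v := z₄) (Z := {z₁, z₅}) (by grind) t.s₄ (p := z₃) (q := w₄)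
    (by simp [n]) (by simp [n]) (t.d₄.all (by simp) (by simp) (by simp))
  obtain ⟨c4, f4, h4⟩ := h3.put_any (v := z₅) (Z := {z₁}) (by grind) t.s₅ (p := z₄) (q := w₅)
    (by simp [n]) (by simp [n]) (t.d₅.all (by simp) (by simp) (by simp))
  obtain ⟨c5, g5, f5, h5, -⟩ := h4.put_false (v := z₁) (Z := ∅) (by grind) t.s₁ (p := z₅)
    (by simp [n]) (t.d₁.all (by simp) (by simp [n, f4, f3, f2, g1])
      (by simp [n, f1, f2, f3, f4, ha]))
  rw [del_empty] at h5
  exact ⟨c5, t.eq_of_mem fun u a1 a2 a3 a4 a5 => by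
    simp [a1, a2, a3, a4, a5, f1, f2, f3, f4, f5], h5⟩

lemma Pent.extend_false (t : Pent G S z₁ z₂ z₃ z₄ z₅ w₁ w₂ w₃ w₄ w₅)
    (h : Good (del G {z₁, z₂, z₃, z₄, z₅}) S c)
    (hl : ¬ Linked (del G {z₁, z₂, z₃, z₄, z₅}) S c w₁ w₂)
    (hw : c w₃ = false ∧ c w₅ = false) :
    ∃ c', (∀ u ∈ S, c' u = c u) ∧ Good G S c' := by
  have n := t.ne
  obtain ⟨c1, g1, f1, h1, l1, -⟩ := h.put_false (v := z₁) (Z := {z₂, z₃, z₄, z₅}) (by grind) t.s₁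
    (p := w₁) (by simp [n]) (t.d₁.all (by simp) (by simp) (by simp))
  replace hl := fun h => hl (l1 w₂ (by simp [n]) h)
  obtain ⟨c2, g2, f2, h2⟩ := h1.put_false_two (v := z₂) (Z := {z₃, z₄, z₅}) (by grind) t.s₂
    (p := z₁) (q := w₂) (by simp [n]) (by simp [n]) (t.d₂.all (by simp) (by simp) (by simp)) hl
  obtain ⟨c3, g3, f3, h3, -⟩ := h2.put_true (v := z₃) (Z := {z₄, z₅}) (by grind)
    (t.d₃.all (by simp [g2]) (by simp) (by simp [n, f1, f2, hw]))
  obtain ⟨c4, g4, f4, h4, -⟩ := h3.put_true (v := z₅) (Z := {z₄}) (by grind)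
    (t.d₅.all (by simp) (by simp [n, f3, f2, g1]) (by simp [n, f1, f2, f3, hw]))
  obtain ⟨c5, g5, f5, h5, -⟩ := h4.put_false (v := z₄) (Z := ∅) (by grind) t.s₄ (p := w₄)
    (by simp [n]) (t.d₄.all (by simp [n, f4, g3]) (by simp [g4]) (by simp))
  rw [del_empty] at h5
  exact ⟨c5, t.eq_of_mem fun u a1 a2 a3 a4 a5 => by
    simp [a1, a2, a3, a4, a5, f1, f2, f3, f4, f5], h5⟩

lemma Pent.extend (t : Pent G S z₁ z₂ z₃ z₄ z₅ w₁ w₂ w₃ w₄ w₅)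
    (h : Good (del G {z₁, z₂, z₃, z₄, z₅}) S c) (hT : ¬ (c w₁ = true ∧ c w₃ = true))
    (hl : c w₁ = false → c w₃ = false → ¬ Linked (del G {z₁, z₂, z₃, z₄, z₅}) S c w₁ w₃) :
    ∃ c', (∀ u ∈ S, c' u = c u) ∧ Good G S c' := by
  by_cases m1 : c w₁ = true ∧ c w₂ = false
  · exact t.extend_mixed h m1.1 m1.2
  by_cases m2 : c w₂ = true ∧ c w₃ = false
  · exact t.rot.extend_mixed (by convert h using 2; grind) m2.1 m2.2
  by_cases m3 : c w₃ = true ∧ c w₄ = false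
  · exact t.rot.rot.extend_mixed (by convert h using 2; grind) m3.1 m3.2
  by_cases m4 : c w₄ = true ∧ c w₅ = false
  · exact t.rot.rot.rot.extend_mixed (by convert h using 2; grind) m4.1 m4.2
  by_cases m5 : c w₅ = true ∧ c w₁ = false
  · exact t.rot.rot.rot.rot.extend_mixed (by convert h using 2; grind) m5.1 m5.2
  obtain ⟨b1, b3, b4, b5⟩ : c w₁ = false ∧ c w₃ = false ∧ c w₄ = false ∧ c w₅ = false := by
    clear hl h t
    grind
  by_cases hl1 : Linked (del G {z₁, z₂, z₃, z₄, z₅}) S c w₁ w₂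
  · have hl2 := fun h23 => hl b1 b3 (h.2.tight_trans hl1 h23)
    have e : ({z₁, z₂, z₃, z₄, z₅} : Set V) = {z₂, z₃, z₄, z₅, z₁} := by grind
    rw [e] at h hl2
    exact t.rot.extend_false h hl2 ⟨b4, b1⟩
  · exact t.extend_false h hl1 ⟨b3, b5⟩

end Extension

section Cross
open Classical

variable {V : Type} {G : SimpleGraph V} {S : Set V} {φ : V → Bool} {L : List V}

lemma LongEdge.ring {a b : V} (h : LongEdge G a b) (hL : Ring G L) (hab : RE L a b) :
    L.length ≤ 3 ∨ 9 ≤ L.length := by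
  obtain ⟨M, hM, -, hl, -⟩ := hL.open hab
  have := h.2 M hM
  omega

/-- A path along a ring can be taken as an initial segment of the ring. -/
lemma Ring.exists_initial (hL : Ring G L) {l : List V} (hl : l.IsChain (RE L)) (hnd : l.Nodup)
    (h2 : 2 ≤ l.length) : ∃ R, Ring G (l ++ R) ∧ (l ++ R).length = L.length ∧
      (∀ y, y ∈ l ++ R ↔ y ∈ L) ∧ ∀ a b, RE (l ++ R) a b ↔ RE L a b := by
  induction l using List.reverseRecOn with
  | nil => simp at h2
  | append_singleton l w ih =>
    have hl' := List.isChain_append.1 hl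
    have hnd' := List.nodup_append.1 hnd
    by_cases h3 : l.length = 1
    · obtain ⟨u, rfl⟩ := List.length_eq_one_iff.1 h3
      have huw : RE L w u := by
        have := hl'.2.2
        simp only [List.getLast?_singleton, Option.mem_def, Option.some.injEq, List.head?_cons,
          forall_eq'] at this
        exact this.symm
      obtain ⟨M, hM, hadj, hlen, hmem, hre⟩ := hL.open huw
      have hR : Ring G ((w :: M) ++ [u]) := by
        simpa using ring_cons_concat.2 ⟨hM, hadj⟩
      refine ⟨M, by simpa using hR.rotate, by simp; omega, fun y => ?_, fun a b => ?_⟩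
      · rw [← hmem]
        simp only [List.cons_append, List.nil_append, List.mem_cons, List.mem_append,
          List.not_mem_nil, or_false]
        tauto
      · rw [← hre]
        exact re_append_comm (l := [u]) (m := w :: M)
    · simp only [List.length_append, List.length_singleton] at h2
      obtain ⟨R, hR, hlen, hmem, hre⟩ := ih hl'.1 hnd'.1 (by omega)
      obtain ⟨l', u, rfl⟩ : ∃ l' u, l = l' ++ [u] :=
        ⟨l.dropLast, l.getLast (by rintro rfl; simp at h2), (List.dropLast_append_getLast _).symm⟩
      obtain ⟨l1, p, rfl⟩ : ∃ l1 p, l' = l1 ++ [p] :=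
        ⟨l'.dropLast, l'.getLast (by rintro rfl; simp at h3), (List.dropLast_append_getLast _).symm⟩
      have huw : RE L u w := by simpa using hl'.2.2
      have hne : w ≠ p ∧ w ≠ u ∧ w ∉ l1 := by
        have h4 := fun a ha => hnd'.2.2 a ha w (by simp)
        exact ⟨fun h => h4 p (by simp) h.symm, fun h => h4 u (by simp) h.symm,
          fun h => h4 w (by simp [h]) rfl⟩
      have hrot : Ring G (u :: ((R ++ l1) ++ [p])) := by
        have : Ring G ((l1 ++ [p]) ++ (u :: R)) := by simpa using hR
        simpa using this.rotate
      rw [← hre] at huw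
      have huw' : RE (u :: ((R ++ l1) ++ [p])) u w := by
        have e := re_append_comm (l := l1 ++ [p]) (m := u :: R) (a := u) (b := w)
        simp only [List.append_assoc, List.cons_append, List.nil_append] at e huw ⊢
        exact e.1 huw
      have hhead : ∃ R', R = w :: R' := by
        rw [re_cons_concat] at huw'
        have hnd2 := hrot.2
        rcases huw' with h | h | h
        · cases R with
          | nil =>
            cases l1 with
            | nil => simp only [List.nil_append] at h hnd2; exact absurd (lnk_head hnd2 h) hne.1
            | cons r l1 =>
              simp only [List.nil_append, List.cons_append] at h hnd2
              exact absurd (lnk_head hnd2 h) (by rintro rfl; simp at hne)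
          | cons r R =>
            simp only [List.cons_append] at h hnd2
            exact ⟨R, by rw [lnk_head hnd2 h]⟩
        · exact absurd h.2 hne.2.1
        · exact absurd h.2 hne.1
      obtain ⟨R', rfl⟩ := hhead
      have e : ((l1 ++ [p]) ++ [u]) ++ [w] ++ R' = ((l1 ++ [p]) ++ [u]) ++ w :: R' := by simp
      exact ⟨R', by rw [e]; exact hR, by rw [e]; exact hlen, by rw [e]; exact hmem,
        by rw [e]; exact hre⟩

variable [Fintype V]

lemma re_iff_ne {D : Dual G} {T : D.X → ZMod 2}
    (hT : ∀ u v, G.Adj u v → (RE L u v ↔ T (D.fc u v) + T (D.fc v u) = 1))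
    {x y : D.X} {u v : V} (hx : bd D x u v) (hy : bd D y u v) (hxy : x ≠ y) :
    RE L u v ↔ T x ≠ T y := by
  rw [hT u v hx.1, zmod2_ne]
  rcases hx.2 with h1 | h1 <;> rcases hy.2 with h2 | h2
  · exact absurd (h1.symm.trans h2) hxy
  · rw [h1, h2]
  · rw [h1, h2]; exact ne_comm
  · exact absurd (h1.symm.trans h2) hxy

lemma Ctr.side_vf (hC : Ctr G S φ) (D : Dual G) {T : D.X → ZMod 2}
    (hT : ∀ u v, G.Adj u v → (RE L u v ↔ T (D.fc u v) + T (D.fc v u) = 1))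
    {p w : V} (hp : p ∉ L) (hpw : G.Adj p w) {x : D.X} (hx : p ∈ vf D x) :
    T (D.fc p w) = T x := by
  have hs : ∀ w, G.Adj p w → T (D.fc p w) = T (D.fc w p) := fun w hw => by
    by_contra h
    exact hp ((hT p w hw).2 (zmod2_ne.2 h)).mem.1
  obtain ⟨v, hv, h | h⟩ := mem_vf.1 hx
  · rw [← h]; exact hC.side D T hs hpw hv
  · rw [← h, ← hs v hv]; exact hC.side D T hs hpw hv

/-- A face whose boundary has a vertex off an admissible ring lies on the same side of the ring
as every other such face. -/
lemma Ctr.cross (hC : Ctr G S φ) (D : Dual G) (hL : AdmRing G L) {T : D.X → ZMod 2}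
    (hT : ∀ u v, G.Adj u v → (RE L u v ↔ T (D.fc u v) + T (D.fc v u) = 1))
    {p p' : V} {x y : D.X} (hp : p ∉ L) (hpx : p ∈ vf D x) (hp' : p' ∉ L) (hpy : p' ∈ vf D y) :
    T x = T y := by
  have hi : ∃ i, ∀ s ∈ S, s ∉ L → ∀ w, G.Adj s w → T (D.fc s w) = i := by
    rcases hC.adm with ⟨z, hz⟩ | ⟨L', hL', hS⟩
    · by_cases h : z ∉ L ∧ ∃ w, G.Adj z w
      · obtain ⟨hzL, w, hw⟩ := h
        refine ⟨T (D.fc z w), fun s hs hsL w' hw' => ?_⟩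
        obtain rfl : s = z := by simpa [hz] using hs
        exact hC.side_vf D hT hzL hw' (mem_vf.2 ⟨w, hw, .inl rfl⟩)
      · refine ⟨0, fun s hs hsL w' hw' => ?_⟩
        obtain rfl : s = z := by simpa [hz] using hs
        exact absurd ⟨hsL, w', hw'⟩ h
    · obtain ⟨f, hf⟩ := hC.outer D hL' hS
      refine ⟨T f, fun s hs hsL w hw => hC.side_vf D hT hsL hw ?_⟩
      obtain ⟨b, hb⟩ := (mem_iff_re hL'.1.2 hL'.2.1).1 (by simpa [hS] using hs : s ∈ L')
      exact mem_vf.2 ⟨b, (hf s b).2 hb⟩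
  obtain ⟨i, hi⟩ := hi
  obtain ⟨w, hw⟩ := mem_vf.1 hpx
  obtain ⟨w', hw'⟩ := mem_vf.1 hpy
  have e1 := hC.side_vf D hT hp hw.1 hpx
  have e2 := hC.side_vf D hT hp' hw'.1 hpy
  by_contra hne
  by_cases hxi : T x = i
  · exact hC.sep D hL hT hi hp' hw'.1 (by rw [e2, ← hxi]; exact Ne.symm hne) hp hw.1
      (by rw [e1, hxi])
  · refine hC.sep D hL hT hi hp hw.1 (by rwa [e1]) hp' hw'.1 ?_
    rw [e2]
    exact (by decide : ∀ a b i : ZMod 2, ¬ a = b → ¬ a = i → b = i) _ _ _ hne hxi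

lemma Ctr.corner (hC : Ctr G S φ) (D : Dual G) {v a b c : V} (hv : Deg3 G v a b c) :
    ∃ x, bd D x v a ∧ bd D x v b := by
  have h1 : bd D (D.fc v a) v a := ⟨hv.adj₁, .inl rfl⟩
  have h2 : bd D (D.fc a v) v a := ⟨hv.adj₁, .inr rfl⟩
  obtain ⟨b1, hb1, e1⟩ := hC.bd_other D h1
  obtain ⟨b2, hb2, e2⟩ := hC.bd_other D h2
  have g1 := (e1 b1).2 (.inr rfl)
  have g2 := (e2 b2).2 (.inr rfl)
  have m1 := (hv.adj b1).1 g1.1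
  have m2 := (hv.adj b2).1 g2.1
  by_cases k1 : b1 = b
  · exact ⟨_, h1, k1 ▸ g1⟩
  by_cases k2 : b2 = b
  · exact ⟨_, h2, k2 ▸ g2⟩
  have k1 : b1 = c := by tauto
  have k2 : b2 = c := by tauto
  have := hC.share D hv.ne₂ h1 h2 (k1 ▸ g1) (k2 ▸ g2) (hC.fc_ne D hv.adj₁) hv.adj₂
  exact absurd this (by have := hv.ne₁; have := hv.ne₃; tauto)

end Cross

section Chord
open Classical

variable {V : Type} {G : SimpleGraph V} {S : Set V} {φ : V → Bool}

variable [Fintype V]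

lemma Ctr.bd_not_three (hC : Ctr G S φ) (D : Dual G) {x : D.X} {u a b c : V} (ha : bd D x u a)
    (hb : bd D x u b) (hc : bd D x u c) : a = b ∨ a = c ∨ b = c := by
  obtain ⟨p, q, -, h⟩ := hC.bd_two D (mem_vf.2 ⟨a, ha⟩)
  have h1 := (h a).1 ha
  have h2 := (h b).1 hb
  have h3 := (h c).1 hc
  grind

omit [Fintype V] in
lemma Pth.ring {u v : V} {A : List V} (h : Pth G u A v) (hv : G.Adj u v) : Ring G (u :: (A ++ [v])) :=
  ring_cons_concat.2 ⟨h, hv⟩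

/-- A path through the boundary of `S` cannot be closed to a short face by an internal vertex of
degree three. -/
lemma Ctr.two_chord (hC : Ctr G S φ) (D : Dual G) {x : D.X} {u c c' t : V} {M : List V}
    (hu : Deg3 G u c c' t) (huS : u ∉ S) (hM : Pth G c M c') (hMS : ∀ y ∈ c :: (M ++ [c']), y ∈ S)
    (h1 : 1 ≤ M.length) (h2 : M.length ≤ 2) (hxc : bd D x u c) (hxc' : bd D x u c')
    (hxM : ∃ m ∈ M, m ∈ vf D x) : False := by
  obtain ⟨L, hL, hS⟩ : ∃ L, AdmRing G L ∧ S = {x | x ∈ L} := by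
    rcases hC.adm with ⟨z, rfl⟩ | h
    · have := hMS c (by simp)
      have := hMS c' (by simp)
      simp only [Set.mem_singleton_iff] at *
      exact absurd (by simp [*]) hM.ne
    · exact h
  have hchain : (c :: (M ++ [c'])).IsChain (RE L) :=
    List.IsChain.imp_of_mem_imp
      (fun a b ha hb hab => hC.chordless hL hS (hMS a ha) (hMS b hb) hab) hM.1
  obtain ⟨B, hB, hlen, hmem, hre⟩ := hL.1.exists_initial hchain hM.2 (by simp)
  have huL : u ∉ L := fun h => huS (by rw [hS]; exact h)
  have huB : u ∉ c :: (M ++ [c']) ++ B := fun h => huL ((hmem u).1 h)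
  have hring : Ring G ((c' :: B) ++ (c :: M)) := by
    have : Ring G ((c :: M) ++ (c' :: B)) := by simpa using hB
    exact this.rotate
  have hre' : ∀ a b, RE L a b → Lnk (c :: (M ++ [c'])) a b ∨ Lnk (c' :: (B ++ [c])) a b := by
    intro a b h
    rw [← hre, show c :: (M ++ [c']) ++ B = c :: (M ++ c' :: B) by simp, re_cons_cons] at h
    exact h
  have hP : Pth G c' B c := by
    unfold Pth
    refine ⟨isChain_of_lnk fun a b hab => hL.1.adj ((hre a b).1 ?_), ?_⟩
    · rw [show c :: (M ++ [c']) ++ B = c :: (M ++ c' :: B) by simp, re_cons_cons]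
      exact .inr hab
    · have := hring.2
      grind
  have hdis : M.Disjoint B := by
    have := hB.2
    grind [List.Disjoint]
  have hPu : Pth G u (c' :: B) c :=
    pth_cons.2 ⟨hu.adj₂, hP, fun h => huB (by simp [h]), fun h => huB (by simp [h])⟩
  have hD : Ring G (u :: ((c' :: B) ++ [c])) := hPu.ring hu.adj₁
  have hMu : Pth G u (c :: M) c' :=
    pth_cons.2 ⟨hu.adj₁, hM, fun h => huB (by simp [h]), fun h => huB (by simp [h])⟩
  have hMring : Ring G (u :: ((c :: M) ++ [c'])) := hMu.ring hu.adj₂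
  have hn : M.length + B.length + 2 = L.length := by
    rw [← hlen]; simp; omega
  -- a long edge of the outer cycle avoids the path
  have hlong : ∀ a b, RE L a b → LongEdge G a b → Lnk (c' :: (B ++ [c])) a b := by
    intro a b hab hl
    refine (hre' a b hab).resolve_left fun h => ?_
    have := hl.ring hMring (re_cons_concat.2 (.inl (.inr (.inr h))))
    simp at this
    omega
  have hadm : AdmRing G (u :: ((c' :: B) ++ [c])) := by
    refine ⟨hD, by simp, ?_⟩
    have hl : (u :: ((c' :: B) ++ [c])).length = B.length + 3 := by simp
    rw [hl]
    rcases hL.2.2 with h | ⟨h, a, b, hab, hlg⟩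
    · left; omega
    · right
      refine ⟨by omega, a, b, ?_, hlg⟩
      exact re_cons_concat.2 (.inl (.inr (.inr (hlong a b hab hlg))))
  obtain ⟨T, hT⟩ := D.ring hD hadm.2.1
  obtain ⟨m, hmM, hmx⟩ := hxM
  obtain ⟨y, hyc, hyt⟩ := hC.corner D hu.swap.rot
  have hxy : x ≠ y := by
    rintro rfl
    have := hC.bd_not_three D hxc hxc' hyt
    have := hu.ne₁; have := hu.ne₂; have := hu.ne₃
    tauto
  have hTne : T x ≠ T y := (re_iff_ne hT hxc hyc hxy).1 (re_cons_concat.2 (.inr (.inr ⟨rfl, rfl⟩)))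
  have hMc : m ≠ c ∧ m ≠ c' := by
    have := hM.left_notMem; have := hM.right_notMem
    exact ⟨by rintro rfl; contradiction, by rintro rfl; contradiction⟩
  have hmD : m ∉ u :: ((c' :: B) ++ [c]) := by
    intro h
    simp only [List.cons_append, List.mem_cons, List.mem_append, List.not_mem_nil, or_false] at h
    rcases h with rfl | h | h | h
    · exact huB (by simp [hmM])
    · exact hMc.2 h
    · exact hdis hmM h
    · exact hMc.1 h
  have htB : t ∈ B := by
    by_contra htB
    refine hTne (hC.cross D hadm hT hmD hmx (p' := t) ?_ (mem_vf.2 ⟨u, hyt.symm⟩))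
    intro h
    simp only [List.cons_append, List.mem_cons, List.mem_append, List.not_mem_nil, or_false] at h
    rcases h with rfl | h | h | h
    · exact hu.adj₃.ne rfl
    · exact hu.ne₃ h.symm
    · exact htB h
    · exact hu.ne₂ h.symm
  obtain ⟨B1, B2, rfl⟩ := List.append_of_mem htB
  rw [pth_append] at hP
  obtain ⟨hP1, hP2, -⟩ := hP
  have hQ1 : Pth G u (t :: B1.reverse) c' :=
    pth_cons.2 ⟨hu.adj₃, hP1.symm, fun h => huB (by simp at h; simp [h]), hMu.ne⟩
  have hQ2 : Pth G u (t :: B2) c :=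
    pth_cons.2 ⟨hu.adj₃, hP2, fun h => huB (by simp [h]), hPu.ne⟩
  have hR1 := hQ1.ring hu.adj₂
  have hR2 := hQ2.ring hu.adj₁
  have hMu' : Pth G u (c' :: M.reverse) c :=
    pth_cons.2 ⟨hu.adj₂, hM.symm, fun h => huB (by simp at h; simp [h]), hPu.ne⟩
  have th1 : Theta G u c' (c :: M) (t :: B1.reverse) := by
    refine ⟨hu.adj₂, hMu, hQ1, by simp, by simp, ?_⟩
    have := hB.2
    have := hu.ne₂
    grind [List.Disjoint]
  have th2 : Theta G u c (c' :: M.reverse) (t :: B2) := by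
    refine ⟨hu.adj₁, hMu', hQ2, by simp, by simp, ?_⟩
    have := hB.2
    have := hu.ne₃
    grind [List.Disjoint]
  have s1 := hC.sparse _ _ _ _ th1
  have s2 := hC.sparse _ _ _ _ th2
  have s3 := hC.sparse _ _ _ _ th1.symm
  have s4 := hC.sparse _ _ _ _ th2.symm
  simp only [List.length_cons, List.length_reverse, List.length_append] at s1 s2 s3 s4 hn
  rcases hL.2.2 with h | ⟨h, a, b, hab, hlg⟩
  · omega
  · have h' := hlong a b hab hlg
    have e : c' :: ((B1 ++ t :: B2) ++ [c]) = (c' :: B1) ++ t :: (B2 ++ [c]) := by simp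
    rw [e, lnk_append] at h'
    rcases h' with h' | h'
    · have h'' : Lnk (t :: B1.reverse ++ [c']) a b := by
        have := lnk_reverse.2 h'
        simpa using this
      have := hlg.ring hR1 (re_cons_concat.2 (.inl (.inr (.inr h''))))
      simp only [List.length_cons, List.length_reverse, List.length_append, List.length_nil] at this
      omega
    · have := hlg.ring hR2 (re_cons_concat.2 (.inl (.inr (.inr h'))))
      simp only [List.length_cons, List.length_append, List.length_nil] at this
      omega

end Chord

section Add
open Classical

variable {V : Type} {G H : SimpleGraph V} {S Z : Set V} {φ : V → Bool} {L : List V} {a b : V}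

/-- The graph with the edge `ab` added. -/
def addEdge (H : SimpleGraph V) (a b : V) : SimpleGraph V where
  Adj u v := H.Adj u v ∨ (u ≠ v ∧ ((u = a ∧ v = b) ∨ (u = b ∧ v = a)))
  symm := ⟨fun u v h => h.elim (fun h => .inl h.symm) fun h => .inr ⟨h.1.symm, by tauto⟩⟩
  loopless := ⟨fun _ h => h.elim (H.loopless.irrefl _) fun h => h.1 rfl⟩

lemma le_addEdge : H ≤ addEdge H a b := fun _ _ h => .inl h

/-- Every path of `H` from `a` to `b` is long. -/
def Far (G H : SimpleGraph V) (a b : V) : Prop :=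
  ∀ Q, Pth H a Q b → 5 ≤ Q.length ∧
    ∀ p q, Lnk (a :: (Q ++ [b])) p q → LongEdge G p q → 7 ≤ Q.length

lemma Far.not_adj (h : Far G H a b) : ¬ H.Adj a b := fun hab => by
  have := (h [] (pth_nil.2 hab)).1
  simp at this

lemma Ring.of_addEdge (hF : Far G H a b) (hGH : G.Adj a b → H.Adj a b)
    (hL : Ring (addEdge H a b) L) (h3 : 3 ≤ L.length) :
    Ring H L ∨ (7 ≤ L.length ∧ ∀ p q, RE L p q → LongEdge G p q → 9 ≤ L.length) := by
  by_cases h : ∀ p q, RE L p q → H.Adj p q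
  · exact .inl (ring_iff.2 ⟨h, hL.2⟩)
  right
  push Not at h
  obtain ⟨p, q, hpq, hn⟩ := h
  have hab : RE L a b := by
    rcases (hL.adj hpq).resolve_left hn with ⟨-, ⟨rfl, rfl⟩ | ⟨rfl, rfl⟩⟩
    · exact hpq
    · exact hpq.symm
  obtain ⟨M, hM, -, hlen, -, hre⟩ := hL.open hab
  have hno : ¬ Lnk (a :: (M ++ [b])) a b := by
    intro h
    cases M with
    | nil => simp at hlen; omega
    | cons m M =>
      have := lnk_head hM.2 h
      exact hM.right_notMem (by simp [this])
  have hMH : Pth H a M b := by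
    refine ⟨isChain_of_lnk fun c d hcd => ?_, hM.2⟩
    rcases hL.adj ((hre c d).1 (re_cons_concat.2 (.inl hcd))) with h | ⟨-, ⟨rfl, rfl⟩ | ⟨rfl, rfl⟩⟩
    · exact h
    · exact absurd hcd hno
    · exact absurd hcd.symm hno
  refine ⟨by have := (hF M hMH).1; omega, fun p q hpq hl => ?_⟩
  rw [← hre, re_cons_concat] at hpq
  rcases hpq with h | ⟨rfl, rfl⟩ | ⟨rfl, rfl⟩
  · have := (hF M hMH).2 p q h hl
    omega
  · exact absurd (hGH hl.1.symm) hF.not_adj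
  · exact absurd (hGH hl.1) hF.not_adj

lemma Sparse.addEdge (hG : Sparse G) (hle : H ≤ G) (hF : Far G H a b)
    (hGH : G.Adj a b → H.Adj a b) : Sparse (addEdge H a b) := by
  intro u v A B ⟨huv, hA, hB, hA0, hB0, hdis⟩
  by_contra hbad
  have lA := List.length_pos_iff.2 hA0
  have lB := List.length_pos_iff.2 hB0
  have rA := Ring.of_addEdge hF hGH (hA.ring huv) (by simp; omega)
  have rB := Ring.of_addEdge hF hGH (hB.ring huv) (by simp; omega)
  simp only [List.length_cons, List.length_append, List.length_nil] at rA rB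
  have rA := rA.resolve_right (by omega)
  obtain ⟨hA', huv'⟩ := ring_cons_concat.1 rA
  rcases rB with rB | ⟨h7, h9⟩
  · obtain ⟨hB', -⟩ := ring_cons_concat.1 rB
    exact hbad (hG _ _ _ _ ⟨hle huv', hA'.mono hle, hB'.mono hle, hA0, hB0, hdis⟩)
  · have h1 : A.length = 1 := by omega
    obtain ⟨x, rfl⟩ := List.length_eq_one_iff.1 h1
    have hx := (pth_cons.1 hA')
    have := h9 u v (re_cons_concat.2 (.inr (.inr ⟨rfl, rfl⟩))) (hG.longEdge_of_triangle (hle huv')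
      (hle hx.1) (hle (pth_nil.1 hx.2.1).symm))
    omega

lemma LongEdge.addEdge {p q : V} (h : LongEdge G p q) (hle : H ≤ G) (hF : Far G H a b)
    (hGH : G.Adj a b → H.Adj a b) (hpq : H.Adj p q) : LongEdge (addEdge H a b) p q := by
  refine ⟨.inl hpq, fun A hA => ?_⟩
  by_contra hn
  rcases Ring.of_addEdge hF hGH (hA.ring (.inl hpq)) (by simp; omega) with r | ⟨-, h9⟩
  · have := h.2 A ((ring_cons_concat.1 r).1.mono hle)
    omega
  · have := h9 p q (re_cons_concat.2 (.inr (.inr ⟨rfl, rfl⟩))) h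
    simp at this
    omega

variable [Fintype V]

lemma Ctr.add_edge (hC : Ctr G S φ) (hZS : ∀ z ∈ Z, z ∉ S) (ha : a ∉ Z) (hb : b ∉ Z) {l : List V}
    (hl : Pth G a l b) (hl0 : l ≠ []) (hlZ : ∀ z ∈ l, z ∈ Z) (hF : Far G (del G Z) a b) :
    ∃ c, (∀ x ∈ S, c x = φ x) ∧ Good (del G Z) S c ∧ ¬ (c a = true ∧ c b = true) ∧
      (c a = false → c b = false → ¬ Linked (del G Z) S c a b) := by
  have hle := del_le G Z
  have hab := hl.ne
  have hGH : G.Adj a b → (del G Z).Adj a b := fun h => ⟨h, ha, hb⟩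
  have hSS : ∀ u ∈ S, ∀ v ∈ S, G.Adj u v → (del G Z).Adj u v := fun u hu v hv h =>
    ⟨h, fun h => hZS _ h hu, fun h => hZS _ h hv⟩
  have hS : ¬ (a ∈ S ∧ b ∈ S) := by
    rintro ⟨haS, hbS⟩
    rcases hC.adm with ⟨z, rfl⟩ | ⟨L, hL, hS⟩
    · exact hab (haS.trans hbS.symm)
    · have haL : a ∈ L := by simpa [hS] using haS
      have hbL : b ∈ L := by simpa [hS] using hbS
      obtain ⟨A, B, hA, hB, -, hlen, hmem, hre⟩ := hL.1.arcs haL hbL hab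
      have hin : ∀ y, y ∈ L → y ∉ Z := fun y hy h => hZS y h (by simpa [hS] using hy)
      have hA' : Pth (del G Z) a A b := hA.imp fun p hp q hq h => by
        refine ⟨h, hin _ ((hmem p).2 ?_), hin _ ((hmem q).2 ?_)⟩
        · simp at hp; tauto
        · simp at hq; tauto
      have hB' : Pth (del G Z) a B.reverse b := hB.symm.imp fun p hp q hq h => by
        refine ⟨h, hin _ ((hmem p).2 ?_), hin _ ((hmem q).2 ?_)⟩
        · simp at hp; tauto
        · simp at hq; tauto
      have fA := hF A hA'
      have fB := hF _ hB'
      rw [List.length_reverse] at fB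
      rcases hL.2.2 with h | ⟨h, p, q, hpq, hlg⟩
      · omega
      · rcases (hre p q).1 hpq with h' | h'
        · have := fA.2 p q h' hlg
          omega
        · have := fB.2 p q (by
            have := lnk_reverse.2 h'
            simpa using this) hlg
          omega
  have hadm : Adm (addEdge (del G Z) a b) S := by
    rcases hC.adm with h | ⟨L, ⟨hL, h3, h⟩, hS⟩
    · exact .inl h
    · have hadj : ∀ p q, RE L p q → (del G Z).Adj p q := fun p q hpq =>
        hSS p (by rw [hS]; exact hpq.mem.1) q (by rw [hS]; exact hpq.mem.2) (hL.adj hpq)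
      refine .inr ⟨L, ⟨ring_iff.2 ⟨fun p q hpq => .inl (hadj p q hpq), hL.2⟩, h3, ?_⟩, hS⟩
      refine h.imp_right fun ⟨h, p, q, hpq, hlg⟩ => ⟨h, p, q, hpq, hlg.addEdge hle hF hGH (hadj p q hpq)⟩
  have hgrid : GridMinor (addEdge (del G Z) a b) := by
    refine hC.grid.minor _ (fun v => if v ∈ Z then ∅ else if v = a then (a :: l).toFinset else {v})
      ?_ ?_ ?_
    · have key : ∀ u w, w ∈ (if u ∈ Z then ∅ else if u = a then (a :: l).toFinset else {u}) →
          u = (if w ∈ Z then a else w) := by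
        intro u w h
        split_ifs at h with h1 h2
        · simp at h
        · subst h2
          simp only [List.toFinset_cons, Finset.mem_insert, List.mem_toFinset] at h
          rcases h with rfl | h
          · simp [h1]
          · simp [hlZ w h]
        · simp only [Finset.mem_singleton] at h
          subst h
          simp [h1]
      intro u v w hu hv
      exact (key u w hu).trans (key v w hv).symm
    · intro v
      have hc : (a :: l).IsChain G.Adj := by
        have := hl.1
        rw [← List.cons_append, List.isChain_append] at this
        exact this.1
      by_cases h1 : v ∈ Z
      · simp [h1, Conn]
      · by_cases h2 : v = a
        · subst h2
          simp only [h1, if_false, if_true]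
          exact conn_toFinset (fun _ _ h => h.symm) hc
        · simp only [h1, h2, if_false]
          intro p hp q hq
          simp only [Finset.mem_singleton] at hp hq
          subst hp hq
          exact .refl
    · have hin : ∀ v, v ∉ Z → v ∈ (if v ∈ Z then ∅ else if v = a then (a :: l).toFinset else {v}) := by
        intro v hv
        by_cases h : v = a <;> simp [hv, h]
        simp [← h, hv]
      obtain ⟨l', r, rfl⟩ : ∃ l' r, l = l' ++ [r] :=
        ⟨l.dropLast, l.getLast hl0, (List.dropLast_append_getLast _).symm⟩
      have hr := (pth_concat.1 hl).2.1
      rintro u v (h | ⟨-, ⟨rfl, rfl⟩ | ⟨rfl, rfl⟩⟩)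
      · exact ⟨u, hin u h.2.1, v, hin v h.2.2, h.1⟩
      · exact ⟨r, by simp [ha], v, hin v hb, hr⟩
      · exact ⟨u, hin u hb, r, by simp [ha], hr.symm⟩
  have hcard : (addEdge (del G Z) a b).edgeSet.ncard < G.edgeSet.ncard := by
    obtain ⟨p, l', rfl⟩ := List.exists_cons_of_ne_nil hl0
    have hp := (pth_cons.1 hl).1
    obtain ⟨r, hrb, hrZ⟩ : ∃ r, G.Adj r b ∧ r ∈ Z := by
      obtain ⟨l'', r, e⟩ : ∃ l'' r, p :: l' = l'' ++ [r] :=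
        ⟨(p :: l').dropLast, (p :: l').getLast hl0, (List.dropLast_append_getLast _).symm⟩
      exact ⟨r, (pth_concat.1 (e ▸ hl)).2.1, hlZ r (by rw [e]; simp)⟩
    have h1 : (addEdge (del G Z) a b).edgeSet ⊆ insert s(a, b) (del G Z).edgeSet := by
      intro e
      induction e with | _ x y
      rintro (h | ⟨-, ⟨rfl, rfl⟩ | ⟨rfl, rfl⟩⟩)
      · exact .inr h
      · exact .inl rfl
      · exact .inl Sym2.eq_swap
    have hpZ := hlZ p (by simp)
    have n2 : s(b, r) ∉ (del G Z).edgeSet := fun h => h.2.2 hrZ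
    have n1 : s(a, p) ∉ insert s(b, r) (del G Z).edgeSet := by
      rintro (h | h)
      · simp only [Sym2.eq_iff] at h
        rcases h with h | h
        · exact hab h.1
        · exact ha (h.1 ▸ hrZ)
      · exact h.2.2 hpZ
    have h2 : insert s(a, p) (insert s(b, r) (del G Z).edgeSet) ⊆ G.edgeSet := by
      rintro e (rfl | rfl | h)
      · exact hp
      · exact hrb.symm
      · exact edgeSet_subset_edgeSet.2 hle h
    have c1 := Set.ncard_le_ncard h1 (Set.toFinite _)
    have c2 := Set.ncard_insert_le s(a, b) (del G Z).edgeSet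
    have c3 := Set.ncard_le_ncard h2 (Set.toFinite _)
    rw [Set.ncard_insert_of_notMem n1, Set.ncard_insert_of_notMem n2] at c3
    omega
  obtain ⟨c, hc, hg⟩ := hC.ih _ S hgrid (hC.sparse.addEdge hle hF hGH) hadm hcard φ
  refine ⟨c, hc, hg.of_le_of_eq (fun u v h _ => .inl h) fun _ _ _ _ => rfl,
    fun h => hS (hg.1 a b (.inr ⟨hab, .inl ⟨rfl, rfl⟩⟩) h.1 h.2), fun h1 h2 => ?_⟩
  exact hg.not_linked (.inr ⟨hab, .inl ⟨rfl, rfl⟩⟩) hS h1 h2 le_addEdge hF.not_adj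

end Add

section Z
open Classical

variable {V : Type} {G : SimpleGraph V} {S Z : Set V} {φ : V → Bool}

variable [Fintype V] {D : Dual G} {x : D.X} {z₁ z₂ z₃ w₁ w₂ w₃ r : V} {R : List V}

lemma Ctr.no_ring (hC : Ctr G S φ) {W : List V} (d₂ : Deg3 G z₂ z₁ z₃ w₂) (h₁ : bd D x z₂ z₁)
    (h₃ : bd D x z₂ z₃) (hr : r ∈ vf D x) (hrW : r ∉ z₂ :: (z₃ :: W ++ [z₁]))
    (hW : Pth G z₃ W z₁) (h2 : z₂ ∉ W) (hw2 : w₂ ∉ W)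
    (hlen : W.length + 3 ≤ 9 ∨
      (W.length + 3 ≤ 12 ∧ ∃ p q, Lnk (z₃ :: (W ++ [z₁])) p q ∧ LongEdge G p q)) : False := by
  have hP : Pth G z₂ (z₃ :: W) z₁ := pth_cons.2 ⟨d₂.adj₂, hW, h2, d₂.adj₁.ne⟩
  have hR := hP.ring d₂.adj₁
  have hA : AdmRing G (z₂ :: (z₃ :: W ++ [z₁])) := by
    refine ⟨hR, by simp, ?_⟩
    have e : (z₂ :: (z₃ :: W ++ [z₁])).length = W.length + 3 := by simp
    rw [e]
    exact hlen.imp_right fun ⟨h, p, q, hpq, hl⟩ =>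
      ⟨h, p, q, re_cons_concat.2 (.inl (.inr (.inr hpq))), hl⟩
  obtain ⟨T, hT⟩ := D.ring hR hA.2.1
  obtain ⟨y, hy1, hyw⟩ := hC.corner D d₂.swap.rot
  have hxy : x ≠ y := by
    rintro rfl
    have := hC.bd_not_three D h₁ h₃ hyw
    have := d₂.ne₁; have := d₂.ne₂; have := d₂.ne₃
    tauto
  have hw : w₂ ∉ z₂ :: (z₃ :: W ++ [z₁]) := by
    have := d₂.adj₃.ne
    have := d₂.ne₂; have := d₂.ne₃
    simp only [List.cons_append, List.mem_cons, List.mem_append, List.not_mem_nil, or_false]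
    grind
  exact (re_iff_ne hT h₁ hy1 hxy).1 (re_cons_concat.2 (.inr (.inr ⟨rfl, rfl⟩)))
    (hC.cross D hA hT hrW hr hw (mem_vf.2 ⟨z₂, hyw.symm⟩))

lemma Ctr.far (hC : Ctr G S φ) (d₂ : Deg3 G z₂ z₁ z₃ w₂) (h₁ : bd D x z₂ z₁)
    (h₃ : bd D x z₂ z₃) (hR : Pth G z₃ R z₁) (hR1 : 1 ≤ R.length) (hR2 : R.length ≤ 2)
    (h2R : z₂ ∉ R) (hrR : r ∈ R) (hr : r ∈ vf D x) (hw₁ : G.Adj z₁ w₁) (hw₃ : G.Adj z₃ w₃)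
    (hZ : ∀ y, y ∈ Z ↔ y = z₂ ∨ y ∈ z₃ :: (R ++ [z₁])) (hz₁ : w₁ ∉ Z) (hz₂ : w₂ ∉ Z)
    (hz₃ : w₃ ∉ Z) : w₁ ≠ w₃ ∧ Far G (del G Z) w₁ w₃ := by
  have hrne : r ≠ z₁ ∧ r ≠ z₂ ∧ r ≠ z₃ := by
    have := hR.left_notMem; have := hR.right_notMem
    refine ⟨?_, ?_, ?_⟩ <;> · rintro rfl; contradiction
  have hrZ : r ∈ Z := (hZ r).2 (by simp [hrR])
  have hno : ∀ W : List V, Pth G z₃ W z₁ → (∀ y ∈ W, y ∉ Z) → w₂ ∉ W →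
      ¬ (W.length + 3 ≤ 9 ∨
      (W.length + 3 ≤ 12 ∧ ∃ p q, Lnk (z₃ :: (W ++ [z₁])) p q ∧ LongEdge G p q)) := by
    intro W hW hWZ hw2 h
    refine hC.no_ring d₂ h₁ h₃ hr ?_ hW (fun h => hWZ _ h ((hZ _).2 (.inl rfl))) hw2 h
    simp only [List.cons_append, List.mem_cons, List.mem_append, List.not_mem_nil, or_false]
    have := fun h => hWZ r h hrZ
    tauto
  have hA1 : Pth G z₁ (R.reverse ++ [z₃]) z₂ :=
    pth_concat.2 ⟨hR.symm, d₂.adj₂.symm, d₂.adj₁.ne', by simpa using h2R⟩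
  have hA3 : Pth G z₃ (R ++ [z₁]) z₂ :=
    pth_concat.2 ⟨hR, d₂.adj₁.symm, d₂.adj₂.ne', h2R⟩
  have hz : ∀ w, w ∉ Z → w ≠ z₁ ∧ w ≠ z₂ ∧ w ≠ z₃ ∧ w ∉ R := by
    intro w hw
    refine ⟨?_, ?_, ?_, ?_⟩ <;> intro h <;> refine hw ((hZ w).2 ?_) <;> simp [h]
  have m1 := hz _ hz₁
  have m2 := hz _ hz₂
  have m3 := hz _ hz₃
  have hne : w₁ ≠ w₂ := by
    rintro rfl
    have := hC.sparse _ _ _ _ (⟨d₂.adj₁.symm, pth_cons.2 ⟨hw₁, pth_nil.2 d₂.adj₃.symm, by simp,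
      d₂.adj₁.ne'⟩, hA1, by simp, by simp, ?_⟩ : Theta G z₁ z₂ [w₁] (R.reverse ++ [z₃]))
    · simp at this; omega
    · simp; tauto
  have hne' : w₃ ≠ w₂ := by
    rintro rfl
    have := hC.sparse _ _ _ _ (⟨d₂.adj₂.symm, pth_cons.2 ⟨hw₃, pth_nil.2 d₂.adj₃.symm, by simp,
      d₂.adj₂.ne'⟩, hA3, by simp, by simp, ?_⟩ : Theta G z₃ z₂ [w₃] (R ++ [z₁]))
    · simp at this; omega
    · simp; tauto
  refine ⟨?_, fun Q hQ => ?_⟩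
  · rintro rfl
    refine hno [w₁] (pth_cons.2 ⟨hw₃, pth_nil.2 hw₁.symm, by simp, hR.ne⟩) (by simpa using hz₁)
      (by simpa using hne.symm) (.inl (by simp))
  have hQZ : ∀ y ∈ w₁ :: (Q ++ [w₃]), y ∉ Z := by
    intro y hy
    obtain ⟨l, e⟩ : ∃ l, l = w₁ :: (Q ++ [w₃]) := ⟨_, rfl⟩
    have h3 : 2 ≤ l.length := by simp [e]
    have hc : l.IsChain (del G Z).Adj := e ▸ hQ.1
    rw [← e] at hy
    clear e hQ
    induction l with
    | nil => simp at hy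
    | cons p l ih =>
      cases l with
      | nil => simp at h3
      | cons q l =>
        rw [List.isChain_cons_cons] at hc
        rcases List.mem_cons.1 hy with rfl | hy
        · exact hc.1.2.1
        · cases l with
          | nil => simp only [List.mem_singleton] at hy; exact hy ▸ hc.1.2.2
          | cons s l => exact ih hy (by simp) hc.2
  have hQG := hQ.mono (del_le G Z)
  have hzQ : ∀ z ∈ Z, z ∉ w₁ :: (Q ++ [w₃]) := fun z hz h => hQZ z h hz
  have n1 := hzQ z₁ ((hZ _).2 (by simp))
  have n2 := hzQ z₂ ((hZ _).2 (by simp))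
  have n3 := hzQ z₃ ((hZ _).2 (by simp))
  have nR : ∀ y ∈ R, y ∉ w₁ :: (Q ++ [w₃]) := fun y hy => hzQ y ((hZ _).2 (by simp [hy]))
  by_cases hw2 : w₂ ∈ Q
  · obtain ⟨Qa, Qb, rfl⟩ := List.append_of_mem hw2
    have hQG' := hQG
    rw [pth_append] at hQG
    obtain ⟨ha, hb, -⟩ := hQG
    simp only [List.mem_cons, List.mem_append, List.not_mem_nil, or_false] at n1 n2 n3 nR
    have pa : Pth G z₁ (w₁ :: (Qa ++ [w₂])) z₂ :=
      pth_cons.2 ⟨hw₁, pth_concat.2 ⟨ha, d₂.adj₃.symm, m1.2.1, by tauto⟩, by simp; tauto,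
        d₂.adj₁.ne'⟩
    have pb : Pth G z₃ (w₃ :: (Qb.reverse ++ [w₂])) z₂ :=
      pth_cons.2 ⟨hw₃, pth_concat.2 ⟨hb.symm, d₂.adj₃.symm, m3.2.1, by simp; tauto⟩,
        by simp; tauto, d₂.adj₂.ne'⟩
    have ta : Theta G z₁ z₂ (w₁ :: (Qa ++ [w₂])) (R.reverse ++ [z₃]) := by
      refine ⟨d₂.adj₁.symm, pa, hA1, by simp, by simp, ?_⟩
      grind [List.Disjoint]
    have tb : Theta G z₃ z₂ (w₃ :: (Qb.reverse ++ [w₂])) (R ++ [z₁]) := by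
      refine ⟨d₂.adj₂.symm, pb, hA3, by simp, by simp, ?_⟩
      grind [List.Disjoint]
    have s1 := hC.sparse _ _ _ _ ta
    have s2 := hC.sparse _ _ _ _ tb
    have s3 := hC.sparse _ _ _ _ ta.symm
    have s4 := hC.sparse _ _ _ _ tb.symm
    have ra := pa.ring d₂.adj₁.symm
    have rb := pb.ring d₂.adj₂.symm
    simp only [List.length_cons, List.length_reverse, List.length_append, List.length_nil]
      at s1 s2 s3 s4 ⊢
    refine ⟨by omega, fun p q hpq hl => ?_⟩
    have e : w₁ :: ((Qa ++ w₂ :: Qb) ++ [w₃]) = (w₁ :: Qa) ++ w₂ :: (Qb ++ [w₃]) := by simp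
    rw [e, lnk_append] at hpq
    rcases hpq with h | h
    · have h' : Lnk (z₁ :: (w₁ :: (Qa ++ [w₂]) ++ [z₂])) p q := by
        have := lnk_append (l := z₁ :: w₁ :: Qa) (x := w₂) (m := [z₂]) (a := p) (b := q)
        simp only [List.cons_append, List.append_assoc, List.nil_append] at this h ⊢
        exact this.2 (.inl (.inr (.inr h)))
      have := hl.ring ra (re_cons_concat.2 (.inl h'))
      simp only [List.length_cons, List.length_append, List.length_nil] at this
      omega
    · have h' : Lnk (z₃ :: (w₃ :: (Qb.reverse ++ [w₂]) ++ [z₂])) p q := by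
        have := lnk_append (l := z₃ :: w₃ :: Qb.reverse) (x := w₂) (m := [z₂]) (a := p) (b := q)
        have h2 := lnk_reverse.2 h
        simp only [List.cons_append, List.append_assoc, List.nil_append, List.reverse_cons,
          List.reverse_append, List.reverse_nil] at this h2 ⊢
        exact this.2 (.inl (.inr (.inr h2)))
      have := hl.ring rb (re_cons_concat.2 (.inl h'))
      simp only [List.length_cons, List.length_append, List.length_nil, List.length_reverse] at this
      omega
  · have hW : Pth G z₃ (w₃ :: (Q.reverse ++ [w₁])) z₁ := by
      simp only [List.mem_cons, List.mem_append, List.not_mem_nil, or_false] at n1 n2 n3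
      exact pth_cons.2 ⟨hw₃, pth_concat.2 ⟨hQG.symm, hw₁.symm, m3.1, by simp; tauto⟩,
        by simp; tauto, hR.ne⟩
    have h := hno _ hW (fun y hy => hQZ y (by simp at hy ⊢; tauto)) (by simp; tauto)
    simp only [List.length_cons, List.length_reverse, List.length_append, List.length_nil] at h
    refine ⟨by omega, fun p q hpq hl => ?_⟩
    by_contra hlt
    refine h (.inr ⟨by omega, p, q, .inr (.inr ?_), hl⟩)
    have := lnk_reverse.2 hpq
    simp only [List.cons_append, List.nil_append, List.reverse_cons,
          List.reverse_append, List.reverse_nil] at this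
    have := lnk_cons_concat (l := w₃ :: Q.reverse) (x := w₁) (y := z₁) (by simpa using this)
    simpa using this

end Z

section ZFace
open Classical

variable {V : Type} {G : SimpleGraph V} {S : Set V} {φ : V → Bool}

/-- Internal vertices of degree three. -/
def Int3 (G : SimpleGraph V) (S : Set V) (v : V) : Prop := v ∉ S ∧ ∃ a b c, Deg3 G v a b c

lemma Int3.deg3 {v a b : V} (h : Int3 G S v) (ha : G.Adj v a) (hb : G.Adj v b) (hab : a ≠ b) :
    ∃ c, Deg3 G v a b c := by
  obtain ⟨-, p, q, r, h⟩ := h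
  rcases (h.adj a).1 ha with rfl | rfl | rfl <;> rcases (h.adj b).1 hb with rfl | rfl | rfl
  · exact absurd rfl hab
  · exact ⟨r, h⟩
  · exact ⟨q, h.rot.swap.rot.rot⟩
  · exact ⟨r, h.swap⟩
  · exact absurd rfl hab
  · exact ⟨p, h.rot⟩
  · exact ⟨q, h.rot.rot⟩
  · exact ⟨p, h.rot.swap⟩
  · exact absurd rfl hab

lemma Deg3.not_adj_third {v a b c d : V} (h : Deg3 G v a b c) (hd : ¬ G.Adj v d) : d ≠ c := by
  rintro rfl
  exact hd h.adj₃

variable [Fintype V]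

lemma Ctr.quad (hC : Ctr G S φ) (D : Dual G) {x : D.X} (hx : len D x = 4)
    (h : ∀ v ∈ vf D x, Int3 G S v) : False := by
  obtain ⟨L, hL, -, hlen, hmem, hre⟩ := hC.face_ring D x
  rw [hx] at hlen
  match L, hlen with
  | [z₁, z₂, z₃, z₄], _ =>
    simp only [← hmem] at h
    have nd := hL.2
    have nd' := nd
    simp only [List.nodup_cons, List.mem_cons, List.not_mem_nil, or_false, not_or] at nd'
    simp only [RE, List.head?_cons, Option.toList_some, List.cons_append, List.nil_append, Lnk,
      or_false] at hre
    have b12 : bd D x z₁ z₂ := by rw [hre]; simp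
    have b23 : bd D x z₂ z₃ := by rw [hre]; simp
    have b34 : bd D x z₃ z₄ := by rw [hre]; simp
    have b41 : bd D x z₄ z₁ := by rw [hre]; simp
    have p : ∀ a b c, G.Adj a b → G.Adj b c → a ≠ c → Pth G a [b] c := fun a b c hab hbc hac =>
      pth_cons.2 ⟨hab, pth_nil.2 hbc, by simp, hac⟩
    have n13 : ¬ G.Adj z₁ z₃ := fun e => by
      have := hC.sparse z₁ z₃ [z₂] [z₄] ⟨e, p _ _ _ b12.1 b23.1 e.ne,
        p _ _ _ b41.1.symm b34.1.symm e.ne, by simp, by simp, by grind [List.Disjoint]⟩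
      simp at this
    have n24 : ¬ G.Adj z₂ z₄ := fun e => by
      have := hC.sparse z₂ z₄ [z₃] [z₁] ⟨e, p _ _ _ b23.1 b34.1 e.ne,
        p _ _ _ b12.1.symm b41.1.symm e.ne, by simp, by simp, by grind [List.Disjoint]⟩
      simp at this
    obtain ⟨w₁, d₁⟩ := (h z₁ (by simp)).deg3 b41.1.symm b12.1 (by tauto)
    obtain ⟨w₂, d₂⟩ := (h z₂ (by simp)).deg3 b12.1.symm b23.1 (by tauto)
    obtain ⟨w₃, d₃⟩ := (h z₃ (by simp)).deg3 b23.1.symm b34.1 (by tauto)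
    obtain ⟨w₄, d₄⟩ := (h z₄ (by simp)).deg3 b34.1.symm b41.1 (by tauto)
    have t : Quad G S z₁ z₂ z₃ z₄ w₁ w₂ w₃ w₄ := by
      refine ⟨(h z₁ (by simp)).1, (h z₂ (by simp)).1, (h z₃ (by simp)).1, (h z₄ (by simp)).1,
        d₁, d₂, d₃, d₄, ?_⟩
      have := d₁.not_adj_third n13
      have := d₂.not_adj_third n24
      have := d₃.not_adj_third fun h => n13 h.symm
      have := d₄.not_adj_third fun h => n24 h.symm
      have := d₁.adj₃.ne; have := d₂.adj₃.ne; have := d₃.adj₃.ne; have := d₄.adj₃.ne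
      have := d₁.ne₂; have := d₂.ne₂; have := d₃.ne₂; have := d₄.ne₂
      have := d₁.ne₃; have := d₂.ne₃; have := d₃.ne₃; have := d₄.ne₃
      grind [List.Disjoint]
    have dj := t.disj
    have hwZ : ∀ w ∈ [w₁, w₂, w₃, w₄], w ∉ ({z₁, z₂, z₃, z₄} : Set V) := fun w hw h =>
      dj hw (by simpa using h)
    have hw1 := hwZ w₁ (by simp)
    have hw3 := hwZ w₃ (by simp)
    obtain ⟨hne, hF⟩ := hC.far (Z := {z₁, z₂, z₃, z₄}) (r := z₄) (R := [z₄]) d₂ b12.symm b23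
      (p _ _ _ b34.1 b41.1 (by tauto)) (by simp) (by simp) (by simp; tauto) (by simp)
      (mem_vf.2 ⟨_, b41⟩) d₁.adj₃ d₃.adj₃ (by simp; grind) (hwZ _ (by simp)) (hwZ _ (by simp))
      (hwZ _ (by simp))
    simp only [Set.mem_insert_iff, Set.mem_singleton_iff, not_or] at hw1 hw3
    have hl : Pth G w₁ [z₁, z₂, z₃] w₃ :=
      pth_cons.2 ⟨d₁.adj₃.symm, pth_cons.2 ⟨b12.1, pth_cons.2 ⟨b23.1, pth_nil.2 d₃.adj₃,
        by simp, Ne.symm hw3.2.1⟩, by simp; tauto, Ne.symm hw3.1⟩, by simp; tauto, hne⟩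
    obtain ⟨c, hc, hg, hT, -⟩ := hC.add_edge (Z := {z₁, z₂, z₃, z₄}) (l := [z₁, z₂, z₃])
      (by have := t.s₁; have := t.s₂; have := t.s₃; have := t.s₄; simp; grind)
      (hwZ _ (by simp)) (hwZ _ (by simp)) hl (by simp) (by simp) hF
    obtain ⟨c', hc', hg'⟩ := t.extend hg hT
    exact hC.bad ⟨c', fun u hu => (hc' u hu).trans (hc u hu), hg'⟩

lemma Ctr.pent (hC : Ctr G S φ) (D : Dual G) {x : D.X} (hx : len D x = 5)
    (h : ∀ v ∈ vf D x, Int3 G S v) : False := by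
  obtain ⟨L, hL, -, hlen, hmem, hre⟩ := hC.face_ring D x
  rw [hx] at hlen
  match L, hlen with
  | [z₁, z₂, z₃, z₄, z₅], _ =>
    simp only [← hmem] at h
    have nd := hL.2
    have nd' := nd
    simp only [List.nodup_cons, List.mem_cons, List.not_mem_nil, or_false, not_or] at nd'
    simp only [RE, List.head?_cons, Option.toList_some, List.cons_append, List.nil_append, Lnk,
      or_false] at hre
    have b12 : bd D x z₁ z₂ := by rw [hre]; simp
    have b23 : bd D x z₂ z₃ := by rw [hre]; simp
    have b34 : bd D x z₃ z₄ := by rw [hre]; simp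
    have b45 : bd D x z₄ z₅ := by rw [hre]; simp
    have b51 : bd D x z₅ z₁ := by rw [hre]; simp
    have p : ∀ a b c, G.Adj a b → G.Adj b c → a ≠ c → Pth G a [b] c := fun a b c hab hbc hac =>
      pth_cons.2 ⟨hab, pth_nil.2 hbc, by simp, hac⟩
    have n : ∀ a b c d e, [a, b, c, d, e].Nodup → G.Adj a b → G.Adj b c → G.Adj c d → G.Adj d e →
        G.Adj e a → ¬ G.Adj a c := by
      intro a b c d e hnd h1 h2 h3 h4 h5 hac
      have := hC.sparse a c [b] [e, d] ⟨hac, p _ _ _ h1 h2 hac.ne,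
        pth_cons.2 ⟨h5.symm, p _ _ _ h4.symm h3.symm (by grind), by grind, hac.ne⟩,
        by simp, by simp, by grind [List.Disjoint]⟩
      simp at this
    have n1 := n z₁ z₂ z₃ z₄ z₅ nd b12.1 b23.1 b34.1 b45.1 b51.1
    have n2 := n z₂ z₃ z₄ z₅ z₁ (by simp; tauto) b23.1 b34.1 b45.1 b51.1 b12.1
    have n3 := n z₃ z₄ z₅ z₁ z₂ (by simp; tauto) b34.1 b45.1 b51.1 b12.1 b23.1
    have n4 := n z₄ z₅ z₁ z₂ z₃ (by simp; tauto) b45.1 b51.1 b12.1 b23.1 b34.1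
    have n5 := n z₅ z₁ z₂ z₃ z₄ (by simp; tauto) b51.1 b12.1 b23.1 b34.1 b45.1
    obtain ⟨w₁, d₁⟩ := (h z₁ (by simp)).deg3 b51.1.symm b12.1 (by tauto)
    obtain ⟨w₂, d₂⟩ := (h z₂ (by simp)).deg3 b12.1.symm b23.1 (by tauto)
    obtain ⟨w₃, d₃⟩ := (h z₃ (by simp)).deg3 b23.1.symm b34.1 (by tauto)
    obtain ⟨w₄, d₄⟩ := (h z₄ (by simp)).deg3 b34.1.symm b45.1 (by tauto)
    obtain ⟨w₅, d₅⟩ := (h z₅ (by simp)).deg3 b45.1.symm b51.1 (by tauto)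
    have t : Pent G S z₁ z₂ z₃ z₄ z₅ w₁ w₂ w₃ w₄ w₅ := by
      refine ⟨(h z₁ (by simp)).1, (h z₂ (by simp)).1, (h z₃ (by simp)).1, (h z₄ (by simp)).1,
        (h z₅ (by simp)).1, d₁, d₂, d₃, d₄, d₅, ?_⟩
      have f : ∀ z z' z'' w p q, Deg3 G z z' z'' w → ¬ G.Adj z p → ¬ G.Adj z q →
          w ≠ z ∧ w ≠ z' ∧ w ≠ z'' ∧ w ≠ p ∧ w ≠ q := fun z z' z'' w p q d hp hq =>
        ⟨d.adj₃.ne', d.ne₂.symm, d.ne₃.symm, (d.not_adj_third hp).symm, (d.not_adj_third hq).symm⟩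
      have f1 := f _ _ _ _ _ _ d₁ n1 fun h => n4 h.symm
      have f2 := f _ _ _ _ _ _ d₂ n2 fun h => n5 h.symm
      have f3 := f _ _ _ _ _ _ d₃ n3 fun h => n1 h.symm
      have f4 := f _ _ _ _ _ _ d₄ n4 fun h => n2 h.symm
      have f5 := f _ _ _ _ _ _ d₅ n5 fun h => n3 h.symm
      intro w hw hz
      simp only [List.mem_cons, List.not_mem_nil, or_false] at hw hz
      rcases hw with rfl | rfl | rfl | rfl | rfl <;> tauto
    have dj := t.disj
    have hwZ : ∀ w ∈ [w₁, w₂, w₃, w₄, w₅], w ∉ ({z₁, z₂, z₃, z₄, z₅} : Set V) := fun w hw h =>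
      dj hw (by simpa using h)
    have hw1 := hwZ w₁ (by simp)
    have hw3 := hwZ w₃ (by simp)
    obtain ⟨hne, hF⟩ := hC.far (Z := {z₁, z₂, z₃, z₄, z₅}) (r := z₄) (R := [z₄, z₅]) d₂ b12.symm b23
      (pth_cons.2 ⟨b34.1, p _ _ _ b45.1 b51.1 (by tauto), by simp; tauto, by tauto⟩)
      (by simp) (by simp) (by simp; tauto) (by simp)
      (mem_vf.2 ⟨_, b45⟩) d₁.adj₃ d₃.adj₃ (by simp; grind) hw1 (hwZ _ (by simp)) hw3
    simp only [Set.mem_insert_iff, Set.mem_singleton_iff, not_or] at hw1 hw3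
    have hl : Pth G w₁ [z₁, z₂, z₃] w₃ :=
      pth_cons.2 ⟨d₁.adj₃.symm, pth_cons.2 ⟨b12.1, pth_cons.2 ⟨b23.1, pth_nil.2 d₃.adj₃,
        by simp, Ne.symm hw3.2.1⟩, by simp; tauto, Ne.symm hw3.1⟩, by simp; tauto, hne⟩
    obtain ⟨c, hc, hg, hT, hlk⟩ := hC.add_edge (Z := {z₁, z₂, z₃, z₄, z₅}) (l := [z₁, z₂, z₃])
      (by
        have := t.s₁; have := t.s₂; have := t.s₃; have := t.s₄; have := t.s₅
        simp only [Set.mem_insert_iff, Set.mem_singleton_iff]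
        rintro z (rfl | rfl | rfl | rfl | rfl) <;> assumption)
      (hwZ _ (by simp)) (hwZ _ (by simp)) hl (by simp) (by simp) hF
    obtain ⟨c', hc', hg'⟩ := t.extend hg hT hlk
    exact hC.bad ⟨c', fun u hu => (hc' u hu).trans (hc u hu), hg'⟩

end ZFace

section Ident
open Classical

variable {V : Type} {G H : SimpleGraph V} {S Z : Set V} {φ : V → Bool} {L : List V} {k d : V}

/-- The graph obtained by merging the vertex `d` into `k`. -/
def ident (H : SimpleGraph V) (k d : V) : SimpleGraph V where
  Adj u v := u ≠ v ∧ u ≠ d ∧ v ≠ d ∧ (H.Adj u v ∨ (u = k ∧ H.Adj d v) ∨ (v = k ∧ H.Adj d u))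
  symm := ⟨fun _ _ h => ⟨h.1.symm, h.2.2.1, h.2.1, h.2.2.2.imp (fun h => h.symm) fun h => h.symm⟩⟩
  loopless := ⟨fun _ h => h.1 rfl⟩

lemma ident_of_adj {u v : V} (h : H.Adj u v) (hu : u ≠ d) (hv : v ≠ d) : (ident H k d).Adj u v :=
  ⟨h.ne, hu, hv, .inl h⟩

/-- Every path of `H` from `k` to `d` has at least eight inner vertices. -/
def Apart (H : SimpleGraph V) (k d : V) : Prop :=
  k ≠ d ∧ ∀ Q, Pth H k Q d → 8 ≤ Q.length

lemma Apart.symm (h : Apart H k d) : Apart H d k :=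
  ⟨h.1.symm, fun Q hQ => by simpa using h.2 _ hQ.symm⟩

lemma Apart.not_adj (h : Apart H k d) : ¬ H.Adj k d := fun hk => by
  have := h.2 [] (pth_nil.2 hk)
  simp at this

lemma Apart.not_common (h : Apart H k d) {x : V} (h1 : H.Adj k x) (h2 : H.Adj d x) : False := by
  have := h.2 [x] (pth_cons.2 ⟨h1, pth_nil.2 h2.symm, by simp, h.1⟩)
  simp at this

lemma Ring.of_ident (hF : Apart H k d) (hL : Ring (ident H k d) L) (h3 : 3 ≤ L.length)
    (h8 : L.length ≤ 8) : (∀ p q, RE L p q → H.Adj p q) ∨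
      (∀ p q, RE L p q → H.Adj (Equiv.swap k d p) (Equiv.swap k d q)) := by
  have hd : ∀ p q, RE L p q → p ≠ d ∧ q ≠ d := fun p q h => ⟨(hL.adj h).2.1, (hL.adj h).2.2.1⟩
  by_cases hk : k ∈ L
  · obtain ⟨M, h1, h2, -, h4⟩ := hL.start hk
    obtain ⟨m, N, m', rfl⟩ : ∃ m N m', M = m :: (N ++ [m']) := by
      cases M with
      | nil => simp at h2; omega
      | cons m M =>
        rcases List.eq_nil_or_concat' M with rfl | ⟨N, m', rfl⟩
        · simp at h2; omega
        · exact ⟨m, N, m', rfl⟩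
    have hRE : ∀ p q, RE L p q ↔ (p = k ∧ q = m) ∨ (p = m ∧ q = k) ∨
        Lnk (m :: (N ++ [m'])) p q ∨ (p = m' ∧ q = k) ∨ (p = k ∧ q = m') := by
      intro p q
      rw [← h4, ← List.cons_append, re_cons_concat]
      simp only [List.cons_append, Lnk]
      tauto
    have hnd := h1.2
    have hkM : k ∉ m :: (N ++ [m']) := (List.nodup_cons.1 hnd).1
    have hmm : ∀ p q, Lnk (m :: (N ++ [m'])) p q → H.Adj p q := by
      intro p q h
      have hp : p ≠ k := fun e => hkM (e ▸ h.mem.1)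
      have hq : q ≠ k := fun e => hkM (e ▸ h.mem.2)
      have := (hL.adj ((hRE p q).2 (by tauto))).2.2.2
      tauto
    have hne : ∀ p ∈ m :: (N ++ [m']), p ≠ k ∧ p ≠ d := by
      intro p hp
      refine ⟨fun e => hkM (e ▸ hp), fun e => ?_⟩
      obtain ⟨a, ha⟩ : ∃ a, RE L p a := by
        obtain ⟨a, b, -, ha⟩ := re_two hnd (by simp) (List.mem_cons_of_mem k hp)
        exact ⟨a, (h4 _ _).1 ((ha a).2 (.inl rfl))⟩
      exact (hd p a ha).1 e
    have hm : H.Adj k m ∨ H.Adj d m := by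
      have := (hL.adj ((hRE k m).2 (by tauto))).2.2.2
      have := (hne m (by simp)).1
      tauto
    have hm' : H.Adj k m' ∨ H.Adj d m' := by
      have := (hL.adj ((hRE k m').2 (by tauto))).2.2.2
      have := (hne m' (by simp)).1
      tauto
    have hP : ∀ {a b}, a ≠ b → (∀ p ∈ m :: (N ++ [m']), p ≠ a ∧ p ≠ b) → H.Adj a m → H.Adj b m' →
        Pth H a (m :: (N ++ [m'])) b := by
      intro a b hab h ha hb
      rw [pth_cons, pth_concat]
      have hnd' := (List.nodup_cons.1 hnd).2
      refine ⟨ha, ⟨⟨isChain_of_lnk fun p q => hmm p q, hnd'⟩, hb.symm, ?_, ?_⟩, ?_, hab⟩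
      · exact (h m (by simp)).2
      · exact fun h' => (h b (by simp [h'])).2 rfl
      · exact fun h' => (h a (List.mem_cons_of_mem _ h')).1 rfl
    simp only [List.length_cons, List.length_append, List.length_nil] at h2
    rcases hm with hm | hm <;> rcases hm' with hm' | hm'
    · left
      intro p q h
      rcases (hRE p q).1 h with ⟨rfl, rfl⟩ | ⟨rfl, rfl⟩ | h | ⟨rfl, rfl⟩ | ⟨rfl, rfl⟩
      exacts [hm, hm.symm, hmm _ _ h, hm'.symm, hm']
    · have := hF.2 _ (hP hF.1 hne hm hm')
      simp at this
      omega
    · have := hF.symm.2 _ (hP hF.1.symm (fun p hp => (hne p hp).symm) hm hm')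
      simp at this
      omega
    · right
      have hs : ∀ p ∈ m :: (N ++ [m']), Equiv.swap k d p = p := fun p hp =>
        Equiv.swap_apply_of_ne_of_ne (hne p hp).1 (hne p hp).2
      have s1 := hs m (by simp)
      have s2 := hs m' (by simp)
      intro p q h
      rcases (hRE p q).1 h with ⟨rfl, rfl⟩ | ⟨rfl, rfl⟩ | h | ⟨rfl, rfl⟩ | ⟨rfl, rfl⟩
      · rwa [s1, Equiv.swap_apply_left]
      · rw [s1, Equiv.swap_apply_left]; exact hm.symm
      · rw [hs p h.mem.1, hs q h.mem.2]; exact hmm p q h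
      · rw [s2, Equiv.swap_apply_left]; exact hm'.symm
      · rwa [s2, Equiv.swap_apply_left]
  · left
    intro p q h
    have hp : p ≠ k := fun e => hk (e ▸ h.mem.1)
    have hq : q ≠ k := fun e => hk (e ▸ h.mem.2)
    have := (hL.adj h).2.2.2
    tauto

lemma Pth.of_ident {u v : V} {A : List V} (hF : Apart H k d) (huv : (ident H k d).Adj u v)
    (hA : Pth (ident H k d) u A v) (h1 : A ≠ []) (h8 : A.length ≤ 6) :
    (H.Adj u v ∧ Pth H u A v) ∨ (H.Adj (Equiv.swap k d u) (Equiv.swap k d v) ∧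
      Pth H (Equiv.swap k d u) (A.map (Equiv.swap k d)) (Equiv.swap k d v)) := by
  have lA := List.length_pos_iff.2 h1
  have key : ∀ f : V → V, Function.Injective f →
      (∀ p q, RE (u :: (A ++ [v])) p q → H.Adj (f p) (f q)) →
      H.Adj (f u) (f v) ∧ Pth H (f u) (A.map f) (f v) := by
    intro f hf h
    have r : Ring (H.comap f) (u :: (A ++ [v])) := ring_iff.2 ⟨h, hA.2⟩
    obtain ⟨h1, h2⟩ := ring_cons_concat.1 r
    exact ⟨h2, h1.map hf fun _ _ _ _ h => h⟩
  rcases Ring.of_ident hF (hA.ring huv) (by simp; omega) (by simp; omega) with h | h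
  · exact .inl (by simpa using key id Function.injective_id h)
  · exact .inr (key _ (Equiv.injective _) h)

lemma swap_clash (hF : Apart H k d) {u v : V} (h1 : H.Adj u v) (hu : u ≠ d) (hv : v ≠ d)
    (h2 : H.Adj (Equiv.swap k d u) (Equiv.swap k d v)) : u ≠ k ∧ v ≠ k := by
  constructor
  · rintro rfl
    rw [Equiv.swap_apply_left, Equiv.swap_apply_of_ne_of_ne h1.ne' hv] at h2
    exact hF.not_common h1 h2
  · rintro rfl
    rw [Equiv.swap_apply_left, Equiv.swap_apply_of_ne_of_ne h1.ne hu] at h2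
    exact hF.not_common h1.symm h2.symm

lemma Sparse.ident (hH : Sparse H) (hF : Apart H k d) : Sparse (ident H k d) := by
  intro u v A B ⟨huv, hA, hB, hA0, hB0, hdis⟩
  by_contra hbad
  have lA := List.length_pos_iff.2 hA0
  have lB := List.length_pos_iff.2 hB0
  have hnot : ∀ p ∈ u :: (A ++ [v]), p ∈ u :: (B ++ [v]) → p = u ∨ p = v := by
    intro p h1 h2
    have := @hdis p
    simp at h1 h2
    tauto
  have hfix : ∀ C : List V, Pth (IFPaper.ident H k d) u C v → k ∉ u :: (C ++ [v]) →
      ∀ p ∈ u :: (C ++ [v]), Equiv.swap k d p = p := by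
    intro C hC hk p hp
    refine Equiv.swap_apply_of_ne_of_ne (fun e => hk (e ▸ hp)) ?_
    have e : p ∈ u :: (C ++ [v]) := hp
    obtain ⟨a, ha⟩ : ∃ a, RE (u :: (C ++ [v])) p a := by
      have h1 : C ≠ [] ∨ C = [] := by tauto
      by_cases hc : C = []
      · subst hc
        simp only [List.nil_append, List.mem_cons, List.not_mem_nil, or_false] at hp
        rcases hp with rfl | rfl
        · exact ⟨v, re_cons_concat.2 (.inr (.inr ⟨rfl, rfl⟩))⟩
        · exact ⟨u, re_cons_concat.2 (.inr (.inl ⟨rfl, rfl⟩))⟩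
      · obtain ⟨a, b, -, ha⟩ := re_two hC.2 (by
          have := List.length_pos_iff.2 hc
          simp; omega) hp
        exact ⟨a, (ha a).2 (.inl rfl)⟩
    exact ((hC.ring huv).adj ha).2.1
  have hmapfix : ∀ C : List V, Pth (IFPaper.ident H k d) u C v → k ∉ u :: (C ++ [v]) →
      Equiv.swap k d u = u ∧ Equiv.swap k d v = v ∧ C.map (Equiv.swap k d) = C := by
    intro C hC hk
    have := hfix C hC hk
    refine ⟨this u (by simp), this v (by simp), ?_⟩
    conv_rhs => rw [← List.map_id C]
    exact List.map_congr_left fun p hp => this p (by simp [hp])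
  have hok : ∀ h : (H.Adj u v ∧ Pth H u A v ∧ Pth H u B v) ∨
      (H.Adj (Equiv.swap k d u) (Equiv.swap k d v) ∧
      Pth H (Equiv.swap k d u) (A.map (Equiv.swap k d)) (Equiv.swap k d v) ∧
      Pth H (Equiv.swap k d u) (B.map (Equiv.swap k d)) (Equiv.swap k d v)), False := by
    rintro (⟨h1, h2, h3⟩ | ⟨h1, h2, h3⟩)
    · exact hbad (hH _ _ _ _ ⟨h1, h2, h3, hA0, hB0, hdis⟩)
    · have := hH _ _ _ _ (⟨h1, h2, h3, by simpa using hA0, by simpa using hB0,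
        List.disjoint_map (Equiv.injective _) hdis⟩ : Theta H _ _ _ _)
      rw [List.length_map, List.length_map] at this
      exact hbad this
  have hmix : ∀ C D : List V, Pth (IFPaper.ident H k d) u C v → Pth (IFPaper.ident H k d) u D v →
      (∀ p ∈ u :: (C ++ [v]), p ∈ u :: (D ++ [v]) → p = u ∨ p = v) →
      H.Adj u v → Pth H u C v → H.Adj (Equiv.swap k d u) (Equiv.swap k d v) →
      Pth H (Equiv.swap k d u) (D.map (Equiv.swap k d)) (Equiv.swap k d v) →
      Pth H u D v ∨ Pth H (Equiv.swap k d u) (C.map (Equiv.swap k d)) (Equiv.swap k d v) := by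
    intro C D hC hD hCD h1 h2 h3 h4
    by_cases hk : k ∈ u :: (C ++ [v])
    · by_cases hk' : k ∈ u :: (D ++ [v])
      · have := swap_clash hF h1 huv.2.1 huv.2.2.1 h3
        rcases hCD k hk hk' with rfl | rfl <;> tauto
      · obtain ⟨e1, e2, e3⟩ := hmapfix D hD hk'
        rw [e1, e2, e3] at h4
        exact .inl h4
    · obtain ⟨e1, e2, e3⟩ := hmapfix C hC hk
      rw [e1, e2, e3]
      exact .inr h2
  rcases Pth.of_ident hF huv hA hA0 (by omega) with ⟨a1, a2⟩ | ⟨a1, a2⟩ <;>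
    rcases Pth.of_ident hF huv hB hB0 (by omega) with ⟨b1, b2⟩ | ⟨b1, b2⟩
  · exact hok (.inl ⟨a1, a2, b2⟩)
  · rcases hmix A B hA hB hnot a1 a2 b1 b2 with h | h
    · exact hok (.inl ⟨a1, a2, h⟩)
    · exact hok (.inr ⟨b1, h, b2⟩)
  · rcases hmix B A hB hA (fun p h1 h2 => hnot p h2 h1) b1 b2 a1 a2 with h | h
    · exact hok (.inl ⟨b1, h, b2⟩)
    · exact hok (.inr ⟨a1, a2, h⟩)
  · exact hok (.inr ⟨a1, a2, b2⟩)

lemma LongEdge.ident {p q : V} (h : LongEdge H p q) (hF : Apart H k d) (hp : p ≠ d) (hq : q ≠ d) :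
    LongEdge (ident H k d) p q := by
  refine ⟨ident_of_adj h.1 hp hq, fun A hA => ?_⟩
  by_contra hn
  rcases Pth.of_ident hF (ident_of_adj h.1 hp hq) hA (by rintro rfl; simp at hn) (by omega)
    with ⟨-, h2⟩ | ⟨h1, h2⟩
  · exact hn (h.2 A h2)
  · have := swap_clash hF h.1 hp hq h1
    rw [Equiv.swap_apply_of_ne_of_ne this.1 hp, Equiv.swap_apply_of_ne_of_ne this.2 hq] at h2
    have := h.2 _ h2
    rw [List.length_map] at this
    exact hn this

variable [Fintype V]

/-- Undoing an identification. -/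
lemma Good.of_ident {c : V → Bool} (hF : Apart H k d) (hd : d ∉ S)
    (hk : k ∈ S → ∀ s ∈ S, ¬ H.Adj d s) (h : Good (ident H k d) S c) (hc : c d = c k) :
    Good H S c ∧ ¬ Linked H S c k d := by
  obtain ⟨f, hf⟩ : ∃ f : V → V, f = fun x => if x = d then k else x := ⟨_, rfl⟩
  have fd : f d = k := by simp [hf]
  have fx : ∀ x, x ≠ d → f x = x := fun x hx => by simp [hf, hx]
  have hcf : ∀ x, c (f x) = c x := fun x => by
    by_cases hx : x = d
    · rw [hx, fd, hc]
    · rw [fx x hx]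
  have hadj : ∀ u v, H.Adj u v → (ident H k d).Adj (f u) (f v) := by
    intro u v huv
    by_cases hu : u = d
    · subst hu
      rw [fd, fx v huv.ne']
      have hkv : k ≠ v := by
        rintro rfl
        exact hF.not_adj huv.symm
      exact ⟨hkv, hF.1, huv.ne', .inr (.inl ⟨rfl, huv⟩)⟩
    · by_cases hv : v = d
      · subst hv
        rw [fd, fx u hu]
        have hku : u ≠ k := by
          rintro rfl
          exact hF.not_adj huv
        exact ⟨hku, hu, hF.1, .inr (.inr ⟨rfl, huv.symm⟩)⟩
      · rw [fx u hu, fx v hv]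
        exact ident_of_adj huv hu hv
  have hSf : ∀ u v, H.Adj u v → f u ∈ S → f v ∈ S → u ∈ S ∧ v ∈ S := by
    intro u v huv h1 h2
    by_cases hu : u = d
    · subst hu
      rw [fd] at h1
      rw [fx v huv.ne'] at h2
      exact absurd huv (hk h1 v h2)
    · by_cases hv : v = d
      · subst hv
        rw [fd] at h2
        rw [fx u hu] at h1
        exact absurd huv.symm (hk h2 u h1)
      · rw [fx u hu] at h1
        rw [fx v hv] at h2
        exact ⟨h1, h2⟩
  have hmap : ∀ e ∈ fedges H S c, Sym2.map f e ∈ fedges (ident H k d) S c := by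
    intro e
    induction e with | _ u v
    simp only [Sym2.map_mk, mk_mem_fedges, hcf]
    exact fun ⟨h1, h2, h3⟩ => ⟨hadj u v h1, h2, fun h => h3 (hSf u v h1 h.1 h.2)⟩
  have hinj1 : ∀ u v u' v', H.Adj u v → H.Adj u' v' → f u = f u' → f v = f v' → u = u' ∧ v = v' := by
    intro u v u' v' h1 h2 e1 e2
    have hh : ∀ x x', f x = f x' → x = x' ∨ (x = k ∧ x' = d) ∨ (x = d ∧ x' = k) := by
      intro x x' e
      simp only [hf] at e
      split_ifs at e <;> grind
    have n1 := hF.not_adj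
    have n2 : ¬ H.Adj d k := fun h => n1 h.symm
    rcases hh u u' e1 with rfl | ⟨rfl, rfl⟩ | ⟨rfl, rfl⟩ <;>
      rcases hh v v' e2 with rfl | ⟨rfl, rfl⟩ | ⟨rfl, rfl⟩
    · exact ⟨rfl, rfl⟩
    · exact (hF.not_common h1.symm h2.symm).elim
    · exact (hF.not_common h2.symm h1.symm).elim
    · exact (hF.not_common h1 h2).elim
    · exact absurd h1 (H.loopless.irrefl _)
    · exact absurd h1 n1
    · exact (hF.not_common h2 h1).elim
    · exact absurd h2 n1
    · exact absurd h1 (H.loopless.irrefl _)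
  have hinj : ∀ e ∈ fedges H S c, ∀ e' ∈ fedges H S c, Sym2.map f e = Sym2.map f e' → e = e' := by
    intro e he e' he' hee
    induction e with | _ u v
    induction e' with | _ u' v'
    rw [mk_mem_fedges] at he he'
    simp only [Sym2.map_mk, Sym2.eq_iff] at hee ⊢
    rcases hee with ⟨e1, e2⟩ | ⟨e1, e2⟩
    · exact .inl (hinj1 _ _ _ _ he.1 he'.1 e1 e2)
    · exact .inr (hinj1 _ _ _ _ he.1 he'.1.symm e1 e2)
  obtain ⟨g, hg⟩ : ∃ g : Option V → Option V, g = fun y => y.bind fun z => contract S (f z) :=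
    ⟨_, rfl⟩
  have hr : ∀ x, contract S (f x) = g (contract S x) := by
    intro x
    subst hg
    by_cases hx : x ∈ S
    · rw [contract_of_mem hx, fx x (fun e => hd (e ▸ hx)), contract_of_mem hx]
      rfl
    · rw [contract_of_notMem hx]
      rfl
  refine ⟨⟨fun u v huv h1 h2 => ?_, h.2.pullback hmap hinj hr⟩,
    h.2.not_tight_of_identified hmap hinj hr ?_ ?_⟩
  · obtain ⟨h3, h4⟩ := h.1 _ _ (hadj u v huv) (by rw [hcf, h1]) (by rw [hcf, h2])
    exact hSf u v huv h3 h4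
  · rw [Ne, contract_eq_contract hd]
    exact hF.1
  · rw [← hr, ← hr, fd, fx k hF.1]

omit [Fintype V] in
lemma Apart.not_mem (hF : Apart (del G Z) k d) (hS : Adm G S) (hZS : ∀ z ∈ Z, z ∉ S) :
    ¬ (k ∈ S ∧ d ∈ S) ∧ (k ∈ S → d ∉ S → ∀ s ∈ S, ¬ (del G Z).Adj d s) := by
  rcases hS with ⟨z, rfl⟩ | ⟨L, hL, hS⟩
  · refine ⟨fun h => hF.1 (h.1.trans h.2.symm), ?_⟩
    rintro rfl - s rfl h
    exact hF.not_adj h.symm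
  have hlen : L.length ≤ 12 := by have := hL.2.2; omega
  have hin : ∀ y, y ∈ L → y ∉ Z := fun y hy h => hZS y h (by simpa [hS] using hy)
  have key : ∀ s ∈ L, k ∈ L → k ≠ s → ∃ A, Pth (del G Z) k A s ∧ A.length ≤ 5 ∧ ∀ y ∈ A, y ∈ L := by
    intro s hs hk hks
    obtain ⟨A, B, hA, hB, -, hl, hmem, -⟩ := hL.1.arcs hk hs hks
    have hA' : Pth (del G Z) k A s := hA.imp fun p hp q hq h => by
      refine ⟨h, hin _ ((hmem p).2 ?_), hin _ ((hmem q).2 ?_)⟩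
      · simp at hp; tauto
      · simp at hq; tauto
    have hB' : Pth (del G Z) k B.reverse s := hB.symm.imp fun p hp q hq h => by
      refine ⟨h, hin _ ((hmem p).2 ?_), hin _ ((hmem q).2 ?_)⟩
      · simp at hp; tauto
      · simp at hq; tauto
    by_cases h : A.length ≤ 5
    · exact ⟨A, hA', h, fun y hy => (hmem y).2 (by tauto)⟩
    · exact ⟨_, hB', by simp; omega, fun y hy => (hmem y).2 (by simp at hy; tauto)⟩
  subst hS
  refine ⟨fun h => ?_, fun hk hd s hs hds => ?_⟩
  · obtain ⟨A, hA, h5, -⟩ := key d h.2 h.1 hF.1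
    have := hF.2 A hA
    omega
  · by_cases hks : k = s
    · subst hks
      exact hF.not_adj hds.symm
    · obtain ⟨A, hA, h5, hm⟩ := key s hs hk hks
      have := hF.2 _ (pth_concat.2 ⟨hA, hds.symm, hF.1, fun h => hd (hm d h)⟩)
      simp at this
      omega

lemma Ctr.ident_aux (hC : Ctr G S φ) (hZS : ∀ z ∈ Z, z ∉ S) (ha : k ∉ Z) (hb : d ∉ Z) {l : List V}
    (hl : Pth G k l d) (hl0 : l ≠ []) (hlZ : ∀ z ∈ l, z ∈ Z) (hF : Apart (del G Z) k d)
    (hd : d ∉ S) (hk : k ∈ S → ∀ s ∈ S, ¬ (del G Z).Adj d s) :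
    ∃ c, (∀ x ∈ S, c x = φ x) ∧ Good (del G Z) S c ∧ c k = c d ∧ ¬ Linked (del G Z) S c k d := by
  have hle := del_le G Z
  have hSd : ∀ x ∈ S, x ≠ d := fun x hx e => hd (e ▸ hx)
  have hadm : Adm (ident (del G Z) k d) S := by
    rcases hC.adm with h | ⟨L, ⟨hL, h3, h⟩, hS⟩
    · exact .inl h
    · have hSL : ∀ x ∈ L, x ≠ d ∧ x ∉ Z := fun x hx =>
        have hx : x ∈ S := by simpa [hS] using hx
        ⟨hSd x hx, fun h => hZS x h hx⟩
      have hadj : ∀ p q, RE L p q → (del G Z).Adj p q := fun p q hpq =>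
        ⟨hL.adj hpq, (hSL p hpq.mem.1).2, (hSL q hpq.mem.2).2⟩
      refine .inr ⟨L, ⟨ring_iff.2 ⟨fun p q hpq => ident_of_adj (hadj p q hpq)
        (hSL p hpq.mem.1).1 (hSL q hpq.mem.2).1, hL.2⟩, h3, ?_⟩, hS⟩
      exact h.imp_right fun ⟨h, p, q, hpq, hlg⟩ => ⟨h, p, q, hpq,
        (hlg.mono hle (hadj p q hpq)).ident hF (hSL p hpq.mem.1).1 (hSL q hpq.mem.2).1⟩
  have hsp : Sparse (ident (del G Z) k d) := Sparse.ident (hC.sparse.mono hle) hF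
  have hgrid : GridMinor (ident (del G Z) k d) := by
    refine hC.grid.minor _ (fun v => if v ∈ Z ∨ v = d then ∅ else
      if v = k then (k :: (l ++ [d])).toFinset else {v}) ?_ ?_ ?_
    · have key : ∀ u w, w ∈ (if u ∈ Z ∨ u = d then ∅ else if u = k then
          (k :: (l ++ [d])).toFinset else {u}) → u = (if w ∈ Z ∨ w = d then k else w) := by
        intro u w h
        split_ifs at h with h1 h2
        · simp at h
        · subst h2
          simp only [List.toFinset_cons, List.toFinset_append, Finset.mem_insert,
            Finset.mem_union, List.mem_toFinset, List.toFinset_nil, Finset.notMem_empty,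
            or_false] at h
          rcases h with rfl | h | rfl
          · simp
          · simp [hlZ w h]
          · simp
        · simp only [Finset.mem_singleton] at h
          subst h
          simp [h1]
      intro u v w hu hv
      exact (key u w hu).trans (key v w hv).symm
    · intro v
      by_cases h1 : v ∈ Z ∨ v = d
      · simp [h1, Conn]
      · by_cases h2 : v = k
        · subst h2
          simp only [h1, if_false, if_true]
          exact conn_toFinset (fun _ _ h => h.symm) hl.1
        · simp only [h1, h2, if_false]
          intro p hp q hq
          simp only [Finset.mem_singleton] at hp hq
          subst hp hq
          exact .refl
    · have hin : ∀ v, v ∉ Z → v ≠ d → v ∈ (if v ∈ Z ∨ v = d then ∅ else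
          if v = k then (k :: (l ++ [d])).toFinset else {v}) := by
        intro v hv hv'
        by_cases h : v = k <;> simp [hv, hv', h]
        simp [← h, hv, hv']
      rintro u v ⟨-, hu, hv, h | ⟨rfl, h⟩ | ⟨rfl, h⟩⟩
      · exact ⟨u, hin u h.2.1 hu, v, hin v h.2.2 hv, h.1⟩
      · exact ⟨d, by simp [ha, hu], v, hin v h.2.2 hv, h.1⟩
      · exact ⟨u, hin u h.2.2 hu, d, by simp [ha, hv], h.1.symm⟩
  have hcard : (ident (del G Z) k d).edgeSet.ncard < G.edgeSet.ncard := by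
    obtain ⟨p, l', rfl⟩ := List.exists_cons_of_ne_nil hl0
    have hp := (pth_cons.1 hl).1
    refine lt_of_le_of_lt ?_ (ncard_edgeSet_lt hle hp fun h => h.2.2 (hlZ p (by simp)))
    have : (ident (del G Z) k d).edgeSet ⊆
        Sym2.map (fun x => if x = d then k else x) '' (del G Z).edgeSet := by
      intro e
      induction e with | _ u v
      rintro ⟨-, hu, hv, h | ⟨rfl, h⟩ | ⟨rfl, h⟩⟩
      · exact ⟨s(u, v), h, by simp [hu, hv]⟩
      · exact ⟨s(d, v), h, by simp [hv]⟩
      · exact ⟨s(u, d), h.symm, by simp [hu]⟩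
    exact (Set.ncard_le_ncard this (Set.toFinite _)).trans (Set.ncard_image_le (Set.toFinite _))
  obtain ⟨c, hc, hg⟩ := hC.ih _ S hgrid hsp hadm hcard φ
  have hg' : Good (ident (del G Z) k d) S (fun x => if x = d then c k else c x) :=
    hg.of_le_of_eq (fun u v h _ => h) fun u v h _ => by simp [h.2.1]
  have := Good.of_ident hF hd hk hg' (by simp)
  refine ⟨_, fun x hx => ?_, this.1, by simp, this.2⟩
  simp [hSd x hx, hc x hx]

lemma Ctr.ident (hC : Ctr G S φ) (hZS : ∀ z ∈ Z, z ∉ S) (ha : k ∉ Z) (hb : d ∉ Z) {l : List V}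
    (hl : Pth G k l d) (hl0 : l ≠ []) (hlZ : ∀ z ∈ l, z ∈ Z) (hF : Apart (del G Z) k d) :
    ∃ c, (∀ x ∈ S, c x = φ x) ∧ Good (del G Z) S c ∧ c k = c d ∧ ¬ Linked (del G Z) S c k d := by
  have h1 := hF.not_mem hC.adm hZS
  have h2 := hF.symm.not_mem hC.adm hZS
  by_cases hd : d ∈ S
  · have hk : k ∉ S := fun hk => h1.1 ⟨hk, hd⟩
    obtain ⟨c, a1, a2, a3, a4⟩ := hC.ident_aux hZS hb ha hl.symm (by simpa using hl0)
      (by simpa using hlZ) hF.symm hk fun hd => h2.2 hd hk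
    exact ⟨c, a1, a2, a3.symm, fun h => a4 h.symm⟩
  · exact hC.ident_aux hZS ha hb hl hl0 hlZ hF hd fun hk => h1.2 hk hd

end Ident

section Red
open Classical

variable {V : Type} {G : SimpleGraph V} {S Z : Set V} {φ : V → Bool}

lemma isChain_del_notMem {l : List V} (hc : l.IsChain (del G Z).Adj) (h2 : 2 ≤ l.length) :
    ∀ y ∈ l, y ∉ Z := by
  intro y hy
  induction l with
  | nil => simp at hy
  | cons p l ih =>
    cases l with
    | nil => simp at h2
    | cons q l =>
      rw [List.isChain_cons_cons] at hc
      rcases List.mem_cons.1 hy with rfl | hy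
      · exact hc.1.2.1
      · cases l with
        | nil => simp only [List.mem_singleton] at hy; exact hy ▸ hc.1.2.2
        | cons s l => exact ih hc.2 (by simp) hy

variable [Fintype V]

/-- A face has no four consecutive internal vertices of degree three such that the edge between
the first two lies on a triangle. -/
lemma Ctr.no_run (hC : Ctr G S φ) (D : Dual G) {f : D.X} {v₀ v₁ v₂ v₃ v₄ x q y z : V}
    (s₁ : v₁ ∉ S) (s₂ : v₂ ∉ S) (s₃ : v₃ ∉ S) (s₄ : v₄ ∉ S) (d₁ : Deg3 G v₁ v₀ v₂ x)
    (d₂ : Deg3 G v₂ v₁ v₃ x) (d₃ : Deg3 G v₃ v₂ v₄ q) (d₄ : Deg3 G v₄ v₃ y z)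
    (h₁ : bd D f v₂ v₁) (h₂ : bd D f v₂ v₃) (h₃ : bd D f v₃ v₄) : False := by
  have hT := fun A => hC.sparse.triangle (A := A) d₂.adj₁.symm d₁.adj₃ d₂.adj₃
  have hT' := fun A => hC.sparse.triangle (A := A) d₂.adj₃ d₂.adj₁ d₁.adj₃.symm
  have hT'' := fun A => hC.sparse.triangle (A := A) d₁.adj₃ d₁.adj₂ d₂.adj₃.symm
  have e12 := d₂.adj₁.ne
  have e23 := d₂.adj₂.ne
  have e34 := d₃.adj₂.ne
  have e2x := d₂.adj₃.ne
  have e3q := d₃.adj₃.ne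
  have e01 := d₁.adj₁.ne
  have e1x := d₁.adj₃.ne
  have e13 := d₂.ne₁
  have ex3 := d₂.ne₃
  have e24 := d₃.ne₁
  have n31 : ¬ G.Adj v₃ v₁ := fun h => by
    rcases hT [v₃] (pth_cons.2 ⟨h.symm, pth_nil.2 d₂.adj₂.symm, by simp, e12.symm⟩)
      with h | h | h <;> simp_all
  have nx3 : ¬ G.Adj x v₃ := fun h => by
    rcases hT' [v₃] (pth_cons.2 ⟨d₂.adj₂, pth_nil.2 h.symm, by simp, e2x⟩)
      with h | h | h <;> simp_all
  have e14 : v₁ ≠ v₄ := fun h => n31 (h ▸ d₃.adj₂)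
  have ex4 : x ≠ v₄ := fun h => nx3 (h ▸ d₃.adj₂.symm)
  have exq : x ≠ q := fun h => nx3 (h ▸ d₃.adj₃.symm)
  have eq1 : q ≠ v₁ := fun h => n31 (h ▸ d₃.adj₃)
  have ev0 : v₀ ≠ v₂ := d₁.ne₁
  have e0x : v₀ ≠ x := d₁.ne₂
  have eq2 : v₂ ≠ q := d₃.ne₂
  have eq4 : v₄ ≠ q := d₃.ne₃
  have e03 : v₀ ≠ v₃ := fun h => n31 (h ▸ d₁.adj₁.symm)
  have n03 : ¬ G.Adj v₀ v₃ := fun h => by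
    rcases hT [v₀, v₃] (pth_cons.2 ⟨d₁.adj₁, pth_cons.2 ⟨h, pth_nil.2 d₂.adj₂.symm, by simp,
      ev0⟩, by simp [e13], e12.symm⟩) with h | h | h <;> simp_all
  have e04 : v₀ ≠ v₄ := fun h => n03 (h ▸ d₃.adj₂.symm)
  have e0q : v₀ ≠ q := fun h => n03 (h ▸ d₃.adj₃.symm)
  have hpath : Pth G v₀ [v₁, v₂, v₃] q := by
    refine ⟨by simp [d₁.adj₁.symm, d₂.adj₁.symm, d₂.adj₂, d₃.adj₃], ?_⟩
    simp only [List.cons_append, List.nil_append, List.nodup_cons, List.mem_cons, List.not_mem_nil,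
      or_false, not_or, List.nodup_nil, and_true, not_false_eq_true]
    exact ⟨⟨e01.symm, ev0, e03, e0q⟩, ⟨e12.symm, e13, eq1.symm⟩, ⟨e23, eq2⟩, e3q⟩
  have hAp : Apart (del G {v₁, v₂, v₃, v₄}) v₀ q := by
    refine ⟨e0q, fun Q hQ => ?_⟩
    by_contra hlt
    have hQZ := isChain_del_notMem hQ.1 (by simp)
    have hQG := hQ.mono (del_le G _)
    have hv : ∀ v ∈ ({v₁, v₂, v₃, v₄} : Set V), v ∉ Q := fun v hv h => hQZ v (by simp [h]) hv
    have hv1 := hv v₁ (by simp)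
    have hv2 := hv v₂ (by simp)
    have hv3 := hv v₃ (by simp)
    have hv4 := hv v₄ (by simp)
    by_cases hx : x ∈ Q
    · obtain ⟨Q₁, Q₂, rfl⟩ := List.append_of_mem hx
      rw [pth_append] at hQG
      obtain ⟨p1, p2, -⟩ := hQG
      simp only [List.mem_append, List.mem_cons, not_or] at hv1 hv2 hv3
      have t1 := hT'' (v₀ :: Q₁) (pth_cons.2 ⟨d₁.adj₁, p1, by simp [hv1], e1x⟩)
      have t2 := hT' (v₃ :: q :: Q₂.reverse) (pth_cons.2 ⟨d₂.adj₂, pth_cons.2 ⟨d₃.adj₃, p2.symm,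
        by simp [hv3], ex3⟩, by simp [eq2, hv2], e2x⟩)
      simp only [List.cons.injEq, reduceCtorEq, false_or, List.length_cons, List.length_reverse,
        List.length_append] at t1 t2 hlt
      grind
    · have hR : Ring G (v₀ :: (Q ++ [q, v₃, v₂, v₁])) := by
        have : Pth G v₀ (Q ++ [q, v₃, v₂]) v₁ := by
          rw [pth_append]
          refine ⟨hQG, hpath.2 |> fun _ => ?_, ?_, e01.symm, hv1, ?_⟩
          · exact (pth_append (A := []) (x := v₁) (B := [v₂, v₃]).1 hpath).2.1.symm
          · simp [e03, ev0]
          · simp [hv3, hv2]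
        simpa using this.ring d₁.adj₁.symm
      have hl : LongEdge G v₂ v₁ := hC.sparse.longEdge_of_triangle d₂.adj₁ d₂.adj₃ d₁.adj₃
      have hre : RE (v₀ :: (Q ++ [q, v₃, v₂, v₁])) v₂ v₁ := by
        have e : v₀ :: (Q ++ [q, v₃, v₂, v₁]) = v₀ :: ((Q ++ [q, v₃, v₂]) ++ [v₁]) := by simp
        rw [e, re_cons_concat]
        left
        have e : v₀ :: ((Q ++ [q, v₃, v₂]) ++ [v₁]) = (v₀ :: (Q ++ [q, v₃])) ++ v₂ :: [v₁] := by simp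
        rw [e, lnk_append]
        right
        simp [Lnk]
      have hA : AdmRing G (v₀ :: (Q ++ [q, v₃, v₂, v₁])) :=
        ⟨hR, by simp, .inr ⟨by simp; omega, v₂, v₁, hre, hl⟩⟩
      obtain ⟨T, hTT⟩ := D.ring hA.1 hA.2.1
      obtain ⟨g, hg1, hgx⟩ := hC.corner D d₂.swap.rot
      have hfg : f ≠ g := by
        rintro rfl
        have := hC.bd_not_three D h₁ h₂ hgx
        tauto
      refine (re_iff_ne hTT h₁ hg1 hfg).1 hre (hC.cross D hA hTT (p := v₄) (p' := x) ?_ ?_ ?_ ?_)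
      · simp only [List.mem_cons, List.mem_append, List.not_mem_nil, or_false]
        grind
      · exact mem_vf.2 ⟨v₃, h₃.symm⟩
      · simp only [List.mem_cons, List.mem_append, List.not_mem_nil, or_false]
        grind
      · exact mem_vf.2 ⟨v₂, hgx.symm⟩
  obtain ⟨c, c1, c2, c3, c4⟩ := hC.ident (Z := {v₁, v₂, v₃, v₄}) (by
      rintro z (rfl | rfl | rfl | rfl) <;> assumption) (k := v₀) (d := q)
    (by simp; grind) (by simp; grind) hpath (by simp) (by simp) hAp
  have tp : TriPath G S v₀ v₁ v₂ v₃ v₄ x q y z := by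
    refine ⟨s₁, s₂, s₃, s₄, d₁, d₂, d₃, d₄, ?_, ?_⟩
    · simp; grind
    · simp; grind
  obtain ⟨c', g1, g2⟩ := tp.extend c2 c3 fun _ => c4
  exact hC.bad ⟨c', fun u hu => (g1 u hu).trans (c1 u hu), g2⟩

end Red

section Adj
open Classical

variable {V : Type} {G : SimpleGraph V} {S : Set V} {φ : V → Bool}

lemma not_three {α : Type} {p q a b c : α} (ha : a = p ∨ a = q) (hb : b = p ∨ b = q)
    (hc : c = p ∨ c = q) (hab : a ≠ b) (hac : a ≠ c) (hbc : b ≠ c) : False := by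
  rcases ha with rfl | rfl <;> rcases hb with rfl | rfl <;> rcases hc with rfl | rfl <;>
    contradiction

/-- `u` has at least three neighbours. -/
def Thick (G : SimpleGraph V) (u : V) : Prop := ∀ p q, ∃ d, G.Adj u d ∧ d ≠ p ∧ d ≠ q

lemma Sparse.no_theta (h : Sparse G) {u v : V} {A B : List V} (huv : G.Adj u v)
    (hA : (u :: (A ++ [v])).IsChain G.Adj) (hB : (u :: (B ++ [v])).IsChain G.Adj)
    (hn : (u :: v :: (A ++ B)).Nodup) (hA0 : A ≠ []) (hB0 : B ≠ []) :
    ¬ (A.length = 1 ∧ B.length ≤ 6) ∧ ¬ (A.length = 2 ∧ B.length ≤ 4) ∧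
      ¬ (A.length = 3 ∧ B.length = 3) := by
  simp only [List.nodup_cons, List.mem_cons, List.mem_append, not_or, List.nodup_append'] at hn
  obtain ⟨⟨h1, h2, h3⟩, ⟨h4, h5⟩, h6, h7, h8⟩ := hn
  refine h u v A B ⟨huv, ⟨hA, ?_⟩, ⟨hB, ?_⟩, hA0, hB0, h8⟩ <;>
    simp [List.nodup_append', h1, h2, h3, h4, h5, h6, h7]

variable [Fintype V]

lemma Ctr.thick (hC : Ctr G S φ) {v w : V} (hv : v ∉ S) (hvw : G.Adj v w) : Thick G v :=
  hC.three hv hvw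

lemma Ctr.eq_of_bd (hC : Ctr G S φ) (D : Dual G) {x y : D.X} {u v p : V} (hxy : x ≠ y)
    (hu : Thick G u) (h1 : bd D x u v) (h2 : bd D y u v) (h3 : bd D x u p) (h4 : bd D y u p) :
    p = v := by
  by_contra h
  obtain ⟨d, hd, h5, h6⟩ := hu v p
  rcases hC.share D (Ne.symm h) h1 h2 h3 h4 hxy hd with rfl | rfl <;> tauto

lemma Ctr.tri_other (hC : Ctr G S φ) (D : Dual G) {x y : D.X} {u v : V} (hxy : x ≠ y)
    (h1 : bd D x u v) (h2 : bd D y u v) (hx : len D x = 3) : 9 ≤ len D y := by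
  obtain ⟨M, hM, hMl, -, -, hMb⟩ := hC.face_open D h1
  obtain ⟨N, hN, hNl, hN1, -, hNb⟩ := hC.face_open D h2
  match M, (by omega : M.length = 1) with
  | [w], _ =>
    rw [pth_cons, pth_nil] at hM
    rcases hC.sparse.triangle h1.1 hM.1 hM.2.1.symm hN with rfl | rfl | h
    · simp at hN1
    · exact (hC.bd_ne D hxy fun a b h => (hNb a b).2 ((hMb a b).1 h)).elim
    · omega

lemma Ctr.quad_other (hC : Ctr G S φ) (D : Dual G) {x y : D.X} {u v : V} (hxy : x ≠ y)
    (h1 : bd D x u v) (h2 : bd D y u v) (hx : len D x = 4)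
    (hu : ∀ p, bd D x u p → bd D y u p → p = v) (hv : ∀ p, bd D x v p → bd D y v p → p = u) :
    7 ≤ len D y := by
  obtain ⟨M, hM, hMl, -, -, hMb⟩ := hC.face_open D h1
  obtain ⟨N, hN, hNl, hN1, -, hNb⟩ := hC.face_open D h2
  have hy3 : len D y ≠ 3 := fun h => by
    have := hC.tri_other D hxy.symm h2 h1 h
    omega
  match M, (by omega : M.length = 2) with
  | [p, q], _ =>
    by_contra hlt
    have nM := hM.2
    have aM := hM.1
    have nN := hN.2
    have aN := hN.1
    have xp : bd D x u p := by rw [hMb, re_cons_concat]; simp [Lnk]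
    have xq : bd D x v q := by rw [hMb, re_cons_concat]; simp [Lnk]
    simp only [List.cons_append, List.nil_append, List.nodup_cons, List.mem_cons,
      List.not_mem_nil, or_false, not_or, List.isChain_cons_cons, List.isChain_singleton] at nM aM
    obtain ⟨⟨m1, m2, m3⟩, ⟨m4, m5⟩, m6, -⟩ := nM
    obtain ⟨-, pq, -, -⟩ := aM
    have tp : ∀ n, G.Adj u n → G.Adj p n → False := fun n e1 e2 => by
      have : Pth G u [v, q] p := ⟨by simp [h1.1, xq.1, pq.symm], by simp; tauto⟩
      rcases hC.sparse.triangle xp.1 e1 e2 this with h | h | h <;> simp at h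
    have tq : ∀ n, G.Adj q n → G.Adj v n → False := fun n e1 e2 => by
      have : Pth G v [u, p] q := ⟨by simp [h1.1.symm, xp.1, pq], by simp; tauto⟩
      rcases hC.sparse.triangle xq.1 e2 e1 this with h | h | h <;> simp at h
    have hd : p ∈ N ∨ q ∈ N := by
      by_contra! h
      refine (hC.sparse u v [p, q] N ⟨h1.1, hM, hN, by simp, by rintro rfl; simp at hN1, ?_⟩).2.1
        ⟨rfl, by omega⟩
      simpa [List.disjoint_cons_left] using h
    have c1 : ¬ G.Adj p v := fun h => tq p pq.symm h.symm
    have c2 : ¬ G.Adj u q := fun h => tp q h pq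
    have ya : ∀ a, RE (u :: (N ++ [v])) u a → a ≠ p := fun a h e =>
      m5 (hu p xp (e ▸ (hNb _ _).2 h))
    have yb : ∀ b, RE (u :: (N ++ [v])) v b → b ≠ q := fun a h e =>
      m2 (hv q xq (e ▸ (hNb _ _).2 h)).symm
    simp only [re_cons_concat] at ya yb
    match N, (by omega : N.length = 2 ∨ N.length = 3 ∨ N.length = 4) with
    | [a, b], _ =>
      have ha := ya a (by simp [Lnk])
      have hb := yb b (by simp [Lnk])
      simp only [List.cons_append, List.nil_append, List.mem_cons, List.not_mem_nil, or_false,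
        List.isChain_cons_cons, List.isChain_singleton] at aN hd
      obtain ⟨a1, -, a2, -⟩ := aN
      rcases hd with (rfl | rfl) | (rfl | rfl) <;> tauto
    | [a, b, c], _ =>
      have ha := ya a (by simp [Lnk])
      have hb := yb c (by simp [Lnk])
      simp only [List.cons_append, List.nil_append, List.mem_cons, List.not_mem_nil, or_false,
        List.isChain_cons_cons, List.isChain_singleton] at aN hd
      obtain ⟨a1, a2, a3, a4, -⟩ := aN
      rcases hd with (rfl | rfl | rfl) | (rfl | rfl | rfl)
      · tauto
      · exact tp a a1 a2.symm
      · tauto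
      · tauto
      · exact tq c a3 a4.symm
      · tauto
    | [a, b, c, d], _ =>
      have ha := ya a (by simp [Lnk])
      have hb := yb d (by simp [Lnk])
      simp only [List.cons_append, List.nil_append, List.mem_cons, List.not_mem_nil, or_false,
        List.isChain_cons_cons, List.isChain_singleton, List.nodup_cons, not_or] at aN hd nN
      obtain ⟨a1, a2, a3, a4, a5, -⟩ := aN
      obtain ⟨n1, n2, n3, n4, n5, -⟩ := nN
      have kp : p ≠ a ∧ p ≠ b ∧ p ≠ d := by
        refine ⟨Ne.symm ha, ?_, ?_⟩
        · rintro rfl; exact tp a a1 a2.symm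
        · rintro rfl; exact c1 a5
      have kq : q ≠ a ∧ q ≠ c ∧ q ≠ d := by
        refine ⟨?_, ?_, Ne.symm hb⟩
        · rintro rfl; exact c2 a1
        · rintro rfl; exact tq d a4 a5.symm
      have key : p = c ∧ q = b := by
        by_contra hno
        rcases hd with hd | hd
        · obtain rfl : p = c := by simpa [kp.1, kp.2.1, kp.2.2] using hd
          have : q ≠ b := fun h => hno ⟨rfl, h⟩
          obtain ⟨kq1, kq2, kq3⟩ := kq
          refine (hC.sparse.no_theta (A := [v, q]) (B := [a, b]) xp.1
            (by simp [h1.1, xq.1, pq.symm]) (by simp [a1, a2, a3]) ?_ (by simp) (by simp)).2.1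
            (by simp)
          simp only [List.nodup_cons, List.mem_cons, List.cons_append, List.nil_append,
            List.not_mem_nil, or_false, not_or, List.nodup_nil, and_true, not_false_eq_true]
          casesm* _ ∧ _
          refine ⟨⟨m1, m3, m2, ?_, ?_⟩, ⟨?_, m4, ?_, ?_⟩, ⟨?_, ?_, ?_⟩, ⟨?_, ?_⟩, ?_⟩ <;>
            first | assumption | (apply Ne.symm; assumption)
        · obtain rfl : q = b := by simpa [kq.1, kq.2.1, kq.2.2] using hd
          have : p ≠ c := fun h => hno ⟨h, rfl⟩
          obtain ⟨kp1, kp2, kp3⟩ := kp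
          refine (hC.sparse.no_theta (A := [u, p]) (B := [d, c]) xq.1
            (by simp [h1.1.symm, xp.1, pq]) (by simp [a3.symm, a4.symm, a5.symm]) ?_ (by simp)
            (by simp)).2.1 (by simp)
          simp only [List.nodup_cons, List.mem_cons, List.cons_append, List.nil_append,
            List.not_mem_nil, or_false, not_or, List.nodup_nil, and_true, not_false_eq_true]
          casesm* _ ∧ _
          refine ⟨⟨?_, ?_, ?_, ?_, ?_⟩, ⟨?_, ?_, ?_, ?_⟩, ⟨?_, ?_, ?_⟩, ⟨?_, ?_⟩, ?_⟩ <;>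
            first | assumption | (apply Ne.symm; assumption)
      obtain ⟨rfl, rfl⟩ := key
      obtain ⟨kp1, kp2, kp3⟩ := kp
      obtain ⟨kq1, kq2, kq3⟩ := kq
      refine (hC.sparse.no_theta (A := [a, q]) (B := [p, d]) h1.1 (by simp [a1, a2, xq.1.symm])
        (by simp [xp.1, a4, a5]) ?_ (by simp) (by simp)).2.1 (by simp)
      simp only [List.nodup_cons, List.mem_cons, List.cons_append, List.nil_append,
        List.not_mem_nil, or_false, not_or, List.nodup_nil, and_true, not_false_eq_true]
      casesm* _ ∧ _
      refine ⟨⟨?_, ?_, ?_, ?_, ?_⟩, ⟨?_, ?_, ?_, ?_⟩, ⟨?_, ?_, ?_⟩, ⟨?_, ?_⟩, ?_⟩ <;>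
        first | assumption | (apply Ne.symm; assumption)

lemma Ctr.quad_thick (hC : Ctr G S φ) (D : Dual G) {x y : D.X} {u v : V} (hxy : x ≠ y)
    (h1 : bd D x u v) (h2 : bd D y u v) (hx : len D x = 4) (hu : Thick G u) (hv : Thick G v) :
    7 ≤ len D y :=
  hC.quad_other D hxy h1 h2 hx (fun _ => hC.eq_of_bd D hxy hu h1 h2)
    fun _ => hC.eq_of_bd D hxy hv h1.symm h2.symm

lemma Ctr.thick_ring (hC : Ctr G S φ) {L : List V} (hL : AdmRing G L) (hS : S = {x | x ∈ L})
    {u v : V} (hu : u ∉ S) (huv : G.Adj u v) : Thick G v := by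
  by_cases hv : v ∈ S
  · obtain ⟨b, c, hbc, h⟩ := re_two hL.1.2 hL.2.1 (a := v) (by simpa [hS] using hv)
    have hb := (h b).2 (.inl rfl)
    have hc := (h c).2 (.inr rfl)
    have hub : u ≠ b := fun e => hu (by rw [hS, e]; exact hb.mem.2)
    have huc : u ≠ c := fun e => hu (by rw [hS, e]; exact hc.mem.2)
    have gb := hL.1.adj hb
    have gc := hL.1.adj hc
    intro p q
    by_contra! hno
    have h' : ∀ d, G.Adj v d → d = p ∨ d = q := fun d hd => or_iff_not_imp_left.2 (hno d hd)
    exact not_three (h' u huv.symm) (h' b gb) (h' c gc) hub huc hbc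
  · exact hC.thick hv huv.symm

/-- A quadrangle which is next to a long face is not next to a short face. -/
lemma Ctr.quad_long (hC : Ctr G S φ) (D : Dual G) {x y₁ y₂ : D.X} {u v b : V} (hu : u ∉ S)
    (h1 : bd D y₁ u v) (h2 : bd D y₂ u v) (h12 : y₁ ≠ y₂) (hl : len D y₁ = 4)
    (hb1 : bd D y₁ u b) (hbx : bd D x u b) (hx : x ≠ y₁) (hbv : b ≠ v) (h7 : 7 ≤ len D x) :
    7 ≤ len D y₂ := by
  have tu := hC.thick hu h1.1
  by_cases tv : Thick G v
  · exact hC.quad_thick D h12 h1 h2 hl tu tv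
  by_contra hlt
  rcases hC.adm with ⟨z, hS⟩ | ⟨L, hL, hS⟩
  swap
  · exact tv (hC.thick_ring hL hS hu h1.1)
  obtain rfl : v = z := by
    by_contra h
    exact tv (hC.thick (by simpa [hS] using h) h1.1.symm)
  obtain ⟨M, hM, hMl, -, -, hMb⟩ := hC.face_open D h1.symm
  obtain ⟨N, hN, hNl, hN1, -, hNb⟩ := hC.face_open D h2.symm
  have hy3 : len D y₂ ≠ 3 := fun h => by
    have := hC.tri_other D h12.symm h2 h1 h
    omega
  match M, (by omega : M.length = 2) with
  | [w, b'], _ =>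
    have nM := hM.2
    simp only [List.cons_append, List.nil_append, List.nodup_cons, List.mem_cons,
      List.not_mem_nil, or_false, not_or] at nM
    obtain ⟨⟨m1, m2, m3⟩, ⟨m4, m5⟩, m6, -⟩ := nM
    have xw : bd D y₁ v w := by rw [hMb, re_cons_concat]; simp [Lnk]
    have xb : bd D y₁ u b' := by rw [hMb, re_cons_concat]; simp [Lnk]
    have wb : bd D y₁ w b' := by rw [hMb, re_cons_concat]; simp [Lnk]
    obtain rfl : b = b' := by
      rcases hC.bd_not_three D h1 hb1 xb with h | h | h <;> grind
    match N, hN1 with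
    | w' :: N, _ =>
      have yw : bd D y₂ v w' := by rw [hNb, re_cons_concat]; simp [Lnk]
      have nN := hN.2
      simp only [List.cons_append, List.nodup_cons, List.mem_cons, List.mem_append,
        List.not_mem_nil, or_false, not_or] at nN
      obtain ⟨⟨n1, n2, n3⟩, ⟨n4, n5⟩, n6⟩ := nN
      obtain rfl : w = w' := by
        unfold Thick at tv
        push Not at tv
        obtain ⟨p, q, h⟩ := tv
        have h' : ∀ d, G.Adj v d → d = p ∨ d = q := fun d hd => or_iff_not_imp_left.2 (h d hd)
        by_contra hw
        exact not_three (h' w xw.1) (h' w' yw.1) (h' u h1.1.symm) hw m5 n5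
      have aN := hN.1
      simp only [List.cons_append, List.isChain_cons_cons] at aN
      have tw : Thick G w := hC.thick (by rw [hS]; exact Ne.symm m1) wb.1
      have hbN : b ∉ N := by
        intro hb
        match N, (by simp at hNl; omega : N.length ≤ 3) with
        | [a], _ =>
          have : bd D y₂ u a := by rw [hNb, re_cons_concat]; simp [Lnk]
          simp only [List.mem_singleton] at hb
          exact hbv (hC.eq_of_bd D h12 tu h1 h2 hb1 (hb ▸ this))
        | [a, c], _ =>
          have ya : bd D y₂ u c := by rw [hNb, re_cons_concat]; simp [Lnk]
          have yc : bd D y₂ w a := by rw [hNb, re_cons_concat]; simp [Lnk]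
          simp only [List.mem_cons, List.not_mem_nil, or_false] at hb
          rcases hb with rfl | rfl
          · exact hbv (hC.eq_of_bd D h12 tw xw.symm yw.symm wb yc)
          · exact hbv (hC.eq_of_bd D h12 tu h1 h2 hb1 ya)
        | [a, d, c], _ =>
          have ya : bd D y₂ u c := by rw [hNb, re_cons_concat]; simp [Lnk]
          have yc : bd D y₂ w a := by rw [hNb, re_cons_concat]; simp [Lnk]
          simp only [List.mem_cons, List.not_mem_nil, or_false] at hb
          rcases hb with rfl | rfl | rfl
          · exact hbv (hC.eq_of_bd D h12 tw xw.symm yw.symm wb yc)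
          · simp only [List.cons_append, List.nil_append, List.isChain_cons_cons] at aN
            have : Pth G w [v, u] b := ⟨by simp [xw.1.symm, h1.1.symm, hb1.1], by
              simp only [List.nodup_cons, List.mem_cons, List.cons_append, List.nil_append,
                List.not_mem_nil, or_false, not_or, List.nodup_nil, and_true, not_false_eq_true]
              exact ⟨⟨Ne.symm m1, m5, m4⟩, ⟨m3, m2⟩, Ne.symm m6⟩⟩
            rcases hC.sparse.triangle wb.1 aN.2.1 aN.2.2.1.symm this with h | h | h <;> simp at h
          · exact hbv (hC.eq_of_bd D h12 tu h1 h2 hb1 ya)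
      have hR : Ring G (u :: b :: w :: N) := by
        refine ⟨?_, ?_⟩
        · simpa [hb1.1, wb.1.symm] using aN.2
        · simp only [List.nodup_cons, List.mem_cons, not_or]
          rw [List.nodup_append'] at n6
          exact ⟨⟨Ne.symm m6, Ne.symm m5, fun h => n6.2.2 h (by simp)⟩, ⟨Ne.symm m4, hbN⟩, n4, n6.1⟩
      have hA : AdmRing G (u :: b :: w :: N) := ⟨hR, by simp, .inl (by simp at hNl ⊢; omega)⟩
      obtain ⟨T, hT⟩ := D.ring hR (by simp)
      have hre : RE (u :: b :: w :: N) u b := by simp [RE, Lnk]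
      obtain ⟨p, hp, hpL⟩ : ∃ p ∈ vf D x, p ∉ u :: b :: w :: N := by
        by_contra! h
        have : (vf D x).card ≤ (u :: b :: w :: N).toFinset.card :=
          Finset.card_le_card fun p hp => List.mem_toFinset.2 (h p hp)
        have := this.trans (List.toFinset_card_le _)
        unfold len at h7
        simp at this hNl
        omega
      refine (re_iff_ne hT hbx hb1 hx).1 hre
        (hC.cross D hA hT hpL hp (p' := v) ?_ (mem_vf.2 ⟨_, h1.symm⟩))
      simp only [List.mem_cons, not_or]
      exact ⟨m3, m2, m1, n2⟩

/-- The vertex of a pentagon opposite to an edge shared with another pentagon has degree at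
least four. -/
lemma Ctr.pent_pent (hC : Ctr G S φ) (D : Dual G) {x y : D.X} {u v : V} (hxy : x ≠ y)
    (h1 : bd D x u v) (h2 : bd D y u v) (hx : len D x = 5) (hy : len D y = 5)
    (hu : Thick G u) (hv : Thick G v) :
    ∃ d ∈ vf D x, d ≠ u ∧ d ≠ v ∧ ¬ Int3 G S d := by
  obtain ⟨M, hM, hMl, -, hMv, hMb⟩ := hC.face_open D h1
  obtain ⟨N, hN, hNl, hN1, -, hNb⟩ := hC.face_open D h2
  match M, N, (by omega : M.length = 3), (by omega : N.length = 3) with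
  | [e, d, c], [r, m, p], _, _ =>
    have nM := hM.2
    have aM := hM.1
    have nN := hN.2
    have aN := hN.1
    have xe : bd D x u e := by rw [hMb, re_cons_concat]; simp [Lnk]
    have xc : bd D x v c := by rw [hMb, re_cons_concat]; simp [Lnk]
    have yr : bd D y u r := by rw [hNb, re_cons_concat]; simp [Lnk]
    have yp : bd D y v p := by rw [hNb, re_cons_concat]; simp [Lnk]
    simp only [List.cons_append, List.nil_append, List.nodup_cons, List.mem_cons,
      List.not_mem_nil, or_false, not_or, List.isChain_cons_cons, List.isChain_singleton] at nM aM nN aN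
    obtain ⟨⟨m1, m2, m3, m4⟩, ⟨m5, m6, m7⟩, ⟨m8, m9⟩, m10, -⟩ := nM
    obtain ⟨a1, a2, a3, a4, -⟩ := aM
    obtain ⟨⟨n1, n2, n3, n4⟩, ⟨n5, n6, n7⟩, ⟨n8, n9⟩, n10, -⟩ := nN
    obtain ⟨b1, b2, b3, b4, -⟩ := aN
    have er : e ≠ r := fun h => m7 (hC.eq_of_bd D hxy hu h1 h2 xe (h ▸ yr))
    have cp : c ≠ p := fun h => m3 (hC.eq_of_bd D hxy hv h1.symm h2.symm xc (h ▸ yp)).symm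
    have cr : c ≠ r := by
      rintro rfl
      rcases hC.sparse.triangle h1.1 b1 a4.symm hM with h | h | h <;> simp at h
    have ep : e ≠ p := by
      rintro rfl
      rcases hC.sparse.triangle h1.1 a1 b4.symm hM with h | h | h <;> simp at h
    have hN' := hN.2
    have hint : d = r ∨ d = m ∨ d = p ∨ e = m ∨ c = m := by
      by_contra! hno
      obtain ⟨k1, k2, k3, k4, k5⟩ := hno
      refine (hC.sparse u v [e, d, c] [r, m, p] ⟨h1.1, hM, hN, by simp, by simp, ?_⟩).2.2
        ⟨rfl, rfl⟩
      simp only [List.disjoint_cons_left, List.disjoint_nil_left, List.mem_cons,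
        List.not_mem_nil, or_false, not_or, and_true]
      exact ⟨⟨er, k4, ep⟩, ⟨k1, k2, k3⟩, cr, k5, cp⟩
    have key : d = m := by
      rcases hint with rfl | h | rfl | rfl | rfl
      · have : Pth G u [v, c] d := ⟨by simp [h1.1, a3.symm, a4.symm], by
          simp only [List.nodup_cons, List.mem_cons, List.cons_append, List.nil_append,
            List.not_mem_nil, or_false, not_or, List.nodup_nil, and_true, not_false_eq_true]
          exact ⟨⟨m4, m3, m2⟩, ⟨Ne.symm m10, Ne.symm m9⟩, Ne.symm m8⟩⟩
        rcases hC.sparse.triangle b1 a1 a2.symm this with h | h | h <;> simp at h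
      · exact h
      · have : Pth G v [u, e] d := ⟨by simp [h1.1.symm, a1, a2], by
          simp only [List.nodup_cons, List.mem_cons, List.cons_append, List.nil_append,
            List.not_mem_nil, or_false, not_or, List.nodup_nil, and_true, not_false_eq_true]
          exact ⟨⟨Ne.symm m4, Ne.symm m7, Ne.symm m9⟩, ⟨m1, m2⟩, m5⟩⟩
        rcases hC.sparse.triangle b4.symm a4.symm a3 this with h | h | h <;> simp at h
      · have : Pth G u [v, c, d] e := ⟨by simp [h1.1, a4.symm, a3.symm, a2.symm], by
          simp only [List.nodup_cons, List.mem_cons, List.cons_append, List.nil_append,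
            List.not_mem_nil, or_false, not_or, List.nodup_nil, and_true, not_false_eq_true]
          exact ⟨⟨m4, m3, m2, m1⟩, ⟨Ne.symm m10, Ne.symm m9, Ne.symm m7⟩,
            ⟨Ne.symm m8, Ne.symm m6⟩, Ne.symm m5⟩⟩
        rcases hC.sparse.triangle a1 b1 b2.symm this with h | h | h <;> simp at h
      · have : Pth G v [u, e, d] c := ⟨by simp [h1.1.symm, a1, a2, a3], by
          simp only [List.nodup_cons, List.mem_cons, List.cons_append, List.nil_append,
            List.not_mem_nil, or_false, not_or, List.nodup_nil, and_true, not_false_eq_true]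
          exact ⟨⟨Ne.symm m4, Ne.symm m7, Ne.symm m9, Ne.symm m10⟩, ⟨m1, m2, m3⟩, ⟨m5, m6⟩, m8⟩⟩
        rcases hC.sparse.triangle a4.symm b4.symm b3 this with h | h | h <;> simp at h
    subst key
    refine ⟨d, (hMv d).1 (by simp), Ne.symm m2, m9, ?_⟩
    rintro ⟨-, α, β, γ, h⟩
    have nb : ∀ w, G.Adj d w → w = α ∨ w = β ∨ w = γ := fun w => (h.adj w).1
    rcases nb e a2.symm with h1 | h1 | h1
    · exact not_three (by have := nb c a3; rwa [or_iff_right (fun h => m6 (h1.trans h.symm))] at this)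
        (by have := nb r b2.symm; rwa [or_iff_right (fun h => er (h1.trans h.symm))] at this)
        (by have := nb p b3; rwa [or_iff_right (fun h => ep (h1.trans h.symm))] at this) cr cp n6
    · have nb' : ∀ w, G.Adj d w → e ≠ w → w = α ∨ w = γ := fun w hw he => by
        rcases nb w hw with h | h | h
        · exact .inl h
        · exact (he (h1.trans h.symm)).elim
        · exact .inr h
      exact not_three (nb' c a3 m6) (nb' r b2.symm er) (nb' p b3 ep) cr cp n6
    · have nb' : ∀ w, G.Adj d w → e ≠ w → w = α ∨ w = β := fun w hw he => by
        rcases nb w hw with h | h | h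
        · exact .inl h
        · exact .inr h
        · exact (he (h1.trans h.symm)).elim
      exact not_three (nb' c a3 m6) (nb' r b2.symm er) (nb' p b3 ep) cr cp n6

end Adj

section Flow
open Classical

variable {V : Type} [Fintype V] {G : SimpleGraph V} {S : Set V} {φ : V → Bool}

noncomputable instance (D : Dual G) : Fintype D.X := D.fin

/-- The face on the other side of the edge `uv` of `x`. -/
noncomputable def oth (D : Dual G) (x : D.X) (u v : V) : D.X :=
  if D.fc u v = x then D.fc v u else D.fc u v

lemma bd.oth {D : Dual G} {x : D.X} {u v : V} (h : bd D x u v) : bd D (oth D x u v) u v := by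
  refine ⟨h.1, ?_⟩
  unfold IFPaper.oth
  split_ifs <;> simp

lemma Ctr.oth_ne (hC : Ctr G S φ) (D : Dual G) {x : D.X} {u v : V} (h : bd D x u v) :
    oth D x u v ≠ x := by
  unfold oth
  split_ifs with h1
  · exact fun h2 => hC.fc_ne D h.1 (h1.trans h2.symm)
  · exact h1

lemma bd.eq_or {D : Dual G} {x y : D.X} {u v : V} (h : bd D x u v) (hy : bd D y u v) :
    y = x ∨ y = IFPaper.oth D x u v := by
  unfold IFPaper.oth
  obtain ⟨h0, h⟩ := h
  obtain ⟨-, hy⟩ := hy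
  split_ifs with h1
  · rcases hy with hy | hy
    · exact .inl (hy.symm.trans h1)
    · exact .inr hy.symm
  · rcases hy with hy | hy
    · exact .inr hy.symm
    · exact .inl (hy.symm.trans (h.resolve_left h1))

lemma bd.eq_oth {D : Dual G} {x y : D.X} {u v : V} (h : bd D x u v) (hy : bd D y u v)
    (hxy : y ≠ x) : y = IFPaper.oth D x u v := (h.eq_or hy).resolve_left hxy

lemma Ctr.oth_symm (hC : Ctr G S φ) (D : Dual G) {x : D.X} {u v : V} (h : bd D x u v) :
    oth D x v u = oth D x u v :=
  h.eq_oth h.symm.oth.symm (hC.oth_ne D h.symm)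

/-- The sum over the two faces at an edge. -/
lemma Ctr.sum_bd (hC : Ctr G S φ) (D : Dual G) {u v : V} (F : D.X → ℤ) :
    ∑ x, (if bd D x u v then F x else 0) =
      if G.Adj u v then F (D.fc u v) + F (D.fc v u) else 0 := by
  by_cases h : G.Adj u v
  · have h1 := hC.fc_ne D h
    rw [if_pos h, ← Finset.sum_filter]
    refine Eq.trans (Finset.sum_congr ?_ fun _ _ => rfl) (Finset.sum_pair h1)
    ext x
    simp only [bd, Finset.mem_filter, Finset.mem_univ, true_and, Finset.mem_insert,
      Finset.mem_singleton, h]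
    tauto
  · simp [bd, h]

noncomputable def dg (G : SimpleGraph V) (u : V) : ℤ := ∑ v, if G.Adj u v then 1 else 0

/-- The weight of an edge next to a short face. -/
noncomputable def sg (D : Dual G) (u v : V) : ℤ :=
  if len D (D.fc u v) ≤ 4 ∨ len D (D.fc v u) ≤ 4 then 28
  else if len D (D.fc u v) ≤ 5 ∨ len D (D.fc v u) ≤ 5 then 14 else 0

/-- How much a vertex of degree at least four gives along an edge next to a face of length at
most four. -/
noncomputable def gg (D : Dual G) (u : V) : ℤ :=
  if (∑ v, if G.Adj u v then sg D u v else 0) ≤ 56 * dg G u - 168 then 28 else 14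

noncomputable def hh (D : Dual G) (S : Set V) (v : V) : ℤ :=
  if Int3 G S v then 4 else if v ∈ S then 7 else if gg D v = 14 then 6 else 0

/-- What the face of length `a` receives through the dart `uv`, when the face on the other side
has length `b`. -/
noncomputable def fl (D : Dual G) (S : Set V) (a b : ℕ) (u v : V) : ℤ :=
  if u ∈ S ∧ v ∈ S then 0
  else if a = 3 then (if u ∈ S then 7 else 14)
  else if b = 3 then (if u ∈ S then -7 else if Int3 G S u then -14 else gg D u - 14)
  else if a = 4 ∧ 7 ≤ b then (if u ∈ S then 0 else if Int3 G S u then hh D S v else gg D u)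
  else if b = 4 ∧ 7 ≤ a then (if u ∈ S then 0 else if Int3 G S u then - hh D S v else 0)
  else if a = 5 ∧ b ≠ 4 ∧ u ∉ S ∧ ¬ Int3 G S u then (if b = 5 then 7 else 14)
  else 0

noncomputable def wt (S : Set V) (u v : V) : ℤ :=
  if u ∈ S ∧ v ∈ S then 7 else if u ∈ S ∨ v ∈ S then 28 else 14

/-- The contribution of a vertex to the charge of a face. -/
noncomputable def part (D : Dual G) (S : Set V) (x : D.X) (u : V) : ℤ :=
  ∑ v, if bd D x u v then wt S u v + fl D S (len D x) (len D (oth D x u v)) u v else 0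

noncomputable def charge (D : Dual G) (S : Set V) (x : D.X) : ℤ := -168 + ∑ u, part D S x u

lemma gg_or (D : Dual G) (u : V) : gg D u = 28 ∨ gg D u = 14 := by
  unfold gg; split_ifs <;> simp

lemma Ctr.len_edge (hC : Ctr G S φ) (D : Dual G) {x y : D.X} {u v : V} (h1 : bd D x u v)
    (h2 : bd D y u v) (hxy : x ≠ y) : 3 ≤ len D x ∧ 3 ≤ len D y ∧ (len D x = 3 → 9 ≤ len D y) ∧
      (len D y = 3 → 9 ≤ len D x) :=
  ⟨hC.len_ge D x, hC.len_ge D y, hC.tri_other D hxy h1 h2, hC.tri_other D hxy.symm h2 h1⟩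

lemma fl_add_zero (D : Dual G) {a b : ℕ} (ha : a = 3 → 9 ≤ b) (hb : b = 3 → 9 ≤ a) {u v : V}
    (hu : u ∈ S ∨ Int3 G S u) : fl D S a b u v + fl D S b a u v = 0 := by
  by_cases hS : u ∈ S
  · have hi : ¬ Int3 G S u := fun h => h.1 hS
    simp only [fl, hS, hi, if_true, if_false, true_and, not_true, false_and, and_false]
    split_ifs <;> first | rfl | omega
  · have hi := hu.resolve_left hS
    simp only [fl, hS, hi, if_true, if_false, not_true, false_and, and_false]
    split_ifs <;> first | rfl | omega

lemma fl_add_le (D : Dual G) {a b : ℕ} (ha : a = 3 → 9 ≤ b) (hb : b = 3 → 9 ≤ a) {u v : V}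
    (hu : u ∉ S) (hi : ¬ Int3 G S u) : fl D S a b u v + fl D S b a u v ≤
      if a ≤ 4 ∨ b ≤ 4 then gg D u else if a ≤ 5 ∨ b ≤ 5 then 14 else 0 := by
  have := gg_or D u
  simp only [fl, hu, hi, if_false, false_and, not_false_eq_true, and_true]
  split_ifs <;> omega

lemma Ctr.dg_ge (hC : Ctr G S φ) {u w : V} (hu : u ∉ S) (huw : G.Adj u w) :
    3 ≤ dg G u ∧ (¬ Int3 G S u → 4 ≤ dg G u) := by
  obtain ⟨x, hx, hxw, -⟩ := hC.thick hu huw w w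
  obtain ⟨y, hy, hyw, hyx⟩ := hC.thick hu huw w x
  have e : dg G u = ((Finset.univ.filter (G.Adj u)).card : ℤ) := by simp [dg]
  have hc : ({w, x, y} : Finset V).card = 3 := by
    rw [Finset.card_eq_three]; exact ⟨w, x, y, Ne.symm hxw, Ne.symm hyw, Ne.symm hyx, rfl⟩
  have hs : ({w, x, y} : Finset V) ⊆ Finset.univ.filter (G.Adj u) := by
    intro z
    simp only [Finset.mem_insert, Finset.mem_singleton, Finset.mem_filter, Finset.mem_univ,
      true_and]
    rintro (rfl | rfl | rfl) <;> assumption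
  have h3 := Finset.card_le_card hs
  refine ⟨by rw [e]; omega, fun hi => ?_⟩
  by_contra hlt
  have := Finset.eq_of_subset_of_card_le hs (by rw [e] at hlt; omega)
  refine hi ⟨hu, w, x, y, fun z => ?_, Ne.symm hxw, Ne.symm hyw, Ne.symm hyx⟩
  have := Finset.ext_iff.1 this z
  simp only [Finset.mem_insert, Finset.mem_singleton, Finset.mem_filter, Finset.mem_univ,
      true_and] at this
  exact this.symm

lemma Ctr.out_le (hC : Ctr G S φ) (D : Dual G) {u w : V} (hu : u ∉ S) (huw : G.Adj u w) :
    (∑ v, if G.Adj u v then fl D S (len D (D.fc u v)) (len D (D.fc v u)) u v +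
      fl D S (len D (D.fc v u)) (len D (D.fc u v)) u v else 0) ≤ 56 * dg G u - 168 := by
  have hd := hC.dg_ge hu huw
  have hl : ∀ v, G.Adj u v → _ := fun v hv =>
    hC.len_edge D (x := D.fc u v) (y := D.fc v u) ⟨hv, .inl rfl⟩ ⟨hv, .inr rfl⟩ (hC.fc_ne D hv)
  by_cases hi : Int3 G S u
  · rw [Finset.sum_eq_zero]
    · omega
    · intro v _
      split_ifs with hv
      · exact fl_add_zero D (hl v hv).2.2.1 (hl v hv).2.2.2 (.inr hi)
      · rfl
  · have hle : ∀ v, G.Adj u v → _ := fun v hv =>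
      fl_add_le D (v := v) (hl v hv).2.2.1 (hl v hv).2.2.2 hu hi
    have h4 := hd.2 hi
    by_cases hg : (∑ v, if G.Adj u v then sg D u v else 0) ≤ 56 * dg G u - 168
    · refine le_trans (Finset.sum_le_sum fun v _ => ?_) hg
      split_ifs with hv
      · refine (hle v hv).trans ?_
        rw [gg, if_pos hg, sg]
      · rfl
    · have : (∑ v, if G.Adj u v then (14 : ℤ) else 0) = 14 * dg G u := by
        rw [dg, Finset.mul_sum]; simp
      refine le_trans (Finset.sum_le_sum fun v _ => ?_) (this.le.trans (by omega))
      split_ifs with hv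
      · refine (hle v hv).trans ?_
        rw [gg, if_neg hg]
        split_ifs <;> omega
      · rfl

lemma fl_zero (D : Dual G) {a b : ℕ} {u v : V} (hu : u ∈ S) (hv : v ∈ S) :
    fl D S a b u v = 0 := by
  rw [fl, if_pos ⟨hu, hv⟩]

lemma sum_symm_adj (F : V → ℤ) : (∑ u, ∑ v, if G.Adj u v then 2 * F u else 0) =
    ∑ u, ∑ v, if G.Adj u v then F u + F v else 0 := by
  have h : (∑ u, ∑ v, if G.Adj u v then F u else 0) = ∑ u, ∑ v, if G.Adj u v then F v else 0 := by
    rw [Finset.sum_comm]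
    simp only [G.adj_comm]
  have h1 : (∑ u, ∑ v, if G.Adj u v then F u + F v else 0) =
      (∑ u, ∑ v, if G.Adj u v then F u else 0) + ∑ u, ∑ v, if G.Adj u v then F v else 0 := by
    simp only [← Finset.sum_add_distrib]
    refine Finset.sum_congr rfl fun u _ => Finset.sum_congr rfl fun v _ => ?_
    split_ifs <;> simp
  rw [h1, ← h]
  simp only [← Finset.sum_add_distrib]
  refine Finset.sum_congr rfl fun u _ => Finset.sum_congr rfl fun v _ => ?_
  split_ifs <;> ring

lemma Ctr.total (hC : Ctr G S φ) (D : Dual G) :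
    ∑ x, charge D S x ≤ -336 - 70 * (∑ u, ∑ v, if G.Adj u v ∧ u ∈ S ∧ v ∈ S then 1 else 0) +
      168 * ∑ u, if u ∈ S ∧ ∃ v, G.Adj u v then 1 else 0 := by
  obtain ⟨p, w, hpw, -⟩ := hC.exists_edge
  have hcount := D.count ⟨p, w, hpw⟩
  have e1 : ∑ x, charge D S x = -168 * (Fintype.card D.X : ℤ) + ∑ u, ∑ v, (if G.Adj u v then
      (wt S u v + wt S u v) + (fl D S (len D (D.fc u v)) (len D (D.fc v u)) u v +
        fl D S (len D (D.fc v u)) (len D (D.fc u v)) u v) else 0) := by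
    simp only [charge, part, Finset.sum_add_distrib]
    congr 1
    · simp [mul_comm]
    · rw [Finset.sum_comm]
      refine Finset.sum_congr rfl fun u _ => ?_
      rw [Finset.sum_comm]
      refine Finset.sum_congr rfl fun v _ => ?_
      rw [hC.sum_bd D fun x => wt S u v + fl D S (len D x) (len D (oth D x u v)) u v]
      split_ifs with h
      · have h1 : oth D (D.fc u v) u v = D.fc v u := if_pos rfl
        have h2 : oth D (D.fc v u) u v = D.fc u v := if_neg (hC.fc_ne D h)
        rw [h1, h2]; ring
      · rfl
  have e2 : ∀ u, (∑ v, (if G.Adj u v then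
      (wt S u v + wt S u v) + (fl D S (len D (D.fc u v)) (len D (D.fc v u)) u v +
        fl D S (len D (D.fc v u)) (len D (D.fc u v)) u v) else 0)) ≤
      (∑ v, if G.Adj u v then 2 * wt S u v else 0) +
        (∑ v, if G.Adj u v then 2 * (if u ∈ S then 0 else 28) else 0) -
        168 * ((if ∃ v, G.Adj u v then 1 else 0) - if u ∈ S ∧ ∃ v, G.Adj u v then 1 else 0) := by
    intro u
    have : (∑ v, (if G.Adj u v then
      (wt S u v + wt S u v) + (fl D S (len D (D.fc u v)) (len D (D.fc v u)) u v +
        fl D S (len D (D.fc v u)) (len D (D.fc u v)) u v) else 0)) =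
        (∑ v, if G.Adj u v then 2 * wt S u v else 0) + ∑ v, (if G.Adj u v then
        (fl D S (len D (D.fc u v)) (len D (D.fc v u)) u v +
        fl D S (len D (D.fc v u)) (len D (D.fc u v)) u v) else 0) := by
      rw [← Finset.sum_add_distrib]
      refine Finset.sum_congr rfl fun v _ => ?_
      split_ifs <;> ring
    rw [this, add_sub_assoc, add_le_add_iff_left]
    by_cases hv : ∃ v, G.Adj u v
    · obtain ⟨v, hv⟩ := hv
      by_cases hu : u ∈ S
      · have : ∃ v, G.Adj u v := ⟨v, hv⟩
        simp only [hu, this, if_true, true_and, sub_self, mul_zero, sub_zero]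
        refine Finset.sum_le_sum fun v _ => ?_
        split_ifs with hv
        · have := hC.len_edge D (x := D.fc u v) (y := D.fc v u) ⟨hv, .inl rfl⟩ ⟨hv, .inr rfl⟩
            (hC.fc_ne D hv)
          exact (fl_add_zero D this.2.2.1 this.2.2.2 (.inl hu)).le
        · rfl
      · refine (hC.out_le D hu hv).trans ?_
        have : ∃ v, G.Adj u v := ⟨v, hv⟩
        simp only [hu, this, if_true, if_false, false_and, sub_zero, dg, Finset.mul_sum]
        simp
    · push Not at hv
      simp [hv]
  have e3 := sum_symm_adj (G := G) fun u => if u ∈ S then (0 : ℤ) else 28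
  have e4 : (∑ u, ∑ v, if G.Adj u v then 2 * wt S u v else 0) +
      (∑ u, ∑ v, if G.Adj u v then ((if u ∈ S then (0 : ℤ) else 28) + if v ∈ S then 0 else 28)
        else 0) = 84 * (∑ u, ∑ v, if G.Adj u v then 1 else 0) -
      70 * ∑ u, ∑ v, if G.Adj u v ∧ u ∈ S ∧ v ∈ S then 1 else 0 := by
    simp only [Finset.mul_sum, ← Finset.sum_add_distrib, ← Finset.sum_sub_distrib]
    refine Finset.sum_congr rfl fun u _ => Finset.sum_congr rfl fun v _ => ?_
    by_cases h : G.Adj u v <;> by_cases hu : u ∈ S <;> by_cases hv : v ∈ S <;>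
      simp [h, hu, hv, wt]
  have e5 : (∑ u, ∑ v, if G.Adj u v then (1 : ℤ) else 0) =
      ((Finset.univ.filter fun p : V × V => G.Adj p.1 p.2).card : ℤ) := by
    rw [Finset.card_filter, Fintype.sum_prod_type]
    push_cast
    rfl
  have e6 : (∑ u, if ∃ v, G.Adj u v then (1 : ℤ) else 0) =
      ((Finset.univ.filter fun u => ∃ v, G.Adj u v).card : ℤ) := by
    rw [Finset.card_filter]
    push_cast
    rfl
  have e7 := Finset.sum_le_sum fun u (_ : u ∈ Finset.univ) => e2 u
  simp only [Finset.sum_add_distrib, Finset.sum_sub_distrib, ← Finset.mul_sum] at e7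
  have hc : ((Finset.univ.filter fun p : V × V => G.Adj p.1 p.2).card : ℤ) + 4 ≤
    2 * (Fintype.card D.X : ℤ) + 2 * ((Finset.univ.filter fun u => ∃ v, G.Adj u v).card : ℤ) := by
    refine le_of_eq_of_le ?_ ((Nat.cast_le (α := ℤ)).2 hcount |>.trans (le_of_eq ?_))
    · push_cast; congr
    · push_cast; congr
  linarith

end Flow

section Gain
open Classical

variable {V : Type} [Fintype V] {G : SimpleGraph V} {S : Set V} {φ : V → Bool}

lemma Ctr.int3_faces (hC : Ctr G S φ) (D : Dual G) {x : D.X} {u a b : V} (hu : Int3 G S u)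
    (ha : bd D x u a) (hb : bd D x u b) (hab : a ≠ b) :
    (len D (oth D x u a) = 3 → 9 ≤ len D (oth D x u b)) ∧
      (7 ≤ len D x → len D (oth D x u a) = 4 → 7 ≤ len D (oth D x u b)) := by
  obtain ⟨c, hc⟩ := hu.deg3 ha.1 hb.1 hab
  have hca : c ≠ a := fun h => hc.ne₂ h.symm
  have hcb : c ≠ b := fun h => hc.ne₃ h.symm
  have huc : G.Adj u c := (hc.adj c).2 (.inr (.inr rfl))
  have key : ∀ y, y ≠ x → bd D y u a → bd D y u b → False := fun y hy h1 h2 => by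
    rcases hC.share D hab h1 ha h2 hb hy huc with h | h
    · exact hca h
    · exact hcb h
  have hya := hC.oth_ne D ha
  have hyb := hC.oth_ne D hb
  have h1 : bd D (oth D x u a) u c := by
    obtain ⟨d, hda, hd⟩ := hC.bd_other D ha.oth
    have hd' := (hd d).2 (.inr rfl)
    rcases (hc.adj d).1 hd'.1 with h | rfl | rfl
    · exact (hda h).elim
    · exact (key _ hya ha.oth hd').elim
    · exact hd'
  have h2 : bd D (oth D x u b) u c := by
    obtain ⟨d, hdb, hd⟩ := hC.bd_other D hb.oth
    have hd' := (hd d).2 (.inr rfl)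
    rcases (hc.adj d).1 hd'.1 with rfl | h | rfl
    · exact (key _ hyb hd' hb.oth).elim
    · exact (hdb h).elim
    · exact hd'
  have hne : oth D x u a ≠ oth D x u b := fun h => key _ hya ha.oth (h ▸ hb.oth)
  exact ⟨hC.tri_other D hne h1 h2, fun h7 hl =>
    hC.quad_long D hu.1 h1 h2 hne hl ha.oth ha hya.symm hca.symm h7⟩

lemma length_le_dg {l : List V} {u : V} (hl : l.Nodup) (h : ∀ z ∈ l, G.Adj u z) :
    (l.length : ℤ) ≤ dg G u := by
  have e : dg G u = ((Finset.univ.filter (G.Adj u)).card : ℤ) := by simp [dg]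
  rw [e, ← List.toFinset_card_of_nodup hl, Nat.cast_le]
  exact Finset.card_le_card fun z hz => by simpa using h z (by simpa using hz)

lemma sum_sg_le (D : Dual G) {l : List V} {u : V} (hl : l.Nodup)
    (h : ∀ z ∈ l, G.Adj u z ∧ sg D u z = 0) :
    (∑ v, if G.Adj u v then sg D u v else 0) ≤ 28 * (dg G u - l.length) := by
  have e : 28 * (dg G u - l.length) =
      ∑ v, ((if G.Adj u v then 28 else 0) - if v ∈ l then 28 else 0) := by
    have : (l.length : ℤ) = ∑ v, if v ∈ l then 1 else 0 := by
      rw [← List.toFinset_card_of_nodup hl, Finset.card_eq_sum_ones, ← Finset.sum_filter]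
      push_cast
      refine Finset.sum_congr ?_ fun _ _ => rfl
      ext; simp
    rw [this, dg, ← Finset.sum_sub_distrib, Finset.mul_sum]
    refine Finset.sum_congr rfl fun v _ => ?_
    split_ifs <;> rfl
  rw [e]
  refine Finset.sum_le_sum fun v _ => ?_
  by_cases hv : v ∈ l
  · simp [hv, h v hv]
  · by_cases ha : G.Adj u v
    · simp only [ha, hv, if_true, if_false, sg]
      split_ifs <;> norm_num
    · simp [ha, hv]

lemma sg_zero (D : Dual G) {x y : D.X} {u v : V} (h1 : bd D x u v) (h2 : bd D y u v) (hxy : x ≠ y)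
    (hx : 6 ≤ len D x) (hy : 6 ≤ len D y) : sg D u v = 0 := by
  obtain ⟨-, h1⟩ := h1
  obtain ⟨-, h2⟩ := h2
  unfold sg
  rcases h1 with rfl | rfl <;> rcases h2 with rfl | rfl
  · exact (hxy rfl).elim
  · rw [if_neg (by omega), if_neg (by omega)]
  · rw [if_neg (by omega), if_neg (by omega)]
  · exact (hxy rfl).elim

lemma Ctr.gg_eq (hC : Ctr G S φ) (D : Dual G) {x : D.X} {B u v u' : V} (hB : B ∉ S)
    (hBi : ¬ Int3 G S B) (h1 : bd D x B v) (h2 : bd D x B u) (huv : u ≠ v)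
    (hl : len D (oth D x B v) ≤ 4) (hu : Int3 G S u) (h3 : bd D x u u') (hu' : u' ≠ B)
    (ht : len D (oth D x u u') = 3) (h7 : 7 ≤ len D x) : gg D B = 28 := by
  have hw := (hC.int3_faces D hu h3 h2.symm hu').1 ht
  rw [hC.oth_symm D h2] at hw
  have su : sg D B u = 0 := sg_zero D h2 h2.oth (hC.oth_ne D h2).symm (by omega) (by omega)
  have nx2 := hC.oth_ne D h1
  have nw := hC.oth_ne D h2
  have b2 := h1.oth
  have bw := h2.oth
  have ex2 : ∀ {y}, bd D y B v → y ≠ x → y = oth D x B v := fun hy h => h1.eq_oth hy h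
  have ew : ∀ {y}, bd D y B u → y ≠ x → y = oth D x B u := fun hy h => h2.eq_oth hy h
  set x2 := oth D x B v
  set w := oth D x B u
  have nxw : x2 ≠ w := fun h => by rw [h] at hl; omega
  have fin5 : 5 ≤ dg G B → gg D B = 28 := fun h5 => by
    have := sum_sg_le D (l := [u]) (u := B) (by simp) (by simp [su, h2.1])
    rw [gg, if_pos]
    simp only [List.length_singleton, Nat.cast_one] at this
    linarith
  by_contra hno
  have hd4 : dg G B = 4 := by
    have := (hC.dg_ge hB h1.1).2 hBi
    by_contra h
    exact hno (fin5 (by omega))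
  have no5 : ∀ {a b c d e : V}, [a, b, c, d, e].Nodup → G.Adj B a → G.Adj B b → G.Adj B c →
      G.Adj B d → G.Adj B e → False := fun hn ha hb hc hd he => by
    have := length_le_dg hn (u := B) (G := G) (by simp [ha, hb, hc, hd, he])
    simp at this
    omega
  obtain ⟨n3, n3v, h5⟩ := hC.bd_other D b2
  obtain ⟨n4, n4u, h6⟩ := hC.bd_other D bw
  obtain ⟨v', v'u, h8⟩ := hC.bd_other D h2
  obtain rfl : v = v' := ((h8 v).1 h1).resolve_left (Ne.symm huv)
  have c3 := (h5 n3).2 (.inr rfl)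
  have c4 := (h6 n4).2 (.inr rfl)
  have n3u : n3 ≠ u := by rintro rfl; exact nxw (ew c3 nx2)
  have n4v : n4 ≠ v := by rintro rfl; exact nxw (ex2 c4 nw).symm
  by_cases h34 : n3 = n4
  · subst h34
    obtain ⟨m, hm, hmn⟩ : ∃ m, G.Adj B m ∧ m ∉ [u, v, n3] := by
      by_contra! h
      have e : dg G B = ((Finset.univ.filter (G.Adj B)).card : ℤ) := by simp [dg]
      have : Finset.univ.filter (G.Adj B) ⊆ [u, v, n3].toFinset := fun z hz =>
        List.mem_toFinset.2 (h z (by simpa using hz))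
      have := (Finset.card_le_card this).trans (List.toFinset_card_le _)
      simp at this
      omega
    simp only [List.mem_cons, List.not_mem_nil, or_false, not_or] at hmn
    obtain ⟨hmu, hmv, hmn⟩ := hmn
    have hF : bd D (D.fc B m) B m := ⟨hm, .inl rfl⟩
    set F := D.fc B m
    obtain ⟨p, hpm, hp⟩ := hC.bd_other D hF
    have bp := (hp p).2 (.inr rfl)
    have f1 : F ≠ x := fun h => by
      rcases (h8 m).1 (h ▸ hF) with h | h
      · exact hmu h
      · exact hmv h
    have f2 : F ≠ x2 := fun h => by
      rcases (h5 m).1 (h ▸ hF) with h | h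
      · exact hmv h
      · exact hmn h
    have f3 : F ≠ w := fun h => by
      rcases (h6 m).1 (h ▸ hF) with h | h
      · exact hmu h
      · exact hmn h
    have p1 : p ≠ u := by rintro rfl; exact f3 (ew bp f1)
    have p2 : p ≠ v := by rintro rfl; exact f2 (ex2 bp f1)
    have p3 : p ≠ n3 := by
      rintro rfl
      rcases c3.eq_or bp with h | h
      · exact f2 h
      · exact f3 (h.trans (c3.eq_oth c4 nxw.symm).symm)
    refine no5 (a := u) (b := v) (c := n3) (d := m) (e := p) ?_ h2.1 h1.1 c3.1 hm bp.1
    simp only [List.nodup_cons, List.mem_cons, List.not_mem_nil, or_false, not_or,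
      List.nodup_nil, and_true, not_false_eq_true]
    exact ⟨⟨huv, n3u.symm, Ne.symm hmu, p1.symm⟩, ⟨n3v.symm, Ne.symm hmv, p2.symm⟩,
      ⟨Ne.symm hmn, p3.symm⟩, hpm.symm⟩
  · have hF := c4.oth
    have fw := hC.oth_ne D c4
    set F := oth D w B n4
    obtain ⟨p, hp4, hp⟩ := hC.bd_other D hF
    have bp := (hp p).2 (.inr rfl)
    have f1 : F ≠ x := fun h => by
      rcases (h8 n4).1 (h ▸ hF) with h | h
      · exact n4u h
      · exact n4v h
    have f2 : F ≠ x2 := fun h => by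
      rcases (h5 n4).1 (h ▸ hF) with h | h
      · exact n4v h
      · exact h34 h.symm
    have p1 : p ≠ u := by rintro rfl; exact fw (ew bp f1)
    have p2 : p ≠ v := by rintro rfl; exact f2 (ex2 bp f1)
    by_cases p3 : p = n3
    · subst p3
      have hl7 : 7 ≤ len D F := by
        have := hC.len_ge D x2
        rcases (by omega : len D x2 = 3 ∨ len D x2 = 4) with h | h
        · exact (by omega : 7 ≤ 9).trans (hC.tri_other D f2.symm c3 bp h)
        · exact hC.quad_long D hB c3 bp f2.symm h b2 h1 nx2.symm n3v.symm h7
      have s4 : sg D B n4 = 0 := sg_zero D c4 hF fw.symm (by omega) (by omega)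
      have := sum_sg_le D (l := [u, n4]) (u := B) (by simp [Ne.symm n4u])
        (by simp [su, s4, h2.1, c4.1])
      refine hno ?_
      rw [gg, if_pos]
      simp only [List.length_cons, List.length_nil] at this
      push_cast at this
      linarith
    · refine no5 (a := u) (b := v) (c := n3) (d := n4) (e := p) ?_ h2.1 h1.1 c3.1 c4.1 bp.1
      simp only [List.nodup_cons, List.mem_cons, List.not_mem_nil, or_false, not_or,
        List.nodup_nil, and_true, not_false_eq_true]
      exact ⟨⟨huv, n3u.symm, n4u.symm, p1.symm⟩, ⟨n3v.symm, n4v.symm, p2.symm⟩,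
        ⟨h34, Ne.symm p3⟩, hp4.symm⟩

/-- Four consecutive internal vertices of degree three with a triangle at their first edge. -/
lemma Ctr.no_three_tri (hC : Ctr G S φ) (D : Dual G) {x : D.X} {v₁ v₂ v₃ v₄ : V}
    (i₁ : Int3 G S v₁) (i₂ : Int3 G S v₂) (i₃ : Int3 G S v₃) (i₄ : Int3 G S v₄)
    (h₁ : bd D x v₁ v₂) (h₂ : bd D x v₂ v₃) (h₃ : bd D x v₃ v₄) (h13 : v₁ ≠ v₃) (h24 : v₂ ≠ v₄)
    (ht : len D (oth D x v₁ v₂) = 3) : False := by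
  obtain ⟨M, hM, hMl, -, -, hMb⟩ := hC.face_open D h₁.oth
  match M, (by omega : M.length = 1) with
  | [t], _ =>
    have t1 : bd D (oth D x v₁ v₂) v₁ t := by rw [hMb, re_cons_concat]; simp [Lnk]
    have t2 : bd D (oth D x v₁ v₂) v₂ t := by rw [hMb, re_cons_concat]; simp [Lnk]
    have nM := hM.2
    simp only [List.cons_append, List.nil_append, List.nodup_cons, List.mem_cons,
      List.not_mem_nil, or_false, not_or] at nM
    have ht3 : v₃ ≠ t := by
      rintro rfl
      obtain ⟨c, hc⟩ := i₂.deg3 h₁.symm.1 h₂.1 h13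
      rcases hC.share D h13 h₁.symm h₁.oth.symm h₂ t2 (hC.oth_ne D h₁).symm
        ((hc.adj c).2 (.inr (.inr rfl))) with h | h
      · exact hc.ne₂ h.symm
      · exact hc.ne₃ h.symm
    have ht2 : v₂ ≠ t := Ne.symm nM.2.1
    have ht1 : v₁ ≠ t := nM.1.1
    obtain ⟨c, hc⟩ := i₁.deg3 h₁.1 t1.1 ht2
    obtain ⟨q, hq⟩ := i₃.deg3 h₂.symm.1 h₃.1 h24
    obtain ⟨s₄, a, b, d, hd⟩ := i₄
    obtain ⟨e, he⟩ := i₂.deg3 h₁.symm.1 h₂.1 h13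
    obtain rfl : t = e := by
      rcases (he.adj t).1 t2.1 with h | h | h
      · exact (ht1 h.symm).elim
      · exact (ht3 h.symm).elim
      · exact h
    obtain ⟨y, z, h4⟩ : ∃ y z, Deg3 G v₄ v₃ y z := by
      rcases (hd.adj v₃).1 h₃.symm.1 with rfl | rfl | rfl
      · exact ⟨_, _, hd⟩
      · exact ⟨_, _, hd.swap⟩
      · exact ⟨_, _, hd.rot.rot⟩
    exact hC.no_run D i₁.1 i₂.1 i₃.1 s₄ hc.rot.rot he hq h4 h₁.symm h₂ h₃

end Gain

section Touch
open Classical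

variable {V : Type} {G : SimpleGraph V} {S : Set V} {φ : V → Bool}

lemma exists_lnk_change {P : V → Prop} {l : List V} {x t : V} (hx : P x) (ht : t ∈ x :: l)
    (hPt : ¬ P t) : ∃ p q, Lnk (x :: l) p q ∧ P p ∧ ¬ P q := by
  induction l generalizing x with
  | nil =>
    simp only [List.mem_singleton] at ht
    exact (hPt (ht ▸ hx)).elim
  | cons y l ih =>
    by_cases hy : P y
    · have : t ∈ y :: l := by
        rcases List.mem_cons.1 ht with rfl | h
        · exact (hPt hx).elim
        · exact h
      obtain ⟨p, q, h, hp, hq⟩ := ih hy this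
      exact ⟨p, q, .inr (.inr h), hp, hq⟩
    · exact ⟨x, y, .inl ⟨rfl, rfl⟩, hx, hy⟩

variable [Fintype V]

lemma sum_two {a b : V} (hab : a ≠ b) {P : V → Prop} (h : ∀ c, P c ↔ c = a ∨ c = b) (F : V → ℤ) :
    (∑ v, if P v then F v else 0) = F a + F b := by
  rw [← Finset.sum_filter]
  refine Eq.trans (Finset.sum_congr ?_ fun _ _ => rfl) (Finset.sum_pair hab)
  ext c
  simp [h]

noncomputable def dart (D : Dual G) (S : Set V) (x : D.X) (u v : V) : ℤ :=
  wt S u v + fl D S (len D x) (len D (oth D x u v)) u v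

lemma Ctr.sum_bd_two (hC : Ctr G S φ) (D : Dual G) {x : D.X} {u a b : V} (ha : bd D x u a)
    (hb : bd D x u b) (hab : a ≠ b) (F : V → ℤ) :
    (∑ v, if bd D x u v then F v else 0) = F a + F b := by
  refine sum_two hab (fun c => ⟨fun hc => ?_, ?_⟩) F
  · rcases hC.bd_not_three D ha hb hc with h | h | h
    · exact (hab h).elim
    · exact .inl h.symm
    · exact .inr h.symm
  · rintro (rfl | rfl) <;> assumption

lemma Ctr.part_eq (hC : Ctr G S φ) (D : Dual G) {x : D.X} {u a b : V} (ha : bd D x u a)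
    (hb : bd D x u b) (hab : a ≠ b) : part D S x u = dart D S x u a + dart D S x u b :=
  hC.sum_bd_two D ha hb hab _

lemma part_zero (D : Dual G) {x : D.X} {u : V} (hu : u ∉ vf D x) : part D S x u = 0 := by
  refine Finset.sum_eq_zero fun v _ => if_neg fun h => hu (mem_vf.2 ⟨v, h⟩)

lemma charge_eq (D : Dual G) (x : D.X) : charge D S x = -168 + ∑ u ∈ vf D x, part D S x u := by
  rw [charge, Finset.sum_subset (Finset.subset_univ (vf D x))]
  exact fun u _ hu => part_zero D hu

lemma Ctr.mixed (hC : Ctr G S φ) (D : Dual G) {x : D.X} {s t : V} (hs : s ∈ vf D x)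
    (hsS : s ∈ S) (ht : t ∈ vf D x) (htS : t ∉ S) :
    2 ≤ ∑ u ∈ vf D x, ∑ v, (if bd D x u v then if u ∈ S ∧ v ∉ S then (1 : ℤ) else 0 else 0) := by
  have key : ∀ c d, bd D x c d → c ∈ S → ∃ p q, bd D x p q ∧ p ∈ S ∧ q ∉ S ∧ ¬ (p = c ∧ q = d) := by
    intro c d hcd hc
    obtain ⟨M, hM, hMl, hM1, hMv, hMb⟩ := hC.face_open D hcd
    obtain ⟨p, q, h, hp, hq⟩ := exists_lnk_change (P := fun v => v ∈ S) hc ((hMv t).2 ht) htS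
    refine ⟨p, q, (hMb _ _).2 (re_cons_concat.2 (.inl h)), hp, hq, ?_⟩
    rintro ⟨rfl, rfl⟩
    match M, hM1 with
    | m :: M, _ =>
      have := lnk_head hM.2 h
      have hn := hM.2
      simp [this] at hn
  obtain ⟨b, hb⟩ := mem_vf.1 hs
  obtain ⟨c, d, hcd, hc, hd, -⟩ := key s b hb hsS
  obtain ⟨p, q, hpq, hp, hq, hne⟩ := key c d hcd hc
  have e : (∑ u ∈ vf D x, ∑ v, (if bd D x u v then if u ∈ S ∧ v ∉ S then (1 : ℤ) else 0 else 0)) =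
      ∑ z : V × V, if bd D x z.1 z.2 then if z.1 ∈ S ∧ z.2 ∉ S then 1 else 0 else 0 := by
    rw [Fintype.sum_prod_type, Finset.sum_subset (Finset.subset_univ (vf D x))]
    exact fun u _ hu => Finset.sum_eq_zero fun v _ => if_neg fun h => hu (mem_vf.2 ⟨v, h⟩)
  rw [e]
  have : (∑ z ∈ ({(p, q), (c, d)} : Finset (V × V)),
      if bd D x z.1 z.2 then if z.1 ∈ S ∧ z.2 ∉ S then (1 : ℤ) else 0 else 0) = 2 := by
    rw [Finset.sum_pair (by simpa [Prod.ext_iff] using hne)]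
    simp [hpq, hp, hq, hcd, hc, hd]
  rw [← this]
  refine Finset.sum_le_sum_of_subset_of_nonneg (Finset.subset_univ _) fun z _ _ => ?_
  split_ifs <;> norm_num

lemma Ctr.mixed' (hC : Ctr G S φ) (D : Dual G) {x : D.X} {s t : V} (hs : s ∈ vf D x)
    (hsS : s ∈ S) (ht : t ∈ vf D x) (htS : t ∉ S) :
    2 ≤ ∑ u ∈ vf D x, ∑ v, (if bd D x u v then if u ∉ S ∧ v ∈ S then (1 : ℤ) else 0 else 0) := by
  refine (hC.mixed D hs hsS ht htS).trans (le_of_eq ?_)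
  have h : ∀ F : V → V → ℤ, (∑ u ∈ vf D x, ∑ v, (if bd D x u v then F u v else 0)) =
      ∑ u, ∑ v, (if bd D x u v then F u v else 0) := fun F =>
    Finset.sum_subset (Finset.subset_univ (vf D x)) fun u _ hu =>
      Finset.sum_eq_zero fun v _ => if_neg fun h => hu (mem_vf.2 ⟨v, h⟩)
  rw [h, h, Finset.sum_comm]
  refine Finset.sum_congr rfl fun u _ => Finset.sum_congr rfl fun v _ => ?_
  have : bd D x v u ↔ bd D x u v := ⟨bd.symm, bd.symm⟩
  simp only [this, and_comm]

/-- The internal vertices of a face. -/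
noncomputable def inn (D : Dual G) (S : Set V) (x : D.X) : Finset V := (vf D x).filter (· ∉ S)

lemma Ctr.charge_ge (hC : Ctr G S φ) (D : Dual G) {x : D.X} {s t : V} (hs : s ∈ vf D x)
    (hsS : s ∈ S) (ht : t ∈ vf D x) (htS : t ∉ S) {α β γ δ : ℤ} (hγ : 0 ≤ γ) (hδ : 0 ≤ δ)
    (h : ∀ u a b, a ≠ b → bd D x u a → bd D x u b →
      (α + if u ∈ S then γ * ((if a ∉ S then 1 else 0) + if b ∉ S then 1 else 0)
        else β + δ * ((if a ∈ S then 1 else 0) + if b ∈ S then 1 else 0)) ≤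
        dart D S x u a + dart D S x u b) :
    -168 + α * len D x + β * (inn D S x).card + 2 * γ + 2 * δ ≤ charge D S x := by
  have h1 := hC.mixed D hs hsS ht htS
  have h2 := hC.mixed' D hs hsS ht htS
  have h3 : ∀ u ∈ vf D x, α + β * (if u ∉ S then 1 else 0) +
      γ * (∑ v, (if bd D x u v then if u ∈ S ∧ v ∉ S then (1 : ℤ) else 0 else 0)) +
      δ * (∑ v, (if bd D x u v then if u ∉ S ∧ v ∈ S then (1 : ℤ) else 0 else 0)) ≤
      part D S x u := by
    intro u hu
    obtain ⟨a, b, hab, hu⟩ := hC.bd_two D hu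
    have ha := (hu a).2 (.inl rfl)
    have hb := (hu b).2 (.inr rfl)
    rw [hC.part_eq D ha hb hab, hC.sum_bd_two D ha hb hab, hC.sum_bd_two D ha hb hab]
    refine le_of_eq_of_le ?_ (h u a b hab ha hb)
    by_cases hu : u ∈ S
    · simp [hu]
    · simp [hu]; ring
  have h4 := Finset.sum_le_sum h3
  simp only [Finset.sum_add_distrib, ← Finset.mul_sum] at h4
  have h5 : (∑ u ∈ vf D x, if u ∉ S then (1 : ℤ) else 0) = (inn D S x).card := by
    rw [inn, Finset.card_filter]; push_cast; rfl
  rw [h5, Finset.sum_const, nsmul_eq_mul] at h4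
  have h6 : ((vf D x).card : ℤ) = len D x := rfl
  rw [h6] at h4
  rw [charge_eq]
  nlinarith

lemma hh_bounds (D : Dual G) (v : V) : 0 ≤ hh D S v ∧ hh D S v ≤ 7 ∧ (v ∉ S → hh D S v ≤ 6) ∧
    (Int3 G S v → hh D S v = 4) ∧ (v ∈ S → hh D S v = 7) := by
  have : v ∈ S → ¬ Int3 G S v := fun h h' => h'.1 h
  unfold hh
  by_cases h1 : Int3 G S v <;> by_cases h2 : v ∈ S
  · exact (this h2 h1).elim
  all_goals simp only [h1, h2, if_true, if_false]; (try split_ifs) <;> simp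

lemma fl_bdry (D : Dual G) {a b : ℕ} {u v : V} (hu : u ∈ S) (hv : v ∉ S) :
    fl D S a b u v = if a = 3 then 7 else if b = 3 then -7 else 0 := by
  have hi : ¬ Int3 G S u := fun h => h.1 hu
  simp only [fl, hu, hv, hi, if_true, if_false, true_and, not_true, false_and, and_false]
  split_ifs <;> rfl

lemma fl_int3 (D : Dual G) {a b : ℕ} {u v : V} (hu : Int3 G S u) :
    fl D S a b u v = if a = 3 then 14 else if b = 3 then -14 else if a = 4 ∧ 7 ≤ b then hh D S v
      else if b = 4 ∧ 7 ≤ a then - hh D S v else 0 := by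
  simp only [fl, hu.1, hu, if_true, if_false, false_and, not_true, and_false]

lemma fl_big (D : Dual G) {a b : ℕ} {u v : V} (hu : u ∉ S) (hi : ¬ Int3 G S u) :
    fl D S a b u v = if a = 3 then 14 else if b = 3 then gg D u - 14
      else if a = 4 ∧ 7 ≤ b then gg D u else if b = 4 ∧ 7 ≤ a then 0
      else if a = 5 ∧ b ≠ 4 then (if b = 5 then 7 else 14) else 0 := by
  simp only [fl, hu, hi, if_false, false_and, not_false_eq_true, and_true]

lemma wt_eq {u v : V} : wt S u v = if u ∈ S then (if v ∈ S then 7 else 28) else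
    if v ∈ S then 28 else 14 := by
  by_cases hu : u ∈ S <;> by_cases hv : v ∈ S <;> simp [wt, hu, hv]

lemma dart_bdry (D : Dual G) {x : D.X} {u v : V} (hu : u ∈ S) :
    dart D S x u v = 7 + if v ∉ S then 21 + (if len D x = 3 then 7 else
      if len D (oth D x u v) = 3 then -7 else 0) else 0 := by
  rw [dart, wt_eq, if_pos hu]
  by_cases hv : v ∈ S
  · simp [hv, fl_zero D hu hv]
  · rw [fl_bdry D hu hv]; simp only [hv, if_false, not_false_eq_true, if_true]; ring

lemma dart_int (D : Dual G) {x : D.X} {u v : V} (hu : u ∉ S) : dart D S x u v =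
    14 + 14 * (if v ∈ S then 1 else 0) + fl D S (len D x) (len D (oth D x u v)) u v := by
  rw [dart, wt_eq, if_neg hu]
  split_ifs <;> ring

end Touch

section Touch
open Classical

variable {V : Type} [Fintype V] {G : SimpleGraph V} {S : Set V} {φ : V → Bool}

lemma Ctr.fl_pair (hC : Ctr G S φ) (D : Dual G) {x : D.X} {u a b : V} (hu : u ∉ S)
    (ha : bd D x u a) (hb : bd D x u b) (hab : a ≠ b) :
    -14 ≤ fl D S (len D x) (len D (oth D x u a)) u a + fl D S (len D x) (len D (oth D x u b)) u b ∧
    (len D x ≤ 8 → -7 ≤ fl D S (len D x) (len D (oth D x u a)) u a +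
      fl D S (len D x) (len D (oth D x u b)) u b) ∧
    (len D x = 3 → 28 ≤ fl D S (len D x) (len D (oth D x u a)) u a +
      fl D S (len D x) (len D (oth D x u b)) u b) ∧
    (len D x ≤ 6 ∨ ¬ Int3 G S u → 0 ≤ fl D S (len D x) (len D (oth D x u a)) u a ∧
      0 ≤ fl D S (len D x) (len D (oth D x u b)) u b) := by
  have l1 := hC.len_edge D ha ha.oth (hC.oth_ne D ha).symm
  have l2 := hC.len_edge D hb hb.oth (hC.oth_ne D hb).symm
  have ea := hh_bounds (S := S) D a
  have eb := hh_bounds (S := S) D b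
  have eg := gg_or D u
  by_cases hi : Int3 G S u
  · have f1 := hC.int3_faces D hi ha hb hab
    have f2 := hC.int3_faces D hi hb ha hab.symm
    have k : ∀ (n A : ℕ) (v : V), (n = 3 ∧ fl D S n A u v = 14) ∨
        (n ≠ 3 ∧ A = 3 ∧ fl D S n A u v = -14) ∨ (n = 4 ∧ A ≠ 3 ∧ fl D S n A u v = hh D S v) ∨
        (7 ≤ n ∧ A = 4 ∧ fl D S n A u v = -hh D S v) ∨ (n ≠ 3 ∧ A ≠ 3 ∧ fl D S n A u v = 0) := by
      intro n A v
      rw [fl_int3 D hi]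
      split_ifs <;> simp <;> omega
    have k1 := k (len D x) (len D (oth D x u a)) a
    have k2 := k (len D x) (len D (oth D x u b)) b
    generalize fl D S (len D x) (len D (oth D x u a)) u a = p at *
    generalize fl D S (len D x) (len D (oth D x u b)) u b = q at *
    refine ⟨by omega, by omega, by omega, fun h => ?_⟩
    have := h.resolve_right (not_not.2 hi)
    omega
  · have k : ∀ (n A : ℕ) (v : V), (n = 3 ∧ fl D S n A u v = 14) ∨
        (n ≠ 3 ∧ 0 ≤ fl D S n A u v) := by
      intro n A v
      rw [fl_big D hu hi]
      split_ifs <;> simp <;> omega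
    have k1 := k (len D x) (len D (oth D x u a)) a
    have k2 := k (len D x) (len D (oth D x u b)) b
    generalize fl D S (len D x) (len D (oth D x u a)) u a = p at *
    generalize fl D S (len D x) (len D (oth D x u b)) u b = q at *
    exact ⟨by omega, by omega, by omega, fun _ => by omega⟩

lemma Ctr.not_int3_of_inn (hC : Ctr G S φ) (D : Dual G) {x : D.X} {u : V} (hu : u ∈ vf D x)
    (huS : u ∉ S) (h1 : (inn D S x).card = 1) (h4 : 4 ≤ len D x) (h5 : len D x ≤ 5) :
    ¬ Int3 G S u := by
  intro hi
  have hS : ∀ v ∈ vf D x, v ≠ u → v ∈ S := by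
    intro v hv hvu
    by_contra hvS
    obtain ⟨w, hw⟩ := Finset.card_eq_one.1 h1
    have e1 : v ∈ inn D S x := Finset.mem_filter.2 ⟨hv, hvS⟩
    have e2 : u ∈ inn D S x := Finset.mem_filter.2 ⟨hu, huS⟩
    rw [hw, Finset.mem_singleton] at e1 e2
    exact hvu (e1.trans e2.symm)
  obtain ⟨c, hc⟩ := mem_vf.1 hu
  obtain ⟨M, hM, hMl, -, hMv, hMb⟩ := hC.face_open D hc
  match M, (by omega : M.length ≠ 0) with
  | c' :: M, _ =>
    rw [pth_cons] at hM
    have hn := hM.2.1.2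
    simp only [List.length_cons] at hMl
    have hc' : bd D x u c' := by rw [hMb, re_cons_concat]; simp [Lnk]
    have hcc : c' ≠ c := by rintro rfl; simp at hn
    obtain ⟨t, ht⟩ := hi.deg3 hc'.1 hc.1 hcc
    refine hC.two_chord D ht huS hM.2.1 (fun y hy => hS y ((hMv y).1 (.tail _ hy)) ?_)
      (by omega) (by omega) hc' hc ?_
    · rintro rfl
      rcases List.mem_cons.1 hy with rfl | hy
      · exact hc'.1.ne rfl
      rcases List.mem_append.1 hy with hy | hy
      · exact hM.2.2.1 hy
      · exact hM.2.2.2 (List.mem_singleton.1 hy)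
    · match M, (by omega : M.length ≠ 0) with
      | m :: M, _ => exact ⟨m, by simp, (hMv m).1 (by simp)⟩

/-- Faces with both internal and boundary vertices end up with nonnegative charge. -/
lemma Ctr.touched (hC : Ctr G S φ) (D : Dual G) {x : D.X} {s t : V} (hs : s ∈ vf D x)
    (hsS : s ∈ S) (ht : t ∈ vf D x) (htS : t ∉ S) :
    0 ≤ charge D S x ∧ (9 ≤ len D x → 14 ≤ charge D S x) := by
  have hpos : 1 ≤ (inn D S x).card := Finset.card_pos.2 ⟨t, Finset.mem_filter.2 ⟨ht, htS⟩⟩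
  have h3 := hC.len_ge D x
  have main : ∀ β γ : ℤ, 0 ≤ γ → γ ≤ (if len D x = 3 then 28 else if len D x ≤ 8 then 21 else 14) →
      (∀ u a b, a ≠ b → bd D x u a → bd D x u b → u ∉ S →
        β ≤ 14 + fl D S (len D x) (len D (oth D x u a)) u a +
          fl D S (len D x) (len D (oth D x u b)) u b) →
      -168 + 14 * len D x + β * (inn D S x).card + 2 * γ + 2 * 14 ≤ charge D S x := by
    intro β γ hγ hγ' h
    refine hC.charge_ge D hs hsS ht htS hγ (by norm_num) fun u a b hab ha hb => ?_
    by_cases hu : u ∈ S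
    · rw [dart_bdry D hu, dart_bdry D hu, if_pos hu]
      have l1 := hC.len_edge D ha ha.oth (hC.oth_ne D ha).symm
      have l2 := hC.len_edge D hb hb.oth (hC.oth_ne D hb).symm
      have key : ∀ (w : V) (p : ℕ), (p = 3 → 9 ≤ len D x) → γ * (if w ∉ S then 1 else 0) ≤
          if w ∉ S then (21 : ℤ) + (if len D x = 3 then 7 else if p = 3 then -7 else 0) else 0 := by
        intro w p hp
        by_cases hw : w ∈ S
        · simp [hw]
        · simp only [hw, not_false_eq_true, if_true]
          split_ifs at hγ' ⊢ <;> omega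
      have := key a _ l1.2.2.2
      have := key b _ l2.2.2.2
      rw [mul_add]
      linarith
    · rw [dart_int D hu, dart_int D hu, if_neg hu]
      have := h u a b hab ha hb hu
      linarith
  by_cases h9 : 9 ≤ len D x
  · have := main 0 14 (by norm_num) (by split_ifs <;> omega) fun u a b hab ha hb hu => by
      have := (hC.fl_pair D hu ha hb hab).1
      linarith
    constructor
    · omega
    · intro; omega
  refine ⟨?_, fun h => (h9 h).elim⟩
  by_cases h7 : 7 ≤ len D x
  · have := main 7 21 (by norm_num) (by split_ifs <;> omega) fun u a b hab ha hb hu => by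
      have := (hC.fl_pair D hu ha hb hab).2.1 (by omega)
      linarith
    omega
  by_cases e3 : len D x = 3
  · have := main 42 28 (by norm_num) (by simp [e3]) fun u a b hab ha hb hu => by
      have := (hC.fl_pair D hu ha hb hab).2.2.1 e3
      linarith
    omega
  have m14 := main 14 21 (by norm_num) (by split_ifs <;> omega) fun u a b hab ha hb hu => by
      have := (hC.fl_pair D hu ha hb hab).2.2.2 (by omega)
      linarith
  by_cases hex : 6 ≤ len D x ∨ len D x = 5 ∧ 2 ≤ (inn D S x).card ∨
      len D x = 4 ∧ 3 ≤ (inn D S x).card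
  · omega
  -- the remaining faces have length four or five and few internal vertices
  have hcard : (inn D S x).card + ((vf D x).filter (· ∈ S)).card = len D x := by
    rw [inn, add_comm, Finset.card_filter_add_card_filter_not]; rfl
  obtain ⟨L, hL, hSL⟩ : ∃ L, AdmRing G L ∧ S = {x | x ∈ L} := by
    rcases hC.adm with ⟨z, hz⟩ | h
    · have : ((vf D x).filter (· ∈ S)).card ≤ 1 := Finset.card_le_one.2 fun p hp q hq => by
        have h1 := (Finset.mem_filter.1 hp).2
        have h2 := (Finset.mem_filter.1 hq).2
        rw [hz] at h1 h2
        exact h1.trans h2.symm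
      omega
    · exact h
  have thick : ∀ u v, G.Adj u v → u ∉ S → Thick G u ∧ Thick G v := fun u v huv hu =>
    ⟨hC.thick hu huv, hC.thick_ring hL hSL hu huv⟩
  by_cases e5 : len D x = 5
  · have hc1 : (inn D S x).card = 1 := by omega
    have := main 28 21 (by norm_num) (by split_ifs <;> omega) fun u a b hab ha hb hu => by
      have hi := hC.not_int3_of_inn D (mem_vf.2 ⟨a, ha⟩) hu hc1 (by omega) (by omega)
      have key : ∀ a, bd D x u a → 7 ≤ fl D S (len D x) (len D (oth D x u a)) u a := by
        intro a ha
        have l1 := hC.len_edge D ha ha.oth (hC.oth_ne D ha).symm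
        have h4 : len D (oth D x u a) ≠ 4 := fun h => by
          have := hC.quad_thick D (hC.oth_ne D ha) ha.oth ha h (thick u a ha.1 hu).1
            (thick u a ha.1 hu).2
          omega
        rw [fl_big D hu hi]
        split_ifs <;> omega
      have := key a ha
      have := key b hb
      linarith
    omega
  · have e4 : len D x = 4 := by omega
    have h7 : ∀ u a, u ∉ S → bd D x u a → 7 ≤ len D (oth D x u a) := fun u a hu ha =>
      hC.quad_thick D (hC.oth_ne D ha).symm ha ha.oth e4 (thick u a ha.1 hu).1 (thick u a ha.1 hu).2
    have big : ∀ u a, u ∉ S → bd D x u a → ¬ Int3 G S u →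
        14 ≤ fl D S (len D x) (len D (oth D x u a)) u a := by
      intro u a hu ha hi
      have := h7 u a hu ha
      have := gg_or D u
      rw [fl_big D hu hi]
      split_ifs <;> omega
    by_cases hc1 : (inn D S x).card = 1
    · have := main 42 21 (by norm_num) (by split_ifs <;> omega) fun u a b hab ha hb hu => by
        have hi := hC.not_int3_of_inn D (mem_vf.2 ⟨a, ha⟩) hu hc1 (by omega) (by omega)
        have := big u a hu ha hi
        have := big u b hu hb hi
        linarith
      omega
    · have hc2 : (inn D S x).card = 2 := by omega
      have := main 21 21 (by norm_num) (by split_ifs <;> omega) fun u a b hab ha hb hu => by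
        by_cases hi : Int3 G S u
        · have key : ∀ a, bd D x u a → fl D S (len D x) (len D (oth D x u a)) u a = hh D S a := by
            intro a ha
            have := h7 u a hu ha
            rw [fl_int3 D hi, if_neg (by omega), if_neg (by omega), if_pos (by omega)]
          have ea := hh_bounds (S := S) D a
          have eb := hh_bounds (S := S) D b
          rw [key a ha, key b hb]
          have : a ∈ S ∨ b ∈ S := by
            by_contra! hn
            have hsub : ({u, a, b} : Finset V) ⊆ inn D S x := by
              intro z
              simp only [Finset.mem_insert, Finset.mem_singleton, inn, Finset.mem_filter]
              rintro (rfl | rfl | rfl)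
              · exact ⟨mem_vf.2 ⟨_, ha⟩, hu⟩
              · exact ⟨mem_vf.2 ⟨_, ha.symm⟩, hn.1⟩
              · exact ⟨mem_vf.2 ⟨_, hb.symm⟩, hn.2⟩
            have h3 : ({u, a, b} : Finset V).card = 3 :=
              Finset.card_eq_three.2 ⟨u, a, b, ha.1.ne, hb.1.ne, hab, rfl⟩
            have := Finset.card_le_card hsub
            omega
          rcases this with h | h
          · have := ea.2.2.2.2 h
            linarith [eb.1]
          · have := eb.2.2.2.2 h
            linarith [ea.1]
        · have := big u a hu ha hi
          have := big u b hu hb hi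
          linarith
      omega

end Touch

section Unt
open Classical

variable {V : Type} [Fintype V] {G : SimpleGraph V} {S : Set V} {φ : V → Bool}

/-- What the face `x` receives through the vertex `u`. -/
noncomputable def fp (D : Dual G) (S : Set V) (x : D.X) (u : V) : ℤ :=
  ∑ v, if bd D x u v then fl D S (len D x) (len D (oth D x u v)) u v else 0

lemma Ctr.fp_eq (hC : Ctr G S φ) (D : Dual G) {x : D.X} {u a b : V} (ha : bd D x u a)
    (hb : bd D x u b) (hab : a ≠ b) :
    fp D S x u = fl D S (len D x) (len D (oth D x u a)) u a +
      fl D S (len D x) (len D (oth D x u b)) u b := hC.sum_bd_two D ha hb hab _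

lemma Ctr.charge_fp (hC : Ctr G S φ) (D : Dual G) {x : D.X} (hx : ∀ v ∈ vf D x, v ∉ S) :
    charge D S x = -168 + 28 * len D x + ∑ u ∈ vf D x, fp D S x u := by
  have h : ∀ u ∈ vf D x, part D S x u = 28 + fp D S x u := by
    intro u hu
    obtain ⟨a, b, hab, h⟩ := hC.bd_two D hu
    have ha := (h a).2 (.inl rfl)
    have hb := (h b).2 (.inr rfl)
    rw [hC.part_eq D ha hb hab, hC.fp_eq D ha hb hab, dart_int D (hx u hu), dart_int D (hx u hu),
      if_neg (hx a (mem_vf.2 ⟨_, ha.symm⟩)), if_neg (hx b (mem_vf.2 ⟨_, hb.symm⟩))]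
    ring
  rw [charge_eq, Finset.sum_congr rfl h, Finset.sum_add_distrib, Finset.sum_const, nsmul_eq_mul]
  have h6 : ((vf D x).card : ℤ) = len D x := rfl
  rw [h6]
  ring

lemma Ctr.fp_ge (hC : Ctr G S φ) (D : Dual G) {x : D.X} {u : V} (hu : u ∈ vf D x) (huS : u ∉ S) :
    -14 ≤ fp D S x u ∧ (len D x ≤ 8 → -7 ≤ fp D S x u) ∧ (len D x = 3 → 28 ≤ fp D S x u) ∧
      (len D x ≤ 6 ∨ ¬ Int3 G S u → 0 ≤ fp D S x u) := by
  obtain ⟨a, b, hab, h⟩ := hC.bd_two D hu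
  have ha := (h a).2 (.inl rfl)
  have hb := (h b).2 (.inr rfl)
  rw [hC.fp_eq D ha hb hab]
  have := hC.fl_pair D huS ha hb hab
  exact ⟨this.1, this.2.1, this.2.2.1, fun h => add_nonneg (this.2.2.2 h).1 (this.2.2.2 h).2⟩

lemma hh_of_not_int3 (D : Dual G) {v : V} (hv : v ∉ S) (hi : ¬ Int3 G S v) :
    hh D S v = if gg D v = 14 then 6 else 0 := by
  simp [hh, hv, hi]

lemma Ctr.unt_four (hC : Ctr G S φ) (D : Dual G) {x : D.X} (hx : ∀ v ∈ vf D x, v ∉ S)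
    (h4 : len D x = 4) : 56 ≤ ∑ u ∈ vf D x, fp D S x u := by
  have hS : ∀ u v, bd D x u v → u ∉ S := fun u v h => hx u (mem_vf.2 ⟨_, h⟩)
  have h7 : ∀ u a, bd D x u a → 7 ≤ len D (oth D x u a) := fun u a ha =>
    hC.quad_thick D (hC.oth_ne D ha).symm ha ha.oth h4 (hC.thick (hS _ _ ha) ha.1)
      (hC.thick (hS _ _ ha.symm) ha.1.symm)
  have h0 : ∀ u ∈ vf D x, 0 ≤ fp D S x u := fun u hu => (hC.fp_ge D hu (hx u hu)).2.2.2 (by omega)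
  have big : ∀ u ∈ vf D x, ¬ Int3 G S u → fp D S x u = 2 * gg D u := by
    intro u hu hi
    obtain ⟨a, b, hab, h⟩ := hC.bd_two D hu
    have ha := (h a).2 (.inl rfl)
    have hb := (h b).2 (.inr rfl)
    have := h7 u a ha
    have := h7 u b hb
    rw [hC.fp_eq D ha hb hab, fl_big D (hx u hu) hi, fl_big D (hx u hu) hi, if_neg (by omega),
      if_neg (by omega), if_pos (by omega), if_neg (by omega), if_neg (by omega), if_pos (by omega)]
    ring
  have small : ∀ u a b, bd D x u a → bd D x u b → a ≠ b → Int3 G S u →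
      fp D S x u = hh D S a + hh D S b := by
    intro u a b ha hb hab hi
    have := h7 u a ha
    have := h7 u b hb
    rw [hC.fp_eq D ha hb hab, fl_int3 D hi, fl_int3 D hi, if_neg (by omega),
      if_neg (by omega), if_pos (by omega), if_neg (by omega), if_neg (by omega), if_pos (by omega)]
  obtain ⟨u, hu, hi⟩ : ∃ u ∈ vf D x, ¬ Int3 G S u := by
    by_contra! h
    exact hC.quad D h4 h
  have bu := big u hu hi
  have g := gg_or D u
  by_cases hg : gg D u = 28
  · exact le_trans (by rw [bu, hg]; norm_num) (Finset.single_le_sum h0 hu)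
  by_cases h2 : ∃ v ∈ vf D x, v ≠ u ∧ ¬ Int3 G S v
  · obtain ⟨v, hv, hvu, hvi⟩ := h2
    have bv := big v hv hvi
    have g' := gg_or D v
    have := Finset.sum_le_sum_of_subset_of_nonneg (s := {v, u}) (t := vf D x) (f := fp D S x)
      (by intro z; simp only [Finset.mem_insert, Finset.mem_singleton]; rintro (rfl | rfl) <;>
        assumption) fun z hz _ => h0 z hz
    rw [Finset.sum_pair hvu] at this
    omega
  push Not at h2
  obtain ⟨a, ha⟩ := mem_vf.1 hu
  obtain ⟨M, hM, hMl, -, hMv, hMb⟩ := hC.face_open D ha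
  match M, (by omega : M.length = 2) with
  | [c, d], _ =>
    have nd := hM.2
    simp only [List.nodup_cons, List.mem_cons, List.cons_append, List.nil_append, List.not_mem_nil,
      or_false, not_or, List.nodup_nil, and_true, not_false_eq_true] at nd
    obtain ⟨⟨uc, ud, ua⟩, ⟨cd, ca⟩, da⟩ := nd
    have b1 : bd D x u c := by rw [hMb, re_cons_concat]; simp [Lnk]
    have b2 : bd D x c d := by rw [hMb, re_cons_concat]; simp [Lnk]
    have b3 : bd D x d a := by rw [hMb, re_cons_concat]; simp [Lnk]
    have ic := h2 c (mem_vf.2 ⟨_, b2⟩) (Ne.symm uc)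
    have id' := h2 d (mem_vf.2 ⟨_, b3⟩) (Ne.symm ud)
    have ia := h2 a (mem_vf.2 ⟨_, b3.symm⟩) (Ne.symm ua)
    have s1 := small c u d b1.symm b2 ud ic
    have s2 := small d c a b2.symm b3 ca id'
    have s3 := small a d u b3.symm ha.symm (Ne.symm ud) ia
    rw [hh_of_not_int3 D (hx u hu) hi] at s1 s3
    have ec := (hh_bounds (S := S) D c).2.2.2.1 ic
    have ed := (hh_bounds (S := S) D d).2.2.2.1 id'
    have ea := (hh_bounds (S := S) D a).2.2.2.1 ia
    have e : vf D x = {u, c, d, a} := by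
      ext z
      rw [← hMv]
      simp
    rw [e, Finset.sum_insert (by simp [uc, ud, ua]), Finset.sum_insert (by simp [cd, ca]),
      Finset.sum_pair da]
    split_ifs at s1 s3 <;> omega

lemma Ctr.unt_five (hC : Ctr G S φ) (D : Dual G) {x : D.X} (hx : ∀ v ∈ vf D x, v ∉ S)
    (h5 : len D x = 5) : 28 ≤ ∑ u ∈ vf D x, fp D S x u := by
  have hS : ∀ u v, bd D x u v → u ∉ S := fun u v h => hx u (mem_vf.2 ⟨_, h⟩)
  have thick : ∀ u v, bd D x u v → Thick G u := fun u v h => hC.thick (hS u v h) h.1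
  have h0 : ∀ u ∈ vf D x, 0 ≤ fp D S x u := fun u hu => (hC.fp_ge D hu (hx u hu)).2.2.2 (by omega)
  have big : ∀ u ∈ vf D x, ¬ Int3 G S u → 14 ≤ fp D S x u ∧
      ((∀ v, bd D x u v → len D (oth D x u v) ≠ 5) → 28 ≤ fp D S x u) := by
    intro u hu hi
    obtain ⟨a, b, hab, h⟩ := hC.bd_two D hu
    have ha := (h a).2 (.inl rfl)
    have hb := (h b).2 (.inr rfl)
    have key : ∀ v, bd D x u v → fl D S (len D x) (len D (oth D x u v)) u v =
        if len D (oth D x u v) = 5 then 7 else 14 := by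
      intro v hv
      have l1 := hC.len_edge D hv hv.oth (hC.oth_ne D hv).symm
      have : len D (oth D x u v) ≠ 4 := fun h => by
        have := hC.quad_thick D (hC.oth_ne D hv) hv.oth hv h (thick _ _ hv) (thick _ _ hv.symm)
        omega
      rw [fl_big D (hx u hu) hi, if_neg (by omega), if_neg (by omega), if_neg (by omega),
        if_neg (by omega), if_pos (by omega)]
    rw [hC.fp_eq D ha hb hab, key a ha, key b hb]
    refine ⟨by split_ifs <;> norm_num, fun h => ?_⟩
    rw [if_neg (h a ha), if_neg (h b hb)]
    norm_num
  obtain ⟨u, hu, hi⟩ : ∃ u ∈ vf D x, ¬ Int3 G S u := by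
    by_contra! h
    exact hC.pent D h5 h
  have bu := big u hu hi
  by_cases h : ∀ v, bd D x u v → len D (oth D x u v) ≠ 5
  · exact (bu.2 h).trans (Finset.single_le_sum h0 hu)
  push Not at h
  obtain ⟨v, hv, h55⟩ := h
  obtain ⟨d, hd, hdu, -, hdi⟩ := hC.pent_pent D (hC.oth_ne D hv).symm hv hv.oth h5 h55
    (thick _ _ hv) (thick _ _ hv.symm)
  have bd' := big d hd hdi
  have := Finset.sum_le_sum_of_subset_of_nonneg (s := {d, u}) (t := vf D x) (f := fp D S x)
      (by intro z; simp only [Finset.mem_insert, Finset.mem_singleton]; rintro (rfl | rfl) <;>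
        assumption) fun z hz _ => h0 z hz
  rw [Finset.sum_pair hdu] at this
  omega

lemma Ctr.unt_seven (hC : Ctr G S φ) (D : Dual G) {x : D.X} (hx : ∀ v ∈ vf D x, v ∉ S)
    (h7 : len D x = 7) : -28 ≤ ∑ u ∈ vf D x, fp D S x u := by
  let P : V → V → Prop := fun u v => Int3 G S u ∧ ¬ Int3 G S v ∧ gg D v = 14
  let τ : V → V → ℤ := fun u v => (if P u v then 2 else 0) - (if P v u then 2 else 0)
  have hτ : ∑ u ∈ vf D x, ∑ v, (if bd D x u v then τ u v else 0) = 0 := by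
    rw [Finset.sum_subset (Finset.subset_univ (vf D x)) fun u _ hu =>
      Finset.sum_eq_zero fun v _ => if_neg fun h => hu (mem_vf.2 ⟨v, h⟩)]
    have e : ∑ u, ∑ v, (if bd D x u v then τ u v else 0) =
        -∑ u, ∑ v, (if bd D x u v then τ u v else 0) := by
      conv_lhs => rw [Finset.sum_comm]
      simp only [← Finset.sum_neg_distrib]
      refine Finset.sum_congr rfl fun u _ => Finset.sum_congr rfl fun v _ => ?_
      have : bd D x v u ↔ bd D x u v := ⟨bd.symm, bd.symm⟩
      simp only [this, τ]
      split_ifs <;> norm_num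
    omega
  have h : ∀ u ∈ vf D x, -4 ≤ fp D S x u + ∑ v, (if bd D x u v then τ u v else 0) := by
    intro u hu
    obtain ⟨a, b, hab, h⟩ := hC.bd_two D hu
    have ha := (h a).2 (.inl rfl)
    have hb := (h b).2 (.inr rfl)
    rw [hC.sum_bd_two D ha hb hab]
    by_cases hi : Int3 G S u
    · have l1 := hC.len_edge D ha ha.oth (hC.oth_ne D ha).symm
      have l2 := hC.len_edge D hb hb.oth (hC.oth_ne D hb).symm
      have f1 := (hC.int3_faces D hi ha hb hab).2 (by omega)
      have key : ∀ v, bd D x u v → 0 ≤ τ u v ∧ -4 ≤ -hh D S v + τ u v := by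
        intro v hv
        have hvS := hx v (mem_vf.2 ⟨_, hv.symm⟩)
        by_cases hvi : Int3 G S v
        · have := (hh_bounds (S := S) D v).2.2.2.1 hvi
          simp [τ, P, hi, hvi, this]
        · rw [hh_of_not_int3 D hvS hvi]
          by_cases hg : gg D v = 14 <;> simp [τ, P, hi, hvi, hg]
      have ka := key a ha
      have kb := key b hb
      rw [hC.fp_eq D ha hb hab, fl_int3 D hi, fl_int3 D hi]
      split_ifs <;> omega
    · have := (hC.fp_ge D hu (hx u hu)).2.2.2 (.inr hi)
      have key : ∀ v, -2 ≤ τ u v := by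
        intro v
        simp only [τ]
        split_ifs <;> norm_num
      have := key a
      have := key b
      omega
  have h1 := Finset.sum_le_sum h
  rw [Finset.sum_add_distrib, hτ, Finset.sum_const, nsmul_eq_mul] at h1
  have h6 : ((vf D x).card : ℤ) = len D x := rfl
  rw [h6] at h1
  omega

end Unt

section Unt
open Classical

variable {V : Type} [Fintype V] {G : SimpleGraph V} {S : Set V} {φ : V → Bool}

lemma Ctr.fp_int3 (hC : Ctr G S φ) (D : Dual G) {x : D.X} (hx : ∀ v ∈ vf D x, v ∉ S)
    (h9 : 9 ≤ len D x) {u a b : V} (hi : Int3 G S u) (ha : bd D x u a) (hb : bd D x u b)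
    (hab : a ≠ b) (h3 : len D (oth D x u a) ≠ 3) (h3' : len D (oth D x u b) ≠ 3) :
    -6 ≤ fp D S x u ∧ ((len D (oth D x u a) = 4 → hh D S a = 0) →
      (len D (oth D x u b) = 4 → hh D S b = 0) → 0 ≤ fp D S x u) := by
  have f1 := (hC.int3_faces D hi ha hb hab).2 (by omega)
  have ea := (hh_bounds (S := S) D a).2.2.1 (hx a (mem_vf.2 ⟨_, ha.symm⟩))
  have eb := (hh_bounds (S := S) D b).2.2.1 (hx b (mem_vf.2 ⟨_, hb.symm⟩))
  rw [hC.fp_eq D ha hb hab, fl_int3 D hi, fl_int3 D hi]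
  split_ifs <;> omega

lemma Ctr.fp_big (hC : Ctr G S φ) (D : Dual G) {x : D.X} (h9 : 9 ≤ len D x) {u a b : V}
    (hu : u ∉ S) (hi : ¬ Int3 G S u) (ha : bd D x u a) (hb : bd D x u b) (hab : a ≠ b) :
    0 ≤ fp D S x u ∧ (gg D u = 28 → len D (oth D x u a) = 3 → 14 ≤ fp D S x u) := by
  have := gg_or D u
  rw [hC.fp_eq D ha hb hab, fl_big D hu hi, fl_big D hu hi]
  split_ifs <;> omega

lemma exists_append_pair {α : Type} {l : List α} (h : 2 ≤ l.length) :
    ∃ l' a b, l = l' ++ [a, b] := by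
  rcases List.eq_nil_or_concat l with rfl | ⟨l₁, b, rfl⟩
  · simp at h
  rcases List.eq_nil_or_concat l₁ with rfl | ⟨l₂, a, rfl⟩
  · simp at h
  exact ⟨l₂, a, b, by simp⟩

lemma lnk_of_append {l l' : List V} {a b : V} (h : Lnk l' a b) : Lnk (l ++ l') a b := by
  induction l with
  | nil => exact h
  | cons x l ih =>
    cases h' : l ++ l' with
    | nil => rw [h'] at ih; exact ih.elim
    | cons y m =>
      rw [List.cons_append, h']
      rw [h'] at ih
      exact .inr (.inr ih)

/-- With at most one vertex that is not internal of degree three, triangles are not next to edges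
joining two internal vertices of degree three. -/
lemma Ctr.no_tri (hC : Ctr G S φ) (D : Dual G) {x : D.X} (h9 : 9 ≤ len D x)
    (h1 : ∀ p ∈ vf D x, ∀ q ∈ vf D x, ¬ Int3 G S p → ¬ Int3 G S q → p = q) {u v : V}
    (hu : Int3 G S u) (hv : Int3 G S v) (huv : bd D x u v) : len D (oth D x u v) ≠ 3 := by
  intro ht
  obtain ⟨M, hM, hMl, -, hMv, hMb⟩ := hC.face_open D huv
  obtain ⟨m₁, m₂, M, rfl⟩ : ∃ m₁ m₂ M', M = m₁ :: m₂ :: M' := by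
    match M, (by omega : 2 ≤ M.length) with
    | m₁ :: m₂ :: M, _ => exact ⟨m₁, m₂, M, rfl⟩
  simp only [List.length_cons] at hMl
  obtain ⟨M, k₂, k₁, rfl⟩ := exists_append_pair (by omega : 2 ≤ M.length)
  have e : u :: ((m₁ :: m₂ :: (M ++ [k₂, k₁])) ++ [v]) = [u, m₁, m₂] ++ (M ++ [k₂, k₁, v]) := by simp
  have hn := hM.2
  have hM' := hMv
  rw [e] at hn hM'
  simp only [List.mem_append, List.mem_cons, List.not_mem_nil, or_false] at hM'
  have b1 : bd D x u m₁ := by rw [hMb, re_cons_concat]; simp [Lnk]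
  have b2 : bd D x m₁ m₂ := by rw [hMb, re_cons_concat]; simp [Lnk]
  have hk : ∀ a b, Lnk [k₂, k₁, v] a b → bd D x a b := fun a b h => by
    rw [hMb, re_cons_concat, e]
    exact .inl (lnk_of_append (lnk_of_append h))
  have b3 : bd D x k₂ k₁ := hk _ _ (by simp [Lnk])
  have b4 : bd D x k₁ v := hk _ _ (by simp [Lnk])
  rw [List.nodup_append', List.nodup_append'] at hn
  obtain ⟨n1, ⟨-, n2, -⟩, n3⟩ := hn
  simp only [List.nodup_cons, List.mem_cons, List.not_mem_nil, or_false, not_or] at n1 n2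
  have dj : ∀ p ∈ [u, m₁, m₂], ∀ q ∈ [k₂, k₁, v], p ≠ q := by
    rintro p hp q hq rfl
    exact n3 hp (List.mem_append_right _ hq)
  by_cases h : Int3 G S m₁ ∧ Int3 G S m₂
  · exact hC.no_three_tri D hv hu h.1 h.2 huv.symm b1 b2 (dj m₁ (by simp) v (by simp)).symm n1.1.2
      (by rw [hC.oth_symm D huv]; exact ht)
  by_cases h' : Int3 G S k₁ ∧ Int3 G S k₂
  · exact hC.no_three_tri D hu hv h'.1 h'.2 huv b4.symm b3.symm (dj u (by simp) k₁ (by simp))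
      (Ne.symm n2.1.2) ht
  have v1 := mem_vf.2 ⟨_, b2⟩
  have v2 := mem_vf.2 ⟨_, b2.symm⟩
  have v3 := mem_vf.2 ⟨_, b3⟩
  have v4 := mem_vf.2 ⟨_, b4⟩
  rcases not_and_or.1 h with h | h <;> rcases not_and_or.1 h' with h' | h'
  · exact dj m₁ (by simp) k₁ (by simp) (h1 _ v1 _ v4 h h')
  · exact dj m₁ (by simp) k₂ (by simp) (h1 _ v1 _ v3 h h')
  · exact dj m₂ (by simp) k₁ (by simp) (h1 _ v2 _ v4 h h')
  · exact dj m₂ (by simp) k₂ (by simp) (h1 _ v2 _ v3 h h')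

lemma Ctr.unt_one (hC : Ctr G S φ) (D : Dual G) {x : D.X} (hx : ∀ v ∈ vf D x, v ∉ S)
    (h9 : 9 ≤ len D x)
    (h1 : ∀ p ∈ vf D x, ∀ q ∈ vf D x, ¬ Int3 G S p → ¬ Int3 G S q → p = q) :
    168 - 28 * (len D x : ℤ) ≤ ∑ u ∈ vf D x, fp D S x u := by
  have h : ∀ u ∈ vf D x, -6 - 8 * ∑ v, (if bd D x u v then if Int3 G S v then 0 else 1 else 0) ≤
      fp D S x u := by
    intro u hu
    obtain ⟨a, b, hab, h⟩ := hC.bd_two D hu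
    have ha := (h a).2 (.inl rfl)
    have hb := (h b).2 (.inr rfl)
    have g := hC.fp_ge D hu (hx u hu)
    rw [hC.sum_bd_two D ha hb hab]
    by_cases hi : Int3 G S u
    · by_cases h2 : Int3 G S a ∧ Int3 G S b
      · have := (hC.fp_int3 D hx h9 hi ha hb hab (hC.no_tri D h9 h1 hi h2.1 ha)
          (hC.no_tri D h9 h1 hi h2.2 hb)).1
        simp [h2.1, h2.2]
        omega
      · have : (1 : ℤ) ≤ (if Int3 G S a then 0 else 1) + if Int3 G S b then 0 else 1 := by
          split_ifs <;> simp_all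
        linarith [g.1]
    · have := g.2.2.2 (.inr hi)
      have : (0 : ℤ) ≤ (if Int3 G S a then 0 else 1) + if Int3 G S b then 0 else 1 := by
          split_ifs <;> simp
      linarith
  have h2 := Finset.sum_le_sum h
  rw [Finset.sum_sub_distrib, Finset.sum_const, nsmul_eq_mul, ← Finset.mul_sum] at h2
  have h3 : ∑ u ∈ vf D x, ∑ v, (if bd D x u v then if Int3 G S v then (0 : ℤ) else 1 else 0) ≤ 2 := by
    rw [Finset.sum_subset (Finset.subset_univ (vf D x)) fun u _ hu =>
      Finset.sum_eq_zero fun v _ => if_neg fun h => hu (mem_vf.2 ⟨v, h⟩), Finset.sum_comm]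
    by_cases hB : ∃ B ∈ vf D x, ¬ Int3 G S B
    · obtain ⟨B, hB, hBi⟩ := hB
      rw [Finset.sum_eq_single B]
      · obtain ⟨a, b, hab, h⟩ := hC.bd_two D hB
        have h' : ∀ c, bd D x c B ↔ c = a ∨ c = b := fun c =>
          (⟨bd.symm, bd.symm⟩ : bd D x c B ↔ bd D x B c).trans (h c)
        rw [sum_two hab h']
        simp [hBi]
      · intro B' _ hne
        refine Finset.sum_eq_zero fun u _ => ?_
        by_cases hb : bd D x u B'
        · by_cases hi : Int3 G S B'
          · simp [hi]
          · exact (hne (h1 _ (mem_vf.2 ⟨_, hb.symm⟩) _ hB hi hBi)).elim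
        · simp [hb]
      · simp
    · push Not at hB
      refine le_of_eq_of_le (Finset.sum_eq_zero fun B _ => Finset.sum_eq_zero fun u _ => ?_)
        zero_le_two
      by_cases hb : bd D x u B
      · simp [hB B (mem_vf.2 ⟨_, hb.symm⟩)]
      · simp [hb]
  have h6 : ((vf D x).card : ℤ) = len D x := rfl
  rw [h6] at h2
  linarith [(by exact_mod_cast h9 : (9 : ℤ) ≤ len D x)]

end Unt

section Nine
open Classical

variable {V : Type} [Fintype V] {G : SimpleGraph V} {S : Set V} {φ : V → Bool}

/-- `z` goes around the face `x` of length nine. -/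
structure Around (D : Dual G) (x : D.X) (z : Fin 9 → V) : Prop where
  inj : Function.Injective z
  bd : ∀ i, bd D x (z i) (z (i + 1))
  surj : ∀ u ∈ vf D x, ∃ i, z i = u

lemma Ctr.exists_around (hC : Ctr G S φ) (D : Dual G) {x : D.X} (h9 : len D x = 9) :
    ∃ z, Around D x z := by
  obtain ⟨L, hL, -, hlen, hmem, hre⟩ := hC.face_ring D x
  rw [h9] at hlen
  match L, hlen with
  | [z₀, z₁, z₂, z₃, z₄, z₅, z₆, z₇, z₈], _ =>
    refine ⟨![z₀, z₁, z₂, z₃, z₄, z₅, z₆, z₇, z₈], ?_, ?_, ?_⟩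
    · have e : List.ofFn ![z₀, z₁, z₂, z₃, z₄, z₅, z₆, z₇, z₈] =
          [z₀, z₁, z₂, z₃, z₄, z₅, z₆, z₇, z₈] := by simp [List.ofFn_succ]
      exact List.nodup_ofFn.1 (e ▸ hL.2)
    · intro i
      rw [hre]
      fin_cases i <;> simp [RE, Lnk]
    · intro u hu
      rw [← hmem] at hu
      simp only [List.mem_cons, List.not_mem_nil, or_false] at hu
      rcases hu with rfl | rfl | rfl | rfl | rfl | rfl | rfl | rfl | rfl
      exacts [⟨0, rfl⟩, ⟨1, rfl⟩, ⟨2, rfl⟩, ⟨3, rfl⟩, ⟨4, rfl⟩, ⟨5, rfl⟩, ⟨6, rfl⟩, ⟨7, rfl⟩, ⟨8, rfl⟩]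

namespace Around

variable {D : Dual G} {x : D.X} {z : Fin 9 → V}

lemma rotate (h : Around D x z) (k : Fin 9) : Around D x fun i => z (i + k) where
  inj := fun i j hij => add_right_cancel (h.inj hij)
  bd := fun i => by
    have := h.bd (i + k)
    rwa [add_right_comm] at this
  surj := fun u hu => by
    obtain ⟨i, hi⟩ := h.surj u hu
    exact ⟨i - k, by simpa using hi⟩

lemma reflect (h : Around D x z) : Around D x fun i => z (-i) where
  inj := fun i j hij => neg_injective (h.inj hij)
  bd := fun i => by
    have := (h.bd (-(i + 1))).symm
    rwa [(by decide : ∀ i : Fin 9, -(i + 1) + 1 = -i) i] at this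
  surj := fun u hu => by
    obtain ⟨i, hi⟩ := h.surj u hu
    exact ⟨-i, by simpa using hi⟩

lemma mem (h : Around D x z) (i : Fin 9) : z i ∈ vf D x := mem_vf.2 ⟨_, h.bd i⟩

lemma bd' (h : Around D x z) (i : Fin 9) : IFPaper.bd D x (z i) (z (i - 1)) := by
  have := (h.bd (i - 1)).symm
  rwa [sub_add_cancel] at this

lemma ne (h : Around D x z) (i : Fin 9) : z (i - 1) ≠ z (i + 1) := fun e =>
  (by decide : ∀ i : Fin 9, i - 1 ≠ i + 1) i (h.inj e)

lemma sum_eq (h : Around D x z) (F : V → ℤ) : ∑ u ∈ vf D x, F u = F (z 0) + F (z 1) + F (z 2) +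
    F (z 3) + F (z 4) + F (z 5) + F (z 6) + F (z 7) + F (z 8) := by
  have : vf D x = Finset.univ.image z := by
    ext u
    simp only [Finset.mem_image, Finset.mem_univ, true_and]
    exact ⟨h.surj u, by rintro ⟨i, rfl⟩; exact h.mem i⟩
  rw [this, Finset.sum_image fun i _ j _ hij => h.inj hij, Fin.sum_univ_castSucc,
    Fin.sum_univ_eight]
  rfl

end Around

/-- The length of the other face at the `i`th edge. -/
noncomputable def ol (D : Dual G) (x : D.X) (z : Fin 9 → V) (i : Fin 9) : ℕ :=
  len D (oth D x (z i) (z (i + 1)))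

lemma Around.ol_eq (hC : Ctr G S φ) {D : Dual G} {x : D.X} {z : Fin 9 → V} (h : Around D x z)
    (i : Fin 9) : len D (oth D x (z i) (z (i - 1))) = ol D x z (i - 1) := by
  rw [ol, hC.oth_symm D (h.bd (i - 1)).symm, sub_add_cancel]

lemma Around.no_tri_fwd (hC : Ctr G S φ) {D : Dual G} {x : D.X} {z : Fin 9 → V}
    (h : Around D x z) (i : Fin 9) (i₁ : Int3 G S (z i)) (i₂ : Int3 G S (z (i + 1)))
    (i₃ : Int3 G S (z (i + 2))) (i₄ : Int3 G S (z (i + 3))) : ol D x z i ≠ 3 := by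
  intro ht
  have b2 := h.bd (i + 1)
  have b3 := h.bd (i + 2)
  have n1 := h.ne (i + 1)
  have n2 := h.ne (i + 2)
  have e1 : i + 1 + 1 = i + 2 := (by decide : ∀ i : Fin 9, i + 1 + 1 = i + 2) i
  have e2 : i + 2 + 1 = i + 3 := (by decide : ∀ i : Fin 9, i + 2 + 1 = i + 3) i
  have e3 : i + 2 - 1 = i + 1 := (by decide : ∀ i : Fin 9, i + 2 - 1 = i + 1) i
  rw [e1] at b2 n1
  rw [add_sub_cancel_right] at n1
  rw [e2] at b3 n2
  rw [e3] at n2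
  exact hC.no_three_tri D i₁ i₂ i₃ i₄ (h.bd i) b2 b3 n1 n2 ht

lemma Around.no_tri_bwd (hC : Ctr G S φ) {D : Dual G} {x : D.X} {z : Fin 9 → V}
    (h : Around D x z) (i : Fin 9) (i₁ : Int3 G S (z i)) (i₂ : Int3 G S (z (i - 1)))
    (i₃ : Int3 G S (z (i - 2))) (i₄ : Int3 G S (z (i - 3))) : ol D x z (i - 1) ≠ 3 := by
  intro ht
  have b2 := h.bd' (i - 1)
  have b3 := h.bd' (i - 2)
  have n1 := h.ne (i - 1)
  have n2 := h.ne (i - 2)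
  have e1 : i - 1 - 1 = i - 2 := (by decide : ∀ i : Fin 9, i - 1 - 1 = i - 2) i
  have e2 : i - 2 - 1 = i - 3 := (by decide : ∀ i : Fin 9, i - 2 - 1 = i - 3) i
  have e3 : i - 2 + 1 = i - 1 := (by decide : ∀ i : Fin 9, i - 2 + 1 = i - 1) i
  rw [e1] at b2 n1
  rw [sub_add_cancel] at n1
  rw [e2] at b3 n2
  rw [e3] at n2
  exact hC.no_three_tri D i₁ i₂ i₃ i₄ (h.bd' i) b2 b3 n1.symm n2.symm (by rw [h.ol_eq hC]; exact ht)

lemma Around.fp_int3 (hC : Ctr G S φ) {D : Dual G} {x : D.X} {z : Fin 9 → V} (h : Around D x z)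
    (hx : ∀ v ∈ vf D x, v ∉ S) (h9 : 9 ≤ len D x) {i : Fin 9} (hi : Int3 G S (z i)) :
    -14 ≤ fp D S x (z i) ∧ (ol D x z (i - 1) = 3 → 9 ≤ ol D x z i) ∧
    (ol D x z i = 3 → 9 ≤ ol D x z (i - 1)) ∧
    (ol D x z (i - 1) ≠ 3 → ol D x z i ≠ 3 → -6 ≤ fp D S x (z i) ∧
      ((ol D x z (i - 1) = 4 → hh D S (z (i - 1)) = 0) →
        (ol D x z i = 4 → hh D S (z (i + 1)) = 0) → 0 ≤ fp D S x (z i))) := by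
  have f1 := hC.int3_faces D hi (h.bd' i) (h.bd i) (h.ne i)
  have f2 := hC.int3_faces D hi (h.bd i) (h.bd' i) (h.ne i).symm
  have f3 := hC.fp_int3 D hx h9 hi (h.bd' i) (h.bd i) (h.ne i)
  rw [h.ol_eq hC] at f1 f2 f3
  exact ⟨(hC.fp_ge D (h.mem i) (hx _ (h.mem i))).1, f1.1, f2.1, f3⟩

lemma Around.near (hC : Ctr G S φ) {D : Dual G} {x : D.X} {z : Fin 9 → V} (h : Around D x z)
    (hx : ∀ v ∈ vf D x, v ∉ S) (h9 : 9 ≤ len D x) {k : Fin 9} (hk : k = 1 ∨ k = 2 ∨ k = 3)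
    (h0 : ¬ Int3 G S (z 0)) (hkI : ¬ Int3 G S (z k)) (hI : ∀ i, i ≠ 0 → i ≠ k → Int3 G S (z i)) :
    -84 ≤ ∑ u ∈ vf D x, fp D S x u := by
  have i4 := hI 4 (by decide) (by rcases hk with rfl | rfl | rfl <;> decide)
  have i5 := hI 5 (by decide) (by rcases hk with rfl | rfl | rfl <;> decide)
  have i6 := hI 6 (by decide) (by rcases hk with rfl | rfl | rfl <;> decide)
  have i7 := hI 7 (by decide) (by rcases hk with rfl | rfl | rfl <;> decide)
  have i8 := hI 8 (by decide) (by rcases hk with rfl | rfl | rfl <;> decide)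
  have t4 : ol D x z 4 ≠ 3 := h.no_tri_fwd hC 4 i4 i5 i6 i7
  have t5 : ol D x z 5 ≠ 3 := h.no_tri_fwd hC 5 i5 i6 i7 i8
  have t6 : ol D x z 6 ≠ 3 := h.no_tri_bwd hC 7 i7 i6 i5 i4
  have t7 : ol D x z 7 ≠ 3 := h.no_tri_bwd hC 8 i8 i7 i6 i5
  have f5 := ((h.fp_int3 hC hx h9 i5).2.2.2 t4 t5).1
  have f6 := ((h.fp_int3 hC hx h9 i6).2.2.2 t5 t6).1
  have f7 := ((h.fp_int3 hC hx h9 i7).2.2.2 t6 t7).1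
  have g : ∀ i, -14 ≤ fp D S x (z i) := fun i => (hC.fp_ge D (h.mem i) (hx _ (h.mem i))).1
  have b : ∀ i, ¬ Int3 G S (z i) → 0 ≤ fp D S x (z i) := fun i hi =>
    (hC.fp_ge D (h.mem i) (hx _ (h.mem i))).2.2.2 (.inr hi)
  have g0 := b 0 h0
  have gk := b k hkI
  have g1 := g 1
  have g2 := g 2
  have g3 := g 3
  have g4 := g 4
  have g8 := g 8
  rw [h.sum_eq]
  rcases hk with rfl | rfl | rfl <;> linarith

lemma Around.far (hC : Ctr G S φ) {D : Dual G} {x : D.X} {z : Fin 9 → V} (h : Around D x z)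
    (hx : ∀ v ∈ vf D x, v ∉ S) (h9 : 9 ≤ len D x)
    (h0 : ¬ Int3 G S (z 0)) (h4 : ¬ Int3 G S (z 4)) (hI : ∀ i, i ≠ 0 → i ≠ 4 → Int3 G S (z i)) :
    -84 ≤ ∑ u ∈ vf D x, fp D S x u := by
  have i1 := hI 1 (by decide) (by decide)
  have i2 := hI 2 (by decide) (by decide)
  have i3 := hI 3 (by decide) (by decide)
  have i5 := hI 5 (by decide) (by decide)
  have i6 := hI 6 (by decide) (by decide)
  have i7 := hI 7 (by decide) (by decide)
  have i8 := hI 8 (by decide) (by decide)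
  have t5 : ol D x z 5 ≠ 3 := h.no_tri_fwd hC 5 i5 i6 i7 i8
  have t7 : ol D x z 7 ≠ 3 := h.no_tri_bwd hC 8 i8 i7 i6 i5
  have f1 := h.fp_int3 hC hx h9 i1
  have f2 := h.fp_int3 hC hx h9 i2
  have f3 := h.fp_int3 hC hx h9 i3
  have f5 := h.fp_int3 hC hx h9 i5
  have f6 := h.fp_int3 hC hx h9 i6
  have f7 := h.fp_int3 hC hx h9 i7
  have f8 := h.fp_int3 hC hx h9 i8
  have b : ∀ i, ¬ Int3 G S (z i) → 0 ≤ fp D S x (z i) ∧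
      (gg D (z i) = 28 → ol D x z i = 3 ∨ ol D x z (i - 1) = 3 → 14 ≤ fp D S x (z i)) ∧
      (gg D (z i) = 28 → hh D S (z i) = 0) := fun i hi => by
    have e1 := hC.fp_big D h9 (hx _ (h.mem i)) hi (h.bd i) (h.bd' i) (h.ne i).symm
    have e2 := hC.fp_big D h9 (hx _ (h.mem i)) hi (h.bd' i) (h.bd i) (h.ne i)
    rw [h.ol_eq hC] at e2
    refine ⟨e1.1, fun hg ht => ht.elim (e1.2 hg) (e2.2 hg), fun hg => ?_⟩
    rw [hh_of_not_int3 D (hx _ (h.mem i)) hi, hg]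
    norm_num
  have b0 := b 0 h0
  have b4 := b 4 h4
  have g4 : ol D x z 4 ≤ 4 → ol D x z 2 = 3 → gg D (z 4) = 28 := fun hl ht =>
    hC.gg_eq D (hx _ (h.mem 4)) h4 (h.bd 4) (h.bd' 4) (h.ne 4) hl i3 (h.bd' 3)
      (h.ne 3) ((h.ol_eq hC 3).trans ht) (by omega)
  have g0 : ol D x z 8 ≤ 4 → ol D x z 1 = 3 → gg D (z 0) = 28 := fun hl ht =>
    hC.gg_eq D (hx _ (h.mem 0)) h0 (h.bd' 0) (h.bd 0) (h.ne 0).symm ((h.ol_eq hC 0).trans_le hl)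
      i1 (h.bd 1) (h.ne 1).symm ht (by omega)
  rw [h.sum_eq]
  simp only [show (1 : Fin 9) - 1 = 0 from rfl, show (2 : Fin 9) - 1 = 1 from rfl,
    show (3 : Fin 9) - 1 = 2 from rfl, show (5 : Fin 9) - 1 = 4 from rfl,
    show (6 : Fin 9) - 1 = 5 from rfl, show (7 : Fin 9) - 1 = 6 from rfl,
    show (8 : Fin 9) - 1 = 7 from rfl, show (0 : Fin 9) - 1 = 8 from rfl,
    show (4 : Fin 9) - 1 = 3 from rfl, show (8 : Fin 9) + 1 = 0 from rfl] at f1 f2 f3 f5 f6 f7 f8 b0 b4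
  obtain ⟨m1, l1, r1, s1⟩ := f1
  obtain ⟨m2, l2, r2, s2⟩ := f2
  obtain ⟨m3, l3, r3, s3⟩ := f3
  obtain ⟨m5, l5, r5, s5⟩ := f5
  obtain ⟨m6, l6, r6, s6⟩ := f6
  obtain ⟨m7, l7, r7, s7⟩ := f7
  obtain ⟨m8, l8, r8, s8⟩ := f8
  obtain ⟨p0, q0, o0⟩ := b0
  obtain ⟨p4, q4, o4⟩ := b4
  by_cases c1 : ol D x z 1 = 3
  · by_cases c8 : ol D x z 8 = 3
    · have := q0 (g0 (by omega) c1) (.inr c8)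
      linarith
    by_cases c6 : ol D x z 6 = 3
    · have := l7 c6
      have := (s8 t7 c8).2 (fun h => by omega) fun h => o0 (g0 h.le c1)
      linarith
    · linarith [(s6 t5 c6).1, (s7 c6 t7).1, (s8 t7 c8).1]
  by_cases c2 : ol D x z 2 = 3
  · by_cases c4 : ol D x z 4 = 3
    · have := q4 (g4 (by omega) c2) (.inl c4)
      linarith
    by_cases c6 : ol D x z 6 = 3
    · have := r6 c6
      have := (s5 c4 t5).2 (fun h => o4 (g4 h.le c2)) fun h => by omega
      linarith
    · linarith [(s6 t5 c6).1, (s7 c6 t7).1, (s5 c4 t5).1]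
  have := s2 c1 c2
  by_cases c0 : ol D x z 0 = 3
  · by_cases c3 : ol D x z 3 = 3
    · have := l1 c0
      have := r3 c3
      have := (s2 c1 c2).2 (fun h => by omega) fun h => by omega
      linarith
    · linarith [(s3 c2 c3).1]
  · linarith [(s1 c0 c1).1]

lemma Ctr.unt_two (hC : Ctr G S φ) (D : Dual G) {x : D.X} (hx : ∀ v ∈ vf D x, v ∉ S)
    (h9 : len D x = 9) {p q : V} (hp : p ∈ vf D x) (hq : q ∈ vf D x) (hpq : p ≠ q)
    (hpi : ¬ Int3 G S p) (hqi : ¬ Int3 G S q) (h : ∀ u ∈ vf D x, u ≠ p → u ≠ q → Int3 G S u) :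
    -84 ≤ ∑ u ∈ vf D x, fp D S x u := by
  have main : ∀ (z : Fin 9 → V) (k : Fin 9), Around D x z → z 0 = p → z k = q →
      (k = 1 ∨ k = 2 ∨ k = 3 ∨ k = 4) → -84 ≤ ∑ u ∈ vf D x, fp D S x u := by
    intro z k hz h0 hk h4
    subst h0 hk
    have hI : ∀ i, i ≠ 0 → i ≠ k → Int3 G S (z i) := fun i hi hik =>
      h _ (hz.mem i) (fun e => hi (hz.inj e)) fun e => hik (hz.inj e)
    by_cases hk4 : k = 4
    · subst hk4
      exact hz.far hC hx h9.ge hpi hqi hI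
    · exact hz.near hC hx h9.ge (by tauto) hpi hqi hI
  obtain ⟨z, hz⟩ := hC.exists_around D h9
  obtain ⟨i, rfl⟩ := hz.surj p hp
  obtain ⟨j, rfl⟩ := hz.surj q hq
  have hd : ∀ k : Fin 9, k ≠ 0 → (k = 1 ∨ k = 2 ∨ k = 3 ∨ k = 4) ∨
      (-k = 1 ∨ -k = 2 ∨ -k = 3 ∨ -k = 4) := by decide
  rcases hd (j - i) (sub_ne_zero.2 fun e => hpq (e ▸ rfl)) with h' | h'
  · exact main _ (j - i) (hz.rotate i) (by simp) (by simp) h'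
  · exact main _ (-(j - i)) (hz.rotate i).reflect (by simp) (by simp) h'

end Nine

section Dis
open Classical

variable {V : Type} [Fintype V] {G : SimpleGraph V} {S : Set V} {φ : V → Bool}

lemma Ctr.unt_large (hC : Ctr G S φ) (D : Dual G) {x : D.X} (hx : ∀ v ∈ vf D x, v ∉ S)
    (h9 : 9 ≤ len D x) : 168 - 28 * (len D x : ℤ) ≤ ∑ u ∈ vf D x, fp D S x u := by
  let B := (vf D x).filter fun u => ¬ Int3 G S u
  have hB : ∀ u, u ∈ B ↔ u ∈ vf D x ∧ ¬ Int3 G S u := fun u => Finset.mem_filter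
  have hcard : ((vf D x).filter fun u => Int3 G S u).card + B.card = len D x :=
    Finset.card_filter_add_card_filter_not _
  by_cases h12 : 12 ≤ len D x + B.card
  · have h : ∀ u ∈ vf D x, -14 * (if Int3 G S u then 1 else 0) ≤ fp D S x u := by
      intro u hu
      have := hC.fp_ge D hu (hx u hu)
      by_cases hi : Int3 G S u
      · simpa [hi] using this.1
      · simpa [hi] using this.2.2.2 (.inr hi)
    have h1 := Finset.sum_le_sum h
    rw [← Finset.mul_sum, Finset.sum_boole] at h1
    omega
  by_cases h1 : B.card ≤ 1
  · exact hC.unt_one D hx h9 fun p hp q hq hpi hqi =>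
      Finset.card_le_one.1 h1 p ((hB p).2 ⟨hp, hpi⟩) q ((hB q).2 ⟨hq, hqi⟩)
  obtain ⟨p, q, hpq, hBpq⟩ := Finset.card_eq_two.1 (by omega : B.card = 2)
  have hn : len D x = 9 := by omega
  have hp := (hB p).1 (hBpq ▸ Finset.mem_insert_self _ _)
  have hq := (hB q).1 (hBpq ▸ Finset.mem_insert_of_mem (Finset.mem_singleton_self _))
  have := hC.unt_two D hx hn hp.1 hq.1 hpq hp.2 hq.2 fun u hu h1 h2 => by
    by_contra hi
    have := (hB u).2 ⟨hu, hi⟩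
    rw [hBpq] at this
    simp only [Finset.mem_insert, Finset.mem_singleton] at this
    tauto
  rw [hn]
  exact this

lemma Ctr.untouched (hC : Ctr G S φ) (D : Dual G) {x : D.X} (hx : ∀ v ∈ vf D x, v ∉ S) :
    0 ≤ charge D S x := by
  rw [hC.charge_fp D hx]
  have h3 := hC.len_ge D x
  have hs : ∀ k : ℤ, (∀ u ∈ vf D x, k ≤ fp D S x u) → len D x * k ≤ ∑ u ∈ vf D x, fp D S x u := by
    intro k hk
    have := Finset.sum_le_sum hk
    rwa [Finset.sum_const, nsmul_eq_mul] at this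
  have g : ∀ u ∈ vf D x, _ := fun u hu => hC.fp_ge D hu (hx u hu)
  by_cases h9 : 9 ≤ len D x
  · linarith [hC.unt_large D hx h9]
  obtain h | h | h | h | h | h : len D x = 3 ∨ len D x = 4 ∨ len D x = 5 ∨ len D x = 6 ∨
    len D x = 7 ∨ len D x = 8 := by omega
  · have := hs 28 fun u hu => (g u hu).2.2.1 h
    rw [h] at this ⊢
    push_cast at this ⊢
    linarith
  · have := hC.unt_four D hx h
    rw [h]
    push_cast
    linarith
  · have := hC.unt_five D hx h
    rw [h]
    push_cast
    linarith
  · have := hs 0 fun u hu => (g u hu).2.2.2 (.inl h.le)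
    rw [h] at this ⊢
    push_cast at this ⊢
    linarith
  · have := hC.unt_seven D hx h
    rw [h]
    push_cast
    linarith
  · have := hs (-7) fun u hu => (g u hu).2.1 h.le
    rw [h] at this ⊢
    push_cast at this ⊢
    linarith

lemma Ctr.charge_nonneg (hC : Ctr G S φ) (D : Dual G) {x : D.X} (h : ∃ t ∈ vf D x, t ∉ S) :
    0 ≤ charge D S x := by
  obtain ⟨t, ht, htS⟩ := h
  by_cases hs : ∃ s ∈ vf D x, s ∈ S
  · obtain ⟨s, hs, hsS⟩ := hs
    exact (hC.touched D hs hsS ht htS).1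
  · push Not at hs
    exact hC.untouched D hs

lemma Ctr.false_of_ring (hC : Ctr G S φ) (D : Dual G) {L : List V} (hL : AdmRing G L)
    (hS : S = {x | x ∈ L}) : False := by
  obtain ⟨f, hf⟩ := hC.outer D hL hS
  have hmem : ∀ u, u ∈ S ↔ u ∈ L := fun u => by rw [hS]; rfl
  have hvf : vf D f = L.toFinset := by
    ext u
    rw [mem_vf, List.mem_toFinset, mem_iff_re hL.1.2 hL.2.1]
    simp only [hf]
  have hlen : len D f = L.length := by
    rw [len, hvf, List.toFinset_card_of_nodup hL.1.2]
  have hnf : ∀ x, x ≠ f → ∃ t ∈ vf D x, t ∉ S := by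
    intro x hx
    by_contra! h
    exact hC.bd_ne D hx fun a b hab => (hf a b).2
      (hC.chordless hL hS (h a (mem_vf.2 ⟨_, hab⟩)) (h b (mem_vf.2 ⟨_, hab.symm⟩)) hab.1)
  have hfS : ∀ u ∈ vf D f, u ∈ S := fun u hu => by
    rw [hvf, List.mem_toFinset] at hu
    exact (hmem u).2 hu
  have hcf : charge D S f = -168 + 14 * L.length := by
    have h : ∀ u ∈ vf D f, part D S f u = 14 := by
      intro u hu
      obtain ⟨a, b, hab, h⟩ := hC.bd_two D hu
      have ha := (h a).2 (.inl rfl)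
      have hb := (h b).2 (.inr rfl)
      rw [hC.part_eq D ha hb hab, dart_bdry D (hfS u hu), dart_bdry D (hfS u hu),
        if_neg (not_not.2 (hfS a (mem_vf.2 ⟨_, ha.symm⟩))),
        if_neg (not_not.2 (hfS b (mem_vf.2 ⟨_, hb.symm⟩)))]
      norm_num
    rw [charge_eq, Finset.sum_congr rfl h, Finset.sum_const, nsmul_eq_mul]
    have h6 : ((vf D f).card : ℤ) = len D f := rfl
    rw [h6, hlen]
    ring
  have hSS : 2 * (L.length : ℤ) ≤ ∑ u, ∑ v, if G.Adj u v ∧ u ∈ S ∧ v ∈ S then (1 : ℤ) else 0 := by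
    have h : ∀ u ∈ vf D f, 2 ≤ ∑ v, if G.Adj u v ∧ u ∈ S ∧ v ∈ S then (1 : ℤ) else 0 := by
      intro u hu
      obtain ⟨a, b, hab, h⟩ := hC.bd_two D hu
      have ha := (h a).2 (.inl rfl)
      have hb := (h b).2 (.inr rfl)
      have := Finset.sum_le_sum_of_subset_of_nonneg (Finset.subset_univ {a, b})
        (f := fun v => if G.Adj u v ∧ u ∈ S ∧ v ∈ S then (1 : ℤ) else 0)
        fun z _ _ => by positivity
      rw [Finset.sum_pair hab] at this
      simpa [ha.1, hb.1, hfS u hu, hfS a (mem_vf.2 ⟨_, ha.symm⟩),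
        hfS b (mem_vf.2 ⟨_, hb.symm⟩)] using this
    have h1 := Finset.sum_le_sum h
    rw [Finset.sum_const, nsmul_eq_mul] at h1
    have h6 : ((vf D f).card : ℤ) = len D f := rfl
    rw [h6, hlen] at h1
    have h2 := Finset.sum_le_sum_of_subset_of_nonneg (Finset.subset_univ (vf D f))
      (f := fun u => ∑ v, if G.Adj u v ∧ u ∈ S ∧ v ∈ S then (1 : ℤ) else 0)
      fun z _ _ => Finset.sum_nonneg fun v _ => by positivity
    linarith
  have hV : (∑ u, if u ∈ S ∧ ∃ v, G.Adj u v then (1 : ℤ) else 0) ≤ L.length := by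
    rw [Finset.sum_boole]
    norm_cast
    refine (Finset.card_le_card (t := L.toFinset) fun u hu => ?_).trans (List.toFinset_card_le _)
    exact List.mem_toFinset.2 ((hmem u).1 (Finset.mem_filter.1 hu).2.1)
  have ht := hC.total D
  rw [← Finset.add_sum_erase _ _ (Finset.mem_univ f), hcf] at ht
  have h0 : ∀ x ∈ Finset.univ.erase f, 0 ≤ charge D S x := fun x hx =>
    hC.charge_nonneg D (hnf x (Finset.ne_of_mem_erase hx))
  have hpos := Finset.sum_nonneg h0
  have h14 : ∀ y, y ≠ f → charge D S y < 14 := by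
    intro y hy
    have := Finset.single_le_sum h0 (Finset.mem_erase.2 ⟨hy, Finset.mem_univ y⟩)
    rcases hL.2.2 with h | ⟨h, -⟩ <;> omega
  rcases hL.2.2 with h | ⟨h, a, b, hab, hl⟩
  · omega
  have bf := (hf a b).2 hab
  have haS := hfS a (mem_vf.2 ⟨_, bf⟩)
  have hbS := hfS b (mem_vf.2 ⟨_, bf.symm⟩)
  have by' := bf.oth
  have hyf := hC.oth_ne D bf
  generalize oth D f a b = y at by' hyf
  obtain ⟨t, ht, htS⟩ := hnf y hyf
  have l3 := hC.len_ge D y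
  obtain ⟨L', hL', -, hlen', -, hre'⟩ := hC.face_ring D y
  rcases hl.ring hL' ((hre' a b).1 by') with h' | h'
  · obtain ⟨M, hM, hMl, -, hMv, hMb⟩ := hC.face_open D by'
    match M, (by omega : M.length = 1) with
    | [w], _ =>
      have b1 : bd D y a w := by rw [hMb, re_cons_concat]; simp [Lnk]
      have hw : w ∉ S := by
        rw [← hMv] at ht
        simp only [List.cons_append, List.nil_append, List.mem_cons, List.not_mem_nil,
          or_false] at ht
        rcases ht with rfl | rfl | rfl
        exacts [(htS haS).elim, htS, (htS hbS).elim]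
      have h9 := hC.tri_other D (hC.oth_ne D b1).symm b1 b1.oth (by omega)
      have hne : oth D y a w ≠ f := fun e => hw (hfS w (mem_vf.2 ⟨_, (e ▸ b1.oth).symm⟩))
      have := (hC.touched D (mem_vf.2 ⟨_, b1.oth⟩) haS (mem_vf.2 ⟨_, b1.oth.symm⟩) hw).2 h9
      exact absurd (h14 _ hne) (not_lt.2 this)
  · have := (hC.touched D (mem_vf.2 ⟨_, by'⟩) haS ht htS).2 (by omega)
    exact absurd (h14 _ hyf) (not_lt.2 this)

/-- There is no minimal counterexample with a dual. -/
lemma Ctr.false_of_dual (hC : Ctr G S φ) (D : Dual G) : False := by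
  rcases hC.adm with ⟨z, hz⟩ | ⟨L, hL, hS⟩
  · have hz' : ∀ u ∈ S, ∀ v ∈ S, u = v := fun u hu v hv => by
      rw [hz] at hu hv
      exact (Set.mem_singleton_iff.1 hu).trans (Set.mem_singleton_iff.1 hv).symm
    have ht := hC.total D
    have h1 : (0 : ℤ) ≤ ∑ u, ∑ v, if G.Adj u v ∧ u ∈ S ∧ v ∈ S then (1 : ℤ) else 0 :=
      Finset.sum_nonneg fun u _ => Finset.sum_nonneg fun v _ => by positivity
    have h2 : (∑ u, if u ∈ S ∧ ∃ v, G.Adj u v then (1 : ℤ) else 0) ≤ 1 := by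
      rw [Finset.sum_boole]
      norm_cast
      exact Finset.card_le_one.2 fun u hu v hv =>
        hz' u (Finset.mem_filter.1 hu).2.1 v (Finset.mem_filter.1 hv).2.1
    have h3 : 0 ≤ ∑ x, charge D S x := Finset.sum_nonneg fun x _ => hC.charge_nonneg D <| by
      by_contra! h
      have : (vf D x).card ≤ 1 := Finset.card_le_one.2 fun u hu v hv =>
        hz' u (h u hu) v (h v hv)
      have := hC.len_ge D x
      unfold len at this
      omega
    linarith
  · exact hC.false_of_ring D hL hS

end Dis

section Dual
open Classical

variable {V : Type} {G : SimpleGraph V}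

/-- The square to the left of a grid edge. -/
def lft (p q : ℤ × ℤ) : ℤ × ℤ :=
  if q.1 = p.1 + 1 then p else if q.1 + 1 = p.1 then (q.1, q.2 - 1)
  else if q.2 = p.2 + 1 then (p.1 - 1, p.2) else q

lemma gadj_iff {p q : ℤ × ℤ} : GAdj p q ↔ q = (p.1 + 1, p.2) ∨ q = (p.1 - 1, p.2) ∨
    q = (p.1, p.2 + 1) ∨ q = (p.1, p.2 - 1) := by
  simp only [GAdj, Prod.ext_iff]
  omega

/-- The neighbours of a grid vertex. -/
def nb (p : ℤ × ℤ) : Finset (ℤ × ℤ) :=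
  {(p.1 + 1, p.2), (p.1 - 1, p.2), (p.1, p.2 + 1), (p.1, p.2 - 1)}

lemma mem_nb {p q : ℤ × ℤ} : q ∈ nb p ↔ GAdj p q := by
  simp [gadj_iff, nb]

lemma sum_nb (p : ℤ × ℤ) (f : ℤ × ℤ → ZMod 2) : ∑ q ∈ nb p, f q =
    f (p.1 + 1, p.2) + f (p.1 - 1, p.2) + f (p.1, p.2 + 1) + f (p.1, p.2 - 1) := by
  unfold nb
  rw [Finset.sum_insert, Finset.sum_insert, Finset.sum_insert, Finset.sum_singleton]
  · ring
  all_goals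
    simp only [Finset.mem_insert, Finset.mem_singleton, Prod.ext_iff]
    omega

/-- The coboundary of a function on squares. -/
def cb (s : ℤ × ℤ → ZMod 2) (p q : ℤ × ℤ) : ZMod 2 := s (lft p q) + s (lft q p)

lemma sum_cb (s : ℤ × ℤ → ZMod 2) (p : ℤ × ℤ) : ∑ q ∈ nb p, cb s p q = 0 := by
  obtain ⟨i, j⟩ := p
  rw [sum_nb]
  simp only [cb, lft]
  have e1 : ¬ i = i + 1 + 1 := by omega
  have e2 : ¬ i - 1 = i + 1 := by omega
  have e3 : ¬ j = j + 1 + 1 := by omega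
  have e4 : ¬ j - 1 = j + 1 := by omega
  simp only [e1, e2, e3, e4, sub_add_cancel, left_eq_add, add_eq_left, add_sub_cancel_right, one_ne_zero,
    if_true, if_false]
  generalize s (i, j) = a, s (i, j - 1) = b, s (i - 1, j - 1) = c, s (i - 1, j) = d
  revert a b c d
  decide

/-- A finite even chain in the grid is a coboundary. -/
lemma exists_cb (γ : ℤ × ℤ → ℤ × ℤ → ZMod 2) (hs : ∀ p q, γ p q = γ q p) (m : ℤ)
    (hm : ∀ p q, p.2 < m → γ p q = 0) (h0 : ∀ p, ∑ q ∈ nb p, γ p q = 0) :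
    ∃ s, ∀ p q, GAdj p q → cb s p q = γ p q := by
  let s : ℤ × ℤ → ZMod 2 := fun x => ∑ k ∈ Finset.Icc m x.2, γ (x.1, k) (x.1 + 1, k)
  have hlow : ∀ i j, j < m → s (i, j) = 0 := fun i j hj => by
    simp only [s, Finset.Icc_eq_empty_of_lt hj, Finset.sum_empty]
  have hstep : ∀ i j, s (i, j) = s (i, j - 1) + γ (i, j) (i + 1, j) := by
    intro i j
    by_cases hj : j < m
    · rw [hlow i j hj, hlow i (j - 1) (by omega), hm _ _ hj, add_zero]
    · have : Finset.Icc m j = insert j (Finset.Icc m (j - 1)) := by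
        ext k
        simp only [Finset.mem_Icc, Finset.mem_insert]
        omega
      simp only [s]
      rw [this, Finset.sum_insert (by simp), add_comm]
  have hE : ∀ i j, s (i, j) + s (i, j - 1) = γ (i, j) (i + 1, j) := by
    intro i j
    rw [hstep]
    generalize s (i, j - 1) = a, γ (i, j) (i + 1, j) = b
    revert a b
    decide
  have hN0 : ∀ n : ℕ, ∀ i j, j < m + n → s (i - 1, j) + s (i, j) = γ (i, j) (i, j + 1) := by
    intro n
    induction n with
    | zero =>
      intro i j hj
      rw [hlow _ _ (by omega), hlow _ _ (by omega), hm _ _ (by simpa using hj), add_zero]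
    | succ n ih =>
      intro i j hj
      have h1 := ih i (j - 1) (by push_cast at hj; omega)
      have h2 := hstep i j
      have h3 := hstep (i - 1) j
      have h4 := h0 (i, j)
      rw [sum_nb] at h4
      simp only [sub_add_cancel] at h1 h3 h4
      rw [hs (i, j) (i - 1, j), hs (i, j) (i, j - 1), ← h1] at h4
      rw [h2, h3]
      generalize s (i - 1, j - 1) = a, s (i, j - 1) = b, γ (i - 1, j) (i, j) = c,
        γ (i, j) (i + 1, j) = d, γ (i, j) (i, j + 1) = e at h4
      revert a b c d e
      decide
  have hN : ∀ i j, s (i - 1, j) + s (i, j) = γ (i, j) (i, j + 1) := fun i j =>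
    hN0 (j + 1 - m).toNat i j (by omega)
  refine ⟨s, ?_⟩
  rintro ⟨i, j⟩ q hq
  rw [gadj_iff] at hq
  simp only at hq
  have e1 : ¬ i = i + 1 + 1 := by omega
  have e2 : ¬ i - 1 = i + 1 := by omega
  have e3 : ¬ j = j + 1 + 1 := by omega
  have e4 : ¬ j - 1 = j + 1 := by omega
  rcases hq with rfl | rfl | rfl | rfl <;>
    simp only [cb, lft, e1, e2, e3, e4, sub_add_cancel, left_eq_add, add_eq_left,
      add_sub_cancel_right, one_ne_zero, if_true, if_false]
  · exact hE i j
  · rw [add_comm, hs]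
    simpa using hE (i - 1) j
  · exact hN i j
  · rw [add_comm, hs]
    simpa using hN i (j - 1)

/-- A walk inside `B`, as a chain. -/
lemma exists_chain {B : Finset (ℤ × ℤ)} {p b : ℤ × ℤ}
    (h : Relation.ReflTransGen (fun a b => GAdj a b ∧ a ∈ B ∧ b ∈ B) p b) :
    ∃ γ : ℤ × ℤ → ℤ × ℤ → ZMod 2, (∀ p q, γ p q = γ q p) ∧
      (∀ p q, γ p q ≠ 0 → p ∈ B ∧ q ∈ B) ∧
      ∀ x, ∑ q ∈ nb x, γ x q = (if x = p then 1 else 0) + if x = b then 1 else 0 := by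
  induction h with
  | refl => exact ⟨0, by simp, by simp, fun x => by simp [CharTwo.add_self_eq_zero]⟩
  | @tail a b _ hab ih =>
    obtain ⟨γ, h1, h2, h3⟩ := ih
    have hne : a ≠ b := by
      rintro rfl
      have := hab.1
      unfold GAdj at this
      omega
    refine ⟨fun x y => γ x y + if (x = a ∧ y = b) ∨ (x = b ∧ y = a) then 1 else 0,
      fun x y => ?_, fun x y hxy => ?_, fun x => ?_⟩
    · have e : ((x = a ∧ y = b) ∨ (x = b ∧ y = a)) ↔ ((y = a ∧ x = b) ∨ (y = b ∧ x = a)) := by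
        tauto
      beta_reduce
      rw [h1, if_congr e rfl rfl]
    · by_cases h : γ x y = 0
      · simp only [h, zero_add, ne_eq, ite_eq_right_iff, one_ne_zero, imp_false, not_not] at hxy
        rcases hxy with ⟨rfl, rfl⟩ | ⟨rfl, rfl⟩
        exacts [hab.2, hab.2.symm]
      · exact h2 x y h
    · rw [Finset.sum_add_distrib, h3]
      by_cases hxa : x = a
      · subst hxa
        simp [hne, mem_nb, hab.1, Finset.sum_ite_eq', add_assoc, CharTwo.add_self_eq_zero]
      · by_cases hxb : x = b
        · subst hxb
          simp [hxa, mem_nb, hab.1.symm, Finset.sum_ite_eq']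
        · simp [hxa, hxb]

end Dual

section Dual
open Classical

variable {V : Type} {G : SimpleGraph V} [Fintype V]

/-- The number of faces is bounded below by Euler's formula. -/
lemma card_faces {X : Type} [Fintype X] (fc : V → V → X)
    (cyc : ∀ c : V → V → ZMod 2, (∀ u v, c u v = c v u) → (∀ u v, ¬ G.Adj u v → c u v = 0) →
      (∀ u, ∑ v, c u v = 0) → ∃ S : X → ZMod 2, ∀ u v, G.Adj u v → c u v = S (fc u v) + S (fc v u))
    (hG : ∃ u v, G.Adj u v) :
    (Finset.univ.filter fun p : V × V => G.Adj p.1 p.2).card + 4 ≤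
      2 * Fintype.card X + 2 * (Finset.univ.filter fun u => ∃ v, G.Adj u v).card := by
  obtain ⟨u0, v0, h0⟩ := hG
  let W := {u : V // ∃ v, G.Adj u v}
  let D (f : G.edgeSet → ZMod 2) (u v : V) : ZMod 2 := if h : G.Adj u v then f ⟨s(u, v), h⟩ else 0
  have hD : ∀ f u v, D f u v = D f v u := by
    intro f u v
    by_cases h : G.Adj u v
    · simp only [D, h, h.symm, dif_pos]
      congr 2
      exact Sym2.eq_swap
    · have h' : ¬ G.Adj v u := fun h' => h h'.symm
      simp only [D, h, h', dif_neg, not_false_eq_true]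
  let T : (G.edgeSet → ZMod 2) →ₗ[ZMod 2] (W → ZMod 2) :=
    { toFun := fun f u => ∑ v, D f u v
      map_add' := fun f g => by
        ext u
        simp only [Pi.add_apply, ← Finset.sum_add_distrib]
        refine Finset.sum_congr rfl fun v _ => ?_
        by_cases h : G.Adj u v <;> simp [D, h]
      map_smul' := fun a f => by
        ext u
        simp only [Pi.smul_apply, RingHom.id_apply, smul_eq_mul, Finset.mul_sum]
        refine Finset.sum_congr rfl fun v _ => ?_
        by_cases h : G.Adj u v <;> simp [D, h] }
  let Φ : (X → ZMod 2) →ₗ[ZMod 2] (G.edgeSet → ZMod 2) :=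
    { toFun := fun S e => Sym2.lift ⟨fun u v => S (fc u v) + S (fc v u), fun _ _ => add_comm _ _⟩ e
      map_add' := fun S S' => by
        ext ⟨e, he⟩
        induction e with
        | _ u v => simp only [Sym2.lift_mk, Pi.add_apply]; ring
      map_smul' := fun a S => by
        ext ⟨e, he⟩
        induction e with
        | _ u v => simp only [Sym2.lift_mk, Pi.smul_apply, smul_eq_mul, RingHom.id_apply]; ring }
  let σ : (W → ZMod 2) →ₗ[ZMod 2] ZMod 2 := ∑ u, LinearMap.proj u
  have hσ : ∀ w, σ w = ∑ u, w u := fun w => by simp [σ]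
  have hTσ : LinearMap.range T ≤ LinearMap.ker σ := by
    rintro _ ⟨f, rfl⟩
    rw [LinearMap.mem_ker, hσ]
    have e : ∑ u : W, T f u = ∑ u : V, ∑ v, D f u v := by
      have h1 : ∑ u : W, T f u = ∑ u : W, ∑ v, D f u v := rfl
      rw [h1, ← Finset.sum_subtype (Finset.univ.filter fun u => ∃ v, G.Adj u v) (by simp)
        fun u => ∑ v, D f u v]
      refine Finset.sum_subset (Finset.subset_univ _) fun u _ hu => ?_
      exact Finset.sum_eq_zero fun v _ => dif_neg fun h => hu (by simpa using ⟨v, h⟩)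
    rw [e, ← Finset.sum_product']
    refine Finset.sum_involution (fun p _ => (p.2, p.1)) ?_ ?_ (by simp) (by simp)
    · intro p _
      rw [hD f p.2 p.1, CharTwo.add_self_eq_zero]
    · rintro ⟨u, v⟩ _ hp he
      simp only [Prod.mk.injEq] at he
      obtain ⟨rfl, -⟩ := he
      exact hp (dif_neg G.irrefl)
  have hker : LinearMap.ker T ≤ LinearMap.range Φ := by
    intro f hf
    rw [LinearMap.mem_ker] at hf
    obtain ⟨S, hS⟩ := cyc (D f) (hD f) (fun u v h => dif_neg h) fun u => by
      by_cases hu : ∃ v, G.Adj u v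
      · exact congrFun hf ⟨u, hu⟩
      · exact Finset.sum_eq_zero fun v _ => dif_neg fun h => hu ⟨v, h⟩
    refine ⟨S, ?_⟩
    ext ⟨e, he⟩
    induction e with
    | _ u v =>
      have he' : G.Adj u v := he
      have := hS u v he'
      simp only [D, he', dif_pos] at this
      exact this.symm
  have hσ1 : σ ≠ 0 := by
    intro h
    have h1 : σ (Pi.single ⟨u0, v0, h0⟩ 1) = 0 := by rw [h]; rfl
    rw [hσ, Finset.sum_pi_single'] at h1
    simp at h1
  have hΦ1 : LinearMap.ker Φ ≠ ⊥ := by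
    intro h
    have h1 : (1 : X → ZMod 2) ∈ LinearMap.ker Φ := by
      rw [LinearMap.mem_ker]
      ext ⟨e, he⟩
      induction e with
      | _ u v => exact CharTwo.add_self_eq_zero (1 : ZMod 2)
    rw [h, Submodule.mem_bot] at h1
    exact one_ne_zero (congrFun h1 (fc u0 v0))
  have r1 := T.finrank_range_add_finrank_ker
  have r2 := Φ.finrank_range_add_finrank_ker
  have r3 := Module.Dual.finrank_ker_add_one_of_ne_zero hσ1
  have r4 := Submodule.finrank_mono hTσ
  have r5 := Submodule.finrank_mono hker
  have r6 : 0 < Module.finrank (ZMod 2) (LinearMap.ker Φ) := by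
    rw [Nat.pos_iff_ne_zero]
    exact fun h => hΦ1 (Submodule.finrank_eq_zero.1 h)
  rw [Module.finrank_fintype_fun_eq_card] at r1 r2 r3
  have c1 : Fintype.card W = (Finset.univ.filter fun u => ∃ v, G.Adj u v).card :=
    Fintype.card_subtype _
  have c2 : (Finset.univ.filter fun p : V × V => G.Adj p.1 p.2).card =
      2 * Fintype.card G.edgeSet := by
    have := G.sum_degrees_eq_twice_card_edges
    rw [← SimpleGraph.edgeFinset_card, ← this, Finset.card_filter, ← Finset.univ_product_univ,
      Finset.sum_product]
    refine Finset.sum_congr rfl fun u _ => ?_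
    rw [← Finset.card_filter, ← SimpleGraph.card_neighborFinset_eq_degree]
    congr 1
    ext v
    simp
  rw [c2, ← c1]
  omega

end Dual

section Dual
open Classical

variable {V : Type} {G : SimpleGraph V} {B : V → Finset (ℤ × ℤ)} {P : V → V → ℤ × ℤ}

/-- `P u v` and `P v u` are the ends of a grid edge representing the edge `uv`. -/
structure Ports (G : SimpleGraph V) (B : V → Finset (ℤ × ℤ)) (P : V → V → ℤ × ℤ) : Prop where
  mem : ∀ u v, G.Adj u v → P u v ∈ B u
  adj : ∀ u v, G.Adj u v → GAdj (P u v) (P v u)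

lemma GridModel.exists_ports (hB : GridModel G B) : ∃ P, Ports G B P := by
  have : ∀ e : Sym2 V, ∃ g : V → ℤ × ℤ, ∀ u v, e = s(u, v) → G.Adj u v →
      g u ∈ B u ∧ GAdj (g u) (g v) := by
    intro e
    induction e with
    | _ a b =>
      by_cases hab : G.Adj a b
      · obtain ⟨p, hp, q, hq, hpq⟩ := hB.adj a b hab
        refine ⟨fun x => if x = a then p else q, fun u v he huv => ?_⟩
        rcases Sym2.eq_iff.1 he with ⟨rfl, rfl⟩ | ⟨rfl, rfl⟩
        · simp [hab.ne', hp, hpq]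
        · simp [hab.ne', hq, hpq.symm]
      · refine ⟨fun _ => 0, fun u v he huv => ?_⟩
        rcases Sym2.eq_iff.1 he with ⟨rfl, rfl⟩ | ⟨rfl, rfl⟩
        exacts [(hab huv).elim, (hab huv.symm).elim]
  choose g hg using this
  refine ⟨fun u v => g s(u, v) u, fun u v h => (hg _ u v rfl h).1, fun u v h => ?_⟩
  have := (hg _ u v rfl h).2
  rwa [Sym2.eq_swap (a := v)]

/-- The grid edges of the model. -/
def Used (G : SimpleGraph V) (B : V → Finset (ℤ × ℤ)) (P : V → V → ℤ × ℤ) (p q : ℤ × ℤ) : Prop :=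
  (∃ v, p ∈ B v ∧ q ∈ B v) ∨ ∃ u v, G.Adj u v ∧ p = P u v ∧ q = P v u

/-- Two squares on the sides of an unused edge. -/
def SqAdj (G : SimpleGraph V) (B : V → Finset (ℤ × ℤ)) (P : V → V → ℤ × ℤ) (a b : ℤ × ℤ) : Prop :=
  ∃ p q, GAdj p q ∧ ¬ Used G B P p q ∧ a = lft p q ∧ b = lft q p

lemma Ports.inj (hP : Ports G B P) (hB : GridModel G B) {u v u' v' : V} (h : G.Adj u v)
    (h' : G.Adj u' v') (e1 : P u v = P u' v') (e2 : P v u = P v' u') : u = u' ∧ v = v' :=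
  ⟨hB.disj u u' _ (hP.mem u v h) (e1 ▸ hP.mem u' v' h'),
    hB.disj v v' _ (hP.mem v u h.symm) (e2 ▸ hP.mem v' u' h'.symm)⟩

variable [Fintype V]

lemma Ports.even (hP : Ports G B P) (hB : GridModel G B) (s : ℤ × ℤ → ZMod 2)
    (hs : ∀ p q, GAdj p q → ¬ Used G B P p q → cb s p q = 0) (u : V) :
    ∑ v, (if G.Adj u v then cb s (P u v) (P v u) else 0) = 0 := by
  let U : Finset (ℤ × ℤ) := (B u).biUnion nb
  let γ : ℤ × ℤ → ℤ × ℤ → ZMod 2 := fun p q => if GAdj p q then cb s p q else 0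
  have hγ : ∀ p q, γ p q = γ q p := fun p q => by
    have : cb s p q = cb s q p := add_comm _ _
    simp only [γ, this, if_congr (⟨GAdj.symm, GAdj.symm⟩ : GAdj p q ↔ GAdj q p) rfl rfl]
  have t0 : ∑ p ∈ B u, ∑ q ∈ U, γ p q = 0 := by
    refine Finset.sum_eq_zero fun p hp => ?_
    rw [← sum_cb s p, ← Finset.sum_subset (s₁ := nb p) (s₂ := U)]
    · exact Finset.sum_congr rfl fun q hq => if_pos (mem_nb.1 hq)
    · exact fun q hq => Finset.mem_biUnion.2 ⟨p, hp, hq⟩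
    · exact fun q _ hq => if_neg fun h => hq (mem_nb.2 h)
  have t1 : ∑ p ∈ B u, ∑ q ∈ U.filter (· ∈ B u), γ p q = 0 := by
    have : ∀ p ∈ B u, ∑ q ∈ U.filter (· ∈ B u), γ p q = ∑ q ∈ B u, γ p q := fun p hp => by
      refine Finset.sum_subset (fun q hq => (Finset.mem_filter.1 hq).2) fun q hq hq' => if_neg ?_
      exact fun h => hq' (Finset.mem_filter.2 ⟨Finset.mem_biUnion.2 ⟨p, hp, mem_nb.2 h⟩, hq⟩)
    rw [Finset.sum_congr rfl this, ← Finset.sum_product']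
    refine Finset.sum_involution (fun p _ => (p.2, p.1)) ?_ ?_ ?_ (by simp)
    · intro p _
      rw [hγ p.2 p.1, CharTwo.add_self_eq_zero]
    · rintro ⟨p, q⟩ _ hp he
      simp only [Prod.mk.injEq] at he
      obtain rfl := he.1
      refine hp (if_neg fun h => ?_)
      simp [GAdj] at h
    · intro p hp
      exact Finset.mem_product.2 (Finset.mem_product.1 hp).symm
  have t2 : ∑ p ∈ B u, ∑ q ∈ U.filter (¬ · ∈ B u), γ p q = 0 := by
    have : ∑ p ∈ B u, ∑ q ∈ U, γ p q = ∑ p ∈ B u, ∑ q ∈ U.filter (· ∈ B u), γ p q +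
        ∑ p ∈ B u, ∑ q ∈ U.filter (¬ · ∈ B u), γ p q := by
      rw [← Finset.sum_add_distrib]
      exact Finset.sum_congr rfl fun p _ => (Finset.sum_filter_add_sum_filter_not _ _ _).symm
    rwa [t0, t1, zero_add, eq_comm] at this
  refine Eq.trans ?_ t2
  have key : ∀ p ∈ B u, ∀ q ∈ U.filter (¬ · ∈ B u), γ p q =
      ∑ v, if G.Adj u v ∧ p = P u v ∧ q = P v u then γ p q else 0 := by
    intro p hp q hq
    have hq' := (Finset.mem_filter.1 hq).2
    by_cases h : ∃ v, G.Adj u v ∧ p = P u v ∧ q = P v u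
    · obtain ⟨v, hv⟩ := h
      rw [Finset.sum_eq_single v, if_pos hv]
      · intro w _ hwv
        exact if_neg fun hw => hwv
          (hP.inj hB hw.1 hv.1 (hw.2.1.symm.trans hv.2.1) (hw.2.2.symm.trans hv.2.2)).2
      · simp
    · rw [Finset.sum_eq_zero fun v _ => if_neg fun hv => h ⟨v, hv⟩]
      by_cases hg : GAdj p q
      · refine (if_pos hg).trans (hs p q hg ?_)
        rintro (⟨v, h1, h2⟩ | ⟨u', v, h1, h2, h3⟩)
        · obtain rfl := hB.disj u v p hp h1
          exact hq' h2
        · obtain rfl := hB.disj u u' p hp (h2 ▸ hP.mem _ _ h1)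
          exact h ⟨v, h1, h2, h3⟩
      · exact if_neg hg
  rw [Finset.sum_congr rfl fun p hp => Finset.sum_congr rfl (key p hp)]
  have sw : ∑ p ∈ B u, ∑ q ∈ U.filter (¬ · ∈ B u), ∑ v,
      (if G.Adj u v ∧ p = P u v ∧ q = P v u then γ p q else 0) =
      ∑ v, ∑ p ∈ B u, ∑ q ∈ U.filter (¬ · ∈ B u),
        if G.Adj u v ∧ p = P u v ∧ q = P v u then γ p q else 0 := by
    rw [Finset.sum_comm]
    rw [Finset.sum_congr rfl fun p _ => Finset.sum_comm]
    rw [Finset.sum_comm]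
    exact Finset.sum_congr rfl fun v _ => Finset.sum_comm
  rw [sw]
  refine Finset.sum_congr rfl fun v _ => ?_
  by_cases h : G.Adj u v
  · have h1 := hP.mem u v h
    have h2 : P v u ∈ U.filter (¬ · ∈ B u) := by
      refine Finset.mem_filter.2 ⟨Finset.mem_biUnion.2 ⟨_, h1, mem_nb.2 (hP.adj u v h)⟩, fun h' => ?_⟩
      exact h.ne (hB.disj u v _ h' (hP.mem v u h.symm))
    rw [if_pos h, Finset.sum_eq_single (P u v), Finset.sum_eq_single (P v u), if_pos ⟨h, rfl, rfl⟩]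
    · exact (if_pos (hP.adj u v h)).symm
    · exact fun q _ hq => if_neg fun h => hq h.2.2
    · exact fun h => (h h2).elim
    · exact fun p _ hp => Finset.sum_eq_zero fun q _ => if_neg fun h => hp h.2.1
    · exact fun h => (h h1).elim
  · rw [if_neg h]
    exact (Finset.sum_eq_zero fun p _ => Finset.sum_eq_zero fun q _ =>
      if_neg (mt And.left h)).symm

lemma Ports.cyc (hP : Ports G B P) (hB : GridModel G B) (c : V → V → ZMod 2)
    (hc : ∀ u v, c u v = c v u) (h0 : ∀ u v, ¬ G.Adj u v → c u v = 0) (hu : ∀ u, ∑ v, c u v = 0) :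
    ∃ s : ℤ × ℤ → ZMod 2, (∀ p q, GAdj p q → ¬ Used G B P p q → cb s p q = 0) ∧
      ∀ u v, G.Adj u v → c u v = cb s (P u v) (P v u) := by
  let b : V → ℤ × ℤ := fun u => if h : ∃ v, G.Adj u v then P u h.choose else 0
  have hw : ∀ u v, ∃ γ : ℤ × ℤ → ℤ × ℤ → ZMod 2, (∀ p q, γ p q = γ q p) ∧
      (∀ p q, γ p q ≠ 0 → p ∈ B u ∧ q ∈ B u) ∧ (G.Adj u v → ∀ x, ∑ q ∈ nb x, γ x q =
        (if x = P u v then 1 else 0) + if x = b u then 1 else 0) := by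
    intro u v
    by_cases h : G.Adj u v
    · have hb : b u ∈ B u := by
        have h' : ∃ v, G.Adj u v := ⟨v, h⟩
        simp only [b, h', dif_pos]
        exact hP.mem _ _ h'.choose_spec
      obtain ⟨γ, h1, h2, h3⟩ := exists_chain (hB.conn u _ (hP.mem u v h) _ hb)
      exact ⟨γ, h1, h2, fun _ => h3⟩
    · exact ⟨0, by simp, by simp, fun h' => (h h').elim⟩
  choose w w1 w2 w3 using hw
  let δ : V → V → ℤ × ℤ → ℤ × ℤ → ZMod 2 := fun u v p q =>
    if p = P u v ∧ q = P v u then 1 else 0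
  let γ : ℤ × ℤ → ℤ × ℤ → ZMod 2 := fun p q => ∑ u, ∑ v, c u v * (δ u v p q + w u v p q)
  have γs : ∀ p q, γ p q = γ q p := by
    intro p q
    simp only [γ, mul_add, Finset.sum_add_distrib]
    congr 1
    · rw [Finset.sum_comm]
      refine Finset.sum_congr rfl fun v _ => Finset.sum_congr rfl fun u _ => ?_
      rw [hc u v]
      simp only [δ, and_comm]
    · exact Finset.sum_congr rfl fun v _ => Finset.sum_congr rfl fun u _ => by rw [w1]
  have γu : ∀ p q, γ p q ≠ 0 → Used G B P p q := by
    intro p q h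
    obtain ⟨u, -, h⟩ := Finset.exists_ne_zero_of_sum_ne_zero h
    obtain ⟨v, -, h⟩ := Finset.exists_ne_zero_of_sum_ne_zero h
    have huv : G.Adj u v := by
      by_contra h'
      exact h (by rw [h0 u v h', zero_mul])
    by_cases hw : w u v p q = 0
    · refine Or.inr ⟨u, v, huv, ?_⟩
      by_contra h'
      exact h (by rw [hw, show δ u v p q = 0 from if_neg h', add_zero, mul_zero])
    · exact Or.inl ⟨u, w2 u v p q hw⟩
  have γ0 : ∀ p, ∑ q ∈ nb p, γ p q = 0 := by
    intro p
    have e1 : ∑ q ∈ nb p, γ p q = ∑ u, ∑ v, ∑ q ∈ nb p, c u v * (δ u v p q + w u v p q) := by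
      rw [Finset.sum_comm]
      exact Finset.sum_congr rfl fun u _ => Finset.sum_comm
    have e2 : ∀ u v, ∑ q ∈ nb p, c u v * (δ u v p q + w u v p q) =
        c u v * if p = b u then 1 else 0 := by
      intro u v
      by_cases h : G.Adj u v
      · rw [← Finset.mul_sum, Finset.sum_add_distrib, w3 u v h]
        have : ∑ q ∈ nb p, δ u v p q = if p = P u v then 1 else 0 := by
          by_cases hp : p = P u v
          · subst hp
            simp [δ, mem_nb, hP.adj u v h]
          · simp [δ, hp]
        rw [this, ← add_assoc, CharTwo.add_self_eq_zero, zero_add]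
      · simp [h0 u v h]
    rw [e1]
    refine Finset.sum_eq_zero fun u _ => ?_
    rw [Finset.sum_congr rfl fun v _ => e2 u v, ← Finset.sum_mul, hu, zero_mul]
  obtain ⟨m, hm⟩ : ∃ m : ℤ, ∀ p ∈ Finset.univ.biUnion B, m ≤ p.2 := by
    obtain ⟨m, hm⟩ := ((Finset.univ.biUnion B).image Prod.snd).bddBelow
    exact ⟨m, fun p hp => hm (Finset.mem_coe.2 (Finset.mem_image_of_mem _ hp))⟩
  obtain ⟨s, hs⟩ := exists_cb γ γs m (fun p q hp => by
    by_contra h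
    have : p ∈ Finset.univ.biUnion B := by
      rcases γu p q h with ⟨v, h1, -⟩ | ⟨u, v, h1, rfl, -⟩
      exacts [Finset.mem_biUnion.2 ⟨v, by simp, h1⟩,
        Finset.mem_biUnion.2 ⟨u, by simp, hP.mem _ _ h1⟩]
    exact absurd (hm p this) (not_le.2 hp)) γ0
  refine ⟨s, fun p q h hn => ?_, fun u v h => ?_⟩
  · rw [hs p q h]
    by_contra h'
    exact hn (γu p q h')
  · rw [hs _ _ (hP.adj u v h)]
    have e : ∀ u' v', c u' v' * (δ u' v' (P u v) (P v u) + w u' v' (P u v) (P v u)) =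
        if u' = u ∧ v' = v then c u v else 0 := by
      intro u' v'
      by_cases h' : G.Adj u' v'
      · have : w u' v' (P u v) (P v u) = 0 := by
          by_contra hw
          have := w2 _ _ _ _ hw
          exact h.ne ((hB.disj u u' _ (hP.mem u v h) this.1).trans
            (hB.disj u' v _ this.2 (hP.mem v u h.symm)))
        rw [this, add_zero]
        by_cases hd : u' = u ∧ v' = v
        · obtain ⟨rfl, rfl⟩ := hd
          simp [δ]
        · rw [if_neg hd]
          have : δ u' v' (P u v) (P v u) = 0 := if_neg fun he =>
            hd (hP.inj hB h' h he.1.symm he.2.symm)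
          rw [this, mul_zero]
      · rw [h0 _ _ h', zero_mul, if_neg]
        rintro ⟨rfl, rfl⟩
        exact h' h
    simp only [γ, e]
    rw [Finset.sum_eq_single u, Finset.sum_eq_single v] <;> simp +contextual

/-- The dual of a plane graph. -/
lemma GridMinor.dual (h : GridMinor G) (hG : ∃ u v, G.Adj u v) : Nonempty (Dual G) := by
  obtain ⟨B, hB⟩ := h
  obtain ⟨P, hP⟩ := hB.exists_ports
  obtain ⟨u0, v0, huv⟩ := id hG
  let f : {p : V × V // G.Adj p.1 p.2} → Quot (SqAdj G B P) := fun p =>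
    Quot.mk _ (lft (P p.1.1 p.1.2) (P p.1.2 p.1.1))
  let X := Set.range f
  let fc : V → V → X := fun u v =>
    if h : G.Adj u v then ⟨f ⟨(u, v), h⟩, ⟨_, rfl⟩⟩ else ⟨f ⟨(u0, v0), huv⟩, ⟨_, rfl⟩⟩
  have hfc : ∀ u v, G.Adj u v → (fc u v : Quot (SqAdj G B P)) =
      Quot.mk _ (lft (P u v) (P v u)) := fun u v h => by simp only [fc, h, dif_pos, f]
  let hX : Fintype X := Fintype.ofFinite X
  have cyc : ∀ c : V → V → ZMod 2, (∀ u v, c u v = c v u) → (∀ u v, ¬ G.Adj u v → c u v = 0) →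
      (∀ u, ∑ v, c u v = 0) →
      ∃ S : X → ZMod 2, ∀ u v, G.Adj u v → c u v = S (fc u v) + S (fc v u) := by
    intro c h1 h2 h3
    obtain ⟨s, hs, hc⟩ := hP.cyc hB c h1 h2 h3
    let s' : Quot (SqAdj G B P) → ZMod 2 := Quot.lift s <| by
      rintro _ _ ⟨p, q, hpq, hn, rfl, rfl⟩
      exact CharTwo.add_eq_zero.1 (hs p q hpq hn)
    refine ⟨fun x => s' x, fun u v h => ?_⟩
    beta_reduce
    rw [hfc u v h, hfc v u h.symm, hc u v h]
    rfl
  refine ⟨⟨X, hX, fc, ?_, ?_, cyc, card_faces fc cyc⟩⟩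
  · rintro ⟨_, ⟨⟨u, v⟩, h⟩, rfl⟩
    exact ⟨u, v, h, by simp only [fc]; rw [dif_pos h]⟩
  · intro S u
    let S' : Quot (SqAdj G B P) → ZMod 2 := fun x => if h : x ∈ X then S ⟨x, h⟩ else 0
    have hS' : ∀ x : X, S x = S' x := fun x => by simp [S']
    have := hP.even hB (fun x => S' (Quot.mk _ x)) (fun p q h hn => by
      have : Quot.mk (SqAdj G B P) (lft p q) = Quot.mk _ (lft q p) :=
        Quot.sound ⟨p, q, h, hn, rfl, rfl⟩
      simp only [cb, this, CharTwo.add_self_eq_zero]) u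
    refine Eq.trans (Finset.sum_congr rfl fun v _ => ?_) this
    by_cases h : G.Adj u v
    · rw [if_pos h, if_pos h, hS', hS', hfc u v h, hfc v u h.symm]
      rfl
    · simp only [h, if_false]

end Dual

section Topo
open Classical Filter Topology

/-- A closed square of side `ε`. -/
def cell (ε : ℝ) (c : ℤ × ℤ) : Set (ℝ × ℝ) :=
  {x | (c.1 * ε ≤ x.1 ∧ x.1 ≤ (c.1 + 1) * ε) ∧ c.2 * ε ≤ x.2 ∧ x.2 ≤ (c.2 + 1) * ε}

/-- The squares meeting `K`. -/
def cells (ε : ℝ) (K : Set (ℝ × ℝ)) : Set (ℤ × ℤ) := {c | ∃ x ∈ K, x ∈ cell ε c}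

lemma isClosed_cell (ε : ℝ) (c : ℤ × ℤ) : IsClosed (cell ε c) := by
  have h1 : IsClosed {x : ℝ × ℝ | c.1 * ε ≤ x.1} := isClosed_le (by fun_prop) (by fun_prop)
  have h2 : IsClosed {x : ℝ × ℝ | x.1 ≤ (c.1 + 1) * ε} := isClosed_le (by fun_prop) (by fun_prop)
  have h3 : IsClosed {x : ℝ × ℝ | c.2 * ε ≤ x.2} := isClosed_le (by fun_prop) (by fun_prop)
  have h4 : IsClosed {x : ℝ × ℝ | x.2 ≤ (c.2 + 1) * ε} := isClosed_le (by fun_prop) (by fun_prop)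
  exact (h1.inter h2).inter (h3.inter h4)

lemma exists_cell {ε : ℝ} (hε : 0 < ε) (x : ℝ × ℝ) : ∃ c, x ∈ cell ε c := by
  have h : ∀ y : ℝ, ⌊y / ε⌋ * ε ≤ y ∧ y ≤ (⌊y / ε⌋ + 1) * ε := fun y =>
    ⟨(le_div_iff₀ hε).1 (Int.floor_le _), ((div_lt_iff₀ hε).1 (Int.lt_floor_add_one _)).le⟩
  exact ⟨(⌊x.1 / ε⌋, ⌊x.2 / ε⌋), h x.1, h x.2⟩

lemma cells_finite {ε : ℝ} (hε : 0 < ε) {K : Set (ℝ × ℝ)} (hK : IsCompact K) :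
    (cells ε K).Finite := by
  obtain ⟨R, hR⟩ := hK.isBounded.exists_norm_le
  have h : ∀ (y : ℝ) (i : ℤ), |y| ≤ R → i * ε ≤ y ∧ y ≤ (i + 1) * ε →
      i ∈ Set.Icc (⌊-R / ε⌋ - 1) ⌈R / ε⌉ := by
    intro y i hy hi
    have := abs_le.1 hy
    have h1 : (i : ℝ) ≤ R / ε := (le_div_iff₀ hε).2 (hi.1.trans this.2)
    have h2 : -R / ε ≤ i + 1 := (div_le_iff₀ hε).2 (this.1.trans hi.2)
    have h3 : ((⌊-R / ε⌋ : ℤ) : ℝ) ≤ ((i + 1 : ℤ) : ℝ) := by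
      push_cast
      exact (Int.floor_le _).trans h2
    have h4 := Int.cast_le.1 h3
    exact ⟨by omega, Int.cast_le.1 (h1.trans (Int.le_ceil _))⟩
  refine ((Set.finite_Icc (⌊-R / ε⌋ - 1) ⌈R / ε⌉).prod
    (Set.finite_Icc (⌊-R / ε⌋ - 1) ⌈R / ε⌉)).subset fun c hc => ?_
  obtain ⟨x, hx, h1, h2⟩ := hc
  have := hR x hx
  rw [Prod.norm_def, max_le_iff, Real.norm_eq_abs, Real.norm_eq_abs] at this
  exact ⟨h _ _ this.1 h1, h _ _ this.2 h2⟩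

lemma cells_conn {ε : ℝ} (hε : 0 < ε) {K : Set (ℝ × ℝ)} (hK : IsCompact K)
    (hc : IsPreconnected K) {p q : ℤ × ℤ} (hp : p ∈ cells ε K) (hq : q ∈ cells ε K) :
    Relation.ReflTransGen (fun a b => GAdj a b ∧ a ∈ cells ε K ∧ b ∈ cells ε K) p q := by
  set r := fun a b => GAdj a b ∧ a ∈ cells ε K ∧ b ∈ cells ε K
  by_contra hn
  have hfin := cells_finite hε hK
  have hcl : ∀ P : ℤ × ℤ → Prop, IsClosed (⋃ c ∈ {c ∈ cells ε K | P c}, cell ε c) := fun P =>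
    (hfin.subset fun _ h => h.1).isClosed_biUnion fun c _ => isClosed_cell ε c
  obtain ⟨x, hx, hx1, hx2⟩ := isPreconnected_closed_iff.1 hc _ _
    (hcl fun c => Relation.ReflTransGen r p c) (hcl fun c => ¬ Relation.ReflTransGen r p c)
    (fun x hx => by
      obtain ⟨c, hxc⟩ := exists_cell hε x
      by_cases h : Relation.ReflTransGen r p c
      · exact Or.inl (Set.mem_biUnion ⟨⟨x, hx, hxc⟩, h⟩ hxc)
      · exact Or.inr (Set.mem_biUnion ⟨⟨x, hx, hxc⟩, h⟩ hxc))
    (by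
      obtain ⟨x, hx, hxc⟩ := id hp
      exact ⟨x, hx, Set.mem_biUnion ⟨hp, .refl⟩ hxc⟩)
    (by
      obtain ⟨x, hx, hxc⟩ := id hq
      exact ⟨x, hx, Set.mem_biUnion ⟨hq, hn⟩ hxc⟩)
  simp only [Set.mem_iUnion] at hx1 hx2
  obtain ⟨c, ⟨hc1, hc2⟩, hxc⟩ := hx1
  obtain ⟨d, ⟨hd1, hd2⟩, hxd⟩ := hx2
  have near : ∀ (y : ℝ) (i j : ℤ), i * ε ≤ y → y ≤ (j + 1) * ε → i ≤ j + 1 := fun y i j h1 h2 => by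
    have := le_of_mul_le_mul_right (h1.trans h2) hε
    exact_mod_cast this
  have a1 := near _ _ _ hxc.1.1 hxd.1.2
  have a2 := near _ _ _ hxd.1.1 hxc.1.2
  have a3 := near _ _ _ hxc.2.1 hxd.2.2
  have a4 := near _ _ _ hxd.2.1 hxc.2.2
  have he : (d.1, c.2) ∈ cells ε K := ⟨x, hx, hxd.1, hxc.2⟩
  have step : ∀ a b, a ∈ cells ε K → b ∈ cells ε K → (a ≠ b → GAdj a b) →
      Relation.ReflTransGen r p a → Relation.ReflTransGen r p b := by
    intro a b ha hb hab h
    by_cases e : a = b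
    · exact e ▸ h
    · exact h.tail ⟨hab e, ha, hb⟩
  refine hd2 (step _ _ he hd1 (fun h => Or.inl ⟨rfl, ?_⟩) (step _ _ hc1 he
    (fun h => Or.inr ⟨rfl, ?_⟩) hc2))
  · have : c.2 ≠ d.2 := fun e => h (Prod.ext rfl e)
    change c.2 + 1 = d.2 ∨ d.2 + 1 = c.2
    omega
  · have : c.1 ≠ d.1 := fun e => h (Prod.ext e rfl)
    change c.1 + 1 = d.1 ∨ d.1 + 1 = c.1
    omega

lemma eventually_cells {K L : Set (ℝ × ℝ)} (hK : IsCompact K) (hL : IsCompact L)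
    (h : ∀ x ∈ K, x ∉ L) : ∀ᶠ ε in 𝓝[>] (0 : ℝ), ∀ c ∈ cells ε K, c ∉ cells ε L := by
  obtain ⟨δ, hδ, hd⟩ := (Set.disjoint_left.2 h).exists_thickenings hK hL.isClosed
  filter_upwards [Ioo_mem_nhdsGT hδ] with ε hε
  rintro c ⟨x, hx, hxc⟩ ⟨y, hy, hyc⟩
  refine Set.disjoint_left.1 hd (Metric.self_subset_thickening hδ _ hx)
    (Metric.mem_thickening_iff.2 ⟨y, hy, ?_⟩)
  rw [Prod.dist_eq, Real.dist_eq, Real.dist_eq]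
  refine lt_of_le_of_lt (max_le ?_ ?_) hε.2 <;> rw [abs_le]
  · constructor <;> linarith [hxc.1.1, hxc.1.2, hyc.1.1, hyc.1.2]
  · constructor <;> linarith [hxc.2.1, hxc.2.2, hyc.2.1, hyc.2.2]

lemma exists_exit {α : Type} {r : α → α → Prop} {P : α → Prop} {a b : α}
    (h : Relation.ReflTransGen r a b) (ha : P a) (hb : ¬ P b) : ∃ x y, r x y ∧ P x ∧ ¬ P y := by
  induction h with
  | refl => exact (hb ha).elim
  | @tail x y _ hxy ih =>
    by_cases hx : P x
    · exact ⟨x, y, hxy, hx, hb⟩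
    · exact ih hx

variable {V : Type} [Fintype V] {G : SimpleGraph V} {vtx : V → ℝ × ℝ} {arc : V → V → ℝ → ℝ × ℝ}

lemma IsPlaneEmbedding.gridMinor (h : IsPlaneEmbedding G vtx arc) : GridMinor G := by
  let K' : V → V → Set (ℝ × ℝ) := fun v w =>
    if G.Adj v w then arc v w '' Set.Icc 0 (1 / 3) else {vtx v}
  let K : V → Set (ℝ × ℝ) := fun v => ⋃ w, K' v w
  let M : V → V → Set (ℝ × ℝ) := fun u v => arc u v '' Set.Icc (1 / 3) (2 / 3)
  have sub1 : Set.Icc (0 : ℝ) (1 / 3) ⊆ Set.Icc 0 1 := Set.Icc_subset_Icc le_rfl (by norm_num)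
  have sub2 : Set.Icc (1 / 3 : ℝ) (2 / 3) ⊆ Set.Icc 0 1 :=
    Set.Icc_subset_Icc (by norm_num) (by norm_num)
  have K'c : ∀ v w, IsCompact (K' v w) ∧ IsPreconnected (K' v w) ∧ vtx v ∈ K' v w := by
    intro v w
    by_cases hvw : G.Adj v w
    · simp only [K', hvw, if_true]
      exact ⟨isCompact_Icc.image_of_continuousOn ((h.arc_cont hvw).mono sub1),
        isPreconnected_Icc.image _ ((h.arc_cont hvw).mono sub1), 0, by norm_num, h.arc_start hvw⟩
    · simp only [K', hvw, if_false]
      exact ⟨isCompact_singleton, isPreconnected_singleton, rfl⟩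
  have Kc : ∀ v, IsCompact (K v) := fun v => isCompact_iUnion fun w => (K'c v w).1
  have Kp : ∀ v, IsPreconnected (K v) := fun v =>
    isPreconnected_iUnion ⟨vtx v, Set.mem_iInter.2 fun w => (K'c v w).2.2⟩ fun w => (K'c v w).2.1
  have Mc : ∀ u v, G.Adj u v → IsCompact (M u v) := fun u v huv =>
    isCompact_Icc.image_of_continuousOn ((h.arc_cont huv).mono sub2)
  have Mp : ∀ u v, G.Adj u v → IsPreconnected (M u v) := fun u v huv =>
    isPreconnected_Icc.image _ ((h.arc_cont huv).mono sub2)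
  have Kmem : ∀ v x, x ∈ K v →
      x = vtx v ∨ ∃ w t, G.Adj v w ∧ 0 < t ∧ t ≤ 1 / 3 ∧ x = arc v w t := by
    intro v x hx
    obtain ⟨w, hw⟩ := Set.mem_iUnion.1 hx
    by_cases hvw : G.Adj v w
    · simp only [K', hvw, if_true] at hw
      obtain ⟨t, ht, rfl⟩ := hw
      rcases ht.1.eq_or_lt with rfl | h0
      · exact Or.inl (h.arc_start hvw)
      · exact Or.inr ⟨w, t, hvw, h0, ht.2, rfl⟩
    · simp only [K', hvw, if_false] at hw
      exact Or.inl hw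
  have arcK : ∀ u v, G.Adj u v → arc u v (1 / 3) ∈ K u := by
    intro u v huv
    refine Set.mem_iUnion.2 ⟨v, ?_⟩
    simp only [K', huv, if_true]
    exact ⟨_, by norm_num, rfl⟩
  have same : ∀ u v u' v' t t', G.Adj u v → G.Adj u' v' → 0 < t → t < 1 → 0 < t' → t' < 1 →
      arc u v t = arc u' v' t' → s(u, v) = s(u', v') := by
    intro u v u' v' t t' h1 h2 a b a' b' e
    by_contra hne
    have : arc u v t ∈ ArcInterior (arc u v) ∩ ArcInterior (arc u' v') :=
      ⟨⟨t, ⟨a, b⟩, rfl⟩, ⟨t', ⟨a', b'⟩, e.symm⟩⟩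
    rw [h.arc_disjoint h1 h2 hne] at this
    exact this
  have av : ∀ u v w t, G.Adj u v → 0 < t → t < 1 → arc u v t ≠ vtx w := fun u v w t huv a b e =>
    h.arc_avoids_vtx huv w ⟨t, ⟨a, b⟩, e⟩
  have d1 : ∀ u v, u ≠ v → ∀ x ∈ K u, x ∉ K v := by
    intro u v huv x hu hv
    rcases Kmem u x hu with rfl | ⟨w, t, hw, t0, t1, rfl⟩ <;>
      rcases Kmem v _ hv with e | ⟨w', t', hw', t0', t1', e⟩
    · exact huv (h.vtx_inj e)
    · exact av v w' u t' hw' t0' (by linarith) e.symm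
    · exact av u w v t hw t0 (by linarith) e
    · have := same _ _ _ _ _ _ hw hw' t0 (by linarith) t0' (by linarith) e
      rcases Sym2.eq_iff.1 this with ⟨rfl, -⟩ | ⟨rfl, rfl⟩
      · exact huv rfl
      · rw [h.arc_symm hw] at e
        have := h.arc_injOn hw ⟨t0.le, by linarith⟩ ⟨by linarith, by linarith⟩ e
        linarith
  have d2 : ∀ u v w, G.Adj u v → w ≠ u → w ≠ v → ∀ x ∈ M u v, x ∉ K w := by
    rintro u v w huv hu hv _ ⟨t, ht, rfl⟩ hx
    rcases Kmem w _ hx with e | ⟨z, t', hw, t0, t1, e⟩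
    · exact av u v w t huv (by linarith [ht.1]) (by linarith [ht.2]) e
    · have := same _ _ _ _ _ _ huv hw (by linarith [ht.1]) (by linarith [ht.2]) t0 (by linarith) e
      rcases Sym2.eq_iff.1 this with ⟨rfl, -⟩ | ⟨-, rfl⟩
      exacts [hu rfl, hv rfl]
  have d3 : ∀ u v u' v', G.Adj u v → G.Adj u' v' → s(u, v) ≠ s(u', v') →
      ∀ x ∈ M u v, x ∉ M u' v' := by
    rintro u v u' v' huv huv' hne _ ⟨t, ht, rfl⟩ ⟨t', ht', e⟩
    exact hne (same _ _ _ _ t t' huv huv' (by linarith [ht.1]) (by linarith [ht.2])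
      (by linarith [ht'.1]) (by linarith [ht'.2]) e.symm)
  have ev : ∀ᶠ ε in 𝓝[>] (0 : ℝ), 0 < ε ∧
      (∀ u v, u ≠ v → ∀ c ∈ cells ε (K u), c ∉ cells ε (K v)) ∧
      (∀ u v w, G.Adj u v ∧ w ≠ u ∧ w ≠ v → ∀ c ∈ cells ε (M u v), c ∉ cells ε (K w)) ∧
      ∀ u v u' v', G.Adj u v ∧ G.Adj u' v' ∧ s(u, v) ≠ s(u', v') →
        ∀ c ∈ cells ε (M u v), c ∉ cells ε (M u' v') := by
    refine (eventually_mem_nhdsWithin.mono fun _ h => h).and (.and ?_ (.and ?_ ?_)) <;>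
      simp only [eventually_all]
    · exact fun u v huv => eventually_cells (Kc u) (Kc v) (d1 u v huv)
    · exact fun u v w hh => eventually_cells (Mc u v hh.1) (Kc w) (d2 u v w hh.1 hh.2.1 hh.2.2)
    · exact fun u v u' v' hh =>
        eventually_cells (Mc u v hh.1) (Mc u' v' hh.2.1) (d3 u v u' v' hh.1 hh.2.1 hh.2.2)
  obtain ⟨ε, hε, e1, e2, e3⟩ := ev.exists
  let o := Fintype.equivFin V
  let F : V → Set (ℤ × ℤ) := fun v =>
    cells ε (K v) ∪ {c | ∃ w, G.Adj v w ∧ o v < o w ∧ c ∈ cells ε (M v w) ∧ c ∉ cells ε (K w)}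
  have Ffin : ∀ v, (F v).Finite := by
    intro v
    refine (cells_finite hε (Kc v)).union ((Set.finite_iUnion fun w : {w // G.Adj v w} =>
      cells_finite hε (Mc v w w.2)).subset ?_)
    rintro c ⟨w, hw, -, hc, -⟩
    exact Set.mem_iUnion.2 ⟨⟨w, hw⟩, hc⟩
  let R : V → ℤ × ℤ → ℤ × ℤ → Prop := fun v a b => GAdj a b ∧ a ∈ F v ∧ b ∈ F v
  let B : V → Finset (ℤ × ℤ) := fun v =>
    (Ffin v).toFinset.filter fun c => ∃ a ∈ cells ε (K v), Relation.ReflTransGen (R v) a c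
  have memB : ∀ v c, c ∈ B v ↔ c ∈ F v ∧ ∃ a ∈ cells ε (K v), Relation.ReflTransGen (R v) a c := by
    simp [B]
  have KB : ∀ v, ∀ c ∈ cells ε (K v), c ∈ B v := fun v c hc =>
    (memB v c).2 ⟨Or.inl hc, c, hc, .refl⟩
  have Fd : ∀ u v c, c ∈ F u → c ∈ F v → u = v := by
    intro u v c hu hv
    by_contra hne
    rcases hu with hu | ⟨w, hw, lw, hu, hu'⟩ <;> rcases hv with hv | ⟨z, hz, lz, hv, hv'⟩
    · exact e1 u v hne c hu hv
    · by_cases hzu : u = z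
      · exact hv' (hzu ▸ hu)
      · exact e2 v z u ⟨hz, hne, hzu⟩ c hv hu
    · by_cases hwv : v = w
      · exact hu' (hwv ▸ hv)
      · exact e2 u w v ⟨hw, Ne.symm hne, hwv⟩ c hu hv
    · by_cases hs : s(u, w) = s(v, z)
      · rcases Sym2.eq_iff.1 hs with ⟨rfl, -⟩ | ⟨rfl, rfl⟩
        exacts [hne rfl, lt_asymm lw lz]
      · exact e3 _ _ _ _ ⟨hw, hz, hs⟩ c hu hv
  have Bd : ∀ u v c, c ∈ B u → c ∈ B v → u = v := fun u v c hu hv =>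
    Fd u v c ((memB u c).1 hu).1 ((memB v c).1 hv).1
  have adj : ∀ u v, G.Adj u v → o u < o v → ∃ p ∈ B u, ∃ q ∈ B v, GAdj p q := by
    intro u v huv hlt
    obtain ⟨a, ha⟩ := exists_cell hε (arc u v (1 / 3))
    obtain ⟨b, hb⟩ := exists_cell hε (arc u v (2 / 3))
    have hbK : b ∈ cells ε (K v) := by
      refine ⟨_, arcK v u huv.symm, ?_⟩
      rw [h.arc_symm huv]
      norm_num at hb ⊢
      exact hb
    have hw := cells_conn hε (Mc u v huv) (Mp u v huv) (p := a) (q := b)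
      ⟨_, ⟨_, by norm_num, rfl⟩, ha⟩ ⟨_, ⟨_, by norm_num, rfl⟩, hb⟩
    obtain ⟨x, y, hxy, hx, hy⟩ := exists_exit (P := fun c => c ∈ B u) hw
      (KB u a ⟨_, arcK u v huv, ha⟩) fun hb' => huv.ne (Bd u v b hb' (KB v b hbK))
    by_cases hyv : y ∈ cells ε (K v)
    · exact ⟨x, hx, y, KB v y hyv, hxy.1⟩
    · have hyF : y ∈ F u := Or.inr ⟨v, huv, hlt, hxy.2.2, hyv⟩
      obtain ⟨hxF, c, hc, hcx⟩ := (memB u x).1 hx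
      exact (hy ((memB u y).2 ⟨hyF, c, hc, hcx.tail ⟨hxy.1, hxF, hyF⟩⟩)).elim
  refine ⟨B, Bd, ?_, fun u v huv => ?_⟩
  · intro v
    have hs : ∀ a b, (GAdj a b ∧ a ∈ B v ∧ b ∈ B v) → (GAdj b a ∧ b ∈ B v ∧ a ∈ B v) :=
      fun a b h => ⟨h.1.symm, h.2.2, h.2.1⟩
    have up : ∀ a ∈ cells ε (K v), ∀ c, Relation.ReflTransGen (R v) a c →
        Relation.ReflTransGen (fun a b => GAdj a b ∧ a ∈ B v ∧ b ∈ B v) a c := by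
      intro a ha c hc
      induction hc with
      | refl => exact .refl
      | @tail x y hax hxy ih =>
        exact ih.tail ⟨hxy.1, (memB v x).2 ⟨hxy.2.1, a, ha, hax⟩,
          (memB v y).2 ⟨hxy.2.2, a, ha, hax.tail hxy⟩⟩
    intro p hp q hq
    obtain ⟨-, a, ha, hap⟩ := (memB v p).1 hp
    obtain ⟨-, b, hb, hbq⟩ := (memB v q).1 hq
    refine ((reflTransGen_symm hs (up a ha p hap)).trans ?_).trans (up b hb q hbq)
    exact reflTransGen_imp (fun x y hxy => ⟨hxy.1, KB v x hxy.2.1, KB v y hxy.2.2⟩)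
      (cells_conn hε (Kc v) (Kp v) ha hb)
  · rcases lt_or_gt_of_ne (o.injective.ne huv.ne) with hlt | hlt
    · exact adj u v huv hlt
    · obtain ⟨p, hp, q, hq, hpq⟩ := adj v u huv.symm hlt
      exact ⟨q, hq, p, hp, hpq.symm⟩

end Topo

section Walks

variable {V : Type} {G : SimpleGraph V} {u v : V} {A B : List V}

lemma Pth.exists_walk (h : Pth G u A v) : ∃ w : G.Walk u v, w.IsPath ∧
    w.support = u :: (A ++ [v]) ∧ (A ≠ [] → s(u, v) ∉ w.edges) := by
  induction A generalizing u with
  | nil => exact ⟨.cons (pth_nil.1 h) .nil, by simpa using h.ne, by simp, by simp⟩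
  | cons x A ih =>
    obtain ⟨hux, hx, huA, huv⟩ := pth_cons.1 h
    obtain ⟨w, hw, hs, -⟩ := ih hx
    have hu : u ∉ w.support := by
      rw [hs]
      simp [hux.ne, huA, huv]
    refine ⟨.cons hux w, hw.cons hu, by simp [hs], fun _ he => ?_⟩
    rw [Walk.edges_cons, List.mem_cons] at he
    rcases he with he | he
    · rcases Sym2.eq_iff.1 he with ⟨-, rfl⟩ | ⟨rfl, -⟩
      exacts [hx.ne rfl, hux.ne rfl]
    · exact hu (w.fst_mem_support_of_mem_edges he)

lemma Pth.exists_cycle (h : Pth G u A v) (huv : G.Adj u v) (hA : A ≠ []) :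
    ∃ w : G.Walk u u, w.IsCycle ∧ w.length = A.length + 2 ∧ s(u, v) ∈ w.edges ∧
      ∀ x, x ∈ w.support ↔ x = u ∨ x = v ∨ x ∈ A := by
  obtain ⟨w, hw, hs, he⟩ := h.exists_walk
  refine ⟨.cons huv w.reverse, (Walk.cons_isCycle_iff _ _).2 ⟨hw.reverse, by simpa using he hA⟩,
    ?_, by simp, fun x => ?_⟩
  · have := congrArg List.length hs
    simp only [Walk.length_support, List.length_cons, List.length_append, List.length_nil] at this
    simp only [Walk.length_cons, Walk.length_reverse]
    omega
  · simp only [Walk.support_cons, Walk.support_reverse, List.mem_cons, List.mem_reverse, hs,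
      List.mem_append, List.not_mem_nil, or_false]
    tauto

lemma Theta.normallyAdjacent (h : Theta G u v A B) : ∃ c1 c2 : G.Walk u u,
    c1.IsCycle ∧ c2.IsCycle ∧ c1.length = A.length + 2 ∧ c2.length = B.length + 2 ∧
      NormallyAdjacent G c1 c2 := by
  obtain ⟨huv, hA, hB, hA0, hB0, hd⟩ := h
  obtain ⟨c1, h1, l1, e1, s1⟩ := hA.exists_cycle huv hA0
  obtain ⟨c2, h2, l2, e2, s2⟩ := hB.exists_cycle huv hB0
  have hs : ∀ x, x ∈ c1.support → x ∈ c2.support → x = u ∨ x = v := by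
    intro x hx hy
    rw [s1] at hx
    rw [s2] at hy
    have := @hd x
    tauto
  refine ⟨c1, c2, h1, h2, l1, l2, ⟨s(u, v), ?_⟩, u, v, huv.ne, ?_⟩
  · ext e
    constructor
    · rintro ⟨ha, hb⟩
      induction e with
      | _ x y =>
      have hx := hs x (c1.fst_mem_support_of_mem_edges ha) (c2.fst_mem_support_of_mem_edges hb)
      have hy := hs y (c1.snd_mem_support_of_mem_edges ha) (c2.snd_mem_support_of_mem_edges hb)
      have hxy : G.Adj x y := c1.edges_subset_edgeSet ha
      have := hxy.ne
      rw [Set.mem_singleton_iff, Sym2.eq_iff]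
      grind
    · rintro rfl
      exact ⟨e1, e2⟩
  · ext x
    constructor
    · exact fun hx => hs x hx.1 hx.2
    · rintro (rfl | rfl)
      · exact ⟨(s1 _).2 (Or.inl rfl), (s2 _).2 (Or.inl rfl)⟩
      · exact ⟨(s1 _).2 (Or.inr (Or.inl rfl)), (s2 _).2 (Or.inr (Or.inl rfl))⟩

lemma Sparse.induce (h : Sparse G) (s : Set V) : Sparse (G.induce s) := by
  rintro u v A B ⟨huv, hA, hB, hA0, hB0, hd⟩
  have := h u v (A.map Subtype.val) (B.map Subtype.val) ⟨huv,
    hA.map Subtype.val_injective fun _ _ _ _ h => h,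
    hB.map Subtype.val_injective fun _ _ _ _ h => h, mt List.map_eq_nil_iff.1 hA0,
    mt List.map_eq_nil_iff.1 hB0, fun x hx hy => ?_⟩
  · rwa [List.length_map, List.length_map] at this
  · obtain ⟨a, ha, rfl⟩ := List.mem_map.1 hx
    obtain ⟨b, hb, hab⟩ := List.mem_map.1 hy
    exact hd ha (Subtype.val_injective hab ▸ hb)

lemma IsPlaneEmbedding.induce {vtx : V → ℝ × ℝ} {arc : V → V → ℝ → ℝ × ℝ}
    (h : IsPlaneEmbedding G vtx arc) (s : Set V) :
    IsPlaneEmbedding (G.induce s) (fun v => vtx v) (fun u v => arc u v) where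
  vtx_inj := h.vtx_inj.comp Subtype.val_injective
  arc_cont := fun _ _ huv => h.arc_cont huv
  arc_injOn := fun _ _ huv => h.arc_injOn huv
  arc_start := fun _ _ huv => h.arc_start huv
  arc_end := fun _ _ huv => h.arc_end huv
  arc_symm := fun _ _ huv => h.arc_symm huv
  arc_avoids_vtx := fun _ _ huv w => h.arc_avoids_vtx huv w
  arc_disjoint := fun _ _ _ _ h1 h2 hne => h.arc_disjoint h1 h2 fun e =>
    hne (Sym2.map.injective Subtype.val_injective e)

end Walks

section Main
open Classical Finset

variable {V : Type} {G : SimpleGraph V}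

/-- The extension theorem. -/
theorem exists_good [Fintype V] (hG : GridMinor G) (hs : Sparse G) {S : Set V} (hS : Adm G S)
    (φ : V → Bool) : ∃ c, (∀ x ∈ S, c x = φ x) ∧ Good G S c := by
  induction hn : G.edgeSet.ncard using Nat.strong_induction_on generalizing G S φ with
  | _ n ih =>
  by_cases he : ∃ u v, G.Adj u v
  · by_contra hbad
    obtain ⟨D⟩ := hG.dual he
    exact Ctr.false_of_dual ⟨hG, hs, hS, hbad, fun H S' h1 h2 h3 hlt φ' =>
      ih _ (hn ▸ hlt) h1 h2 h3 φ' rfl⟩ D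
  · push Not at he
    refine ⟨φ, fun _ _ => rfl, fun u v huv => (he u v huv).elim, fun Y hY => ?_⟩
    have : fedges G S φ = ∅ := by
      refine Finset.eq_empty_of_forall_notMem fun e => ?_
      induction e with
      | _ x y => exact fun h => he x y (mk_mem_fedges.1 h).1
    rw [this, spanned, Finset.filter_empty]
    exact hY.card_pos

lemma Good.ifColoring [Fintype V] {z : V} {c : V → Bool} (h : Good G {z} c) :
    IFColoring G c := by
  constructor
  · intro u v huv hu
    by_contra hv
    obtain ⟨rfl, rfl⟩ := h.1 u v huv hu (by simpa using hv)
    exact huv.ne rfl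
  · intro v w hw hF
    have hinj : Function.Injective (contract ({z} : Set V)) := by
      intro a b hab
      by_cases hb : b = z
      · subst hb
        by_contra ha
        rw [contract_of_mem (Set.mem_singleton b), contract_of_notMem (S := {b}) ha] at hab
        cases hab
      · exact (contract_eq_contract (S := {z}) hb).1 hab
    have hY := h.2 ((w.support.tail.toFinset).image (contract {z}))
      ⟨_, Finset.mem_image_of_mem _ (List.mem_toFinset.2 (Walk.end_mem_tail_support hw.not_nil))⟩
    have hmem : ∀ x ∈ w.support, x ∈ w.support.tail := by
      intro x hx
      rw [← Walk.cons_tail_support, List.mem_cons] at hx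
      rcases hx with rfl | hx
      · exact Walk.end_mem_tail_support hw.not_nil
      · exact hx
    have hsub : w.edges.toFinset ⊆ spanned (fedges G {z} c) (contract {z})
        ((w.support.tail.toFinset).image (contract {z})) := by
      intro e he
      rw [List.mem_toFinset] at he
      induction e with
      | _ x y =>
      have hx := w.fst_mem_support_of_mem_edges he
      have hy := w.snd_mem_support_of_mem_edges he
      have hxy : G.Adj x y := w.edges_subset_edgeSet he
      simp only [spanned, Finset.mem_filter]
      refine ⟨mk_mem_fedges.2 ⟨hxy, ⟨hF x hx, hF y hy⟩, ?_⟩, ?_⟩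
      · rintro ⟨rfl, rfl⟩
        exact hxy.ne rfl
      · exact Sym2.ball.2 ⟨Finset.mem_image_of_mem _ (List.mem_toFinset.2 (hmem x hx)),
          Finset.mem_image_of_mem _ (List.mem_toFinset.2 (hmem y hy))⟩
    have h1 := Finset.card_le_card hsub
    rw [List.toFinset_card_of_nodup hw.isTrail.edges_nodup, Walk.length_edges] at h1
    rw [Finset.card_image_of_injective _ hinj, List.toFinset_card_of_nodup hw.support_nodup,
      List.length_tail, Walk.length_support] at hY
    omega

/-- Compactness: a graph is `(I,F)`-colorable if its finite induced subgraphs are. -/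
lemma ifColorable_of_finite (h : ∀ s : Finset V, IFColorable (G.induce (s : Set V))) :
    IFColorable G := by
  choose g hg using h
  obtain ⟨c, hc⟩ := Finset.rado_selection_subtype (β := fun _ : V => Bool) fun s x => g s x
  refine ⟨c, fun u v huv hu => ?_, fun v w hw hF => ?_⟩
  · obtain ⟨t, hst, ht⟩ := hc {u, v}
    have hu' := ht ⟨u, by simp⟩
    have hv' := ht ⟨v, by simp⟩
    dsimp only at hu' hv'
    rw [hv']
    exact (hg t).1 (v := ⟨v, hst (by simp)⟩) (u := ⟨u, hst (by simp)⟩) huv (hu' ▸ hu)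
  · obtain ⟨t, hst, ht⟩ := hc w.support.toFinset
    have hw' : ∀ x ∈ w.support, x ∈ (t : Set V) := fun x hx => hst (List.mem_toFinset.2 hx)
    refine (hg t).2 _ (w.induce _ hw') ?_ fun x hx => ?_
    · rw [← Walk.isCycle_map_iff_of_injective (f := (Embedding.induce (t : Set V)).toHom)
        Subtype.val_injective, Walk.map_induce]
      exact hw
    · have hx' : (x : V) ∈ w.support := by
        rw [Walk.support_induce] at hx
        simpa using hx
      have := ht ⟨x, List.mem_toFinset.2 hx'⟩
      exact this.symm.trans (hF x hx')

lemma IsPlanarGraph.ifColorable (hG : IsPlanarGraph G) (hs : Sparse G) : IFColorable G := by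
  obtain ⟨vtx, arc, h⟩ := hG
  refine ifColorable_of_finite fun s => ?_
  rcases isEmpty_or_nonempty (s : Set V) with he | ⟨⟨z⟩⟩
  · exact ⟨fun _ => true, fun u => he.elim u, fun u => he.elim u⟩
  · obtain ⟨c, -, hc⟩ := exists_good (h.induce (s : Set V)).gridMinor (hs.induce _)
      (adm_singleton z) fun _ => true
    exact ⟨c, hc.ifColoring⟩

end Main
variable {V : Type}
/-- Every planar graph with no triangle normally adjacent to
a cycle of length at most `8`, no `4`-cycle normally adjacent to a cycle of
length at most `6`, and no two normally adjacent `5`-cycles, is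
`(I,F)`-colorable. -/
theorem planar_no_normally_adjacent_IFColorable {V : Type}
    (G : SimpleGraph V) (hplanar : IsPlanarGraph G)
    (h38 : ∀ ⦃a b : V⦄ (c1 : G.Walk a a) (c2 : G.Walk b b),
      c1.IsCycle → c2.IsCycle → c1.length = 3 → c2.length ≤ 8 →
      ¬ NormallyAdjacent G c1 c2)
    (h46 : ∀ ⦃a b : V⦄ (c1 : G.Walk a a) (c2 : G.Walk b b),
      c1.IsCycle → c2.IsCycle → c1.length = 4 → c2.length ≤ 6 →
      ¬ NormallyAdjacent G c1 c2)
    (h55 : ∀ ⦃a b : V⦄ (c1 : G.Walk a a) (c2 : G.Walk b b),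
      c1.IsCycle → c2.IsCycle → c1.length = 5 → c2.length = 5 →
      ¬ NormallyAdjacent G c1 c2) :
    IFColorable G := by
  refine hplanar.ifColorable fun u v A B h => ?_
  obtain ⟨c1, c2, h1, h2, l1, l2, h⟩ := h.normallyAdjacent
  refine ⟨fun hl => ?_, fun hl => ?_, fun hl => ?_⟩
  · exact h38 c1 c2 h1 h2 (by omega) (by omega) h
  · exact h46 c1 c2 h1 h2 (by omega) (by omega) h
  · exact h55 c1 c2 h1 h2 (by omega) (by omega) h

end IFPaper
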